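/- For every integer n ≥ 0 the following two-term and four-term rank-crank inequalities hold. Writing N_i = N(i,11,11n) and M_i = M(i,11,11n): M_1 ≥ N_4 and N_2 + N_3 ≥ N_4 + M_1. Writing N_i = N(i,11,11n+1) and M_i = M(i,11,11n+1): N_2 ≥ M_2; M_2 ≥ N_4; and N_2 + N_4 ≥ N_3 + N_5. Writing N_i = N(i,11,11n+2) and M_i = M(i,11,11n+2): N_1 ≥ M_2; M_0 ≥ N_5; 2M_0 ≥ N_2 + N_5; N_2 + M_0 ≥ N_0 + N_5; N_1 + N_3 ≥ M_0 + M_2; and N_1 + N_5 ≥ N_4 + M_2. Writing N_i = N(i,11,11n+3) and M_i = M(i,11,11n+3): N_0 ≥ M_0; M_1 ≥ N_4; N_0 + M_0 ≥ 2N_2; N_2 + M_1 ≥ N_4 + M_0; and N_0 + N_3 ≥ N_2 + M_1. Writing N_i = N(i,11,11n+4) and M_i = M(i,11,11n+4): N_1 ≥ M_0; 2N_1 ≥ N_0 + M_0; N_1 + M_1 ≥ N_2 + M_0; and N_1 + N_3 ≥ 2M_0. Writing N_i = N(i,11,11n+5) and M_i = M(i,11,11n+5): N_2 ≥ M_0;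 M_2 ≥ N_5; N_2 + N_3 ≥ M_0 + M_2; N_2 + M_2 ≥ N_0 + N_5; N_0 + M_0 ≥ N_1 + N_4; N_2 + N_3 ≥ N_1 + N_5; and N_0 + N_2 ≥ N_1 + M_0. -/

import Mathlib

/-- `p n`: the number of partitions of `n`. -/
def partitionCount (n : ℕ) : ℕ := Fintype.card (Nat.Partition n)

/-- The rank of a partition: its largest part minus its number of parts
(the empty partition has rank 0). -/
def partitionRank {n : ℕ} (π : Nat.Partition n) : ℤ :=
  (π.parts.sup : ℤ) - (Multiset.card π.parts : ℤ)

/-- The crank of a partition `π`: if `π` has no parts equal to 1, it is the largest part;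
otherwise it is (number of parts larger than the number of ones) − (number of ones). -/
def partitionCrank {n : ℕ} (π : Nat.Partition n) : ℤ :=
  if π.parts.count 1 = 0 then (π.parts.sup : ℤ)
  else ((π.parts.filter fun x => π.parts.count 1 < x).card : ℤ) - (π.parts.count 1 : ℤ)

/-- `rankCount a r n` = `N(a,r,n)`: the number of partitions of `n` whose rank is
congruent to `a` modulo `r`. -/
def rankCount (a r : ℤ) (n : ℕ) : ℕ :=
  (Finset.univ.filter fun π : Nat.Partition n => partitionRank π % r = a % r).card

/-- `crankCount a n` = `M(a,11,n)`: for `n ≠ 1`, the number of partitions of `n` whose crank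
is congruent to `a` modulo 11; at `n = 1` the standard convention `M(0,11,1) = −1`,
`M(1,11,1) = M(10,11,1) = 1`, and `M(a,11,1) = 0` otherwise. -/
def crankCount (a : ℤ) (n : ℕ) : ℤ :=
  if n = 1 then
    if a % 11 = 0 then -1
    else if a % 11 = 1 ∨ a % 11 = 10 then 1
    else 0
  else ((Finset.univ.filter fun π : Nat.Partition n => partitionCrank π % 11 = a % 11).card : ℤ)

section

open Filter Topology Finset

/-- The infinite `q`-Pochhammer symbol `(x; q)_∞`. -/
noncomputable def qPoch (q x : ℝ) : ℝ := ∏' n : ℕ, (1 - x * q ^ n)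

/-- The finite `q`-Pochhammer symbol `(x; q)_N`. -/
noncomputable def qPochFin (q x : ℝ) (N : ℕ) : ℝ := ∏ n ∈ range N, (1 - x * q ^ n)

/-- The theta function `(x; q)_∞ (q/x; q)_∞`. -/
noncomputable def jTheta (q x : ℝ) : ℝ := qPoch q x * qPoch q (q / x)

section qPoch
variable {q : ℝ}

lemma summable_mul_geometric (h0 : 0 < q) (h1 : q < 1) (x : ℝ) :
    Summable fun n : ℕ => ‖-(x * q ^ n)‖ := by
  simpa using ((summable_geometric_of_lt_one h0.le h1).mul_left |x|).congr fun n => by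
    simp [abs_of_pos h0]

lemma multipliable_qPoch (h0 : 0 < q) (h1 : q < 1) (x : ℝ) :
    Multipliable fun n : ℕ => (1 - x * q ^ n) := by
  simpa [sub_eq_add_neg] using multipliable_one_add_of_summable (summable_mul_geometric h0 h1 x)

lemma tendsto_qPochFin (h0 : 0 < q) (h1 : q < 1) (x : ℝ) :
    Tendsto (qPochFin q x) atTop (𝓝 (qPoch q x)) :=
  (multipliable_qPoch h0 h1 x).hasProd.tendsto_prod_nat

lemma qPoch_eq_mul (h0 : 0 < q) (h1 : q < 1) (x : ℝ) :
    qPoch q x = (1 - x) * qPoch q (q * x) := by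
  unfold qPoch
  have h := multipliable_qPoch h0 h1 (q * x)
  rw [tprod_eq_zero_mul' (f := fun n : ℕ => (1 - x * q ^ n))]
  · simp only [pow_zero, mul_one]
    congr 1
    refine tprod_congr fun n => by ring
  · convert h using 2 with n
    ring

lemma qPoch_ne_zero (h0 : 0 < q) (h1 : q < 1) {x : ℝ} (hx : ∀ n : ℕ, x * q ^ n ≠ 1) :
    qPoch q x ≠ 0 := by
  have := tprod_one_add_ne_zero_of_summable (f := fun n : ℕ => -(x * q ^ n))
    (fun n => by
      rw [← sub_eq_add_neg]
      exact sub_ne_zero.2 (hx n).symm) (summable_mul_geometric h0 h1 x)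
  simpa [qPoch, sub_eq_add_neg] using this

lemma qPoch_zero : qPoch q 0 = 1 := by simp [qPoch]

lemma qPoch_one (h0 : 0 < q) (h1 : q < 1) : qPoch q 1 = 0 := by
  rw [qPoch_eq_mul h0 h1]; simp

lemma qPoch_pos (h0 : 0 < q) (h1 : q < 1) {x : ℝ} (hx : x < 1) : 0 < qPoch q x := by
  refine lt_of_le_of_ne ?_ (qPoch_ne_zero h0 h1 fun n => ?_).symm
  · refine ge_of_tendsto' (tendsto_qPochFin h0 h1 x) fun N => prod_nonneg fun n _ => ?_
    have : q ^ n ≤ 1 := pow_le_one₀ h0.le h1.le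
    have : 0 < q ^ n := by positivity
    nlinarith
  · have : q ^ n ≤ 1 := pow_le_one₀ h0.le h1.le
    have : 0 < q ^ n := by positivity
    intro h
    nlinarith

lemma qPochFin_succ_left (x : ℝ) (N : ℕ) :
    qPochFin q x (N + 1) = (1 - x) * qPochFin q (q * x) N := by
  simp only [qPochFin, prod_range_succ', pow_zero, mul_one]
  rw [mul_comm]
  congr 1
  exact prod_congr rfl fun n _ => by ring

lemma qPochFin_succ (x : ℝ) (N : ℕ) :
    qPochFin q x (N + 1) = qPochFin q x N * (1 - x * q ^ N) := by
  simp only [qPochFin, prod_range_succ]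

lemma qPochFin_ne_zero {x : ℝ} (hx : ∀ n : ℕ, x * q ^ n ≠ 1) (N : ℕ) : qPochFin q x N ≠ 0 :=
  prod_ne_zero_iff.2 fun n _ => sub_ne_zero.2 (hx n).symm

/-- Finite Pochhammer symbols are uniformly bounded. -/
lemma exists_qPochFin_le (h0 : 0 < q) (h1 : q < 1) (x : ℝ) :
    ∃ C, ∀ N, |qPochFin q x N| ≤ C := by
  obtain ⟨C, hC⟩ := (tendsto_qPochFin h0 h1 x).abs.bddAbove_range
  exact ⟨C, fun N => hC ⟨N, rfl⟩⟩

lemma exists_inv_qPochFin_le (h0 : 0 < q) (h1 : q < 1) {x : ℝ} (hx : ∀ n : ℕ, x * q ^ n ≠ 1) :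
    ∃ C, ∀ N, |(qPochFin q x N)⁻¹| ≤ C := by
  obtain ⟨C, hC⟩ := ((tendsto_qPochFin h0 h1 x).inv₀ (qPoch_ne_zero h0 h1 hx)).abs.bddAbove_range
  exact ⟨C, fun N => hC ⟨N, rfl⟩⟩

lemma qPoch_sq (h0 : 0 < q) (h1 : q < 1) (x : ℝ) :
    qPoch (q ^ 2) (x ^ 2) = qPoch q x * qPoch q (-x) := by
  unfold qPoch
  rw [← (multipliable_qPoch h0 h1 x).tprod_mul (multipliable_qPoch h0 h1 (-x))]
  exact tprod_congr fun n => by ring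

lemma qPoch_even_odd (h0 : 0 < q) (h1 : q < 1) (x : ℝ) :
    qPoch q x = qPoch (q ^ 2) x * qPoch (q ^ 2) (q * x) := by
  have h0' : 0 < q ^ 2 := by positivity
  have h1' : q ^ 2 < 1 := by nlinarith
  unfold qPoch
  rw [← tprod_even_mul_odd (f := fun n : ℕ => (1 - x * q ^ n))]
  · congr 1
    · exact tprod_congr fun n => by ring
    · exact tprod_congr fun n => by ring
  · simpa [pow_mul] using multipliable_qPoch h0' h1' x
  · convert multipliable_qPoch h0' h1' (q * x) using 2 with n
    ring

lemma differentiable_qPoch (h0 : 0 < q) (h1 : q < 1) : Differentiable ℝ (qPoch q) := by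
  let g : ℂ → ℂ := fun x => ∏' n : ℕ, (1 + -(x * (q : ℂ) ^ n))
  have hg : Differentiable ℂ g := by
    intro x
    have hd : DifferentiableOn ℂ g (Metric.ball 0 (‖x‖ + 1)) := by
      have := Summable.hasProdLocallyUniformlyOn_nat_one_add (K := Metric.ball (0 : ℂ) (‖x‖ + 1))
        (f := fun (n : ℕ) (x : ℂ) => -(x * (q : ℂ) ^ n)) (u := fun n => (‖x‖ + 1) * q ^ n)
        Metric.isOpen_ball ((summable_geometric_of_lt_one h0.le h1).mul_left _)
        (Eventually.of_forall fun n y hy => by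
          rw [norm_neg, norm_mul, norm_pow, Complex.norm_real, Real.norm_eq_abs, abs_of_pos h0]
          have : ‖y‖ < ‖x‖ + 1 := by simpa using hy
          gcongr) (fun n => by fun_prop)
      refine TendstoLocallyUniformlyOn.differentiableOn
        (hasProdLocallyUniformlyOn_iff_tendstoLocallyUniformlyOn.1 this)
        (Eventually.of_forall fun s => ?_) Metric.isOpen_ball
      fun_prop
    exact hd.differentiableAt (Metric.isOpen_ball.mem_nhds (by simp))
  intro x
  have h := (hg x).hasDerivAt.real_of_complex
  have he : (fun x : ℝ => (g x).re) = qPoch q := by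
    funext y
    have : g y = ((qPoch q y : ℝ) : ℂ) := by
      have hm := (multipliable_qPoch h0 h1 y).map_tprod (Complex.ofRealHom) Complex.continuous_ofReal
      simp only [qPoch, g]
      refine Eq.trans ?_ hm.symm
      refine tprod_congr fun n => ?_
      simp [sub_eq_add_neg]
    rw [this, Complex.ofReal_re]
  rw [he] at h
  exact h.differentiableAt

end qPoch

end

section

open Filter Topology Finset

/-- Triangular numbers `n(n+1)/2` for integers. -/
def tri (n : ℤ) : ℤ := n * (n + 1) / 2

lemma two_mul_tri (n : ℤ) : 2 * tri n = n * (n + 1) :=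
  Int.mul_ediv_cancel' (Int.even_mul_succ_self n).two_dvd

lemma tri_add_one (n : ℤ) : tri (n + 1) = tri n + (n + 1) := by
  have h1 := two_mul_tri n
  have h2 := two_mul_tri (n + 1)
  linarith

lemma tri_zero : tri 0 = 0 := rfl

lemma tri_neg (n : ℤ) : tri (-n) = tri n - n := by
  have h1 := two_mul_tri n
  have h2 := two_mul_tri (-n)
  linarith

section theta
variable {q : ℝ}

lemma summable_theta_nat (h0 : 0 < q) (h1 : q < 1) {c : ℝ} (hc : c ≠ 0) {d : ℕ} (hd : 1 ≤ d) :
    Summable fun n : ℕ => c ^ (n : ℤ) * q ^ ((d : ℤ) * tri n) := by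
  refine summable_of_ratio_test_tendsto_lt_one (l := 0) one_pos
    (Eventually.of_forall fun n => by positivity) ?_
  have h : Tendsto (fun n : ℕ => |c| * ((q ^ d) ^ (n + 1))) atTop (𝓝 (|c| * 0)) :=
    ((tendsto_pow_atTop_nhds_zero_of_lt_one (by positivity)
      (pow_lt_one₀ h0.le h1 (by lia))).comp (tendsto_add_atTop_nat 1)).const_mul _
  rw [mul_zero] at h
  refine h.congr fun n => ?_
  have hq : q ^ ((d : ℤ) * tri ((n : ℤ) + 1)) = q ^ ((d : ℤ) * tri n) * (q ^ d) ^ (n + 1) := by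
    rw [tri_add_one, mul_add, zpow_add₀ h0.ne', ← pow_mul, ← zpow_natCast q (d * (n + 1))]
    push_cast
    ring
  have hne : q ^ ((d : ℤ) * tri n) ≠ 0 := by positivity
  push_cast
  rw [hq, zpow_add_one₀ hc, norm_mul, norm_mul, norm_mul, norm_mul]
  have h3 : ‖c ^ (n : ℤ)‖ ≠ 0 := norm_ne_zero_iff.2 (zpow_ne_zero _ hc)
  have h4 : ‖q ^ ((d : ℤ) * tri n)‖ ≠ 0 := norm_ne_zero_iff.2 hne
  field_simp
  simp [abs_of_pos h0]

lemma summable_theta (h0 : 0 < q) (h1 : q < 1) {c : ℝ} (hc : c ≠ 0) {d : ℕ} (hd : 1 ≤ d) :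
    Summable fun n : ℤ => c ^ n * q ^ ((d : ℤ) * tri n) := by
  refine Summable.of_nat_of_neg (summable_theta_nat h0 h1 hc hd) ?_
  have : (q ^ d * c)⁻¹ ≠ 0 := by positivity
  refine (summable_theta_nat h0 h1 this hd).congr fun n => ?_
  rw [tri_neg, mul_sub, zpow_sub₀ h0.ne', inv_zpow, mul_zpow, zpow_neg, zpow_mul q d n,
    zpow_natCast q d]
  field_simp

lemma exists_inv_one_sub_le (h0 : 0 < q) (h1 : q < 1) {b : ℝ} (hb : b ≠ 0) :
    ∃ C, ∀ n : ℤ, |(1 - b * q ^ n)⁻¹| ≤ C := by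
  have t1 : Tendsto (fun n : ℕ => |(1 - b * q ^ n)⁻¹|) atTop (𝓝 |(1 - b * 0)⁻¹|) := by
    refine (((tendsto_pow_atTop_nhds_zero_of_lt_one h0.le h1).const_mul b).const_sub 1 |>.inv₀
      (by simp)).abs
  have t2 : Tendsto (fun n : ℕ => |(q ^ n - b)⁻¹|) atTop (𝓝 |(0 - b)⁻¹|) := by
    refine (((tendsto_pow_atTop_nhds_zero_of_lt_one h0.le h1).sub_const b).inv₀
      (by simpa using hb)).abs
  obtain ⟨C1, hC1⟩ := t1.bddAbove_range
  obtain ⟨C2, hC2⟩ := t2.bddAbove_range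
  refine ⟨max C1 C2, fun n => ?_⟩
  rcases n.eq_nat_or_neg with ⟨m, rfl | rfl⟩
  · exact le_max_of_le_left (by simpa using hC1 ⟨m, rfl⟩)
  · refine le_max_of_le_right (le_trans ?_ (hC2 ⟨m, rfl⟩))
    have hm : q ^ m ≠ 0 := by positivity
    have : 1 - b * q ^ (-(m : ℤ)) = (q ^ m - b) / q ^ m := by
      rw [zpow_neg, zpow_natCast]; field_simp
    rw [this, inv_div, div_eq_mul_inv, abs_mul, abs_of_pos (by positivity : 0 < q ^ m)]
    exact mul_le_of_le_one_left (abs_nonneg _) (pow_le_one₀ h0.le h1.le)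

lemma jTheta_eq (h0 : 0 < q) (h1 : q < 1) (x : ℝ) :
    jTheta q x = (1 - x) * (qPoch q (q * x) * qPoch q (q / x)) := by
  rw [jTheta, qPoch_eq_mul h0 h1 x, mul_assoc]

lemma jTheta_mul_q (h0 : 0 < q) (h1 : q < 1) {x : ℝ} (hx : x ≠ 0) :
    jTheta q (q * x) = -jTheta q x / x := by
  have h := h0.ne'
  rw [jTheta_eq h0 h1 x, jTheta, show q / (q * x) = x⁻¹ by field_simp, qPoch_eq_mul h0 h1 x⁻¹,
    div_eq_mul_inv q x]
  field_simp
  ring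

lemma jTheta_inv (h0 : 0 < q) (h1 : q < 1) {x : ℝ} (hx : x ≠ 0) :
    jTheta q x⁻¹ = -jTheta q x / x := by
  have h := h0.ne'
  rw [← jTheta_mul_q h0 h1 hx, jTheta, jTheta, mul_comm]
  congr 2 <;> field_simp

lemma jTheta_one (h0 : 0 < q) (h1 : q < 1) : jTheta q 1 = 0 := by
  simp [jTheta, qPoch_one h0 h1]

lemma qPoch_ne_zero_of_zpow (h0 : 0 < q) (h1 : q < 1) {x : ℝ}
    (hx : ∀ n : ℤ, x * q ^ n ≠ 1) : qPoch q x ≠ 0 :=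
  qPoch_ne_zero h0 h1 fun n => by simpa using hx n

lemma zpow_ne_of_inv {x : ℝ} (h0 : 0 < q) (hx : ∀ n : ℤ, x * q ^ n ≠ 1) (n : ℤ) :
    q / x * q ^ n ≠ 1 := by
  intro h
  have hx0 : x ≠ 0 := by rintro rfl; simp at h
  refine hx (-(n + 1)) ?_
  rw [zpow_neg, zpow_add_one₀ h0.ne']
  have := zpow_ne_zero n h0.ne'
  field_simp at h ⊢
  linarith

lemma jTheta_ne_zero (h0 : 0 < q) (h1 : q < 1) {x : ℝ} (hx : ∀ n : ℤ, x * q ^ n ≠ 1) :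
    jTheta q x ≠ 0 :=
  mul_ne_zero (qPoch_ne_zero_of_zpow h0 h1 hx)
    (qPoch_ne_zero_of_zpow h0 h1 (zpow_ne_of_inv h0 hx))

/-- The finite, possibly unbalanced, theta product `(x; q)_A (q/x; q)_B`. -/
noncomputable def thetaFin (q x : ℝ) (A B : ℕ) : ℝ := qPochFin q x A * qPochFin q (q / x) B

lemma thetaFin_div_q (h0 : 0 < q) {x : ℝ} (hx : x ≠ 0) (A B : ℕ) :
    thetaFin q (x / q) (A + 1) B = -x / q * thetaFin q x A (B + 1) := by
  have h := h0.ne'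
  rw [thetaFin, thetaFin, qPochFin_succ_left, qPochFin_succ_left,
    show q * (x / q) = x by field_simp, show q / (x / q) = q * (q / x) by field_simp]
  field_simp
  ring

lemma thetaFin_shift (h0 : 0 < q) {x : ℝ} (hx : x ≠ 0) (n : ℤ) (A B A' B' : ℕ)
    (hA : (A' : ℤ) = A - n) (hB : (B' : ℤ) = B + n) :
    thetaFin q (x * q ^ (-n)) A B = (-x) ^ n * q ^ (-tri n) * thetaFin q x A' B' := by
  have h := h0.ne'
  have key : ∀ (n : ℕ) (x : ℝ), x ≠ 0 → ∀ A B : ℕ,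
      thetaFin q (x * q ^ (-(n : ℤ))) (A + n) B
        = (-x) ^ (n : ℤ) * q ^ (-tri n) * thetaFin q x A (B + n) := by
    intro n
    induction n with
    | zero => intro x hx A B; simp [tri_zero]
    | succ n ih =>
      intro x hx A B
      have e1 : x * q ^ (-((n + 1 : ℕ) : ℤ)) = x / q * q ^ (-(n : ℤ)) := by
        push_cast
        rw [neg_add, zpow_add₀ h, zpow_neg_one]; field_simp
      rw [e1, show A + (n + 1) = (A + 1) + n by ring, ih (x / q) (by positivity), 
        thetaFin_div_q h0 hx, show B + n + 1 = B + (n + 1) by ring]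
      push_cast
      rw [tri_add_one, neg_add, zpow_add₀ h, neg_add, zpow_add₀ h, zpow_neg_one,
        zpow_add_one₀ (neg_ne_zero.2 hx), ← neg_div, div_zpow, zpow_neg q (n : ℤ)]
      field_simp
  rcases n.eq_nat_or_neg with ⟨m, rfl | rfl⟩
  · obtain rfl : A = A' + m := by lia
    obtain rfl : B' = B + m := by lia
    exact key m x hx A' B
  · obtain rfl : A' = A + m := by lia
    obtain rfl : B = B' + m := by lia
    have := key m (x * q ^ (m : ℤ)) (by positivity) A B'
    rw [mul_assoc, ← zpow_add₀ h, add_neg_cancel, zpow_zero, mul_one] at this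
    rw [neg_neg, this, tri_neg]
    have e2 : (-x) ^ (m : ℤ) ≠ 0 := zpow_ne_zero _ (neg_ne_zero.2 hx)
    rw [← neg_mul, mul_zpow, ← zpow_mul, zpow_neg (-x)]
    have e3 := two_mul_tri m
    rw [show (m : ℤ) * m = tri m + (tri m - m) by linarith, zpow_add₀ h, zpow_neg q, zpow_neg q]
    field_simp

lemma tendsto_thetaFin (h0 : 0 < q) (h1 : q < 1) (x : ℝ) :
    Tendsto (fun N => thetaFin q x N N) atTop (𝓝 (jTheta q x)) :=
  (tendsto_qPochFin h0 h1 x).mul (tendsto_qPochFin h0 h1 (q / x))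

lemma thetaFin_ne_zero (h0 : 0 < q) {x : ℝ} (hx : ∀ n : ℤ, x * q ^ n ≠ 1) (A B : ℕ) :
    thetaFin q x A B ≠ 0 :=
  mul_ne_zero (qPochFin_ne_zero (fun n => by simpa using hx n) _)
    (qPochFin_ne_zero (fun n => by simpa using zpow_ne_of_inv h0 hx n) _)

end theta

end

section

open Filter Topology Finset Polynomial

/-- Partial fractions for `A / D` where `D` vanishes at the nodes `v i`. -/
lemma partial_fraction {α : Type*} [DecidableEq α] (s : Finset α) (v : α → ℝ)
    (hv : Set.InjOn v s) (A D : ℝ[X]) (E : α → ℝ[X]) (hE : ∀ i ∈ s, D = (X - C (v i)) * E i)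
    (hE0 : ∀ i ∈ s, (E i).eval (v i) ≠ 0) (hA : A.degree < s.card) (hD : D.natDegree ≤ s.card)
    (x : ℝ) (hx : D.eval x ≠ 0) :
    A.eval x / D.eval x = ∑ i ∈ s, A.eval (v i) / ((E i).eval (v i) * (x - v i)) := by
  have key : A = ∑ i ∈ s, C (A.eval (v i) / (E i).eval (v i)) * E i := by
    refine eq_of_degrees_lt_of_eval_index_eq s hv hA ?_ ?_
    · refine lt_of_le_of_lt (degree_sum_le _ _) ((Finset.sup_lt_iff ?_).2 fun i hi => ?_)
      · exact_mod_cast WithBot.bot_lt_coe _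
      · refine lt_of_le_of_lt (degree_le_of_natDegree_le (natDegree_C_mul_le _ _)) ?_
        have hEi : E i ≠ 0 := by rintro h; simpa [h] using hE0 i hi
        have h1 := hE i hi
        have h2 : D.natDegree = 1 + (E i).natDegree := by
          rw [h1, natDegree_mul (X_sub_C_ne_zero _) hEi, natDegree_X_sub_C]
        exact_mod_cast (by lia : (E i).natDegree < s.card)
    · intro j hj
      rw [eval_finsetSum, Finset.sum_eq_single j]
      · simp [div_mul_cancel₀ _ (hE0 j hj)]
      · intro i hi hij
        have h1 : D.eval (v j) = 0 := by rw [hE j hj]; simp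
        rw [hE i hi] at h1
        have h2 : v j - v i ≠ 0 := sub_ne_zero.2 fun h => hij (hv hi hj h.symm)
        simp only [eval_mul, eval_sub, eval_X, eval_C, mul_eq_zero] at h1
        simp [h1.resolve_left h2]
      · exact fun h => absurd hj h
  conv_lhs => rw [key]
  rw [eval_finsetSum, Finset.sum_div]
  refine Finset.sum_congr rfl fun i hi => ?_
  have h1 : D.eval x = (x - v i) * (E i).eval x := by rw [hE i hi]; simp
  have h2 : (x - v i) * (E i).eval x ≠ 0 := h1 ▸ hx
  have h3 := left_ne_zero_of_mul h2
  have h4 := right_ne_zero_of_mul h2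
  have h5 := hE0 i hi
  rw [h1]
  simp only [eval_mul, eval_C]
  field_simp

/-- `x ^ N (a x; q)_N (q/(a x); q)_N` as a polynomial in `x`. -/
noncomputable def thetaPoly (q a : ℝ) (N : ℕ) : ℝ[X] :=
  ∏ k ∈ range N, ((1 - C (a * q ^ k) * X) * (X - C (q / a * q ^ k)))

section
variable {q : ℝ}

lemma eval_thetaPoly {a x : ℝ} (hx : x ≠ 0) (N : ℕ) :
    (thetaPoly q a N).eval x = x ^ N * thetaFin q (a * x) N N := by
  simp only [thetaPoly, eval_prod, thetaFin, qPochFin, ← Finset.prod_mul_distrib]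
  have : x ^ N = ∏ _k ∈ range N, x := by simp
  rw [this, ← Finset.prod_mul_distrib]
  refine Finset.prod_congr rfl fun k _ => ?_
  simp only [eval_mul, eval_sub, eval_one, eval_C, eval_X]
  field_simp

lemma natDegree_thetaPoly_le (a : ℝ) (N : ℕ) : (thetaPoly q a N).natDegree ≤ 2 * N := by
  refine (natDegree_prod_le _ _).trans ?_
  refine (Finset.sum_le_sum (g := fun _ => 2) fun k _ => ?_).trans (by simp [mul_comm])
  refine natDegree_mul_le.trans ?_
  have h1 : (1 - C (a * q ^ k) * X : ℝ[X]).natDegree ≤ 1 := by compute_degree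
  have h2 : (X - C (q / a * q ^ k) : ℝ[X]).natDegree ≤ 1 := by compute_degree
  lia

lemma thetaFin_zpow_eq (h0 : 0 < q) (n : ℤ) (y : ℝ) (hy : y ≠ 0) {N : ℕ}
    (hn : n ∈ Ico (-(N : ℤ)) N) :
    thetaFin q (y * q ^ (-n)) N N = (1 - y) * ((-y) ^ n * q ^ (-tri n) *
      (qPochFin q (q * y) ((N - n - 1).toNat) * qPochFin q (q / y) ((N + n).toNat))) := by
  have hn' := Finset.mem_Ico.1 hn
  rw [thetaFin_shift h0 hy n N N ((N - n - 1).toNat + 1) ((N + n).toNat) (by lia) (by lia),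
    thetaFin, qPochFin_succ_left]
  ring

lemma continuous_qPochFin (N : ℕ) : Continuous fun x => qPochFin q x N := by
  unfold qPochFin; fun_prop

lemma continuousAt_thetaFin {x : ℝ} (hx : x ≠ 0) (A B : ℕ) :
    ContinuousAt (fun x => thetaFin q x A B) x :=
  (continuous_qPochFin A).continuousAt.mul
    ((continuous_qPochFin B).continuousAt.comp (continuousAt_const.div continuousAt_id hx))

lemma thetaFin_partial_fraction {ι κ : Type*} [Fintype ι] [Fintype κ] [DecidableEq ι]
    (h0 : 0 < q) (a : κ → ℝ) (b : ι → ℝ) (hb0 : ∀ i, b i ≠ 0)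
    (h1 : q < 1) (hb : ∀ i (n : ℤ), b i * q ^ n ≠ 1)
    (hbb : ∀ i j, i ≠ j → ∀ n : ℤ, b j / b i * q ^ n ≠ 1)
    (hc : Fintype.card κ < Fintype.card ι) {N : ℕ} (hN : 1 ≤ N) :
    (∏ k, thetaFin q (a k) N N) / ∏ j, thetaFin q (b j) N N =
      ∑ i, ∑ n ∈ Ico (-(N : ℤ)) N, (∏ k, thetaFin q (a k / b i * q ^ (-n)) N N) /
        (∏ j ∈ univ.erase i, thetaFin q (b j / b i * q ^ (-n)) N N) *
        ((-1) ^ n * q ^ tri n / (qPochFin q q ((N - n - 1).toNat) *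
          qPochFin q q ((N + n).toNat))) / (1 - b i * q ^ n) := by
  set D : ℝ[X] := ∏ j, thetaPoly q (b j) N with hD
  set A : ℝ[X] := X ^ (N * (Fintype.card ι - Fintype.card κ)) * ∏ k, thetaPoly q (a k) N with hA
  set v : ι × ℤ → ℝ := fun p => q ^ (-p.2) / b p.1 with hv
  have hv0 : ∀ p, v p ≠ 0 := fun p => div_ne_zero (zpow_ne_zero _ h0.ne') (hb0 _)
  set s : Finset (ι × ℤ) := univ ×ˢ Ico (-(N : ℤ)) N with hs
  have hcard : s.card = Fintype.card ι * (2 * N) := by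
    rw [hs, card_product, card_univ, Int.card_Ico]; congr 1; lia
  have evD : ∀ x, x ≠ 0 → D.eval x = x ^ (N * Fintype.card ι) * ∏ j, thetaFin q (b j * x) N N := by
    intro x hx
    rw [hD, eval_prod, prod_congr rfl fun j _ => eval_thetaPoly hx N, prod_mul_distrib, prod_const,
      card_univ, pow_mul]
  have evA : ∀ x, x ≠ 0 → A.eval x = x ^ (N * Fintype.card ι) * ∏ k, thetaFin q (a k * x) N N := by
    intro x hx
    rw [hA, eval_mul, eval_prod, prod_congr rfl fun j _ => eval_thetaPoly hx N, prod_mul_distrib,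
      prod_const, card_univ, ← pow_mul, eval_pow, eval_X, ← mul_assoc, ← pow_add, ← mul_add,
      Nat.sub_add_cancel hc.le]
  have hroot : ∀ p ∈ s, D.IsRoot (v p) := by
    intro p hp
    have hp2 := (mem_product.1 hp).2
    rw [IsRoot.def, evD _ (hv0 p), prod_eq_zero (mem_univ p.1), mul_zero]
    have := thetaFin_zpow_eq h0 p.2 1 one_ne_zero hp2
    rw [one_mul, sub_self, zero_mul] at this
    rw [hv, mul_div_cancel₀ _ (hb0 _), this]
  set E : ι × ℤ → ℝ[X] := fun p => D /ₘ (X - C (v p)) with hEdef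
  have hE : ∀ p ∈ s, D = (X - C (v p)) * E p := fun p hp =>
    (mul_divByMonic_eq_iff_isRoot.2 (hroot p hp)).symm
  have evE : ∀ p ∈ s, (E p).eval (v p) = -(v p ^ (N * Fintype.card ι) / v p) *
      (((-1) ^ p.2 * q ^ (-tri p.2) *
      (qPochFin q q ((N - p.2 - 1).toNat) * qPochFin q q ((N + p.2).toNat))) *
      ∏ j ∈ univ.erase p.1, thetaFin q (b j * v p) N N) := by
    rintro ⟨i, n⟩ hp
    set x := v (i, n) with hx
    have hx0 : x ≠ 0 := hv0 _
    have hn := (mem_product.1 hp).2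
    let R : ℝ → ℝ := fun y => -((y * x) ^ (N * Fintype.card ι) / x) * (((-y) ^ n * q ^ (-tri n) *
      (qPochFin q (q * y) ((N - n - 1).toNat) * qPochFin q (q / y) ((N + n).toNat))) *
      ∏ j ∈ univ.erase i, thetaFin q (b j * (y * x)) N N)
    have hL : Tendsto (fun y => (E (i, n)).eval (y * x)) (𝓝[≠] 1) (𝓝 ((E (i, n)).eval (1 * x))) :=
      tendsto_nhdsWithin_of_tendsto_nhds
        (((E (i, n)).continuous.comp (continuous_id.mul continuous_const)).tendsto 1)
    have hR : ContinuousAt R 1 := by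
      refine ContinuousAt.mul (by fun_prop) (ContinuousAt.mul (ContinuousAt.mul
        (ContinuousAt.mul (ContinuousAt.zpow₀ (by fun_prop) n (by simp)) continuousAt_const)
        (ContinuousAt.mul ?_ ?_)) (tendsto_finsetProd _ fun j _ => ?_))
      · exact ((continuous_qPochFin _).comp (continuous_const.mul continuous_id)).continuousAt
      · exact (continuous_qPochFin _).continuousAt.comp
          (continuousAt_const.div continuousAt_id one_ne_zero)
      · refine ContinuousAt.tendsto (x := (1 : ℝ)) (f := fun y => thetaFin q (b j * (y * x)) N N) ?_
        refine ContinuousAt.comp (g := fun x => thetaFin q x N N)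
          (f := fun y => b j * (y * x)) (continuousAt_thetaFin ?_ _ _) (by fun_prop)
        simpa using ⟨hb0 j, hx0⟩
    have heq : ∀ᶠ y in 𝓝[≠] (1 : ℝ), R y = (E (i, n)).eval (y * x) := by
      have h2 : ∀ᶠ y in 𝓝[≠] (1 : ℝ), y ≠ 0 :=
        eventually_nhdsWithin_of_eventually_nhds (isOpen_ne.mem_nhds one_ne_zero)
      filter_upwards [h2, self_mem_nhdsWithin] with y hy hy1
      have hy1' : y - 1 ≠ 0 := sub_ne_zero.2 hy1
      have h3 := evD (y * x) (mul_ne_zero hy hx0)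
      rw [hE _ hp, eval_mul, ← mul_prod_erase _ _ (mem_univ i)] at h3
      have h4 : b i * (y * x) = y * q ^ (-n) := by
        rw [hx, hv]; have := hb0 i; field_simp
      rw [h4, thetaFin_zpow_eq h0 n y hy hn] at h3
      simp only [eval_sub, eval_X, eval_C, ← hx] at h3
      have h5 : (y * x - x) ≠ 0 := by
        rw [show y * x - x = (y - 1) * x by ring]; exact mul_ne_zero hy1' hx0
      apply mul_left_cancel₀ h5
      rw [h3]
      simp only [R]
      field_simp
      ring
    have := tendsto_nhds_unique ((tendsto_nhdsWithin_of_tendsto_nhds hR).congr' heq) hL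
    rw [one_mul] at this
    rw [← this]
    simp only [R, one_mul, mul_one, div_one]
  have hfq : ∀ M, qPochFin q q M ≠ 0 := fun M => qPochFin_ne_zero (fun n => by
    rw [← pow_succ']; exact (pow_lt_one₀ h0.le h1 (by simp)).ne) M
  have evE0 : ∀ p ∈ s, (E p).eval (v p) ≠ 0 := by
    intro p hp
    rw [evE p hp]
    refine mul_ne_zero (neg_ne_zero.2 (div_ne_zero (pow_ne_zero _ (hv0 p)) (hv0 p)))
      (mul_ne_zero (mul_ne_zero (mul_ne_zero (zpow_ne_zero _ (by norm_num))
        (zpow_ne_zero _ h0.ne')) (mul_ne_zero (hfq _) (hfq _))) ?_)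
    refine prod_ne_zero_iff.2 fun j hj => thetaFin_ne_zero h0 (fun m => ?_) _ _
    have h6 := hbb p.1 j (ne_of_mem_erase hj).symm (-p.2 + m)
    rw [zpow_add₀ h0.ne'] at h6
    rw [hv]
    convert h6 using 1
    ring
  have hinj : Set.InjOn v s := by
    rintro ⟨i, n⟩ - ⟨j, m⟩ - h
    simp only [hv] at h
    have hbi := hb0 i
    have hbj := hb0 j
    have h7 : b j / b i * q ^ (m - n) = 1 := by
      rw [zpow_sub₀ h0.ne', zpow_neg, zpow_neg] at *
      have := zpow_ne_zero n h0.ne'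
      have := zpow_ne_zero m h0.ne'
      field_simp at h ⊢
      linarith
    by_cases hij : i = j
    · subst hij
      rw [div_self hbi, one_mul] at h7
      have := zpow_right_injective₀ h0 h1.ne (h7.trans (zpow_zero q).symm)
      rw [show n = m by lia]
    · exact absurd h7 (hbb i j hij _)
  have hDdeg : D.natDegree ≤ s.card := by
    rw [hcard, hD]
    refine (natDegree_prod_le _ _).trans ((sum_le_sum fun j _ => natDegree_thetaPoly_le _ N).trans ?_)
    simp
  have hAdeg : A.degree < s.card := by
    refine lt_of_le_of_lt degree_le_natDegree ?_
    have : A.natDegree ≤ N * (Fintype.card ι - Fintype.card κ) + Fintype.card κ * (2 * N) := by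
      refine natDegree_mul_le.trans (add_le_add (natDegree_X_pow_le _) ?_)
      refine (natDegree_prod_le _ _).trans
        ((sum_le_sum fun j _ => natDegree_thetaPoly_le _ N).trans ?_)
      simp
    obtain ⟨e, he⟩ := Nat.exists_eq_add_of_lt hc
    rw [hcard]
    rw [he] at this ⊢
    have h8 : A.natDegree < (Fintype.card κ + e + 1) * (2 * N) := by
      refine lt_of_le_of_lt this ?_
      rw [show Fintype.card κ + e + 1 - Fintype.card κ = e + 1 by lia]
      nlinarith
    exact_mod_cast h8
  have hD1 : D.eval 1 ≠ 0 := by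
    rw [evD 1 one_ne_zero, one_pow, one_mul]
    exact prod_ne_zero_iff.2 fun j _ => thetaFin_ne_zero h0 (by simpa using hb j) _ _
  have main := partial_fraction s v hinj A D E hE evE0 hAdeg hDdeg 1 hD1
  rw [evA 1 one_ne_zero, evD 1 one_ne_zero] at main
  simp only [one_pow, one_mul, mul_one] at main
  rw [main, hs, sum_product]
  refine sum_congr rfl fun i _ => sum_congr rfl fun n hn => ?_
  have hp : (i, n) ∈ s := mem_product.2 ⟨mem_univ _, hn⟩
  have e0 := evE0 _ hp
  rw [evE _ hp] at e0 ⊢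
  rw [evA _ (hv0 _)]
  have hbi := hb0 i
  have e1 : ∀ c, c * v (i, n) = c / b i * q ^ (-n) := fun c => by rw [hv]; ring
  simp only [e1] at e0 ⊢
  have e2 : 1 - b i * q ^ n = - (1 - v (i, n)) / v (i, n) := by
    have h9 : v (i, n) * (b i * q ^ n) = 1 := by
      simp only [hv]
      rw [zpow_neg]
      have := zpow_ne_zero n h0.ne'
      field_simp
    have h10 := hv0 (i, n)
    rw [eq_div_iff h10]
    linear_combination -h9
  rw [e2, zpow_neg q (tri n)]
  have h11 : (-1 : ℝ) ^ n * (-1) ^ n = 1 := by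
    rw [← mul_zpow]; simp
  have h13 := hv0 (i, n)
  have h14 : (v (i, n)) ^ (N * Fintype.card ι) ≠ 0 := pow_ne_zero _ h13
  generalize (∏ j ∈ univ.erase i, thetaFin q (b j / b i * q ^ (-n)) N N) = P1
  generalize (∏ k, thetaFin q (a k / b i * q ^ (-n)) N N) = P2
  generalize (v (i, n)) ^ (N * Fintype.card ι) = V at *
  simp only [div_eq_mul_inv, mul_inv, inv_neg, inv_inv]
  field_simp
  rw [pow_two, h11, mul_one]

end

end

section

open Filter Topology Finset
variable {q : ℝ}

lemma exists_thetaFin_le (h0 : 0 < q) (h1 : q < 1) (x : ℝ) :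
    ∃ C, ∀ A B, |thetaFin q x A B| ≤ C := by
  obtain ⟨C1, hC1⟩ := exists_qPochFin_le h0 h1 x
  obtain ⟨C2, hC2⟩ := exists_qPochFin_le h0 h1 (q / x)
  refine ⟨C1 * C2, fun A B => ?_⟩
  rw [thetaFin, abs_mul]
  exact mul_le_mul (hC1 A) (hC2 B) (abs_nonneg _) ((abs_nonneg _).trans (hC1 0))

lemma exists_inv_thetaFin_le (h0 : 0 < q) (h1 : q < 1) {x : ℝ} (hx : ∀ n : ℤ, x * q ^ n ≠ 1) :
    ∃ C, ∀ A B, |(thetaFin q x A B)⁻¹| ≤ C := by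
  obtain ⟨C1, hC1⟩ := exists_inv_qPochFin_le h0 h1 (x := x) (fun n => by simpa using hx n)
  obtain ⟨C2, hC2⟩ := exists_inv_qPochFin_le h0 h1 (x := q / x)
    (fun n => by simpa using zpow_ne_of_inv h0 hx n)
  refine ⟨C1 * C2, fun A B => ?_⟩
  rw [thetaFin, mul_inv, abs_mul]
  exact mul_le_mul (hC1 A) (hC2 B) (abs_nonneg _) ((abs_nonneg _).trans (hC1 0))

lemma exists_prod_abs_le {α β : Type*} (s : Finset α) (f : α → β → ℝ)
    (h : ∀ i ∈ s, ∃ C, ∀ x, |f i x| ≤ C) : ∃ C, ∀ x, |∏ i ∈ s, f i x| ≤ C := by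
  choose! C hC using h
  refine ⟨∏ i ∈ s, C i, fun x => ?_⟩
  rw [abs_prod]
  exact prod_le_prod (fun _ _ => abs_nonneg _) fun i hi => hC i hi x

lemma mul_zpow_self_ne_one (h0 : 0 < q) (h1 : q < 1) (n : ℕ) : q * q ^ n ≠ 1 := by
  rw [← pow_succ']; exact (pow_lt_one₀ h0.le h1 (by simp)).ne

lemma tendsto_toNat_add (n : ℤ) : Tendsto (fun N : ℕ => ((N : ℤ) + n).toNat) atTop atTop := by
  refine tendsto_atTop.2 fun b => ?_
  filter_upwards [eventually_ge_atTop (b + n.natAbs)] with N hN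
  lia

/-- Partial fractions for quotients of theta functions. -/
theorem jTheta_partial_fraction {ι κ : Type*} [Fintype ι] [Fintype κ] [DecidableEq ι]
    (h0 : 0 < q) (h1 : q < 1) (a : κ → ℝ) (b : ι → ℝ) (ha0 : ∀ k, a k ≠ 0) (hb0 : ∀ i, b i ≠ 0)
    (hb : ∀ i (n : ℤ), b i * q ^ n ≠ 1)
    (hbb : ∀ i j, i ≠ j → ∀ n : ℤ, b j / b i * q ^ n ≠ 1) (d : ℕ) (hd : 1 ≤ d)
    (hc : Fintype.card ι = Fintype.card κ + d) :
    (∏ k, jTheta q (a k)) / ∏ j, jTheta q (b j) =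
      ∑ i, (∏ k, jTheta q (a k / b i)) / (∏ j ∈ univ.erase i, jTheta q (b j / b i)) /
        qPoch q q ^ 2 *
        ∑' n : ℤ, ((-b i) ^ d * ((∏ k, a k) / ∏ j, b j)) ^ n * q ^ ((d : ℤ) * tri n) /
          (1 - b i * q ^ n) := by
  let br : ι → ℕ → ℤ → ℝ := fun i N n =>
    (∏ k, thetaFin q (a k / b i) ((N + -n : ℤ)).toNat ((N + n : ℤ)).toNat) *
    (∏ j ∈ univ.erase i, (thetaFin q (b j / b i) ((N + -n : ℤ)).toNat ((N + n : ℤ)).toNat)⁻¹) *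
    ((qPochFin q q ((N + (-n - 1) : ℤ).toNat))⁻¹ * (qPochFin q q ((N + n : ℤ).toNat))⁻¹)
  let w : ι → ℝ := fun i => (-b i) ^ d * ((∏ k, a k) / ∏ j, b j)
  let th : ι → ℤ → ℝ := fun i n => w i ^ n * q ^ ((d : ℤ) * tri n) / (1 - b i * q ^ n)
  have hw : ∀ i, w i ≠ 0 := fun i => mul_ne_zero (pow_ne_zero _ (neg_ne_zero.2 (hb0 i)))
    (div_ne_zero (prod_ne_zero_iff.2 fun k _ => ha0 k) (prod_ne_zero_iff.2 fun k _ => hb0 k))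
  have hbr : ∀ i, ∃ C, ∀ p : ℕ × ℤ, |br i p.1 p.2| ≤ C := by
    intro i
    obtain ⟨C1, hC1⟩ := exists_prod_abs_le univ (fun k (p : ℕ × ℤ) =>
      thetaFin q (a k / b i) ((p.1 + -p.2 : ℤ)).toNat ((p.1 + p.2 : ℤ)).toNat) fun k _ => by
        obtain ⟨C, hC⟩ := exists_thetaFin_le h0 h1 (a k / b i)
        exact ⟨C, fun p => hC _ _⟩
    obtain ⟨C2, hC2⟩ := exists_prod_abs_le (univ.erase i) (fun j (p : ℕ × ℤ) =>
      (thetaFin q (b j / b i) ((p.1 + -p.2 : ℤ)).toNat ((p.1 + p.2 : ℤ)).toNat)⁻¹) fun j hj => by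
        obtain ⟨C, hC⟩ := exists_inv_thetaFin_le h0 h1 (hbb i j (ne_of_mem_erase hj).symm)
        exact ⟨C, fun p => hC _ _⟩
    obtain ⟨C3, hC3⟩ := exists_inv_qPochFin_le h0 h1 (mul_zpow_self_ne_one h0 h1)
    refine ⟨C1 * C2 * (C3 * C3), fun p => ?_⟩
    simp only [br, abs_mul]
    have p1 := (abs_nonneg _).trans (hC1 p)
    have p2 := (abs_nonneg _).trans (hC2 p)
    have p3 := (abs_nonneg _).trans (hC3 0)
    gcongr
    · exact hC1 p
    · exact hC2 p
    · exact hC3 _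
    · exact hC3 _
  have hlim : ∀ i n, Tendsto (fun N => br i N n) atTop
      (𝓝 ((∏ k, jTheta q (a k / b i)) * (∏ j ∈ univ.erase i, (jTheta q (b j / b i))⁻¹) *
        ((qPoch q q)⁻¹ * (qPoch q q)⁻¹))) := by
    intro i n
    have hT : ∀ x, Tendsto (fun N : ℕ => thetaFin q x ((N + -n : ℤ)).toNat ((N + n : ℤ)).toNat) atTop
        (𝓝 (jTheta q x)) := fun x => ((tendsto_qPochFin h0 h1 x).comp (tendsto_toNat_add _)).mul
          ((tendsto_qPochFin h0 h1 (q / x)).comp (tendsto_toNat_add _))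
    have hJ := qPoch_ne_zero h0 h1 (mul_zpow_self_ne_one h0 h1)
    refine ((tendsto_finsetProd _ fun k _ => hT _).mul (tendsto_finsetProd _ fun j hj =>
      (hT _).inv₀ (jTheta_ne_zero h0 h1 (hbb i j (ne_of_mem_erase hj).symm)))).mul
      ((((tendsto_qPochFin h0 h1 q).comp (tendsto_toNat_add _)).inv₀ hJ).mul
      (((tendsto_qPochFin h0 h1 q).comp (tendsto_toNat_add _)).inv₀ hJ))
  have hsum : ∀ i, Summable fun n => |th i n| := by
    intro i
    obtain ⟨C, hC⟩ := exists_inv_one_sub_le h0 h1 (hb0 i)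
    refine Summable.of_nonneg_of_le (fun _ => abs_nonneg _) (fun n => ?_)
      ((summable_theta h0 h1 (hw i) hd).abs.mul_right C)
    simp only [th, div_eq_mul_inv, abs_mul]
    gcongr
    exact hC n
  have hfin : ∀ᶠ N : ℕ in atTop, (∏ k, thetaFin q (a k) N N) / ∏ j, thetaFin q (b j) N N =
      ∑ i, ∑' n : ℤ, (if n ∈ Ico (-(N : ℤ)) N then th i n * br i N n else 0) := by
    filter_upwards [eventually_ge_atTop 1] with N hN
    rw [thetaFin_partial_fraction h0 a b hb0 h1 hb hbb (by lia) hN]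
    refine sum_congr rfl fun i _ => ?_
    rw [tsum_eq_sum (s := Ico (-(N : ℤ)) N) fun n hn => by rw [if_neg hn]]
    refine sum_congr rfl fun n hn => ?_
    rw [if_pos hn]
    have hn' := mem_Ico.1 hn
    have hs : ∀ x, x ≠ 0 → thetaFin q (x * q ^ (-n)) N N = (-x) ^ n * q ^ (-tri n) *
        thetaFin q x ((N + -n : ℤ)).toNat ((N + n : ℤ)).toNat := fun x hx =>
      thetaFin_shift h0 hx n N N _ _ (by lia) (by lia)
    rw [prod_congr rfl fun k _ => hs _ (div_ne_zero (ha0 k) (hb0 i)),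
      prod_congr rfl fun k _ => hs _ (div_ne_zero (hb0 k) (hb0 i)),
      prod_mul_distrib, prod_mul_distrib, prod_mul_distrib, prod_mul_distrib, prod_const, prod_const,
      prod_zpow, prod_zpow]
    have c1 : (univ.erase i).card = Fintype.card κ + d - 1 := by
      rw [card_erase_of_mem (mem_univ i), card_univ, hc]
    have c2 : ∏ k, -(a k / b i) = (∏ k, a k) / (-b i) ^ (Fintype.card κ) := by
      rw [prod_congr rfl fun k _ => (div_neg (a k)).symm, prod_div_distrib, prod_const, card_univ]
    have c3 : ∏ j ∈ univ.erase i, -(b j / b i) = (∏ j, b j) / b i /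
        (-b i) ^ (Fintype.card κ + d - 1) := by
      rw [prod_congr rfl fun k _ => (div_neg (b k)).symm, prod_div_distrib, prod_const, c1,
        ← mul_prod_erase univ b (mem_univ i), mul_div_cancel_left₀ _ (hb0 i)]
    rw [c1, c2, c3]
    simp only [th, br, w, prod_inv_distrib]
    rw [show (N : ℤ) - n - 1 = N + (-n - 1) by ring]
    have hni := neg_ne_zero.2 (hb0 i)
    have hpa : (∏ k, a k) ≠ 0 := prod_ne_zero_iff.2 fun k _ => ha0 k
    have hpb : (∏ k, b k) ≠ 0 := prod_ne_zero_iff.2 fun k _ => hb0 k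
    generalize (∏ k, a k) = PA at *
    generalize (∏ k, b k) = PB at *
    obtain ⟨e, rfl⟩ := Nat.exists_eq_add_of_le hd
    have e1 : (PA / (-b i) ^ Fintype.card κ) ^ n * (-1) ^ n /
        (PB / b i / (-b i) ^ (Fintype.card κ + (1 + e) - 1)) ^ n
        = ((-b i) ^ (1 + e) * (PA / PB)) ^ n := by
      rw [← mul_zpow, ← div_zpow]
      congr 1
      rw [show Fintype.card κ + (1 + e) - 1 = Fintype.card κ + e by lia, pow_add, pow_add]
      field_simp
    have e2 : (q ^ (-tri n)) ^ Fintype.card κ * q ^ tri n /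
        (q ^ (-tri n)) ^ (Fintype.card κ + (1 + e) - 1)
        = q ^ (((1 + e : ℕ) : ℤ) * tri n) := by
      rw [show Fintype.card κ + (1 + e) - 1 = Fintype.card κ + e by lia, pow_add]
      have : (q ^ (-tri n)) ≠ 0 := zpow_ne_zero _ h0.ne'
      have h3 : q ^ (((1 + e : ℕ) : ℤ) * tri n) = q ^ tri n * ((q ^ (-tri n)) ^ e)⁻¹ := by
        push_cast
        rw [add_mul, one_mul, zpow_add₀ h0.ne', zpow_neg, inv_pow, inv_inv, ← zpow_natCast,
          ← zpow_mul, mul_comm (tri n)]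
      rw [h3]
      field_simp
    rw [← e1, ← e2, card_univ]
    simp only [div_eq_mul_inv, mul_inv]
    ring
  have hT : Tendsto (fun N : ℕ => ∑ i, ∑' n : ℤ,
      (if n ∈ Ico (-(N : ℤ)) N then th i n * br i N n else 0)) atTop
      (𝓝 (∑ i, ∑' n : ℤ, th i n * ((∏ k, jTheta q (a k / b i)) *
        (∏ j ∈ univ.erase i, (jTheta q (b j / b i))⁻¹) * ((qPoch q q)⁻¹ * (qPoch q q)⁻¹)))) := by
    refine tendsto_finsetSum _ fun i _ => ?_
    obtain ⟨C, hC⟩ := hbr i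
    refine tendsto_tsum_of_dominated_convergence ((hsum i).mul_right C) (fun n => ?_)
      (Eventually.of_forall fun N n => ?_)
    · refine ((hlim i n).const_mul (th i n)).congr' ?_
      filter_upwards [eventually_ge_atTop (n.natAbs + 1)] with N hN
      rw [if_pos (mem_Ico.2 (by lia))]
    · split_ifs
      · rw [Real.norm_eq_abs, abs_mul]
        gcongr
        exact hC (N, n)
      · rw [norm_zero]
        exact mul_nonneg (abs_nonneg _) ((abs_nonneg _).trans (hC (0, 0)))
  have hL : Tendsto (fun N : ℕ => (∏ k, thetaFin q (a k) N N) / ∏ j, thetaFin q (b j) N N) atTop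
      (𝓝 ((∏ k, jTheta q (a k)) / ∏ j, jTheta q (b j))) :=
    (tendsto_finsetProd _ fun k _ => tendsto_thetaFin h0 h1 _).div
      (tendsto_finsetProd _ fun k _ => tendsto_thetaFin h0 h1 _)
      (prod_ne_zero_iff.2 fun j _ => jTheta_ne_zero h0 h1 (hb j))
  rw [tendsto_nhds_unique (hL.congr' hfin) hT]
  refine sum_congr rfl fun i _ => ?_
  rw [tsum_mul_right, mul_comm]
  congr 1
  simp only [prod_inv_distrib]
  ring

end

section

open Filter Topology Finset
variable {q : ℝ}

/-- Appell--Lerch sums `∑ wⁿ q^(d n(n+1)/2) / (1 - b qⁿ)`. -/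
noncomputable def appell (q : ℝ) (d : ℕ) (w b : ℝ) : ℝ :=
  ∑' n : ℤ, w ^ n * q ^ ((d : ℤ) * tri n) / (1 - b * q ^ n)

lemma jTheta_of_zpow (h0 : 0 < q) (h1 : q < 1) {x : ℝ} {n : ℤ} (h : x * q ^ n = 1) :
    jTheta q x = 0 := by
  have key : ∀ m : ℤ, jTheta q (q ^ m) = 0 := by
    intro m
    induction m with
    | zero => simpa using jTheta_one h0 h1
    | succ m ih =>
      rw [zpow_add_one₀ h0.ne', mul_comm, jTheta_mul_q h0 h1 (by positivity), ih]; simp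
    | pred m ih =>
      have h2 : q ^ (-(m : ℤ)) = q * q ^ (-(m : ℤ) - 1) := by
        rw [zpow_sub_one₀ h0.ne']; field_simp
      rw [h2, jTheta_mul_q h0 h1 (by positivity)] at ih
      have h3 : q ^ (-(m : ℤ) - 1) ≠ 0 := by positivity
      field_simp at ih
      simpa using ih
  have hx : x = q ^ (-n) := by
    rw [zpow_neg]; exact eq_inv_of_mul_eq_one_left h
  rw [hx, key]

lemma zpow_ne_of_jTheta_ne_zero (h0 : 0 < q) (h1 : q < 1) {x : ℝ} (h : jTheta q x ≠ 0) (n : ℤ) :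
    x * q ^ n ≠ 1 := fun h' => h (jTheta_of_zpow h0 h1 h')

lemma jTheta_inv_ne_zero (h0 : 0 < q) (h1 : q < 1) {x : ℝ} (hx : x ≠ 0) (h : jTheta q x ≠ 0) :
    jTheta q x⁻¹ ≠ 0 := by
  rw [jTheta_inv h0 h1 hx]
  exact div_ne_zero (neg_ne_zero.2 h) hx

lemma sq_div_jTheta (h0 : 0 < q) (h1 : q < 1) {z : ℝ} (hz : z ≠ 0) (hP : jTheta q z ≠ 0) :
    qPoch q q ^ 2 / jTheta q z = appell q 1 (-1) z := by
  have h := jTheta_partial_fraction h0 h1 (fun k : Fin 0 => (0 : ℝ)) (fun _ : Fin 1 => z)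
    (by simp) (fun _ => hz) (fun _ n => zpow_ne_of_jTheta_ne_zero h0 h1 hP n)
    (fun i j hij => absurd (Subsingleton.elim i j) hij) 1 le_rfl (by simp)
  have hJ : qPoch q q ≠ 0 := (qPoch_pos h0 h1 h1).ne'
  have he : (univ.erase (0 : Fin 1)) = ∅ := rfl
  simp only [Fin.prod_univ_zero, Fin.prod_univ_one, Fin.sum_univ_one, he, prod_empty] at h
  have hw : (-z) ^ 1 * (1 / z) = -1 := by field_simp
  rw [hw] at h
  rw [appell, div_eq_mul_one_div, h]
  field_simp

lemma crank_pair (h0 : 0 < q) (h1 : q < 1) {z ζ : ℝ} (hz : z ≠ 0) (hζ : ζ ≠ 0)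
    (hP : jTheta q ζ ≠ 0) (hP2 : jTheta q (ζ ^ 2) ≠ 0)
    (ha : jTheta q (z * ζ) ≠ 0) (hb : jTheta q (z / ζ) ≠ 0) :
    ζ * appell q 1 (-ζ) (z * ζ) + appell q 1 (-ζ⁻¹) (z / ζ) =
      qPoch q q ^ 2 * jTheta q z * jTheta q (ζ ^ 2) /
        (jTheta q (z * ζ) * jTheta q (z / ζ) * jTheta q ζ) := by
  have hJ : qPoch q q ≠ 0 := (qPoch_pos h0 h1 h1).ne'
  have e01 : z / ζ / (z * ζ) = (ζ ^ 2)⁻¹ := by field_simp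
  have e10 : z * ζ / (z / ζ) = ζ ^ 2 := by field_simp
  have h := jTheta_partial_fraction h0 h1 (fun k : Fin 1 => z) ![z * ζ, z / ζ]
    (fun _ => hz) (by simp [Fin.forall_fin_two, hz, hζ])
    (by
      rw [Fin.forall_fin_two]
      exact ⟨fun n => zpow_ne_of_jTheta_ne_zero h0 h1 ha n,
        fun n => zpow_ne_of_jTheta_ne_zero h0 h1 hb n⟩)
    (by
      rw [Fin.forall_fin_two]
      simp only [Fin.forall_fin_two, Matrix.cons_val_zero, Matrix.cons_val_one, e01, e10]
      refine ⟨⟨fun h => absurd rfl h, fun _ => ?_⟩, fun _ => ?_, fun h => absurd rfl h⟩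
      · exact zpow_ne_of_jTheta_ne_zero h0 h1 (jTheta_inv_ne_zero h0 h1 (by positivity) hP2)
      · exact zpow_ne_of_jTheta_ne_zero h0 h1 hP2) 1 le_rfl (by simp)
  have he0 : (univ.erase (0 : Fin 2)) = {1} := rfl
  have he1 : (univ.erase (1 : Fin 2)) = {0} := rfl
  have w0 : (-(z * ζ)) ^ 1 * (z / (z * ζ * (z / ζ))) = -ζ := by field_simp
  have w1 : (-(z / ζ)) ^ 1 * (z / (z * ζ * (z / ζ))) = -ζ⁻¹ := by field_simp
  have f0 : z / (z * ζ) = ζ⁻¹ := by field_simp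
  have f1 : z / (z / ζ) = ζ := by field_simp
  simp only [Fin.prod_univ_two, Fin.prod_univ_one, Fin.sum_univ_two, he0, he1, prod_singleton,
    Matrix.cons_val_zero, Matrix.cons_val_one, e01, e10, w0, w1, f0, f1,
    jTheta_inv h0 h1 hζ, jTheta_inv h0 h1 (pow_ne_zero 2 hζ)] at h
  change _ = _ * appell q 1 (-ζ) (z * ζ) + _ * appell q 1 (-ζ⁻¹) (z / ζ) at h
  have h' : qPoch q q ^ 2 * jTheta q z * jTheta q (ζ ^ 2) /
        (jTheta q (z * ζ) * jTheta q (z / ζ) * jTheta q ζ) =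
      jTheta q z / (jTheta q (z * ζ) * jTheta q (z / ζ)) *
        (qPoch q q ^ 2 * jTheta q (ζ ^ 2) / jTheta q ζ) := by field_simp
  rw [h', h]
  field_simp

lemma rank_triple (h0 : 0 < q) (h1 : q < 1) {z ζ : ℝ} (hz : z ≠ 0) (hζ : ζ ≠ 0)
    (hPz : jTheta q z ≠ 0) (hP : jTheta q ζ ≠ 0) (hP2 : jTheta q (ζ ^ 2) ≠ 0)
    (ha : jTheta q (z * ζ) ≠ 0) (hb : jTheta q (z / ζ) ≠ 0) :
    ζ ^ 3 * appell q 3 (-ζ ^ 3) (z * ζ) + appell q 3 (-(ζ ^ 3)⁻¹) (z / ζ) =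
      ζ * (jTheta q (ζ ^ 2) / jTheta q ζ) * appell q 3 (-1) z +
      qPoch q q ^ 2 * jTheta q ζ * jTheta q (ζ ^ 2) /
        (jTheta q z * jTheta q (z * ζ) * jTheta q (z / ζ)) := by
  have hJ : qPoch q q ≠ 0 := (qPoch_pos h0 h1 h1).ne'
  have e01 : z * ζ / z = ζ := by field_simp
  have e02 : z / ζ / z = ζ⁻¹ := by field_simp
  have e10 : z / (z * ζ) = ζ⁻¹ := by field_simp
  have e12 : z / ζ / (z * ζ) = (ζ ^ 2)⁻¹ := by field_simp
  have e20 : z / (z / ζ) = ζ := by field_simp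
  have e21 : z * ζ / (z / ζ) = ζ ^ 2 := by field_simp
  have i1 := zpow_ne_of_jTheta_ne_zero h0 h1 hP
  have i2 := zpow_ne_of_jTheta_ne_zero h0 h1 (jTheta_inv_ne_zero h0 h1 hζ hP)
  have i3 := zpow_ne_of_jTheta_ne_zero h0 h1 hP2
  have i4 := zpow_ne_of_jTheta_ne_zero h0 h1 (jTheta_inv_ne_zero h0 h1 (pow_ne_zero 2 hζ) hP2)
  have h := jTheta_partial_fraction h0 h1 (fun k : Fin 0 => (0 : ℝ)) ![z, z * ζ, z / ζ]
    (by simp) (by simp [Fin.forall_fin_succ, hz, hζ])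
    (by
      simp only [Fin.forall_fin_succ, Matrix.cons_val_zero, Matrix.cons_val_succ]
      exact ⟨zpow_ne_of_jTheta_ne_zero h0 h1 hPz, zpow_ne_of_jTheta_ne_zero h0 h1 ha,
        zpow_ne_of_jTheta_ne_zero h0 h1 hb, fun i => i.elim0⟩)
    (by
      intro i j hij
      fin_cases i <;> fin_cases j <;> first
        | exact absurd rfl hij
        | (simp only [Fin.zero_eta, Fin.mk_one, Fin.reduceFinMk, Matrix.cons_val_zero,
            Matrix.cons_val_one, Matrix.cons_val, e01, e02, e10, e12, e20, e21]
           assumption)) 3 (by norm_num) (by simp)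
  have he0 : (univ.erase (0 : Fin 3)) = {1, 2} := rfl
  have he1 : (univ.erase (1 : Fin 3)) = {0, 2} := rfl
  have he2 : (univ.erase (2 : Fin 3)) = {0, 1} := rfl
  have w0 : (-z) ^ 3 * (1 / (z * (z * ζ) * (z / ζ))) = -1 := by field_simp
  have w1 : (-(z * ζ)) ^ 3 * (1 / (z * (z * ζ) * (z / ζ))) = -ζ ^ 3 := by field_simp
  have w2 : (-(z / ζ)) ^ 3 * (1 / (z * (z * ζ) * (z / ζ))) = -(ζ ^ 3)⁻¹ := by field_simp
  simp only [Fin.prod_univ_three, Fin.prod_univ_zero, Fin.sum_univ_three, he0, he1, he2,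
    Finset.prod_pair (show (1 : Fin 3) ≠ 2 by decide),
    Finset.prod_pair (show (0 : Fin 3) ≠ 2 by decide),
    Finset.prod_pair (show (0 : Fin 3) ≠ 1 by decide),
    Matrix.cons_val_zero, Matrix.cons_val_one, Matrix.cons_val, e01, e02, e10, e12, e20, e21,
    w0, w1, w2, jTheta_inv h0 h1 hζ, jTheta_inv h0 h1 (pow_ne_zero 2 hζ)] at h
  change _ = _ * appell q 3 (-1) z + _ * appell q 3 (-ζ ^ 3) (z * ζ) +
    _ * appell q 3 (-(ζ ^ 3)⁻¹) (z / ζ) at h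
  have h' : qPoch q q ^ 2 * jTheta q ζ * jTheta q (ζ ^ 2) /
        (jTheta q z * jTheta q (z * ζ) * jTheta q (z / ζ)) =
      1 / (jTheta q z * jTheta q (z * ζ) * jTheta q (z / ζ)) *
        (qPoch q q ^ 2 * jTheta q ζ * jTheta q (ζ ^ 2)) := by field_simp
  rw [h', h]
  field_simp
  ring

/-- The theta quotient playing the role of a difference of two values of the `℘`-function. -/
noncomputable def weierDiff (q u v : ℝ) : ℝ :=
  v * jTheta q (u * v) * jTheta q (u / v) / (jTheta q u ^ 2 * jTheta q v ^ 2)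

lemma weierDiff_eq_sub (h0 : 0 < q) (h1 : q < 1) {u v : ℝ} (hu : u ≠ 0) (hv : v ≠ 0)
    (hPu : jTheta q u ≠ 0) (hPv : jTheta q v ≠ 0) (huv : jTheta q (u / v) ≠ 0) :
    weierDiff q u v = -u * appell q 1 (-u) u / (qPoch q q ^ 2 * jTheta q u) -
      -v * appell q 1 (-v) v / (qPoch q q ^ 2 * jTheta q v) := by
  have hJ : qPoch q q ≠ 0 := (qPoch_pos h0 h1 h1).ne'
  have e01 : (v / u) = (u / v)⁻¹ := by field_simp
  have hne : u / v ≠ 0 := div_ne_zero hu hv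
  have h := jTheta_partial_fraction h0 h1 (fun k : Fin 1 => u * v) ![u, v]
    (fun _ => mul_ne_zero hu hv) (by simp [Fin.forall_fin_two, hu, hv])
    (by
      rw [Fin.forall_fin_two]
      exact ⟨fun n => zpow_ne_of_jTheta_ne_zero h0 h1 hPu n,
        fun n => zpow_ne_of_jTheta_ne_zero h0 h1 hPv n⟩)
    (by
      rw [Fin.forall_fin_two]
      simp only [Fin.forall_fin_two, Matrix.cons_val_zero, Matrix.cons_val_one, e01]
      refine ⟨⟨fun h => absurd rfl h, fun _ => ?_⟩, fun _ => ?_, fun h => absurd rfl h⟩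
      · exact zpow_ne_of_jTheta_ne_zero h0 h1 (jTheta_inv_ne_zero h0 h1 hne huv)
      · exact zpow_ne_of_jTheta_ne_zero h0 h1 huv) 1 le_rfl (by simp)
  have he0 : (univ.erase (0 : Fin 2)) = {1} := rfl
  have he1 : (univ.erase (1 : Fin 2)) = {0} := rfl
  have w0 : (-u) ^ 1 * (u * v / (u * v)) = -u := by field_simp
  have w1 : (-v) ^ 1 * (u * v / (u * v)) = -v := by field_simp
  have f0 : u * v / u = v := by field_simp
  have f1 : u * v / v = u := by field_simp
  simp only [Fin.prod_univ_two, Fin.prod_univ_one, Fin.sum_univ_two, he0, he1, prod_singleton,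
    Matrix.cons_val_zero, Matrix.cons_val_one, e01, w0, w1, f0, f1,
    jTheta_inv h0 h1 hne] at h
  change _ = _ * appell q 1 (-u) u + _ * appell q 1 (-v) v at h
  have h' : weierDiff q u v = jTheta q (u * v) / (jTheta q u * jTheta q v) *
      (v * jTheta q (u / v) / (jTheta q u * jTheta q v)) := by
    rw [weierDiff]; field_simp
  rw [h', h]
  field_simp
  ring

/-- A model of the Weierstrass `℘`-function, normalised to vanish at `-1`. -/
noncomputable def weierP (q u : ℝ) : ℝ := weierDiff q u (-1)

lemma weierDiff_eq (h0 : 0 < q) (h1 : q < 1) {u v : ℝ} (hu : u ≠ 0) (hv : v ≠ 0)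
    (hPu : jTheta q u ≠ 0) (hPv : jTheta q v ≠ 0) (huv : jTheta q (u / v) ≠ 0)
    (hu' : jTheta q (-u) ≠ 0) (hv' : jTheta q (-v) ≠ 0) :
    weierDiff q u v = weierP q u - weierP q v := by
  have h2 : jTheta q (-1) ≠ 0 := by
    refine jTheta_ne_zero h0 h1 fun n hn => ?_
    have : 0 < q ^ n := by positivity
    linarith
  rw [weierP, weierP, weierDiff_eq_sub h0 h1 hu hv hPu hPv huv,
    weierDiff_eq_sub h0 h1 hu (by norm_num) hPu h2 (by simpa [div_neg] using hu'),
    weierDiff_eq_sub h0 h1 hv (by norm_num) hPv h2 (by simpa [div_neg] using hv')]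
  ring

end

section

open Filter Topology Finset
variable {q : ℝ}

lemma jTheta_sq (h0 : 0 < q) (h1 : q < 1) {s u : ℝ} (hs : 0 < s) (hsq : s ^ 2 = q) (hu : u ≠ 0) :
    jTheta q (u ^ 2) = jTheta q u * jTheta q (-u) * jTheta q (u * s) * jTheta q (-(u * s)) := by
  have hs1 : s < 1 := by nlinarith
  subst hsq
  have a1 := qPoch_sq hs hs1 u
  have a2 := qPoch_sq hs hs1 (s / u)
  have b1 := qPoch_even_odd hs hs1 u
  have b2 := qPoch_even_odd hs hs1 (-u)
  have b3 := qPoch_even_odd hs hs1 (s / u)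
  have b4 := qPoch_even_odd hs hs1 (-(s / u))
  simp only [jTheta]
  rw [show s ^ 2 / u ^ 2 = (s / u) ^ 2 by field_simp, a1, a2, b1, b2, b3, b4,
    show s ^ 2 / (u * s) = s / u by field_simp, show s ^ 2 / -(u * s) = -(s / u) by field_simp,
    show s ^ 2 / -u = s * -(s / u) by field_simp, show s ^ 2 / u = s * (s / u) by field_simp,
    show s * -u = - (u * s) by ring, show s * u = u * s by ring]
  ring

lemma jTheta_half_periods (h0 : 0 < q) (h1 : q < 1) {s : ℝ} (hs : 0 < s) (hsq : s ^ 2 = q) :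
    jTheta q (-1) * jTheta q s * jTheta q (-s) = 2 := by
  have hJ : qPoch q q ≠ 0 := (qPoch_pos h0 h1 h1).ne'
  have a1 := qPoch_sq h0 h1 s
  have a2 := qPoch_sq h0 h1 q
  have a3 := qPoch_even_odd h0 h1 q
  rw [hsq] at a1
  rw [a1, show q * q = q ^ 2 by ring, a2] at a3
  have a4 : qPoch q (-q) * qPoch q s * qPoch q (-s) = 1 := by
    apply mul_left_cancel₀ hJ
    linear_combination -a3
  have a5 := qPoch_eq_mul h0 h1 (-1)
  simp only [jTheta]
  rw [a5, show q / s = s by rw [← hsq]; field_simp, show q / -s = -s by rw [← hsq]; field_simp,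
    show q / -1 = -q by ring, show q * -1 = -q by ring]
  linear_combination 2 * (qPoch q (-q) * qPoch q s * qPoch q (-s) + 1) * a4

lemma jTheta_neg_ne_zero (h0 : 0 < q) (h1 : q < 1) {u : ℝ} (hu : 0 < u) :
    jTheta q (-u) ≠ 0 := by
  refine jTheta_ne_zero h0 h1 fun n hn => ?_
  have : 0 < u * q ^ n := by positivity
  linarith

lemma weierP_eq (q u : ℝ) : weierP q u = -(jTheta q (-u) / (jTheta q u * jTheta q (-1))) ^ 2 := by
  rw [weierP, weierDiff, mul_neg_one, div_neg, div_one, div_pow, mul_pow]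
  ring

lemma weierDiff_half (h0 : 0 < q) (h1 : q < 1) {s u : ℝ} (hs : s ≠ 0) (hsq : s ^ 2 = q)
    (hu : u ≠ 0) :
    weierDiff q u s = -u * (jTheta q (u * s) / (jTheta q u * jTheta q s)) ^ 2 := by
  have h := jTheta_mul_q h0 h1 (div_ne_zero hu hs)
  rw [show q * (u / s) = u * s by rw [← hsq]; field_simp] at h
  have h' : jTheta q (u / s) = -(u / s) * jTheta q (u * s) := by rw [h]; field_simp
  rw [weierDiff, h', div_pow, mul_pow]
  field_simp

lemma weierP_half (h0 : 0 < q) (h1 : q < 1) {s u : ℝ} (hs : 0 < s) (hsq : s ^ 2 = q)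
    (hu : 0 < u) (h2 : jTheta q (u ^ 2) ≠ 0) :
    weierP q u - weierP q s = -u * (jTheta q (u * s) / (jTheta q u * jTheta q s)) ^ 2 ∧
    weierP q u - weierP q (-s) = -u * (jTheta q (-(u * s)) / (jTheta q u * jTheta q (-s))) ^ 2 := by
  have h3 := jTheta_half_periods h0 h1 hs hsq
  rw [jTheta_sq h0 h1 hs hsq hu.ne'] at h2
  have hPs : jTheta q s ≠ 0 := fun h => by simp [h] at h3
  have hPs' : jTheta q (-s) ≠ 0 := fun h => by simp [h] at h3
  have hPu : jTheta q u ≠ 0 := fun h => by simp [h] at h2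
  have hPus : jTheta q (u * s) ≠ 0 := fun h => by simp [h] at h2
  have h := jTheta_mul_q h0 h1 (div_ne_zero hu.ne' hs.ne')
  rw [show q * (u / s) = u * s by rw [← hsq]; field_simp] at h
  have hd : jTheta q (u / s) ≠ 0 := fun h' => by simp [h'] at h; exact hPus h
  constructor
  · rw [← weierDiff_half h0 h1 hs.ne' hsq hu.ne', weierDiff_eq h0 h1 hu.ne' hs.ne' hPu hPs hd
      (jTheta_neg_ne_zero h0 h1 hu) hPs']
  · rw [← mul_neg, ← weierDiff_half h0 h1 (neg_ne_zero.2 hs.ne') (by rw [neg_sq, hsq]) hu.ne',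
      weierDiff_eq h0 h1 hu.ne' (neg_ne_zero.2 hs.ne') hPu hPs' (by
        rw [div_neg]; exact jTheta_neg_ne_zero h0 h1 (by positivity))
      (jTheta_neg_ne_zero h0 h1 hu) (by rwa [neg_neg])]

lemma weierP_cubic (h0 : 0 < q) (h1 : q < 1) {s u : ℝ} (hs : 0 < s) (hsq : s ^ 2 = q)
    (hu : 0 < u) (h2 : jTheta q (u ^ 2) ≠ 0) :
    weierP q u * (weierP q u - weierP q s) * (weierP q u - weierP q (-s)) =
      -(u * jTheta q (u ^ 2) / jTheta q u ^ 4) ^ 2 / 4 := by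
  obtain ⟨e1, e2⟩ := weierP_half h0 h1 hs hsq hu h2
  rw [e1, e2, weierP_eq]
  have h3 := jTheta_half_periods h0 h1 hs hsq
  have hP1 : jTheta q (-1) ≠ 0 := fun h => by simp [h] at h3
  have hPs : jTheta q s ≠ 0 := fun h => by simp [h] at h3
  have hPs' : jTheta q (-s) ≠ 0 := fun h => by simp [h] at h3
  rw [jTheta_sq h0 h1 hs hsq hu.ne'] at h2 ⊢
  have hPu : jTheta q u ≠ 0 := fun h => by simp [h] at h2
  have h4 : (4 : ℝ) = (jTheta q (-1) * jTheta q s * jTheta q (-s)) ^ 2 := by rw [h3]; norm_num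
  rw [h4]
  field_simp

lemma weierP_disc (h0 : 0 < q) (h1 : q < 1) {s : ℝ} (hs : 0 < s) (hsq : s ^ 2 = q) :
    (weierP q s * weierP q (-s) * (weierP q s - weierP q (-s))) ^ 2 = q / 16 := by
  have h3 := jTheta_half_periods h0 h1 hs hsq
  have hP1 : jTheta q (-1) ≠ 0 := fun h => by simp [h] at h3
  have hPs : jTheta q s ≠ 0 := fun h => by simp [h] at h3
  have hPs' : jTheta q (-s) ≠ 0 := fun h => by simp [h] at h3
  have h := jTheta_mul_q h0 h1 (x := -1) (by norm_num)
  rw [← weierDiff_eq h0 h1 hs.ne' (neg_ne_zero.2 hs.ne') hPs hPs'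
    (by rwa [div_neg, div_self hs.ne']) hPs' (by rwa [neg_neg]),
    weierDiff_half h0 h1 (neg_ne_zero.2 hs.ne') (by rw [neg_sq, hsq]) hs.ne', weierP_eq, weierP_eq,
    neg_neg, show s * -s = q * -1 by rw [← hsq]; ring, h]
  have e : (q : ℝ) / 16 = q / (jTheta q (-1) * jTheta q s * jTheta q (-s)) ^ 4 := by
    rw [h3]; norm_num
  rw [e, ← hsq]
  field_simp

end

section

open Filter Topology Finset
variable {q : ℝ}

lemma differentiableAt_jTheta (h0 : 0 < q) (h1 : q < 1) {x : ℝ} (hx : x ≠ 0) :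
    DifferentiableAt ℝ (jTheta q) x := by
  unfold jTheta
  have h := differentiable_qPoch h0 h1
  have h2 : DifferentiableAt ℝ (fun x => q / x) x := by fun_prop (disch := assumption)
  exact (h x).mul ((h (q / x)).comp x h2)

lemma deriv_jTheta_one (h0 : 0 < q) (h1 : q < 1) :
    HasDerivAt (jTheta q) (-qPoch q q ^ 2) 1 := by
  have h := differentiable_qPoch h0 h1
  have hd : DifferentiableAt ℝ (fun x => qPoch q (q * x) * qPoch q (q / x)) 1 := by
    have h2 : DifferentiableAt ℝ (fun x => q / x) 1 := by fun_prop (disch := norm_num)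
    have h3 : DifferentiableAt ℝ (fun x => q * x) 1 := by fun_prop
    exact ((h _).comp 1 h3).mul ((h (q / 1)).comp 1 h2)
  have h4 := ((hasDerivAt_id (1 : ℝ)).const_sub 1).mul hd.hasDerivAt
  refine (h4.congr_of_eventuallyEq (Eventually.of_forall fun x => ?_)).congr_deriv ?_
  · simp [jTheta_eq h0 h1]
  · simp; ring

/-- The logarithmic derivative `x P'(x) / P(x)` of the theta function. -/
noncomputable def thetaLog (q x : ℝ) : ℝ := x * deriv (jTheta q) x / jTheta q x

lemma hasDerivAt_jTheta (h0 : 0 < q) (h1 : q < 1) {x : ℝ} (hx : x ≠ 0) (hP : jTheta q x ≠ 0) :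
    HasDerivAt (jTheta q) (thetaLog q x * jTheta q x / x) x := by
  refine (differentiableAt_jTheta h0 h1 hx).hasDerivAt.congr_deriv ?_
  rw [thetaLog]; field_simp

lemma thetaLog_eq {x d : ℝ} (h : HasDerivAt (jTheta q) d x) :
    thetaLog q x = x * d / jTheta q x := by rw [thetaLog, h.deriv]

lemma thetaLog_mul_q (h0 : 0 < q) (h1 : q < 1) {x : ℝ} (hx : x ≠ 0) (hP : jTheta q x ≠ 0) :
    thetaLog q (q * x) = thetaLog q x - 1 := by
  have hq := h0.ne'
  have h := hasDerivAt_jTheta h0 h1 hx hP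
  have hy : q * x / q = x := by field_simp
  have h2 : HasDerivAt (fun y => -jTheta q (y / q) / (y / q)) _ (q * x) :=
    ((HasDerivAt.comp (h₂ := jTheta q) (q * x) (by rw [id, hy]; exact h)
      ((hasDerivAt_id (q * x)).div_const q)).neg).div ((hasDerivAt_id (q * x)).div_const q)
      (by simpa [hy] using hx)
  have h3 := h2.congr_of_eventuallyEq (f₁ := jTheta q) (by
    filter_upwards [eventually_ne_nhds (mul_ne_zero hq hx)] with y hyy
    rw [← jTheta_mul_q h0 h1 (div_ne_zero hyy hq)]
    congr 1; field_simp)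
  rw [thetaLog_eq h3, jTheta_mul_q h0 h1 hx]
  simp only [Function.comp, id, hy, Pi.neg_apply]
  field_simp
  ring

lemma thetaLog_inv (h0 : 0 < q) (h1 : q < 1) {x : ℝ} (hx : x ≠ 0) (hP : jTheta q x ≠ 0) :
    thetaLog q x⁻¹ = 1 - thetaLog q x := by
  have h := hasDerivAt_jTheta h0 h1 hx hP
  have hi := hasDerivAt_inv (inv_ne_zero hx)
  have h2 : HasDerivAt (fun y => -jTheta q y⁻¹ / y⁻¹) _ x⁻¹ :=
    ((HasDerivAt.comp (h₂ := jTheta q) x⁻¹ (by rw [inv_inv]; exact h) hi).neg).div hi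
      (by simpa using hx)
  have h3 := h2.congr_of_eventuallyEq (f₁ := jTheta q) (by
    filter_upwards [eventually_ne_nhds (inv_ne_zero hx)] with y hyy
    rw [← jTheta_inv h0 h1 (inv_ne_zero hyy), inv_inv])
  rw [thetaLog_eq h3, jTheta_inv h0 h1 hx]
  simp only [Function.comp, inv_inv, Pi.neg_apply]
  field_simp
  ring

/-- The derivative of `weierDiff q · c`, with the factor `P(u/c)` singled out. -/
lemma hasDerivAt_weierDiff (h0 : 0 < q) (h1 : q < 1) {u c d : ℝ} (hu : u ≠ 0) (hc : c ≠ 0)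
    (hPu : jTheta q u ≠ 0) (hPuc : jTheta q (u * c) ≠ 0)
    (hd : HasDerivAt (jTheta q) d (u / c)) :
    HasDerivAt (fun u => weierDiff q u c) (c * jTheta q (u * c) / (jTheta q u ^ 2 * jTheta q c ^ 2) *
      (d / c + jTheta q (u / c) * (thetaLog q (u * c) - 2 * thetaLog q u) / u)) u := by
  by_cases hPc : jTheta q c = 0
  · simp only [weierDiff, hPc]
    simpa using hasDerivAt_const u (0 : ℝ)
  have a1 := hasDerivAt_jTheta h0 h1 hu hPu
  have a2 : HasDerivAt (fun u => jTheta q (u * c)) _ u :=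
    HasDerivAt.comp (h₂ := jTheta q) u (hasDerivAt_jTheta h0 h1 (mul_ne_zero hu hc) hPuc)
      ((hasDerivAt_id u).mul_const c)
  have a3 : HasDerivAt (fun u => jTheta q (u / c)) _ u :=
    HasDerivAt.comp (h₂ := jTheta q) u hd ((hasDerivAt_id u).div_const c)
  refine (((a2.const_mul c).mul a3).div ((a1.pow 2).mul_const (jTheta q c ^ 2))
    (mul_ne_zero (pow_ne_zero 2 hPu) (pow_ne_zero 2 hPc))).congr_deriv ?_
  simp only [Pi.pow_apply, Pi.mul_apply]
  field_simp
  push_cast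
  ring

lemma eventually_jTheta_div_ne_zero (h0 : 0 < q) (h1 : q < 1) {c : ℝ} (hc : c ≠ 0) :
    ∀ᶠ u in 𝓝[≠] c, jTheta q (u / c) ≠ 0 := by
  have h : HasDerivAt (fun u => jTheta q (u / c)) (-qPoch q q ^ 2 * (1 / c)) c :=
    HasDerivAt.comp (h₂ := jTheta q) c (by rw [div_self hc]; exact deriv_jTheta_one h0 h1)
      ((hasDerivAt_id c).div_const c)
  have hJ : qPoch q q ≠ 0 := (qPoch_pos h0 h1 h1).ne'
  exact h.eventually_ne (by
    have : qPoch q q ^ 2 ≠ 0 := by positivity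
    have : 1 / c ≠ 0 := by positivity
    simp_all)

lemma deriv_weierP (h0 : 0 < q) (h1 : q < 1) {c : ℝ} (hc : 0 < c)
    (hP : jTheta q c ≠ 0) (hP2 : jTheta q (c * c) ≠ 0) :
    HasDerivAt (weierP q) (-qPoch q q ^ 2 * (jTheta q (c ^ 2) / jTheta q c ^ 4)) c := by
  have h := hasDerivAt_weierDiff h0 h1 hc.ne' hc.ne' hP hP2
    (by rw [div_self hc.ne']; exact deriv_jTheta_one h0 h1)
  have e : (fun u => weierP q u) =ᶠ[𝓝 c] fun u => weierDiff q u c + weierP q c := by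
    have e1 := eventually_jTheta_div_ne_zero h0 h1 hc.ne'
    rw [eventually_nhdsWithin_iff] at e1
    have e2 := (differentiableAt_jTheta h0 h1 hc.ne').continuousAt.eventually_ne hP
    filter_upwards [e1, e2, lt_mem_nhds hc] with u a1 a2 a3
    by_cases hu : u = c
    · subst hu
      rw [weierDiff, div_self hc.ne', jTheta_one h0 h1]; simp
    · rw [weierDiff_eq h0 h1 a3.ne' hc.ne' a2 hP (a1 hu) (jTheta_neg_ne_zero h0 h1 a3)
        (jTheta_neg_ne_zero h0 h1 hc)]
      ring
  refine ((h.add_const _).congr_of_eventuallyEq e).congr_deriv ?_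
  rw [div_self hc.ne', jTheta_one h0 h1, show c * c = c ^ 2 by ring]
  field_simp
  ring

lemma thetaLog_relation (h0 : 0 < q) (h1 : q < 1) {u c : ℝ} (hu : 0 < u) (hc : 0 < c)
    (hPu : jTheta q u ≠ 0) (hPu2 : jTheta q (u * u) ≠ 0) (hPc : jTheta q c ≠ 0)
    (hm : jTheta q (u * c) ≠ 0) (hd : jTheta q (u / c) ≠ 0) :
    weierDiff q u c * (thetaLog q (u * c) + thetaLog q (u / c) - 2 * thetaLog q u) =
      -qPoch q q ^ 2 * (u * jTheta q (u ^ 2) / jTheta q u ^ 4) := by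
  have h := hasDerivAt_weierDiff h0 h1 hu.ne' hc.ne' hPu hm
    (hasDerivAt_jTheta h0 h1 (div_ne_zero hu.ne' hc.ne') hd)
  have e : (fun u => weierDiff q u c) =ᶠ[𝓝 u] fun u => weierP q u - weierP q c := by
    have e1 : ContinuousAt (fun u => jTheta q (u / c)) u :=
      ContinuousAt.comp (g := jTheta q)
        (differentiableAt_jTheta h0 h1 (div_ne_zero hu.ne' hc.ne')).continuousAt
        (by fun_prop)
    have e2 := (differentiableAt_jTheta h0 h1 hu.ne').continuousAt.eventually_ne hPu
    filter_upwards [e1.eventually_ne hd, e2, lt_mem_nhds hu] with v a1 a2 a3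
    rw [weierDiff_eq h0 h1 a3.ne' hc.ne' a2 hPc a1 (jTheta_neg_ne_zero h0 h1 a3)
        (jTheta_neg_ne_zero h0 h1 hc)]
  have h2 := ((deriv_weierP h0 h1 hu hPu hPu2).sub_const (weierP q c)).congr_of_eventuallyEq e
  have h3 := h.unique h2
  rw [weierDiff]
  have h4 : -qPoch q q ^ 2 * (u * jTheta q (u ^ 2) / jTheta q u ^ 4) =
    u * (-qPoch q q ^ 2 * (jTheta q (u ^ 2) / jTheta q u ^ 4)) := by ring
  rw [h4, ← h3]
  field_simp
  ring

end

section

open Filter Topology Finset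
variable {q : ℝ}

/-- The theta series `∑ (-x)ⁿ q^(n * (3 * n - 1) / 2)`. -/
noncomputable def pentTheta (q x : ℝ) : ℝ := ∑' n : ℤ, (-x / q ^ 2) ^ n * q ^ ((3 : ℤ) * tri n)

lemma summable_pentTheta (h0 : 0 < q) (h1 : q < 1) {x : ℝ} (hx : x ≠ 0) :
    Summable fun n : ℤ => (-x / q ^ 2) ^ n * q ^ ((3 : ℤ) * tri n) :=
  summable_theta h0 h1 (d := 3) (div_ne_zero (neg_ne_zero.2 hx) (by positivity)) (by norm_num)

lemma pentTheta_term (h0 : 0 < q) (x : ℝ) (n : ℤ) :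
    (-x / q ^ 2) ^ n * q ^ ((3 : ℤ) * tri n) = (-x) ^ n * q ^ (3 * tri n - 2 * n) := by
  rw [zpow_sub₀ h0.ne', div_zpow, zpow_mul q 2 n, zpow_ofNat]
  ring

lemma pentTheta_one (h0 : 0 < q) (h1 : q < 1) : pentTheta q 1 = qPoch q q := by
  have hpr : ∀ k n : ℕ, 0 ≤ ∏ i ∈ range n, (1 - q ^ (k + i + 1)) ∧
      ∏ i ∈ range n, (1 - q ^ (k + i + 1)) ≤ 1 := fun k n => by
    have h2 : ∀ i ∈ range n, 0 ≤ 1 - q ^ (k + i + 1) := fun i _ =>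
      sub_nonneg.2 (pow_le_one₀ h0.le h1.le)
    exact ⟨prod_nonneg h2, prod_le_one h2 fun i _ => sub_le_self _ (by positivity)⟩
  have hb : ∀ k n : ℕ, ‖q ^ ((k + 1) * n) * ∏ i ∈ range (n + 1), (1 - q ^ (k + i + 1))‖ ≤ q ^ n := by
    intro k n
    obtain ⟨a, b⟩ := hpr k (n + 1)
    rw [norm_mul, Real.norm_eq_abs, Real.norm_eq_abs, abs_of_nonneg a, abs_of_pos (by positivity)]
    calc _ ≤ q ^ n * 1 := mul_le_mul (pow_le_pow_of_le_one h0.le h1.le (by nlinarith)) b a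
            (by positivity)
      _ = _ := mul_one _
  have hg := summable_geometric_of_lt_one h0.le h1
  have hs := fun k => Summable.of_norm_bounded hg (hb k)
  have hf : Summable fun n : ℤ => (-(1 : ℝ) / q ^ 2) ^ n * q ^ ((3 : ℤ) * tri n) :=
    summable_pentTheta h0 h1 one_ne_zero
  have hf' := (Equiv.neg ℤ).summable_iff.2 hf
  have e1 : ∀ k : ℕ, (-(1 : ℝ) / q ^ 2) ^ (-(k : ℤ)) * q ^ ((3 : ℤ) * tri (-k)) =
      (-1) ^ k * q ^ pentagonal (-k) := fun k => by
    have h2 : (3 : ℤ) * tri (-(k : ℤ)) = (pentagonal (-k) : ℕ) + -2 * (k : ℤ) := by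
      have := two_mul_natCast_pentagonal_neg k
      have := two_mul_tri (-(k : ℤ))
      linarith
    rw [pentTheta_term h0, h2, zpow_neg, zpow_natCast, ← inv_pow,
      show ((pentagonal (-k) : ℕ) + -2 * (k : ℤ) - 2 * -(k : ℤ)) = (pentagonal (-k) : ℕ) by ring,
      zpow_natCast]
    norm_num
  have e2 : ∀ k : ℕ, (-(1 : ℝ) / q ^ 2) ^ ((k : ℤ) + 1) * q ^ ((3 : ℤ) * tri (k + 1)) =
      -((-1) ^ k * q ^ pentagonal (k + 1)) := fun k => by
    have h2 : (3 : ℤ) * tri (k + 1) = (pentagonal (k + 1) : ℕ) + 2 * ((k : ℤ) + 1) := by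
      have := two_mul_natCast_pentagonal (k + 1)
      have := two_mul_tri (k + 1)
      linarith
    rw [h2, zpow_add₀ h0.ne', zpow_natCast, zpow_mul, div_zpow, zpow_ofNat,
      zpow_add_one₀ (by norm_num), zpow_natCast]
    field_simp
  have s1 : Summable fun k : ℕ => (-1 : ℝ) ^ k * q ^ pentagonal (-k) :=
    (hf'.comp_injective Nat.cast_injective).congr fun k => e1 k
  have s2 : Summable fun k : ℕ => -((-1 : ℝ) ^ k * q ^ pentagonal (k + 1)) :=
    (hf.comp_injective (i := fun k : ℕ => (k : ℤ) + 1) fun a b h => by simpa using h).congr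
      fun k => e2 k
  have hJ : qPoch q q = ∏' n : ℕ, (1 - q ^ (n + 1)) := tprod_congr fun n => by rw [pow_succ']
  rw [hJ, Pentagonal.tprod_one_sub_pow]
  · have hh := HasSum.of_nat_of_neg_add_one
      (f := fun n : ℤ => (-(1 : ℝ) / q ^ 2) ^ (-n) * q ^ ((3 : ℤ) * tri (-n)))
      (s1.hasSum.congr_fun fun k => (e1 k))
      (s2.hasSum.congr_fun fun k => by rw [neg_neg]; exact (e2 k))
    have := (Equiv.neg ℤ).tsum_eq fun n : ℤ => (-(1 : ℝ) / q ^ 2) ^ n * q ^ ((3 : ℤ) * tri n)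
    rw [pentTheta, ← this]
    refine hh.tsum_eq.trans ?_
    rw [← s1.tsum_add s2]
    exact tsum_congr fun k => by ring
  · exact tendsto_pow_atTop_nhds_zero_of_lt_one h0.le h1
  · exact hs
  · intro k
    have := multipliable_qPoch h0 h1 (q ^ (k + 1))
    refine this.congr fun n => ?_
    rw [← pow_add]; congr 2; ring
  · exact (s1.add s2).congr fun k => by ring
  · refine squeeze_zero_norm (a := fun k : ℕ => q ^ k * ∑' n : ℕ, q ^ n) (fun k => ?_) ?_
    · rw [norm_mul, norm_mul, norm_pow, norm_neg, norm_one, one_pow, one_mul]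
      have h3 := (hs k).norm
      refine mul_le_mul ?_ ((norm_tsum_le_tsum_norm h3).trans (h3.tsum_le_tsum (hb k) hg))
        (norm_nonneg _) (by positivity)
      rw [Real.norm_eq_abs, abs_of_pos (by positivity)]
      exact pow_le_pow_of_le_one h0.le h1.le
        ((Nat.le_div_iff_mul_le (by norm_num)).2 (by nlinarith))
    · simpa using (tendsto_pow_atTop_nhds_zero_of_lt_one h0.le h1).mul_const (∑' n : ℕ, q ^ n)

end

section

open Filter Topology Finset
variable {q : ℝ}

lemma summable_appell (h0 : 0 < q) (h1 : q < 1) {w b : ℝ} (hw : w ≠ 0) (hb : b ≠ 0) {d : ℕ}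
    (hd : 1 ≤ d) : Summable fun n : ℤ => w ^ n * q ^ ((d : ℤ) * tri n) / (1 - b * q ^ n) := by
  obtain ⟨C, hC⟩ := exists_inv_one_sub_le h0 h1 hb
  refine Summable.of_norm_bounded ((summable_theta h0 h1 hw hd).norm.mul_right C) fun n => ?_
  rw [div_eq_mul_inv, norm_mul]
  exact mul_le_mul_of_nonneg_left (hC n) (norm_nonneg _)

lemma appell_three_mul_q (h0 : 0 < q) (h1 : q < 1) {β z : ℝ} (hβ : β ≠ 0) (hz : z ≠ 0)
    (hn : ∀ n : ℤ, β * z * q ^ n ≠ 1) :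
    appell q 3 (-β ^ 3) (β * (q * z)) + z ^ 3 * appell q 3 (-β ^ 3) (β * z) =
      -((β ^ 3)⁻¹ * (∑' n : ℤ, (-β ^ 3 / q ^ 3) ^ n * q ^ ((3 : ℤ) * tri n)) +
        z * ((β ^ 2)⁻¹ * pentTheta q (β ^ 3)) +
        z ^ 2 * (β⁻¹ * ∑' n : ℤ, (-β ^ 3 / q) ^ n * q ^ ((3 : ℤ) * tri n))) := by
  have hw : -β ^ 3 ≠ 0 := neg_ne_zero.2 (pow_ne_zero 3 hβ)
  have s1 := summable_appell h0 h1 hw (mul_ne_zero hβ (mul_ne_zero h0.ne' hz)) (d := 3) (by norm_num)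
  have s2 := summable_appell h0 h1 hw (mul_ne_zero hβ hz) (d := 3) (by norm_num)
  have t0 := summable_theta h0 h1 (d := 3) (div_ne_zero hw (pow_ne_zero 3 h0.ne')) (by norm_num)
  have t1 := summable_theta h0 h1 (d := 3) (div_ne_zero hw (pow_ne_zero 2 h0.ne')) (by norm_num)
  have t2 := summable_theta h0 h1 (d := 3) (div_ne_zero hw h0.ne') (by norm_num)
  have hs : Summable fun n : ℤ => (-β ^ 3) ^ (n - 1) * q ^ (((3 : ℕ) : ℤ) * tri (n - 1)) /
      (1 - β * (q * z) * q ^ (n - 1)) := (Equiv.subRight (1 : ℤ)).summable_iff.2 s1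
  have e0 : appell q 3 (-β ^ 3) (β * (q * z)) = ∑' n : ℤ, (-β ^ 3) ^ (n - 1) *
      q ^ (((3 : ℕ) : ℤ) * tri (n - 1)) / (1 - β * (q * z) * q ^ (n - 1)) :=
    ((Equiv.subRight (1 : ℤ)).tsum_eq _).symm
  rw [e0]
  simp only [appell, pentTheta]
  simp only [Nat.cast_ofNat] at s1 s2 t0 t1 t2 hs ⊢
  rw [← tsum_mul_left, ← tsum_mul_left, ← tsum_mul_left,
    ← tsum_mul_left, ← tsum_mul_left, ← tsum_mul_left, ← hs.tsum_add (s2.mul_left _)]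
  rw [← (t0.mul_left _).tsum_add ((t1.mul_left _).mul_left _),
    ← ((t0.mul_left _).add ((t1.mul_left _).mul_left _)).tsum_add ((t2.mul_left _).mul_left _),
    ← tsum_neg]
  refine tsum_congr fun n => ?_
  have htri : tri (n - 1) = tri n - n := by
    have := two_mul_tri n
    have := two_mul_tri (n - 1)
    linarith
  have hne : 1 - β * z * q ^ n ≠ 0 := sub_ne_zero.2 (hn n).symm
  have hq := h0.ne'
  have z3 : q ^ (3 * n) = (q ^ n) ^ 3 := by
    rw [mul_comm, zpow_mul]; exact zpow_natCast _ 3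
  have zk : ∀ k : ℕ, (q ^ k) ^ n = (q ^ n) ^ k := fun k => by
    rw [← zpow_natCast, ← zpow_natCast, ← zpow_mul, ← zpow_mul, mul_comm]
  rw [htri, zpow_sub_one₀ h0.ne', zpow_sub_one₀ hw, mul_sub, zpow_sub₀ h0.ne', z3,
    div_zpow, div_zpow, div_zpow, zk, zk]
  have e : 1 - β * (q * z) * (q ^ n * q⁻¹) = 1 - β * z * q ^ n := by field_simp
  have hX : q ^ n ≠ 0 := zpow_ne_zero _ hq
  rw [e]
  generalize (-β ^ 3) ^ n = A
  generalize q ^ ((3 : ℤ) * tri n) = T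
  generalize q ^ n = X at *
  obtain ⟨D, hD⟩ : ∃ D, D = 1 - β * z * X := ⟨_, rfl⟩
  rw [← hD] at hne ⊢
  field_simp
  rw [hD]
  ring

lemma quintuple_product (h0 : 0 < q) (h1 : q < 1) {ζ : ℝ} (hζ : 0 < ζ) (hP : jTheta q ζ ≠ 0)
    (hP2 : jTheta q (ζ ^ 2) ≠ 0) :
    pentTheta q (ζ ^ 3) + ζ * pentTheta q (ζ ^ 3)⁻¹ =
      qPoch q q * (jTheta q (ζ ^ 2) / jTheta q ζ) := by
  have key : ∃ A B : ℝ, ∀ x : ℝ, 0 < x → A + -x * (ζ ^ 3 * ((ζ ^ 2)⁻¹ * pentTheta q (ζ ^ 3)) +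
      (ζ⁻¹ ^ 2)⁻¹ * pentTheta q (ζ⁻¹ ^ 3) -
      ζ * (jTheta q (ζ ^ 2) / jTheta q ζ) * pentTheta q 1) + x ^ 2 * B = 0 := by
    refine ⟨ζ ^ 3 * ((ζ ^ 3)⁻¹ * (∑' n : ℤ, (-ζ ^ 3 / q ^ 3) ^ n * q ^ ((3 : ℤ) * tri n))) +
      (ζ⁻¹ ^ 3)⁻¹ * (∑' n : ℤ, (-ζ⁻¹ ^ 3 / q ^ 3) ^ n * q ^ ((3 : ℤ) * tri n)) -
      ζ * (jTheta q (ζ ^ 2) / jTheta q ζ) *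
        ((1 ^ 3)⁻¹ * (∑' n : ℤ, (-1 ^ 3 / q ^ 3) ^ n * q ^ ((3 : ℤ) * tri n))),
      ζ ^ 3 * (ζ⁻¹ * (∑' n : ℤ, (-ζ ^ 3 / q) ^ n * q ^ ((3 : ℤ) * tri n))) +
      ζ⁻¹⁻¹ * (∑' n : ℤ, (-ζ⁻¹ ^ 3 / q) ^ n * q ^ ((3 : ℤ) * tri n)) -
      ζ * (jTheta q (ζ ^ 2) / jTheta q ζ) *
        (1⁻¹ * (∑' n : ℤ, (-1 ^ 3 / q) ^ n * q ^ ((3 : ℤ) * tri n))), fun x hx => ?_⟩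
    have hn : ∀ β : ℝ, 0 < β → ∀ n : ℤ, β * -x * q ^ n ≠ 1 := fun β hβ n h => by
      have : 0 < β * x * q ^ n := by positivity
      nlinarith
    have hx' : -x ≠ 0 := by linarith
    have hqx : q * -x ≠ 0 := mul_ne_zero h0.ne' hx'
    have a1 := appell_three_mul_q h0 h1 hζ.ne' hx' (hn ζ hζ)
    have a2 := appell_three_mul_q h0 h1 (inv_pos.2 hζ).ne' hx' (hn _ (inv_pos.2 hζ))
    have a3 := appell_three_mul_q h0 h1 one_ne_zero hx' (hn _ one_pos)
    have p0 := jTheta_neg_ne_zero h0 h1 hx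
    have p1 : jTheta q (-x * ζ) ≠ 0 := by
      rw [neg_mul]; exact jTheta_neg_ne_zero h0 h1 (by positivity)
    have p2 : jTheta q (-x / ζ) ≠ 0 := by
      rw [neg_div]; exact jTheta_neg_ne_zero h0 h1 (by positivity)
    have q0 := jTheta_mul_q h0 h1 hx'
    have q1 : jTheta q (q * -x * ζ) = -jTheta q (-x * ζ) / (-x * ζ) := by
      rw [mul_assoc]; exact jTheta_mul_q h0 h1 (mul_ne_zero hx' hζ.ne')
    have q2 : jTheta q (q * -x / ζ) = -jTheta q (-x / ζ) / (-x / ζ) := by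
      rw [mul_div_assoc]; exact jTheta_mul_q h0 h1 (div_ne_zero hx' hζ.ne')
    have b1 := rank_triple h0 h1 hx' hζ.ne' p0 hP hP2 p1 p2
    have b2 := rank_triple h0 h1 hqx hζ.ne' (by rw [q0]; exact div_ne_zero (neg_ne_zero.2 p0) hx')
      hP hP2
      (by rw [q1]; exact div_ne_zero (neg_ne_zero.2 p1) (mul_ne_zero hx' hζ.ne'))
      (by rw [q2]; exact div_ne_zero (neg_ne_zero.2 p2) (div_ne_zero hx' hζ.ne'))
    have e : qPoch q q ^ 2 * jTheta q ζ * jTheta q (ζ ^ 2) /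
        (-jTheta q (-x) / -x * (-jTheta q (-x * ζ) / (-x * ζ)) * (-jTheta q (-x / ζ) / (-x / ζ))) =
      -(-x) ^ 3 * (qPoch q q ^ 2 * jTheta q ζ * jTheta q (ζ ^ 2) /
        (jTheta q (-x) * jTheta q (-x * ζ) * jTheta q (-x / ζ))) := by
      field_simp
    rw [q0, q1, q2, e] at b2
    have f1 : -(ζ ^ 3)⁻¹ = -ζ⁻¹ ^ 3 := by rw [inv_pow]
    rw [f1] at b1 b2
    rw [show ζ * (q * -x) = q * -x * ζ by ring, mul_comm ζ (-x)] at a1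
    rw [show ζ⁻¹ * (q * -x) = q * -x / ζ by field_simp, show ζ⁻¹ * -x = -x / ζ by field_simp] at a2
    simp only [one_pow, one_mul] at a3 ⊢
    linear_combination ζ ^ 3 * a1 + a2 - ζ * (jTheta q (ζ ^ 2) / jTheta q ζ) * a3 - b2 -
      (-x) ^ 3 * b1
  obtain ⟨A, B, h⟩ := key
  have g1 := h 1 one_pos
  have g2 := h 2 two_pos
  have g3 := h 3 (by norm_num)
  rw [pentTheta_one h0 h1] at *
  have g4 : ζ ^ 3 * ((ζ ^ 2)⁻¹ * pentTheta q (ζ ^ 3)) +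
      (ζ⁻¹ ^ 2)⁻¹ * pentTheta q (ζ⁻¹ ^ 3) -
      ζ * (jTheta q (ζ ^ 2) / jTheta q ζ) * qPoch q q = 0 := by linarith
  rw [inv_pow, inv_pow, inv_inv, show ζ ^ 3 * ((ζ ^ 2)⁻¹ * pentTheta q (ζ ^ 3)) =
    ζ * pentTheta q (ζ ^ 3) by field_simp] at g4
  apply mul_left_cancel₀ hζ.ne'
  linear_combination g4

end

section

open Filter Topology Finset

lemma tsum_int_eleven {f : ℤ → ℝ} (hf : Summable f) (s : ℤ) :
    ∑' k, f k = ∑ i : Fin 11, ∑' n : ℤ, f (11 * n + ((i : ℕ) + s)) := by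
  have hs : Summable fun k => f (k + s) := (Equiv.addRight s).summable_iff.2 hf
  rw [← (Equiv.addRight s).tsum_eq f, ← (Int.divModEquiv 11).symm.tsum_eq]
  have h2 := (Int.divModEquiv 11).symm.summable_iff.2 hs
  have h3 := (Equiv.prodComm (Fin 11) ℤ).summable_iff.2 h2
  rw [← (Equiv.prodComm (Fin 11) ℤ).tsum_eq]
  refine (Summable.tsum_prod h3).trans ?_
  rw [tsum_fintype]
  refine Finset.sum_congr rfl fun i _ => tsum_congr fun n => ?_
  simp only [Function.comp, Equiv.prodComm_apply, Prod.swap, Int.divModEquiv_symm_apply]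
  congr 1
  push_cast
  ring

/-- The normalised theta values `(-1)^a V^(a² - 11 * a) P(V^(22 * a))` for the nome `V^242`. -/
noncomputable def thetaZ (V : ℝ) (a : ℤ) : ℝ :=
  (-1) ^ a * V ^ (a ^ 2 - 11 * a) * jTheta (V ^ 242) (V ^ (22 * a))

variable {V : ℝ}

lemma jTheta_zpow_ne_zero (h0 : 0 < V) (h1 : V < 1) {a : ℤ} (ha : ¬ (11 : ℤ) ∣ a) :
    jTheta (V ^ 242) (V ^ (22 * a)) ≠ 0 := by
  refine jTheta_ne_zero (by positivity) (pow_lt_one₀ h0.le h1 (by norm_num)) fun n hn => ha ?_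
  rw [← zpow_natCast V 242, ← zpow_mul, ← zpow_add₀ h0.ne',
    zpow_eq_one_iff_right₀ h0.le h1.ne] at hn
  push_cast at hn
  omega

lemma thetaZ_ne_zero (h0 : 0 < V) (h1 : V < 1) {a : ℤ} (ha : ¬ (11 : ℤ) ∣ a) :
    thetaZ V a ≠ 0 :=
  mul_ne_zero (mul_ne_zero (zpow_ne_zero _ (by norm_num)) (zpow_ne_zero _ h0.ne'))
    (jTheta_zpow_ne_zero h0 h1 ha)

lemma thetaZ_neg (h0 : 0 < V) (h1 : V < 1) (a : ℤ) : thetaZ V (-a) = -thetaZ V a := by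
  have h := jTheta_inv (q := V ^ 242) (by positivity) (pow_lt_one₀ h0.le h1 (by norm_num))
    (x := V ^ (22 * a)) (by positivity)
  have e' : V ^ (22 * -a) = (V ^ (22 * a))⁻¹ := by rw [← zpow_neg]; congr 1; ring
  rw [thetaZ, thetaZ, e', h, zpow_neg, ← inv_zpow]
  have e : V ^ ((-a) ^ 2 - 11 * -a) = V ^ (a ^ 2 - 11 * a) * V ^ (22 * a) := by
    rw [← zpow_add₀ h0.ne']; congr 1; ring
  rw [e]
  have : V ^ (22 * a) ≠ 0 := by positivity
  norm_num
  field_simp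

lemma thetaZ_add_eleven (h0 : 0 < V) (h1 : V < 1) (a : ℤ) : thetaZ V (a + 11) = thetaZ V a := by
  have h := jTheta_mul_q (q := V ^ 242) (by positivity) (pow_lt_one₀ h0.le h1 (by norm_num))
    (x := V ^ (22 * a)) (by positivity)
  have e2 : V ^ (22 * (a + 11)) = V ^ 242 * V ^ (22 * a) := by
    rw [← zpow_natCast V 242, ← zpow_add₀ h0.ne']; congr 1; push_cast; ring
  have e : V ^ ((a + 11) ^ 2 - 11 * (a + 11)) = V ^ (a ^ 2 - 11 * a) * V ^ (22 * a) := by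
    rw [← zpow_add₀ h0.ne']; congr 1; ring
  have e3 : (-1 : ℝ) ^ (a + 11) = -(-1) ^ a := by
    rw [zpow_add₀ (by norm_num)]; norm_num
  rw [thetaZ, thetaZ, e2, h, e, e3]
  have : V ^ (22 * a) ≠ 0 := by positivity
  field_simp

lemma thetaZ_two_mul_div (h0 : 0 < V) (t : ℤ) :
    thetaZ V (2 * t) / thetaZ V t = (-1) ^ t * V ^ (3 * t ^ 2 - 11 * t) *
      (jTheta (V ^ 242) ((V ^ (22 * t)) ^ 2) / jTheta (V ^ 242) (V ^ (22 * t))) := by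
  have e : V ^ ((2 * t) ^ 2 - 11 * (2 * t)) = V ^ (3 * t ^ 2 - 11 * t) * V ^ (t ^ 2 - 11 * t) := by
    rw [← zpow_add₀ h0.ne']; congr 1; ring
  have e2 : V ^ (22 * (2 * t)) = (V ^ (22 * t)) ^ 2 := by
    rw [← zpow_natCast, ← zpow_mul]; congr 1; push_cast; ring
  have e3 : (-1 : ℝ) ^ (2 * t) = (-1) ^ t * (-1) ^ t := by
    rw [← zpow_add₀ (by norm_num)]; congr 1; ring
  have n1 : (-1 : ℝ) ^ t ≠ 0 := zpow_ne_zero _ (by norm_num)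
  have n2 : V ^ (t ^ 2 - 11 * t) ≠ 0 := zpow_ne_zero _ h0.ne'
  rw [thetaZ, thetaZ, e, e2, e3, mul_div_mul_comm]
  field_simp

lemma pentTheta_pair (h0 : 0 < V) (h1 : V < 1) {t : ℤ} (ht : ¬ (11 : ℤ) ∣ t) :
    (-1) ^ t * V ^ (3 * t ^ 2 - 11 * t + 10) * pentTheta (V ^ 242) (V ^ (66 * t)) +
      (-1) ^ (-t) * V ^ (3 * (-t) ^ 2 - 11 * (-t) + 10) * pentTheta (V ^ 242) (V ^ (66 * -t)) =
    V ^ 10 * (qPoch (V ^ 242) (V ^ 242) * (thetaZ V (2 * t) / thetaZ V t)) := by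
  have hq := quintuple_product (q := V ^ 242) (ζ := V ^ (22 * t)) (by positivity)
    (pow_lt_one₀ h0.le h1 (by norm_num)) (by positivity) (jTheta_zpow_ne_zero h0 h1 ht) (by
      have := jTheta_zpow_ne_zero (a := 2 * t) h0 h1 (by omega)
      rwa [show V ^ (22 * (2 * t)) = (V ^ (22 * t)) ^ 2 by
        rw [← zpow_natCast, ← zpow_mul]; congr 1; push_cast; ring] at this)
  rw [thetaZ_two_mul_div h0]
  have e1 : V ^ (66 * t) = (V ^ (22 * t)) ^ 3 := by
    rw [← zpow_natCast, ← zpow_mul]; congr 1; push_cast; ring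
  have e2 : V ^ (66 * -t) = ((V ^ (22 * t)) ^ 3)⁻¹ := by
    rw [← e1, ← zpow_neg]; congr 1; ring
  have e3 : V ^ (3 * (-t) ^ 2 - 11 * (-t) + 10) =
      V ^ (3 * t ^ 2 - 11 * t) * V ^ (22 * t) * V ^ 10 := by
    rw [← zpow_natCast V 10, ← zpow_add₀ h0.ne', ← zpow_add₀ h0.ne']; congr 1; push_cast; ring
  have e4 : V ^ (3 * t ^ 2 - 11 * t + 10) = V ^ (3 * t ^ 2 - 11 * t) * V ^ 10 := by
    rw [← zpow_natCast V 10, ← zpow_add₀ h0.ne']; rfl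
  have e5 : (-1 : ℝ) ^ (-t) = (-1) ^ t := by rw [zpow_neg, ← inv_zpow]; norm_num
  rw [e1, e2, e3, e4, e5]
  linear_combination (-1) ^ t * V ^ (3 * t ^ 2 - 11 * t) * V ^ 10 * hq

lemma qPoch_dissection (h0 : 0 < V) (h1 : V < 1) :
    qPoch (V ^ 2) (V ^ 2) = V ^ 10 * (qPoch (V ^ 242) (V ^ 242) *
      (1 + (thetaZ V 2 / thetaZ V 1 + thetaZ V 4 / thetaZ V 2 + thetaZ V 6 / thetaZ V 3 +
        thetaZ V 8 / thetaZ V 4 + thetaZ V 10 / thetaZ V 5))) := by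
  have hq0 : 0 < V ^ 2 := by positivity
  have hq1 : V ^ 2 < 1 := pow_lt_one₀ h0.le h1 (by norm_num)
  have hq0' : 0 < V ^ 242 := by positivity
  have hs := (Equiv.neg ℤ).summable_iff.2 (summable_pentTheta hq0 hq1 one_ne_zero)
  have e0 := (Equiv.neg ℤ).tsum_eq fun n : ℤ =>
    (-1 / (V ^ 2) ^ 2) ^ n * (V ^ 2) ^ ((3 : ℤ) * tri n)
  have h2 : ∀ t n : ℤ, (-1 / (V ^ 2) ^ 2) ^ (-(11 * n + (t - 2))) *
      (V ^ 2) ^ ((3 : ℤ) * tri (-(11 * n + (t - 2)))) =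
      (-1) ^ t * V ^ (3 * t ^ 2 - 11 * t + 10) *
        ((-V ^ (66 * t) / (V ^ 242) ^ 2) ^ n * (V ^ 242) ^ ((3 : ℤ) * tri n)) := fun t n => by
    rw [pentTheta_term hq0, pentTheta_term hq0', ← neg_one_mul (V ^ (66 * t)), mul_zpow,
      ← zpow_natCast V 2, ← zpow_natCast V 242, ← zpow_mul, ← zpow_mul, ← zpow_mul]
    have s1 : (-1 : ℝ) ^ (-(11 * n + (t - 2))) = (-1) ^ t * (-1) ^ n := by
      rw [show -(11 * n + (t - 2)) = t + n + 2 * (1 - t - 6 * n) by ring,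
        zpow_add₀ (by norm_num), zpow_add₀ (by norm_num), zpow_mul]
      norm_num
    have s2 : V ^ ((2 : ℕ) * (3 * tri (-(11 * n + (t - 2))) - 2 * -(11 * n + (t - 2)))) =
        V ^ (3 * t ^ 2 - 11 * t + 10) * (V ^ (66 * t * n) *
          V ^ ((242 : ℕ) * (3 * tri n - 2 * n))) := by
      rw [← zpow_add₀ h0.ne', ← zpow_add₀ h0.ne']
      congr 1
      push_cast
      linear_combination 3 * two_mul_tri (-(11 * n + (t - 2))) - 363 * two_mul_tri n
    rw [s1, s2]
    ring
  have h3 : ∀ t : ℤ, ∑' n : ℤ, (-1 / (V ^ 2) ^ 2) ^ (-(11 * n + (t - 2))) *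
      (V ^ 2) ^ ((3 : ℤ) * tri (-(11 * n + (t - 2)))) =
      (-1) ^ t * V ^ (3 * t ^ 2 - 11 * t + 10) * pentTheta (V ^ 242) (V ^ (66 * t)) := fun t => by
    rw [pentTheta, ← tsum_mul_left]
    exact tsum_congr (h2 t)
  rw [← pentTheta_one hq0 hq1, pentTheta, ← e0]
  have h4 := tsum_int_eleven hs (-7)
  refine h4.trans ?_
  simp only [Function.comp, Equiv.neg_apply]
  have h5 : ∀ i : Fin 11, ∑' n : ℤ, (-1 / (V ^ 2) ^ 2) ^ (-(11 * n + ((i : ℕ) + -7))) *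
      (V ^ 2) ^ ((3 : ℤ) * tri (-(11 * n + ((i : ℕ) + -7)))) =
      (-1) ^ ((i : ℕ) - 5 : ℤ) * V ^ (3 * ((i : ℕ) - 5 : ℤ) ^ 2 - 11 * ((i : ℕ) - 5 : ℤ) + 10) *
        pentTheta (V ^ 242) (V ^ (66 * ((i : ℕ) - 5 : ℤ))) := fun i => by
    rw [← h3]
    refine tsum_congr fun n => ?_
    rw [show ((i : ℕ) : ℤ) + -7 = (i : ℕ) - 5 - 2 by ring]
  simp only [h5, Fin.sum_univ_succ]
  have p1 := pentTheta_pair h0 h1 (t := 1) (by norm_num)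
  have p2 := pentTheta_pair h0 h1 (t := 2) (by norm_num)
  have p3 := pentTheta_pair h0 h1 (t := 3) (by norm_num)
  have p4 := pentTheta_pair h0 h1 (t := 4) (by norm_num)
  have p5 := pentTheta_pair h0 h1 (t := 5) (by norm_num)
  have p0 := pentTheta_one hq0' (pow_lt_one₀ h0.le h1 (by norm_num))
  norm_num at p1 p2 p3 p4 p5 ⊢
  linear_combination p1 + p2 + p3 + p4 + p5 + V ^ 10 * p0

end

section

open Filter Topology Finset

/-- The algebraic relations satisfied by the values of theta functions, of the Weierstrass
function and of the zeta function at the multiples of a point of order eleven on `ℝˣ / q^ℤ`. -/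
structure ThetaSys (Z p l : ℤ → ℝ) (q : ℝ) : Prop where
  ne_zero : ∀ a, ¬ (11 : ℤ) ∣ a → Z a ≠ 0
  neg : ∀ a, Z (-a) = -Z a
  add_eleven : ∀ a, Z (a + 11) = Z a
  lneg : ∀ a, ¬ (11 : ℤ) ∣ a → l (-a) = -l a
  ladd_eleven : ∀ a, ¬ (11 : ℤ) ∣ a → l (a + 11) = l a
  sub_eq : ∀ a b, ¬ (11 : ℤ) ∣ a → ¬ (11 : ℤ) ∣ b → ¬ (11 : ℤ) ∣ a - b →
    p a - p b = Z (a + b) * Z (a - b) / (Z a ^ 2 * Z b ^ 2)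
  cubic : ∃ e f, (e * f * (e - f)) ^ 2 = q / 16 ∧ ∀ a, ¬ (11 : ℤ) ∣ a →
    p a * (p a - e) * (p a - f) = -(Z (2 * a) / Z a ^ 4) ^ 2 / 4
  lrel : ∀ a c, ¬ (11 : ℤ) ∣ a → ¬ (11 : ℤ) ∣ c → ¬ (11 : ℤ) ∣ a + c → ¬ (11 : ℤ) ∣ a - c →
    l (a + c) + l (a - c) - 2 * l a =
      -(Z (2 * a) * Z c ^ 2 / (Z a ^ 2 * Z (a + c) * Z (a - c)))

lemma eleven_dvd_mul {r a : ℤ} (hr : ¬ (11 : ℤ) ∣ r) : (11 : ℤ) ∣ r * a ↔ (11 : ℤ) ∣ a :=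
  ⟨fun h => ((by norm_num : Prime (11 : ℤ)).dvd_or_dvd h).resolve_left hr,
    fun h => h.mul_left r⟩

/-- A periodic function is determined by residues. -/
lemma eq_add_eleven_mul {P : ℤ → Prop} (hP : ∀ a, P a → P (a + 11)) {f : ℤ → ℝ}
    (hn : ∀ a, P (-a) ↔ P a)
    (hf : ∀ a, P a → f (a + 11) = f a) (hf' : ∀ a, P a → f (-a) = -f a) {a : ℤ} (ha : P a)
    (r : ℤ) : P (a + 11 * r) ∧ f (a + 11 * r) = f a := by
  have key : ∀ n : ℕ, ∀ a, P a → P (a + 11 * (n : ℤ)) ∧ f (a + 11 * (n : ℤ)) = f a := by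
    intro n
    induction n with
    | zero => intro a h; simpa using h
    | succ k ih =>
      intro a h
      obtain ⟨h2, h3⟩ := ih a h
      have e : a + 11 * ((k + 1 : ℕ) : ℤ) = a + 11 * (k : ℤ) + 11 := by push_cast; ring
      rw [e]
      exact ⟨hP _ h2, (hf _ h2).trans h3⟩
  obtain ⟨n, rfl | rfl⟩ := r.eq_nat_or_neg
  · exact key n a ha
  · have h := key n (-a) ((hn a).2 ha)
    rw [show -a + 11 * (n : ℤ) = -(a + 11 * -(n : ℤ)) by ring, hn] at h
    refine ⟨h.1, ?_⟩
    have := h.2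
    rw [hf' _ h.1, hf' _ ha] at this
    linarith

lemma ThetaSys.add_eleven_mul {Z p l : ℤ → ℝ} {q : ℝ} (h : ThetaSys Z p l q) (a r : ℤ) :
    Z (a + 11 * r) = Z a :=
  (eq_add_eleven_mul (P := fun _ => True) (fun _ _ => trivial) (fun _ => Iff.rfl)
    (fun a _ => h.add_eleven a) (fun a _ => h.neg a) trivial r).2

lemma ThetaSys.ladd_eleven_mul {Z p l : ℤ → ℝ} {q : ℝ} (h : ThetaSys Z p l q) {a : ℤ}
    (ha : ¬ (11 : ℤ) ∣ a) (r : ℤ) : l (a + 11 * r) = l a :=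
  (eq_add_eleven_mul (P := fun a => ¬ (11 : ℤ) ∣ a) (fun a ha => by omega)
    (fun a => by rw [dvd_neg]) h.ladd_eleven h.lneg ha r).2

lemma ThetaSys.diamond {Z p l : ℤ → ℝ} {q : ℝ} (h : ThetaSys Z p l q) {r : ℤ}
    (hr : ¬ (11 : ℤ) ∣ r) :
    ThetaSys (fun a => Z (r * a)) (fun a => p (r * a)) (fun a => l (r * a)) q where
  ne_zero a ha := h.ne_zero _ (by rwa [eleven_dvd_mul hr])
  neg a := by rw [mul_neg, h.neg]
  add_eleven a := by rw [mul_add, mul_comm r 11, h.add_eleven_mul]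
  lneg a ha := by rw [mul_neg, h.lneg _ (by rwa [eleven_dvd_mul hr])]
  ladd_eleven a ha := by
    rw [mul_add, mul_comm r 11, h.ladd_eleven_mul (by rwa [eleven_dvd_mul hr])]
  sub_eq a b ha hb hab := by
    rw [h.sub_eq _ _ (by rwa [eleven_dvd_mul hr]) (by rwa [eleven_dvd_mul hr])
      (by rwa [← mul_sub, eleven_dvd_mul hr]), ← mul_sub, ← mul_add]
  cubic := by
    obtain ⟨e, f, h1, h2⟩ := h.cubic
    refine ⟨e, f, h1, fun a ha => ?_⟩
    rw [h2 _ (by rwa [eleven_dvd_mul hr]), mul_left_comm]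
  lrel a c ha hc hac hac' := by
    have := h.lrel (r * a) (r * c) (by rwa [eleven_dvd_mul hr]) (by rwa [eleven_dvd_mul hr])
      (by rwa [← mul_add, eleven_dvd_mul hr]) (by rwa [← mul_sub, eleven_dvd_mul hr])
    rw [← mul_sub, ← mul_add, mul_left_comm 2] at this
    exact this

variable {V : ℝ}

/-- The normalised zeta values. -/
noncomputable def thetaL (V : ℝ) (a : ℤ) : ℝ :=
  (thetaLog (V ^ 242) (V ^ (22 * a)) + a / 11 - 1 / 2) / qPoch (V ^ 242) (V ^ 242) ^ 2

lemma weierDiff_zpow (h0 : 0 < V) (h1 : V < 1) {a b : ℤ}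
    (ha : ¬ (11 : ℤ) ∣ a) (hb : ¬ (11 : ℤ) ∣ b) :
    weierDiff (V ^ 242) (V ^ (22 * a)) (V ^ (22 * b)) =
      thetaZ V (a + b) * thetaZ V (a - b) / (thetaZ V a ^ 2 * thetaZ V b ^ 2) := by
  have na := thetaZ_ne_zero h0 h1 ha
  have nb := thetaZ_ne_zero h0 h1 hb
  have na' := jTheta_zpow_ne_zero h0 h1 ha
  have nb' := jTheta_zpow_ne_zero h0 h1 hb
  rw [weierDiff, div_eq_div_iff (by positivity) (by positivity)]
  simp only [thetaZ]
  rw [← zpow_add₀ h0.ne', ← zpow_sub₀ h0.ne', ← mul_add, ← mul_sub]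
  have s1 : ((-1 : ℝ) ^ a) ^ 2 = 1 := by
    rw [← zpow_natCast, ← zpow_mul, mul_comm, zpow_mul]; norm_num
  have s2 : ((-1 : ℝ) ^ b) ^ 2 = 1 := by
    rw [← zpow_natCast, ← zpow_mul, mul_comm, zpow_mul]; norm_num
  have s3 : (-1 : ℝ) ^ (a + b) * (-1) ^ (a - b) = 1 := by
    rw [← zpow_add₀ (by norm_num), show a + b + (a - b) = 2 * a by ring, zpow_mul]; norm_num
  have e : V ^ (22 * b) * ((V ^ (a ^ 2 - 11 * a)) ^ 2 * (V ^ (b ^ 2 - 11 * b)) ^ 2) =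
      V ^ ((a + b) ^ 2 - 11 * (a + b)) * V ^ ((a - b) ^ 2 - 11 * (a - b)) := by
    rw [← zpow_natCast, ← zpow_natCast, ← zpow_mul, ← zpow_mul, ← zpow_add₀ h0.ne',
      ← zpow_add₀ h0.ne', ← zpow_add₀ h0.ne']
    congr 1; push_cast; ring
  simp only [mul_pow, s1, s2]
  linear_combination jTheta (V ^ 242) (V ^ (22 * (a + b))) * jTheta (V ^ 242) (V ^ (22 * (a - b))) *
    jTheta (V ^ 242) (V ^ (22 * a)) ^ 2 * jTheta (V ^ 242) (V ^ (22 * b)) ^ 2 * (e - 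
    V ^ ((a + b) ^ 2 - 11 * (a + b)) * V ^ ((a - b) ^ 2 - 11 * (a - b)) * s3)

lemma thetaZ_double (h0 : 0 < V) (h1 : V < 1) {a : ℤ} (ha : ¬ (11 : ℤ) ∣ a) :
    V ^ (22 * a) * jTheta (V ^ 242) ((V ^ (22 * a)) ^ 2) / jTheta (V ^ 242) (V ^ (22 * a)) ^ 4 =
      thetaZ V (2 * a) / thetaZ V a ^ 4 := by
  have na := thetaZ_ne_zero h0 h1 ha
  have na' := jTheta_zpow_ne_zero h0 h1 ha
  have e2 : V ^ (22 * (2 * a)) = (V ^ (22 * a)) ^ 2 := by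
    rw [← zpow_natCast, ← zpow_mul]; congr 1; push_cast; ring
  rw [div_eq_div_iff (by positivity) (by positivity)]
  simp only [thetaZ, e2]
  have s1 : ((-1 : ℝ) ^ a) ^ 4 = 1 := by
    rw [← zpow_natCast, ← zpow_mul, mul_comm, zpow_mul]; norm_num
  have s2 : (-1 : ℝ) ^ (2 * a) = 1 := by rw [zpow_mul]; norm_num
  have e : V ^ (22 * a) * (V ^ (a ^ 2 - 11 * a)) ^ 4 = V ^ ((2 * a) ^ 2 - 11 * (2 * a)) := by
    rw [← zpow_natCast, ← zpow_mul, ← zpow_add₀ h0.ne']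
    congr 1; push_cast; ring
  rw [s2, mul_pow, mul_pow, s1]
  linear_combination jTheta (V ^ 242) ((V ^ (22 * a)) ^ 2) *
    jTheta (V ^ 242) (V ^ (22 * a)) ^ 4 * e

lemma thetaSys (h0 : 0 < V) (h1 : V < 1) :
    ThetaSys (thetaZ V) (fun a => weierP (V ^ 242) (V ^ (22 * a))) (thetaL V) (V ^ 242) where
  ne_zero a ha := thetaZ_ne_zero h0 h1 ha
  neg a := thetaZ_neg h0 h1 a
  add_eleven a := thetaZ_add_eleven h0 h1 a
  lneg a ha := by
    have h := thetaLog_inv (q := V ^ 242) (by positivity) (pow_lt_one₀ h0.le h1 (by norm_num))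
      (x := V ^ (22 * a)) (by positivity) (jTheta_zpow_ne_zero h0 h1 ha)
    rw [thetaL, thetaL, mul_neg, zpow_neg, h]
    push_cast
    ring
  ladd_eleven a ha := by
    have h := thetaLog_mul_q (q := V ^ 242) (by positivity) (pow_lt_one₀ h0.le h1 (by norm_num))
      (x := V ^ (22 * a)) (by positivity) (jTheta_zpow_ne_zero h0 h1 ha)
    have e2 : V ^ (22 * (a + 11)) = V ^ 242 * V ^ (22 * a) := by
      rw [← zpow_natCast V 242, ← zpow_add₀ h0.ne']; congr 1; push_cast; ring
    rw [thetaL, thetaL, e2, h]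
    push_cast
    ring
  sub_eq a b ha hb hab := by
    have hq0 : 0 < V ^ 242 := by positivity
    have hq1 : V ^ 242 < 1 := pow_lt_one₀ h0.le h1 (by norm_num)
    rw [← weierDiff_zpow h0 h1 ha hb, weierDiff_eq hq0 hq1 (by positivity) (by positivity)
      (jTheta_zpow_ne_zero h0 h1 ha) (jTheta_zpow_ne_zero h0 h1 hb) _
      (jTheta_neg_ne_zero hq0 hq1 (by positivity)) (jTheta_neg_ne_zero hq0 hq1 (by positivity))]
    rw [← zpow_sub₀ h0.ne', ← mul_sub]
    exact jTheta_zpow_ne_zero h0 h1 hab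
  cubic := by
    have hq0 : 0 < V ^ 242 := by positivity
    have hq1 : V ^ 242 < 1 := pow_lt_one₀ h0.le h1 (by norm_num)
    refine ⟨_, _, weierP_disc hq0 hq1 (s := V ^ 121) (by positivity) (by ring), fun a ha => ?_⟩
    rw [weierP_cubic hq0 hq1 (by positivity) (by ring) (by positivity), thetaZ_double h0 h1 ha]
    have := jTheta_zpow_ne_zero (a := 2 * a) h0 h1 (by omega)
    rwa [show V ^ (22 * (2 * a)) = (V ^ (22 * a)) ^ 2 by
        rw [← zpow_natCast, ← zpow_mul]; congr 1; push_cast; ring] at this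
  lrel a c ha hc hac hac' := by
    have hq0 : 0 < V ^ 242 := by positivity
    have hq1 : V ^ 242 < 1 := pow_lt_one₀ h0.le h1 (by norm_num)
    have hJ : qPoch (V ^ 242) (V ^ 242) ≠ 0 := (qPoch_pos hq0 hq1 hq1).ne'
    have h := thetaLog_relation hq0 hq1 (u := V ^ (22 * a)) (c := V ^ (22 * c)) (by positivity)
      (by positivity) (jTheta_zpow_ne_zero h0 h1 ha) (by
        rw [← zpow_add₀ h0.ne', ← mul_add]
        exact jTheta_zpow_ne_zero h0 h1 (by omega)) (jTheta_zpow_ne_zero h0 h1 hc) (by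
        rw [← zpow_add₀ h0.ne', ← mul_add]
        exact jTheta_zpow_ne_zero h0 h1 hac) (by
        rw [← zpow_sub₀ h0.ne', ← mul_sub]
        exact jTheta_zpow_ne_zero h0 h1 hac')
    rw [weierDiff_zpow h0 h1 ha hc, thetaZ_double h0 h1 ha, ← zpow_add₀ h0.ne',
      ← zpow_sub₀ h0.ne', ← mul_sub, ← mul_add] at h
    have na := thetaZ_ne_zero h0 h1 ha
    have nc := thetaZ_ne_zero h0 h1 hc
    have np := thetaZ_ne_zero h0 h1 hac
    have nm := thetaZ_ne_zero h0 h1 hac'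
    have e : thetaL V (a + c) + thetaL V (a - c) - 2 * thetaL V a =
        (thetaLog (V ^ 242) (V ^ (22 * (a + c))) + thetaLog (V ^ 242) (V ^ (22 * (a - c))) -
          2 * thetaLog (V ^ 242) (V ^ (22 * a))) / qPoch (V ^ 242) (V ^ 242) ^ 2 := by
      simp only [thetaL]
      push_cast
      ring
    rw [e, div_eq_iff (by positivity)]
    have h' := congrArg (fun x => x * (thetaZ V a ^ 2 * thetaZ V c ^ 2) /
      (thetaZ V (a + c) * thetaZ V (a - c))) h
    field_simp at h' ⊢
    linear_combination h'

end

section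

open Filter Topology Finset

variable {Z p l : ℤ → ℝ} {q : ℝ}

namespace ThetaSys

lemma val_six (h : ThetaSys Z p l q) : Z 6 = -Z 5 := by
  rw [← h.neg, ← h.add_eleven (-_)]; norm_num

lemma val_seven (h : ThetaSys Z p l q) : Z 7 = -Z 4 := by
  rw [← h.neg, ← h.add_eleven (-_)]; norm_num

lemma val_eight (h : ThetaSys Z p l q) : Z 8 = -Z 3 := by
  rw [← h.neg, ← h.add_eleven (-_)]; norm_num

lemma val_nine (h : ThetaSys Z p l q) : Z 9 = -Z 2 := by
  rw [← h.neg, ← h.add_eleven (-_)]; norm_num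

lemma val_ten (h : ThetaSys Z p l q) : Z 10 = -Z 1 := by
  rw [← h.neg, ← h.add_eleven (-_)]; norm_num

/-- The three-term relation. -/
lemma three_term (h : ThetaSys Z p l q) {a b c : ℤ} (ha : ¬ (11 : ℤ) ∣ a) (hb : ¬ (11 : ℤ) ∣ b)
    (hc : ¬ (11 : ℤ) ∣ c) (hab : ¬ (11 : ℤ) ∣ a - b) (hbc : ¬ (11 : ℤ) ∣ b - c)
    (hac : ¬ (11 : ℤ) ∣ a - c) :
    Z (a + b) * Z (a - b) * Z c ^ 2 + Z (b + c) * Z (b - c) * Z a ^ 2 =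
      Z (a + c) * Z (a - c) * Z b ^ 2 := by
  have e1 := h.sub_eq a b ha hb hab
  have e2 := h.sub_eq b c hb hc hbc
  have e3 := h.sub_eq a c ha hc hac
  have na := h.ne_zero a ha
  have nb := h.ne_zero b hb
  have nc := h.ne_zero c hc
  have e : Z (a + b) * Z (a - b) / (Z a ^ 2 * Z b ^ 2) +
      Z (b + c) * Z (b - c) / (Z b ^ 2 * Z c ^ 2) =
      Z (a + c) * Z (a - c) / (Z a ^ 2 * Z c ^ 2) := by
    rw [← e1, ← e2, ← e3]; ring
  field_simp at e
  linear_combination e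

lemma rel_three (h : ThetaSys Z p l q) : Z 2 ^ 3 * Z 4 = Z 1 * Z 3 ^ 3 + Z 1 ^ 3 * Z 5 := by
  have := h.three_term (a := 1) (b := 2) (c := 3) (by norm_num) (by norm_num) (by norm_num)
    (by norm_num) (by norm_num) (by norm_num)
  norm_num [h.neg] at this
  linear_combination this

lemma rel_four (h : ThetaSys Z p l q) :
    Z 1 * Z 3 * Z 4 ^ 2 = Z 2 ^ 2 * Z 3 * Z 5 + Z 1 ^ 2 * Z 2 * Z 5 := by
  have := h.three_term (a := 1) (b := 2) (c := 4) (by norm_num) (by norm_num) (by norm_num)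
    (by norm_num) (by norm_num) (by norm_num)
  norm_num [h.neg, h.val_six] at this
  linear_combination -this

lemma rel_five (h : ThetaSys Z p l q) :
    Z 1 ^ 2 * Z 3 * Z 4 = Z 1 * Z 3 * Z 5 ^ 2 + Z 2 ^ 2 * Z 4 * Z 5 := by
  have := h.three_term (a := 1) (b := 2) (c := 5) (by norm_num) (by norm_num) (by norm_num)
    (by norm_num) (by norm_num) (by norm_num)
  norm_num [h.neg, h.val_six, h.val_seven] at this
  linear_combination this

end ThetaSys

/-- First coordinate on the modular curve. -/
noncomputable def curveX (Z : ℤ → ℝ) : ℝ := -(Z 1 ^ 2 / (Z 2 * Z 3))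

/-- Second coordinate on the modular curve. -/
noncomputable def curveY (Z : ℤ → ℝ) : ℝ := Z 1 * Z 3 * Z 5 / (Z 2 ^ 2 * Z 4)

/-- Laurent monomials in the theta values. -/
noncomputable def mon (Z : ℤ → ℝ) (a b c d e : ℤ) : ℝ :=
  Z 1 ^ a * Z 2 ^ b * Z 3 ^ c * Z 4 ^ d * Z 5 ^ e

namespace ThetaSys

lemma ne_one (h : ThetaSys Z p l q) : Z 1 ≠ 0 := h.ne_zero 1 (by norm_num)
lemma ne_two (h : ThetaSys Z p l q) : Z 2 ≠ 0 := h.ne_zero 2 (by norm_num)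
lemma ne_three (h : ThetaSys Z p l q) : Z 3 ≠ 0 := h.ne_zero 3 (by norm_num)
lemma ne_four (h : ThetaSys Z p l q) : Z 4 ≠ 0 := h.ne_zero 4 (by norm_num)
lemma ne_five (h : ThetaSys Z p l q) : Z 5 ≠ 0 := h.ne_zero 5 (by norm_num)

lemma one_sub_curveX (h : ThetaSys Z p l q) :
    1 - curveX Z = Z 1 * Z 4 ^ 2 / (Z 2 ^ 2 * Z 5) := by
  have n2 := h.ne_two
  have n3 := h.ne_three
  have n5 := h.ne_five
  rw [curveX]
  field_simp
  linear_combination -h.rel_four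

lemma one_add_curveY (h : ThetaSys Z p l q) :
    1 + curveY Z = Z 1 ^ 2 * Z 3 / (Z 2 ^ 2 * Z 5) := by
  have n2 := h.ne_two
  have n4 := h.ne_four
  have n5 := h.ne_five
  rw [curveY]
  field_simp
  linear_combination -h.rel_five

lemma curve (h : ThetaSys Z p l q) :
    curveY Z ^ 2 + (curveX Z ^ 2 + 1) * curveY Z + curveX Z = 0 := by
  have n1 := h.ne_one
  have n2 := h.ne_two
  have n3 := h.ne_three
  have n4 := h.ne_four
  have n5 := h.ne_five
  have e1 : curveY Z * (1 + curveY Z) = Z 1 ^ 3 * Z 3 ^ 2 / (Z 2 ^ 4 * Z 4) := by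
    rw [h.one_add_curveY, curveY]
    field_simp
  have e2 : 1 + curveX Z * curveY Z = Z 1 * Z 3 ^ 3 / (Z 2 ^ 3 * Z 4) := by
    rw [curveX, curveY]
    field_simp
    linear_combination h.rel_three
  have e3 : curveX Z * (1 + curveX Z * curveY Z) = -(Z 1 ^ 3 * Z 3 ^ 2 / (Z 2 ^ 4 * Z 4)) := by
    rw [e2, curveX]
    field_simp
  linear_combination e1 + e3

lemma mon_eq (h : ThetaSys Z p l q) {a b c d e : ℤ} (a' b' c' d' e' : ℤ) (i j k m : ℕ)
    (ha : a = a' + 2 * i + j + k + 2 * m) (hb : b = b' - i - 2 * j - 2 * k - 2 * m)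
    (hc : c = c' - i + j + m) (hd : d = d' - j + 2 * k) (he : e = e' + j - k - m) :
    mon Z a b c d e = mon Z a' b' c' d' e' *
      ((-curveX Z) ^ i * curveY Z ^ j * (1 - curveX Z) ^ k * (1 + curveY Z) ^ m) := by
  have n1 := h.ne_one
  have n2 := h.ne_two
  have n3 := h.ne_three
  have n4 := h.ne_four
  have n5 := h.ne_five
  have ex : -curveX Z = Z 1 ^ (2 : ℤ) * Z 2 ^ (-1 : ℤ) * Z 3 ^ (-1 : ℤ) := by
    simp only [curveX, neg_neg, zpow_neg, zpow_ofNat]; field_simp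
  have ey : curveY Z = Z 1 ^ (1 : ℤ) * Z 2 ^ (-2 : ℤ) * Z 3 ^ (1 : ℤ) * Z 4 ^ (-1 : ℤ) *
      Z 5 ^ (1 : ℤ) := by
    simp only [curveY, zpow_neg, zpow_ofNat]; field_simp
  have ek : 1 - curveX Z = Z 1 ^ (1 : ℤ) * Z 2 ^ (-2 : ℤ) * Z 4 ^ (2 : ℤ) * Z 5 ^ (-1 : ℤ) := by
    simp only [h.one_sub_curveX, zpow_neg, zpow_ofNat]; field_simp
  have em : 1 + curveY Z = Z 1 ^ (2 : ℤ) * Z 2 ^ (-2 : ℤ) * Z 3 ^ (1 : ℤ) * Z 5 ^ (-1 : ℤ) := by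
    simp only [h.one_add_curveY, zpow_neg, zpow_ofNat]; field_simp
  rw [ex, em, ek, ey, mon, mon]
  rw [← zpow_natCast _ i, ← zpow_natCast _ j, ← zpow_natCast _ k, ← zpow_natCast _ m]
  simp only [mul_zpow, ← zpow_mul]
  rw [show a = a' + 2 * i + 1 * j + 1 * k + 2 * m by rw [ha]; ring,
    show b = b' + (-1) * i + (-2) * j + (-2) * k + (-2) * m by rw [hb]; ring,
    show c = c' + (-1) * i + 1 * j + 1 * m by rw [hc]; ring,
    show d = d' + (-1) * j + 2 * k by rw [hd]; ring,
    show e = e' + 1 * j + (-1) * k + (-1) * m by rw [he]; ring]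
  simp only [zpow_add₀ n1, zpow_add₀ n2, zpow_add₀ n3, zpow_add₀ n4, zpow_add₀ n5]
  ring

end ThetaSys

/-- The discriminant of Tate's normal form of the curve with a point of order eleven. -/
lemma tate_disc {x y : ℝ} (h : y ^ 2 + (x ^ 2 + 1) * y + x = 0) {b c r s t : ℝ}
    (hc : c = (1 - x) * x * y) (hb : b = c * (1 + x * y)) (hb0 : b ≠ 0) (hc0 : c ≠ 0)
    (hbc : b ≠ c) (h1 : -(r * s * t) = b ^ 2 / 4)
    (h2 : (b - r) * (b - s) * (b - t) = (b * c) ^ 2 / 4)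
    (h3 : (c - r) * (c - s) * (c - t) = (b - c - c ^ 2) ^ 2 / 4) :
    16 * ((r - s) * (r - t) * (s - t)) ^ 2 =
      x ^ 4 * y ^ 7 * (1 - x) ^ 2 * (1 + y) ^ 7 * (1 + 4 * x + 2 * y - x ^ 2 + x * y) := by
  have g3 : r * s * t = -b ^ 2 / 4 := by linear_combination -h1
  have k2 : b ^ 2 - (r + s + t) * b + (r * s + r * t + s * t) = b * (c ^ 2 - 1) / 4 := by
    apply mul_left_cancel₀ hb0
    linear_combination h2 - h1
  have k3 : c ^ 2 - (r + s + t) * c + (r * s + r * t + s * t) =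
      (1 + c) * (c * (1 + c) - 2 * b) / 4 := by
    apply mul_left_cancel₀ hc0
    linear_combination h3 - h1
  have g1 : r + s + t = b - (1 - c) ^ 2 / 4 := by
    apply mul_left_cancel₀ (sub_ne_zero.2 hbc)
    linear_combination k3 - k2
  have g2 : r * s + r * t + s * t = -b * (1 - c) / 2 := by
    linear_combination k2 + b * g1
  have e : ((r - s) * (r - t) * (s - t)) ^ 2 = (r + s + t) ^ 2 * (r * s + r * t + s * t) ^ 2 -
      4 * (r * s + r * t + s * t) ^ 3 - 4 * (r + s + t) ^ 3 * (r * s * t) +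
      18 * (r + s + t) * (r * s + r * t + s * t) * (r * s * t) - 27 * (r * s * t) ^ 2 := by ring
  rw [e, g1, g2, g3, hb, hc]
  linear_combination (
     - 1 * x ^ 4 * y ^ 6 - 8 * x ^ 4 * y ^ 7 - 27 * x ^ 4 * y ^ 8 - 50 * x ^ 4 * y ^ 9 - 55 * 
    x ^ 4 * y ^ 10 - 36 * x ^ 4 * y ^ 11 - 13 * x ^ 4 * y ^ 12 - 2 * x ^ 4 * y ^ 13 + 1 * x ^ 
    5 * y ^ 5 + 5 * x ^ 5 * y ^ 6 + 11 * x ^ 5 * y ^ 7 + 18 * x ^ 5 * y ^ 8 + 30 * x ^ 5 * y 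
    ^ 9 + 41 * x ^ 5 * y ^ 10 + 35 * x ^ 5 * y ^ 11 + 16 * x ^ 5 * y ^ 12 + 3 * x ^ 5 * y ^ 
    13 - 4 * x ^ 6 * y ^ 5 + 2 * x ^ 6 * y ^ 6 + 44 * x ^ 6 * y ^ 7 + 121 * x ^ 6 * y ^ 8 + 
    168 * x ^ 6 * y ^ 9 + 132 * x ^ 6 * y ^ 10 + 56 * x ^ 6 * y ^ 11 + 10 * x ^ 6 * y ^ 12 + 
    6 * x ^ 7 * y ^ 5 - 49 * x ^ 7 * y ^ 6 - 126 * x ^ 7 * y ^ 7 - 193 * x ^ 7 * y ^ 8 - 200 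
    * x ^ 7 * y ^ 9 - 142 * x ^ 7 * y ^ 10 - 64 * x ^ 7 * y ^ 11 - 15 * x ^ 7 * y ^ 12 - 1 * 
    x ^ 7 * y ^ 13 - 4 * x ^ 8 * y ^ 5 + 111 * x ^ 8 * y ^ 6 + 75 * x ^ 8 * y ^ 7 + 25 * x ^ 
    8 * y ^ 8 - 16 * x ^ 8 * y ^ 9 - 17 * x ^ 8 * y ^ 10 - 3 * x ^ 8 * y ^ 11 + 1 * x ^ 8 * y 
    ^ 12 + 1 * x ^ 9 * y ^ 5 - 113 * x ^ 9 * y ^ 6 + 116 * x ^ 9 * y ^ 7 + 121 * x ^ 9 * y ^ 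
    8 + 96 * x ^ 9 * y ^ 9 + 49 * x ^ 9 * y ^ 10 + 14 * x ^ 9 * y ^ 11 + 1 * x ^ 9 * y ^ 12 + 
    56 * x ^ 10 * y ^ 6 - 208 * x ^ 10 * y ^ 7 - 24 * x ^ 10 * y ^ 8 + 3 * x ^ 10 * y ^ 10 - 
    1 * x ^ 10 * y ^ 11 - 11 * x ^ 11 * y ^ 6 + 120 * x ^ 11 * y ^ 7 - 103 * x ^ 11 * y ^ 8 - 
    35 * x ^ 11 * y ^ 9 - 13 * x ^ 11 * y ^ 10 - 1 * x ^ 11 * y ^ 11 - 23 * x ^ 12 * y ^ 7 + 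
    77 * x ^ 12 * y ^ 8 - 3 * x ^ 12 * y ^ 9 + 1 * x ^ 12 * y ^ 10 - 1 * x ^ 13 * y ^ 7 - 13 
    * x ^ 13 * y ^ 8 + 12 * x ^ 13 * y ^ 9 + 1 * x ^ 13 * y ^ 10 - 2 * x ^ 14 * y ^ 8 - 1 * x 
    ^ 14 * y ^ 9 - 1 * x ^ 15 * y ^ 9
    ) * h

namespace ThetaSys

lemma q_eq (h : ThetaSys Z p l q) :
    q = (1 + 4 * curveX Z + 2 * curveY Z - curveX Z ^ 2 + curveX Z * curveY Z) *
      mon Z (-5) 0 (-2) (-3) (-2) := by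
  obtain ⟨e, f, hq, hC⟩ := h.cubic
  have n1 := h.ne_one
  have n2 := h.ne_two
  have n3 := h.ne_three
  have n4 := h.ne_four
  have n5 := h.ne_five
  have d2 := h.sub_eq 2 1 (by norm_num) (by norm_num) (by norm_num)
  have d3 := h.sub_eq 3 1 (by norm_num) (by norm_num) (by norm_num)
  have d23 := h.sub_eq 3 2 (by norm_num) (by norm_num) (by norm_num)
  have c1 := hC 1 (by norm_num)
  have c2 := hC 2 (by norm_num)
  have c3 := hC 3 (by norm_num)
  norm_num [h.val_six] at d2 d3 d23 c1 c2 c3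
  set k : ℝ := -(Z 1 ^ 6 * Z 3 ^ 2 / Z 2 ^ 6) with hk
  have ec : (1 - curveX Z) * curveX Z * curveY Z = -(Z 1 ^ 4 * Z 4 / Z 2 ^ 5) := by
    rw [h.one_sub_curveX, curveX, curveY]; field_simp
  have eb : -(Z 1 ^ 4 * Z 4 / Z 2 ^ 5) * (1 + curveX Z * curveY Z) =
      -(Z 1 ^ 5 * Z 3 ^ 3 / Z 2 ^ 8) := by
    have e2 : 1 + curveX Z * curveY Z = Z 1 * Z 3 ^ 3 / (Z 2 ^ 3 * Z 4) := by
      rw [curveX, curveY]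
      field_simp
      linear_combination h.rel_three
    rw [e2]; field_simp
  have e2 : k * (p 2 - p 1) = -(Z 1 ^ 5 * Z 3 ^ 3 / Z 2 ^ 8) := by
    rw [d2, hk]; field_simp
  have e3 : k * (p 3 - p 1) = -(Z 1 ^ 4 * Z 4 / Z 2 ^ 5) := by
    rw [d3, hk]; field_simp
  have e23 : k * (p 3 - p 2) = -(Z 1 ^ 7 * Z 5 / Z 2 ^ 8) := by
    rw [d23, hk]; field_simp
  have hd := tate_disc h.curve (b := k * (p 2 - p 1)) (c := k * (p 3 - p 1))
    (r := -(k * p 1)) (s := k * (e - p 1)) (t := k * (f - p 1)) (by rw [e3, ec])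
    (by rw [e2, e3, eb]) (by rw [e2]; simp [n1, n2, n3]) (by rw [e3]; simp [n1, n2, n4])
    (fun h0 => by
      have : k * (p 3 - p 2) = 0 := by linear_combination -h0
      rw [e23] at this
      simp [n1, n2, n5] at this)
    (by
      rw [e2, show -(-(k * p 1) * (k * (e - p 1)) * (k * (f - p 1))) =
        k ^ 3 * (p 1 * (p 1 - e) * (p 1 - f)) by ring, c1, hk]
      field_simp)
    (by
      rw [show (k * (p 2 - p 1) - -(k * p 1)) * (k * (p 2 - p 1) - k * (e - p 1)) *
        (k * (p 2 - p 1) - k * (f - p 1)) = k ^ 3 * (p 2 * (p 2 - e) * (p 2 - f)) by ring, c2, e2,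
        e3, hk]
      field_simp)
    (by
      rw [show (k * (p 3 - p 1) - -(k * p 1)) * (k * (p 3 - p 1) - k * (e - p 1)) *
        (k * (p 3 - p 1) - k * (f - p 1)) = k ^ 3 * (p 3 * (p 3 - e) * (p 3 - f)) by ring, c3,
        show k * (p 2 - p 1) - k * (p 3 - p 1) = -(k * (p 3 - p 2)) by ring, e23, e3, hk]
      field_simp
      linear_combination -(Z 1 * Z 3 * Z 4 ^ 2 - Z 2 ^ 2 * Z 3 * Z 5 + Z 1 ^ 2 * Z 2 * Z 5) *
        h.rel_four)
  have e6 : 16 * ((-(k * p 1) - k * (e - p 1)) * (-(k * p 1) - k * (f - p 1)) *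
      (k * (e - p 1) - k * (f - p 1))) ^ 2 = k ^ 6 * q := by
    linear_combination 16 * k ^ 6 * hq
  rw [e6] at hd
  have k0 : k ^ 6 ≠ 0 := pow_ne_zero _ (by rw [hk]; simp [n1, n2, n3])
  apply mul_left_cancel₀ k0
  rw [hd]
  have : curveX Z ^ 4 * curveY Z ^ 7 * (1 - curveX Z) ^ 2 * (1 + curveY Z) ^ 7 =
      k ^ 6 * mon Z (-5) 0 (-2) (-3) (-2) := by
    rw [h.one_add_curveY, h.one_sub_curveX, curveX, curveY, hk, mon]
    simp only [zpow_neg, zpow_ofNat]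
    field_simp
  linear_combination (1 + 4 * curveX Z + 2 * curveY Z - curveX Z ^ 2 + curveX Z * curveY Z) * this

end ThetaSys

end

section

open Filter Topology Finset

/-! ### A verified normal form for theta monomials on the modular curve -/

/-- An integer multiple of a Laurent monomial in `Z 1, …, Z 5`: coefficient, then exponents. -/
abbrev ThetaTerm := ℤ × ℤ × ℤ × ℤ × ℤ × ℤ

namespace ThetaTerm

/-- The product of two terms. -/
def mul : ThetaTerm → ThetaTerm → ThetaTerm
  | (x, a, b, c, d, e), (x', a', b', c', d', e') =>
    (x * x', a + a', b + b', c + c', d + d', e + e')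

/-- Multiplication of the coefficient by an integer. -/
def smul (n : ℤ) : ThetaTerm → ThetaTerm
  | (x, a, b, c, d, e) => (n * x, a, b, c, d, e)

/-- The value of a term. -/
noncomputable def val (Z : ℤ → ℝ) : ThetaTerm → ℝ
  | (x, a, b, c, d, e) => x * mon Z a b c d e

/-- Multiplication of coefficient by a parity sign. -/
def sgn (n : ℤ) : ℤ := if n % 2 = 0 then 1 else -1

/-- The effect of replacing `Z a` by `Z (r * a)`. -/
def diamond : ℕ → ThetaTerm → ThetaTerm
  | 2, (x, a, b, c, d, e) => (sgn (c + d + e) * x, e, a, d, b, c)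
  | 3, (x, a, b, c, d, e) => (sgn (b + c) * x, d, c, a, e, b)
  | 4, (x, a, b, c, d, e) => (sgn (b + e) * x, c, e, b, a, d)
  | 5, (x, a, b, c, d, e) => (sgn (b + d) * x, b, d, e, c, a)
  | _, t => t

/-- The residue class modulo eleven of the exponents in the expansion of a term. -/
def cls : ThetaTerm → ℤ
  | (_, a, b, c, d, e) => (6 * a + 2 * b + 10 * c + 8 * d + 7 * e) % 11

end ThetaTerm

/-- Build a term from its coefficient and exponents. -/
def thetaTerm (x a b c d e : ℤ) : ThetaTerm := (x, a, b, c, d, e)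

/-- The value of a list of terms. -/
noncomputable def thetaSum (Z : ℤ → ℝ) (T : List ThetaTerm) : ℝ := (T.map (ThetaTerm.val Z)).sum

/-- All products of two lists of terms. -/
def mulTerms (S T : List ThetaTerm) : List ThetaTerm := S.flatMap fun s => T.map s.mul

/-- Addition of coefficient lists. -/
def addCoeffs : List ℤ → List ℤ → List ℤ
  | [], m => m
  | a :: l, [] => a :: l
  | a :: l, b :: m => (a + b) :: addCoeffs l m

/-- Negation of coefficient lists. -/
def negCoeffs : List ℤ → List ℤ
  | [] => []
  | a :: l => -a :: negCoeffs l

/-- The value of a coefficient list. -/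
noncomputable def coeffsVal (x : ℝ) : List ℤ → ℝ
  | [] => 0
  | a :: l => a + x * coeffsVal x l

lemma coeffsVal_add (x : ℝ) : ∀ l m, coeffsVal x (addCoeffs l m) = coeffsVal x l + coeffsVal x m
  | [], m => by simp [addCoeffs, coeffsVal]
  | a :: l, [] => by simp [addCoeffs, coeffsVal]
  | a :: l, b :: m => by
    simp only [addCoeffs, coeffsVal, coeffsVal_add x l m]; push_cast; ring

lemma coeffsVal_neg (x : ℝ) : ∀ l, coeffsVal x (negCoeffs l) = -coeffsVal x l
  | [] => by simp [negCoeffs, coeffsVal]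
  | a :: l => by simp only [negCoeffs, coeffsVal, coeffsVal_neg x l]; push_cast; ring

/-- Elements `f + g y` of the coordinate ring of the curve. -/
abbrev CurvePoly := List ℤ × List ℤ

namespace CurvePoly

/-- The value of a function at a point. -/
noncomputable def val (x y : ℝ) (p : CurvePoly) : ℝ := coeffsVal x p.1 + coeffsVal x p.2 * y

/-- The sum of two functions. -/
def add (p r : CurvePoly) : CurvePoly := (addCoeffs p.1 r.1, addCoeffs p.2 r.2)

/-- Multiplication by `-x`. -/
def mulNegX (p : CurvePoly) : CurvePoly := (0 :: negCoeffs p.1, 0 :: negCoeffs p.2)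

/-- Multiplication by `y`. -/
def mulY (p : CurvePoly) : CurvePoly :=
  (0 :: negCoeffs p.2, addCoeffs p.1 (negCoeffs (addCoeffs p.2 (0 :: 0 :: p.2))))

/-- Multiplication by `1 - x`. -/
def mulOneSubX (p : CurvePoly) : CurvePoly := p.add p.mulNegX

/-- Multiplication by `1 + y`. -/
def mulOneAddY (p : CurvePoly) : CurvePoly := p.add p.mulY

/-- A constant times a product of powers of the four basic units. -/
def unit (n : ℤ) (i j k m : ℕ) : CurvePoly :=
  mulNegX^[i] (mulY^[j] (mulOneSubX^[k] (mulOneAddY^[m] ([n], []))))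

variable {x y : ℝ}

lemma val_add (p r : CurvePoly) : (p.add r).val x y = p.val x y + r.val x y := by
  simp only [val, add, coeffsVal_add]; ring

lemma val_mulNegX (p : CurvePoly) : p.mulNegX.val x y = -x * p.val x y := by
  simp only [val, mulNegX, coeffsVal, coeffsVal_neg]; push_cast; ring

lemma val_mulY (h : y ^ 2 + (x ^ 2 + 1) * y + x = 0) (p : CurvePoly) :
    p.mulY.val x y = y * p.val x y := by
  simp only [val, mulY, coeffsVal, coeffsVal_neg, coeffsVal_add]; push_cast
  linear_combination -coeffsVal x p.2 * h

lemma val_mulOneSubX (p : CurvePoly) : p.mulOneSubX.val x y = (1 - x) * p.val x y := by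
  rw [mulOneSubX, val_add, val_mulNegX]; ring

lemma val_mulOneAddY (h : y ^ 2 + (x ^ 2 + 1) * y + x = 0) (p : CurvePoly) :
    p.mulOneAddY.val x y = (1 + y) * p.val x y := by
  rw [mulOneAddY, val_add, val_mulY h]; ring

lemma val_iterate {f : CurvePoly → CurvePoly} {c : ℝ} (h : ∀ p, (f p).val x y = c * p.val x y)
    (n : ℕ) (p : CurvePoly) : (f^[n] p).val x y = c ^ n * p.val x y := by
  induction n generalizing p with
  | zero => simp
  | succ n ih => rw [Function.iterate_succ_apply, ih, h]; ring

lemma val_unit (h : y ^ 2 + (x ^ 2 + 1) * y + x = 0) (n : ℤ) (i j k m : ℕ) :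
    (unit n i j k m).val x y = n * ((-x) ^ i * y ^ j * (1 - x) ^ k * (1 + y) ^ m) := by
  rw [unit, val_iterate val_mulNegX, val_iterate (val_mulY h), val_iterate val_mulOneSubX,
    val_iterate (val_mulOneAddY h)]
  simp only [val, coeffsVal]
  ring

end CurvePoly

/-- The value of a coefficient list at a large integer. -/
def coeffsCode : List ℤ → ℤ
  | [] => 0
  | a :: l => a + 2 ^ 100 * coeffsCode l

/-- The sum of the absolute values of the coefficients. -/
def coeffsNorm : List ℤ → ℕ
  | [] => 0
  | a :: l => a.natAbs + coeffsNorm l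

lemma coeffsCode_neg : ∀ l, coeffsCode (negCoeffs l) = -coeffsCode l
  | [] => by simp [negCoeffs, coeffsCode]
  | a :: l => by simp only [negCoeffs, coeffsCode, coeffsCode_neg l]; ring

lemma coeffsCode_add : ∀ l m, coeffsCode (addCoeffs l m) = coeffsCode l + coeffsCode m
  | [], m => by simp [addCoeffs, coeffsCode]
  | a :: l, [] => by simp [addCoeffs, coeffsCode]
  | a :: l, b :: m => by simp only [addCoeffs, coeffsCode, coeffsCode_add l m]; ring

lemma coeffsNorm_neg : ∀ l, coeffsNorm (negCoeffs l) = coeffsNorm l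
  | [] => by simp [negCoeffs, coeffsNorm]
  | a :: l => by simp only [negCoeffs, coeffsNorm, coeffsNorm_neg l, Int.natAbs_neg]

lemma coeffsNorm_add : ∀ l m, coeffsNorm (addCoeffs l m) ≤ coeffsNorm l + coeffsNorm m
  | [], m => by simp [addCoeffs, coeffsNorm]
  | a :: l, [] => by simp [addCoeffs, coeffsNorm]
  | a :: l, b :: m => by
    have h1 := coeffsNorm_add l m
    have h2 := Int.natAbs_add_le a b
    simp only [addCoeffs, coeffsNorm]
    lia

lemma coeffsVal_eq_zero (x : ℝ) {l : List ℤ} (h : coeffsCode l = 0)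
    (hn : coeffsNorm l < 2 ^ 100) : coeffsVal x l = 0 := by
  induction l with
  | nil => rfl
  | cons a l ih =>
    simp only [coeffsCode, coeffsNorm] at h hn
    have ha : a = 0 := by lia
    have hl : coeffsCode l = 0 := by lia
    rw [coeffsVal, ih hl (by lia), ha]
    simp

/-- A compressed encoding of functions on the curve: two large integers and a norm bound. -/
abbrev CurveCode := ℤ × ℤ × ℕ

namespace CurveCode

/-- The relation of a code to the function it encodes. -/
def Encodes (c : CurveCode) (p : CurvePoly) : Prop :=
  coeffsCode p.1 = c.1 ∧ coeffsCode p.2 = c.2.1 ∧ coeffsNorm p.1 + coeffsNorm p.2 ≤ c.2.2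

/-- Encoded addition. -/
def add : CurveCode → CurveCode → CurveCode
  | (a, b, n), (a', b', n') => (a + a', b + b', n + n')

/-- Encoded multiplication by `-x`. -/
def mulNegX : CurveCode → CurveCode
  | (a, b, n) => (-2 ^ 100 * a, -2 ^ 100 * b, n)

/-- Encoded multiplication by `y`. -/
def mulY : CurveCode → CurveCode
  | (a, b, n) => (-2 ^ 100 * b, a - (1 + 2 ^ 200) * b, 3 * n)

/-- Encoded multiplication by `1 - x`. -/
def mulOneSubX : CurveCode → CurveCode
  | (a, b, n) => ((1 - 2 ^ 100) * a, (1 - 2 ^ 100) * b, 2 * n)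

/-- Encoded multiplication by `1 + y`. -/
def mulOneAddY : CurveCode → CurveCode
  | (a, b, n) => (a - 2 ^ 100 * b, a - 2 ^ 200 * b, 4 * n)

/-- Encoded version of `CurvePoly.unit`. -/
def unit (n : ℤ) (i j k m : ℕ) : CurveCode :=
  mulNegX^[i] (mulY^[j] (mulOneSubX^[k] (mulOneAddY^[m] (n, 0, n.natAbs))))

/-- Whether the code encodes zero. -/
def isZero : CurveCode → Bool
  | (a, b, n) => a == 0 && b == 0 && Nat.blt n (2 ^ 100)

lemma Encodes.add {c d : CurveCode} {p r : CurvePoly} (hc : c.Encodes p) (hd : d.Encodes r) :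
    (c.add d).Encodes (p.add r) := by
  obtain ⟨h1, h2, h3⟩ := hc
  obtain ⟨g1, g2, g3⟩ := hd
  have e1 := coeffsNorm_add p.1 r.1
  have e2 := coeffsNorm_add p.2 r.2
  refine ⟨?_, ?_, ?_⟩
  · simp only [CurvePoly.add, CurveCode.add, coeffsCode_add, h1, g1]
  · simp only [CurvePoly.add, CurveCode.add, coeffsCode_add, h2, g2]
  · simp only [CurvePoly.add, CurveCode.add]; lia

lemma Encodes.mulNegX {c : CurveCode} {p : CurvePoly} (hc : c.Encodes p) :
    c.mulNegX.Encodes p.mulNegX := by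
  obtain ⟨h1, h2, h3⟩ := hc
  refine ⟨?_, ?_, ?_⟩
  · simp only [CurvePoly.mulNegX, CurveCode.mulNegX, coeffsCode, coeffsCode_neg, h1]; ring
  · simp only [CurvePoly.mulNegX, CurveCode.mulNegX, coeffsCode, coeffsCode_neg, h2]; ring
  · simp only [CurvePoly.mulNegX, CurveCode.mulNegX, coeffsNorm, coeffsNorm_neg]; simpa using h3

lemma Encodes.mulY {c : CurveCode} {p : CurvePoly} (hc : c.Encodes p) :
    c.mulY.Encodes p.mulY := by
  obtain ⟨h1, h2, h3⟩ := hc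
  have e1 := coeffsNorm_add p.1 (negCoeffs (addCoeffs p.2 (0 :: 0 :: p.2)))
  have e2 := coeffsNorm_add p.2 (0 :: 0 :: p.2)
  rw [coeffsNorm_neg] at e1
  simp only [coeffsNorm, Int.natAbs_zero, zero_add] at e2
  refine ⟨?_, ?_, ?_⟩
  · simp only [CurvePoly.mulY, CurveCode.mulY, coeffsCode, coeffsCode_neg, h2]; ring
  · simp only [CurvePoly.mulY, CurveCode.mulY, coeffsCode, coeffsCode_neg, coeffsCode_add, h1, h2]
    ring
  · simp only [CurvePoly.mulY, CurveCode.mulY, coeffsNorm, coeffsNorm_neg, Int.natAbs_zero]; lia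

lemma Encodes.mulOneSubX {c : CurveCode} {p : CurvePoly} (hc : c.Encodes p) :
    c.mulOneSubX.Encodes p.mulOneSubX := by
  obtain ⟨h1, h2, h3⟩ := hc.add hc.mulNegX
  refine ⟨h1.trans ?_, h2.trans ?_, h3.trans ?_⟩ <;>
    simp only [CurveCode.add, CurveCode.mulNegX, CurveCode.mulOneSubX]
  · ring
  · ring
  · lia

lemma Encodes.mulOneAddY {c : CurveCode} {p : CurvePoly} (hc : c.Encodes p) :
    c.mulOneAddY.Encodes p.mulOneAddY := by
  obtain ⟨h1, h2, h3⟩ := hc.add hc.mulY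
  refine ⟨h1.trans ?_, h2.trans ?_, h3.trans ?_⟩ <;>
    simp only [CurveCode.add, CurveCode.mulY, CurveCode.mulOneAddY]
  · ring
  · ring
  · lia

lemma Encodes.iterate {f : CurveCode → CurveCode} {g : CurvePoly → CurvePoly}
    (h : ∀ {c : CurveCode} {p : CurvePoly}, c.Encodes p → (f c).Encodes (g p)) (n : ℕ)
    {c : CurveCode} {p : CurvePoly} (hc : c.Encodes p) : (f^[n] c).Encodes (g^[n] p) := by
  induction n generalizing c p with
  | zero => exact hc
  | succ n ih => exact ih (h hc)

lemma encodes_unit (n : ℤ) (i j k m : ℕ) : (unit n i j k m).Encodes (CurvePoly.unit n i j k m) :=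
  .iterate .mulNegX i <| .iterate .mulY j <| .iterate .mulOneSubX k <| .iterate .mulOneAddY m
    ⟨by simp [coeffsCode], by simp [coeffsCode], by simp [coeffsNorm]⟩

lemma Encodes.val_eq_zero {c : CurveCode} {p : CurvePoly} (hc : c.Encodes p)
    (h : c.isZero = true) (x y : ℝ) : p.val x y = 0 := by
  obtain ⟨h1, h2, h3⟩ := hc
  obtain ⟨a, b, n⟩ := c
  simp only [isZero, Bool.and_eq_true, beq_iff_eq, Nat.blt_eq] at h
  simp only at h1 h2 h3
  rw [CurvePoly.val, coeffsVal_eq_zero x (h1.trans h.1.1) (by lia),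
    coeffsVal_eq_zero x (h2.trans h.1.2) (by lia)]
  simp

end CurveCode

/-- The quotient of a term by a monomial, as a function on the curve, when it is in the lattice. -/
def curveQuotient : ThetaTerm → ThetaTerm → Option CurveCode
  | (_, a', b', c', d', e'), (n, a, b, c, d, e) =>
    let s := a - a' + 2 * (c - c') + 7 * (d - d') + 4 * (e - e')
    if s % 11 = 0 then
    let k := s / 11
    let j := 2 * k - (d - d')
    let m := j - k - (e - e')
    let i := j + m - (c - c')
    if a = a' + 2 * i + j + k + 2 * m ∧ b = b' - i - 2 * j - 2 * k - 2 * m ∧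
        (0 ≤ i ∧ 0 ≤ j ∧ 0 ≤ k ∧ 0 ≤ m) then
      some (CurveCode.unit n i.toNat j.toNat k.toNat m.toNat)
    else none
    else none

/-- Collect the terms of a list lying in the class of a monomial. -/
def curveCollect (s : ThetaTerm) : List ThetaTerm → CurveCode × List ThetaTerm
  | [] => ((0, 0, 0), [])
  | t :: T => match curveQuotient s t with
    | some p => (p.add (curveCollect s T).1, (curveCollect s T).2)
    | none => ((curveCollect s T).1, t :: (curveCollect s T).2)

/-- A verification that a list of terms sums to zero, given a base monomial for each class. -/
def curveCheck : List ThetaTerm → List ThetaTerm → Bool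
  | [], T => T.isEmpty
  | s :: S, T => (curveCollect s T).1.isZero && curveCheck S (curveCollect s T).2

lemma thetaSum_cons (Z : ℤ → ℝ) (t : ThetaTerm) (T : List ThetaTerm) :
    thetaSum Z (t :: T) = t.val Z + thetaSum Z T := by simp [thetaSum]

lemma thetaSum_append (Z : ℤ → ℝ) (S T : List ThetaTerm) :
    thetaSum Z (S ++ T) = thetaSum Z S + thetaSum Z T := by simp [thetaSum]

lemma thetaSum_smul (Z : ℤ → ℝ) (n : ℤ) (T : List ThetaTerm) :
    thetaSum Z (T.map (ThetaTerm.smul n)) = n * thetaSum Z T := by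
  induction T with
  | nil => simp [thetaSum]
  | cons t T ih =>
    obtain ⟨x, a, b, c, d, e⟩ := t
    rw [List.map_cons, thetaSum_cons, thetaSum_cons, ih]
    simp only [ThetaTerm.smul, ThetaTerm.val]
    push_cast; ring

namespace ThetaSys

variable {Z p l : ℤ → ℝ} {q : ℝ}

lemma val_mul (h : ThetaSys Z p l q) (s t : ThetaTerm) :
    (s.mul t).val Z = s.val Z * t.val Z := by
  obtain ⟨x, a, b, c, d, e⟩ := s
  obtain ⟨x', a', b', c', d', e'⟩ := t
  simp only [ThetaTerm.mul, ThetaTerm.val, mon, zpow_add₀ h.ne_one, zpow_add₀ h.ne_two,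
    zpow_add₀ h.ne_three, zpow_add₀ h.ne_four, zpow_add₀ h.ne_five]
  push_cast; ring

lemma thetaSum_mul (h : ThetaSys Z p l q) (S T : List ThetaTerm) :
    thetaSum Z (mulTerms S T) = thetaSum Z S * thetaSum Z T := by
  have h1 (s : ThetaTerm) : thetaSum Z (T.map s.mul) = s.val Z * thetaSum Z T := by
    induction T with
    | nil => simp [thetaSum]
    | cons t T ih =>
      rw [List.map_cons, thetaSum_cons, thetaSum_cons, ih, h.val_mul]; ring
  induction S with
  | nil => simp [mulTerms, thetaSum]
  | cons s S ih =>
    rw [mulTerms, List.flatMap_cons, thetaSum_append, h1, thetaSum_cons, add_mul, ← ih]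
    rfl

lemma curveQuotient_spec (h : ThetaSys Z p l q) {s t : ThetaTerm} {r : CurveCode}
    (hr : curveQuotient s t = some r) : ∃ f : CurvePoly, r.Encodes f ∧
    t.val Z = mon Z s.2.1 s.2.2.1 s.2.2.2.1 s.2.2.2.2.1 s.2.2.2.2.2 *
      f.val (curveX Z) (curveY Z) := by
  obtain ⟨x', a', b', c', d', e'⟩ := s
  obtain ⟨n, a, b, c, d, e⟩ := t
  simp only [curveQuotient] at hr
  split_ifs at hr with _ hh
  rw [Option.some.injEq] at hr
  refine ⟨_, hr ▸ CurveCode.encodes_unit _ _ _ _ _, ?_⟩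
  rw [CurvePoly.val_unit h.curve]
  simp only [ThetaTerm.val]
  generalize (a - a' + 2 * (c - c') + 7 * (d - d') + 4 * (e - e')) / 11 = k at *
  obtain ⟨h1, h2, hi, hj, hk, hm⟩ := hh
  generalize hj' : 2 * k - (d - d') = j at *
  generalize hm' : j - k - (e - e') = m at *
  generalize hi' : j + m - (c - c') = i at *
  lift i to ℕ using hi
  lift j to ℕ using hj
  lift k to ℕ using hk
  lift m to ℕ using hm
  simp only [Int.toNat_natCast]
  rw [h.mon_eq a' b' c' d' e' i j k m h1 h2 (by linarith) (by linarith) (by linarith)]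
  ring

lemma curveCollect_spec (h : ThetaSys Z p l q) (s : ThetaTerm) (T : List ThetaTerm) :
    ∃ f : CurvePoly, (curveCollect s T).1.Encodes f ∧
    thetaSum Z T = mon Z s.2.1 s.2.2.1 s.2.2.2.1 s.2.2.2.2.1 s.2.2.2.2.2 *
      f.val (curveX Z) (curveY Z) + thetaSum Z (curveCollect s T).2 := by
  induction T with
  | nil =>
    refine ⟨([], []), by simp [curveCollect, CurveCode.Encodes, coeffsCode, coeffsNorm], ?_⟩
    simp [curveCollect, thetaSum, CurvePoly.val, coeffsVal]
  | cons t T ih =>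
    obtain ⟨f, hf, e⟩ := ih
    rw [thetaSum_cons, curveCollect]
    cases hr : curveQuotient s t with
    | none => exact ⟨f, hf, by simp only [thetaSum_cons]; rw [e]; ring⟩
    | some r =>
      obtain ⟨g, hg, e'⟩ := h.curveQuotient_spec hr
      exact ⟨g.add f, hg.add hf, by simp only [CurvePoly.val_add]; rw [e, e']; ring⟩

lemma thetaSum_eq_zero (h : ThetaSys Z p l q) (S : List ThetaTerm) {T : List ThetaTerm}
    (hT : curveCheck S T = true) : thetaSum Z T = 0 := by
  induction S generalizing T with
  | nil =>
    simp only [curveCheck, List.isEmpty_iff] at hT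
    simp [hT, thetaSum]
  | cons s S ih =>
    simp only [curveCheck, Bool.and_eq_true] at hT
    obtain ⟨f, hf, e⟩ := h.curveCollect_spec s T
    rw [e, hf.val_eq_zero hT.1, ih hT.2]; simp

lemma neg_one_zpow (n : ℤ) : ((-1 : ℝ)) ^ n = (ThetaTerm.sgn n : ℤ) := by
  unfold ThetaTerm.sgn
  split_ifs with h
  · rw [(Int.even_iff.2 h).neg_one_zpow]; simp
  · rw [(Int.not_even_iff_odd.1 (mt Int.even_iff.1 h)).neg_one_zpow]; simp

lemma val_diamond (h : ThetaSys Z p l q) (r : ℕ) (hr : 1 ≤ r) (hr' : r ≤ 5) (t : ThetaTerm) :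
    t.val (fun a => Z (r * a)) = (t.diamond r).val Z := by
  have e12 : Z 12 = Z 1 := by rw [← h.add_eleven 1]; norm_num
  have e15 : Z 15 = Z 4 := by rw [← h.add_eleven 4]; norm_num
  have e16 : Z 16 = Z 5 := by rw [← h.add_eleven 5]; norm_num
  have e20 : Z 20 = -Z 2 := by rw [← h.val_nine, ← h.add_eleven 9]; norm_num
  have e25 : Z 25 = Z 3 := by rw [← h.add_eleven 3, ← h.add_eleven (3 + 11)]; norm_num
  obtain ⟨x, a, b, c, d, e⟩ := t
  have n1 : (-1 : ℝ) ≠ 0 := by norm_num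
  interval_cases r <;>
  · norm_num [ThetaTerm.val, mon, ThetaTerm.diamond, h.val_six, h.val_eight, h.val_nine,
      h.val_ten, e12, e15, e16, e20, e25]
    try simp only [neg_eq_neg_one_mul (Z _), mul_zpow, ← neg_one_zpow, zpow_add₀ n1]
    try ring

lemma thetaSum_diamond (h : ThetaSys Z p l q) (r : ℕ) (hr : 1 ≤ r) (hr' : r ≤ 5)
    (T : List ThetaTerm) :
    thetaSum (fun a => Z (r * a)) T = thetaSum Z (T.map (ThetaTerm.diamond r)) := by
  rw [thetaSum, thetaSum, List.map_map]
  congr 1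
  exact List.map_congr_left fun t _ => h.val_diamond r hr hr' t

end ThetaSys

end

section

open Filter Topology Finset

/-- The terms in the dissection of the Euler product. -/
def eulerTerms : List ThetaTerm :=
    [thetaTerm 1 0 0 0 0 0, thetaTerm 1 (-1) 1 0 0 0, thetaTerm 1 0 (-1) 0 1 0,
     thetaTerm (-1) 0 0 (-1) 0 1, thetaTerm (-1) 0 0 1 (-1) 0, thetaTerm (-1) 1 0 0 0 (-1)]

/-- The expansion of the nome in theta monomials. -/
def nomeTerms : List ThetaTerm :=
    [thetaTerm 1 (-5) 0 (-2) (-3) (-2), thetaTerm (-4) (-3) (-1) (-3) (-3) (-2),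
     thetaTerm 2 (-4) (-2) (-1) (-4) (-1), thetaTerm (-1) (-1) (-2) (-4) (-3) (-2),
     thetaTerm (-1) (-2) (-3) (-2) (-4) (-1)]

/-- Theta monomials in the dissection of the rank generating function (scaled). -/
def rankTerms : List ThetaTerm :=
    [thetaTerm (-132) (-3) (-4) (-3) 0 (-3), thetaTerm 132 (-1) (-4) (-5) (-3) 0,
     thetaTerm 12 (-5) 0 (-3) (-3) (-2), thetaTerm 48 (-4) (-3) 0 (-4) (-2),
     thetaTerm (-96) (-4) (-2) (-2) (-4) (-1), thetaTerm 12 (-3) (-2) (-6) (-2) 0,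
     thetaTerm (-72) (-2) (-4) (-2) (-1) (-4), thetaTerm (-40) (-5) (-1) 0 (-5) (-2),
     thetaTerm (-16) (-4) (-2) (-3) 0 (-4), thetaTerm 64 (-4) (-2) (-2) (-3) (-2),
     thetaTerm (-12) (-3) (-3) (-4) (-1) (-2), thetaTerm (-56) (-1) (-5) (-3) (-1) (-3),
     thetaTerm 8 (-1) (-2) 0 (-6) (-4), thetaTerm (-51) (-5) 0 (-2) (-4) (-2),
     thetaTerm 90 (-4) (-1) (-4) (-2) (-2), thetaTerm 15 (-3) (-4) (-1) (-3) (-2),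
     thetaTerm (-75) (-2) (-2) 0 (-6) (-3), thetaTerm 18 0 (-3) (-2) (-3) (-5),
     thetaTerm (-48) (-6) (-1) 0 (-4) (-2), thetaTerm (-108) (-4) (-3) (-3) (-3) 0,
     thetaTerm (-36) (-3) (-5) (-3) (-1) (-1), thetaTerm 36 (-3) (-4) (-5) (-1) 0,
     thetaTerm (-36) (-5) 0 (-2) (-3) (-3), thetaTerm 24 0 (-3) (-2) (-2) (-6),
     thetaTerm (-36) (-5) (-1) (-4) (-1) (-2), thetaTerm 60 (-3) (-3) (-2) (-4) (-1),
     thetaTerm (-60) (-2) (-4) (-4) (-2) (-1), thetaTerm (-36) (-3) (-2) 0 (-5) (-3),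
     thetaTerm 12 (-2) (-3) (-2) (-3) (-3), thetaTerm (-36) (-4) (-4) 0 (-4) (-1),
     thetaTerm 6 (-4) (-2) 0 (-5) (-2), thetaTerm (-30) (-4) 0 (-5) (-2) (-2),
     thetaTerm (-84) (-3) (-3) (-2) (-3) (-2), thetaTerm (-60) (-2) (-3) (-1) (-5) (-2),
     thetaTerm (-6) 0 (-2) (-3) (-3) (-5), thetaTerm 36 (-4) (-3) (-3) 0 (-3),
     thetaTerm 12 (-4) (-2) (-4) (-3) 0, thetaTerm 24 (-3) (-4) (-4) (-1) (-1),
     thetaTerm 72 (-2) (-5) (-2) 0 (-4), thetaTerm (-60) (-2) (-1) (-1) (-5) (-4),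
     thetaTerm (-42) (-4) (-3) (-1) (-5) 0, thetaTerm 18 (-4) (-1) (-6) (-2) 0,
     thetaTerm 48 (-3) (-4) (-3) (-3) 0, thetaTerm (-12) (-3) (-3) (-1) (-4) (-2),
     thetaTerm 6 0 (-3) (-4) (-3) (-3), thetaTerm (-24) 0 (-2) (-2) (-4) (-5),
     thetaTerm (-96) (-5) (-1) (-2) (-3) (-2), thetaTerm (-48) (-3) (-3) (-5) (-2) 0,
     thetaTerm 24 (-3) (-2) (-3) (-3) (-2), thetaTerm (-36) (-2) (-4) (-2) (-4) (-1),
     thetaTerm 12 (-2) (-3) 0 (-5) (-3), thetaTerm (-60) (-4) (-3) (-1) (-3) (-2),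
     thetaTerm (-12) (-4) (-2) (-4) 0 (-3), thetaTerm (-48) (-3) (-5) (-1) (-1) (-3),
     thetaTerm 12 (-4) (-1) (-1) (-4) (-3), thetaTerm (-36) (-3) (-3) 0 (-5) (-2),
     thetaTerm 84 (-2) (-3) (-4) (-3) (-1)]

/-- Theta monomials in the dissection of the Lambert series of the rank (scaled). -/
def rankLambertTerms : List ThetaTerm :=
    [thetaTerm 12 (-3) 3 (-1) 0 0, thetaTerm (-36) (-2) 0 2 (-1) 0,
     thetaTerm (-36) (-2) 1 (-1) 2 (-1), thetaTerm 36 (-2) 1 0 (-1) 1,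
     thetaTerm 48 1 (-2) (-1) 1 0, thetaTerm (-132) (-2) 1 (-1) 1 0,
     thetaTerm 132 (-1) (-1) 1 (-1) 1, thetaTerm 132 (-1) 0 0 1 (-1),
     thetaTerm (-132) 0 0 0 (-1) 0]

/-- Theta monomials in the dissection of the crank generating function (scaled). -/
def crankTerms : List ThetaTerm :=
    [thetaTerm (-48) (-5) 0 (-3) (-3) (-2), thetaTerm 96 (-3) (-3) (-4) (-2) (-1),
     thetaTerm 48 (-2) (-3) (-4) (-1) (-3), thetaTerm 48 (-1) (-3) (-3) (-3) (-3),
     thetaTerm (-72) (-3) (-4) (-2) (-1) (-3), thetaTerm (-72) (-4) (-1) (-4) (-3) (-1),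
     thetaTerm 72 (-4) 0 (-2) (-4) (-3), thetaTerm (-72) (-2) (-4) (-2) 0 (-5),
     thetaTerm 72 (-1) (-2) 0 (-6) (-4), thetaTerm (-36) (-5) 0 (-2) (-4) (-2),
     thetaTerm 72 (-3) (-3) (-3) (-3) (-1), thetaTerm 36 (-2) (-3) (-3) (-2) (-3),
     thetaTerm 36 (-1) (-3) (-2) (-4) (-3), thetaTerm (-24) (-3) (-3) (-3) (-2) (-2),
     thetaTerm (-48) (-3) (-1) (-3) (-3) (-3), thetaTerm (-24) (-2) (-3) (-3) (-1) (-4),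
     thetaTerm 24 (-2) (-2) 0 (-5) (-4), thetaTerm (-12) (-6) 0 (-2) (-3) (-2),
     thetaTerm 24 (-4) (-3) (-3) (-2) (-1), thetaTerm 12 (-3) (-3) (-3) (-1) (-3),
     thetaTerm 12 (-2) (-3) (-2) (-3) (-3), thetaTerm 12 (-5) (-1) (-3) (-3) (-1),
     thetaTerm (-24) (-3) (-4) (-4) (-2) 0, thetaTerm (-12) (-3) (-3) (-3) 0 (-4),
     thetaTerm 12 (-1) (-3) (-1) (-4) (-4), thetaTerm 16 (-6) 0 (-1) (-4) (-2),
     thetaTerm (-32) (-4) (-4) (-1) 0 (-4), thetaTerm 8 (-4) (-2) (-4) (-3) 0,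
     thetaTerm 40 (-4) (-2) 0 (-4) (-3), thetaTerm (-24) (-2) (-3) (-1) (-4) (-3),
     thetaTerm 36 (-5) (-2) 0 (-4) (-2), thetaTerm (-72) (-4) (-2) (-4) (-2) (-1),
     thetaTerm (-36) (-4) 0 (-4) (-3) (-2), thetaTerm (-36) (-3) (-2) (-4) (-1) (-3),
     thetaTerm (-60) (-3) (-4) (-3) (-2) (-1), thetaTerm (-120) (-3) (-2) (-3) (-3) (-2),
     thetaTerm (-60) (-2) (-4) (-3) (-1) (-3), thetaTerm 60 (-2) (-3) 0 (-5) (-3),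
     thetaTerm (-48) (-3) (-4) (-3) (-1) (-2), thetaTerm (-96) (-3) (-2) (-3) (-2) (-3),
     thetaTerm (-48) (-2) (-4) (-3) 0 (-4), thetaTerm 48 (-2) (-3) 0 (-4) (-4)]

/-- Theta monomials in the dissection of the Lambert series of the crank (scaled). -/
def crankLambertTerms : List ThetaTerm :=
    [thetaTerm 48 (-3) 3 (-1) 0 0, thetaTerm (-12) (-2) 0 2 (-1) 0,
     thetaTerm (-12) (-2) 1 (-1) 2 (-1), thetaTerm 12 (-2) 1 0 (-1) 1,
     thetaTerm 60 1 (-2) (-1) 1 0, thetaTerm 132 (-1) 0 0 0 0,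
     thetaTerm (-132) 0 (-1) (-1) 1 0, thetaTerm 132 1 (-1) (-1) (-1) 1,
     thetaTerm 132 1 0 0 (-1) (-1), thetaTerm (-132) 2 0 0 (-1) (-2)]

variable {Z p l : ℤ → ℝ} {q : ℝ}

/-- The elliptic part of the dissection of the Lambert series for the rank. -/
noncomputable def rankLambert (Z l : ℤ → ℝ) : ℝ :=
  l 1 + l 2 + (Z 2 * Z 4 / (Z 3 * Z 1 * Z (-1)) + Z 3 * Z 6 / (Z 4 * Z 1 * Z (-2)) +
    Z 4 * Z 8 / (Z 5 * Z 1 * Z (-3)) + Z 5 * Z 10 / (Z 6 * Z 1 * Z (-4)))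

/-- The elliptic part of the dissection of the Lambert series for the crank. -/
noncomputable def crankLambert (Z l : ℤ → ℝ) : ℝ :=
  l 2 - l 1 + (1 / Z 1 + (Z 4 * Z 1 / (Z 2 * Z 3 * Z (-1)) + Z 6 * Z 1 / (Z 3 * Z 4 * Z (-2)) +
    Z 8 * Z 1 / (Z 4 * Z 5 * Z (-3)) + Z 10 * Z 1 / (Z 5 * Z 6 * Z (-4))))

namespace ThetaSys

lemma nome_eq (h : ThetaSys Z p l q) : thetaSum Z nomeTerms = q := by
  have n1 := h.ne_one
  have n2 := h.ne_two
  have n3 := h.ne_three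
  have n4 := h.ne_four
  have n5 := h.ne_five
  conv_rhs => rw [h.q_eq]
  simp only [thetaSum, nomeTerms, thetaTerm, List.map, List.sum_cons, List.sum_nil, ThetaTerm.val, mon, curveX,
    curveY, zpow_neg, zpow_ofNat, Int.cast_ofNat, Int.cast_neg, Int.cast_one]
  field_simp
  ring

lemma lambert_rows (h : ThetaSys Z p l q) :
    -3 * l 1 + l 3 = Z 2 ^ 3 / (Z 1 ^ 3 * Z 3) ∧
    -2 * l 1 - l 2 + l 4 = Z 3 ^ 2 / (Z 1 ^ 2 * Z 4) ∧
    -2 * l 1 - l 3 + l 5 = Z 2 * Z 4 ^ 2 / (Z 1 ^ 2 * Z 3 * Z 5) ∧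
    -2 * l 1 - l 4 - l 5 = -(Z 2 * Z 5 / (Z 1 ^ 2 * Z 4)) ∧
    l 1 - 2 * l 2 + l 3 = -(Z 1 * Z 4 / (Z 2 ^ 2 * Z 3)) := by
  have n1 := h.ne_one
  have n2 := h.ne_two
  have n3 := h.ne_three
  have n4 := h.ne_four
  have n5 := h.ne_five
  have m6 : l 6 = -l 5 := by
    rw [← h.lneg 5 (by norm_num), ← h.ladd_eleven (-5) (by norm_num)]; norm_num
  have r1 := h.lrel 1 2 (by norm_num) (by norm_num) (by norm_num) (by norm_num)
  have r2 := h.lrel 1 3 (by norm_num) (by norm_num) (by norm_num) (by norm_num)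
  have r3 := h.lrel 1 4 (by norm_num) (by norm_num) (by norm_num) (by norm_num)
  have r4 := h.lrel 1 5 (by norm_num) (by norm_num) (by norm_num) (by norm_num)
  have r5 := h.lrel 2 1 (by norm_num) (by norm_num) (by norm_num) (by norm_num)
  norm_num [h.neg, h.lneg, h.val_six, m6] at r1 r2 r3 r4 r5
  refine ⟨?_, ?_, ?_, ?_, ?_⟩
  · rw [show Z 2 ^ 3 / (Z 1 ^ 3 * Z 3) = -(Z 2 * Z 2 ^ 2 / (Z 1 ^ 2 * Z 3 * -Z 1)) by field_simp]
    linear_combination r1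
  · rw [show Z 3 ^ 2 / (Z 1 ^ 2 * Z 4) = -(Z 2 * Z 3 ^ 2 / (Z 1 ^ 2 * Z 4 * -Z 2)) by field_simp]
    linear_combination r2
  · rw [show Z 2 * Z 4 ^ 2 / (Z 1 ^ 2 * Z 3 * Z 5) =
      -(Z 2 * Z 4 ^ 2 / (Z 1 ^ 2 * Z 5 * -Z 3)) by field_simp]
    linear_combination r3
  · rw [show Z 2 * Z 5 / (Z 1 ^ 2 * Z 4) = Z 2 * Z 5 ^ 2 / (Z 1 ^ 2 * Z 5 * Z 4) by field_simp]
    linear_combination r4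
  · rw [show Z 1 * Z 4 / (Z 2 ^ 2 * Z 3) = Z 4 * Z 1 ^ 2 / (Z 2 ^ 2 * Z 3 * Z 1) by field_simp]
    linear_combination r5

lemma rankLambert_eq (h : ThetaSys Z p l q) :
    thetaSum Z rankLambertTerms = 132 * rankLambert Z l := by
  have n1 := h.ne_one
  have n2 := h.ne_two
  have n3 := h.ne_three
  have n4 := h.ne_four
  have n5 := h.ne_five
  obtain ⟨r1, r2, r3, r4, r5⟩ := h.lambert_rows
  have e : 132 * (l 1 + l 2) =
      12 * (Z 2 ^ 3 / (Z 1 ^ 3 * Z 3)) - 36 * (Z 3 ^ 2 / (Z 1 ^ 2 * Z 4))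
        - 36 * (Z 2 * Z 4 ^ 2 / (Z 1 ^ 2 * Z 3 * Z 5)) + 36 * (Z 2 * Z 5 / (Z 1 ^ 2 * Z 4))
        + 48 * (Z 1 * Z 4 / (Z 2 ^ 2 * Z 3)) := by
    linear_combination 12 * r1 - 36 * r2 - 36 * r3 - 36 * r4 - 48 * r5
  rw [rankLambert, mul_add, e]
  norm_num [thetaSum, rankLambertTerms, thetaTerm, ThetaTerm.val, mon, zpow_neg, h.neg,
    h.val_six, h.val_eight, h.val_ten]
  field_simp
  ring

lemma curveCheck_rank : curveCheck
    [thetaTerm 1 (-16) 12 (-5) (-4) 0, thetaTerm 1 (-16) 13 (-6) (-6) 2,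
     thetaTerm 1 (-14) 11 (-5) (-5) 0, thetaTerm 1 (-16) 13 (-6) (-4) 0,
     thetaTerm 1 (-16) 13 (-5) (-6) 1, thetaTerm 1 (-16) 14 (-7) (-5) 1,
     thetaTerm 1 (-17) 13 (-5) (-5) 1, thetaTerm 1 (-15) 12 (-6) (-4) 0,
     thetaTerm 1 (-14) 10 (-5) (-4) 0, thetaTerm 1 (-16) 12 (-5) (-6) 2,
     thetaTerm 1 (-16) 12 (-5) (-5) 1]
    (mulTerms eulerTerms rankTerms ++
      (mulTerms nomeTerms rankLambertTerms).map (ThetaTerm.smul (-1))) = true := by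
  decide +kernel

lemma rankTerms_identity (h : ThetaSys Z p l q) :
    thetaSum Z eulerTerms * thetaSum Z rankTerms = 132 * q * rankLambert Z l := by
  have := h.thetaSum_eq_zero _ curveCheck_rank
  rw [thetaSum_append, thetaSum_smul, h.thetaSum_mul, h.thetaSum_mul, h.nome_eq,
    h.rankLambert_eq] at this
  push_cast at this
  linear_combination this

lemma crankLambert_eq (h : ThetaSys Z p l q) :
    thetaSum Z crankLambertTerms = 132 * crankLambert Z l := by
  have n1 := h.ne_one
  have n2 := h.ne_two
  have n3 := h.ne_three
  have n4 := h.ne_four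
  have n5 := h.ne_five
  obtain ⟨r1, r2, r3, r4, r5⟩ := h.lambert_rows
  have e : 132 * (l 2 - l 1) =
      48 * (Z 2 ^ 3 / (Z 1 ^ 3 * Z 3)) - 12 * (Z 3 ^ 2 / (Z 1 ^ 2 * Z 4))
        - 12 * (Z 2 * Z 4 ^ 2 / (Z 1 ^ 2 * Z 3 * Z 5)) + 12 * (Z 2 * Z 5 / (Z 1 ^ 2 * Z 4))
        + 60 * (Z 1 * Z 4 / (Z 2 ^ 2 * Z 3)) := by
    linear_combination 48 * r1 - 12 * r2 - 12 * r3 - 12 * r4 - 60 * r5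
  rw [crankLambert, mul_add, e]
  norm_num [thetaSum, crankLambertTerms, thetaTerm, ThetaTerm.val, mon, zpow_neg, h.neg,
    h.val_six, h.val_eight, h.val_ten]
  field_simp
  ring

lemma curveCheck_crank : curveCheck
    [thetaTerm 1 (-13) 8 (-3) (-5) 0, thetaTerm 1 (-14) 11 (-5) (-6) 1,
     thetaTerm 1 (-13) 9 (-4) (-6) 1, thetaTerm 1 (-15) 11 (-5) (-5) 1,
     thetaTerm 1 (-15) 11 (-4) (-7) 2, thetaTerm 1 (-12) 8 (-5) (-4) 0,
     thetaTerm 1 (-12) 8 (-4) (-6) 1, thetaTerm 1 (-11) 6 (-4) (-3) (-1),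
     thetaTerm 1 (-11) 6 (-3) (-5) 0, thetaTerm 1 (-14) 10 (-4) (-6) 1,
     thetaTerm 1 (-13) 8 (-3) (-6) 1]
    (mulTerms eulerTerms crankTerms ++
      (mulTerms nomeTerms crankLambertTerms).map (ThetaTerm.smul (-1))) = true := by
  decide +kernel

lemma crankTerms_identity (h : ThetaSys Z p l q) :
    thetaSum Z eulerTerms * thetaSum Z crankTerms = 132 * q * crankLambert Z l := by
  have := h.thetaSum_eq_zero _ curveCheck_crank
  rw [thetaSum_append, thetaSum_smul, h.thetaSum_mul, h.thetaSum_mul, h.nome_eq,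
    h.crankLambert_eq] at this
  push_cast at this
  linear_combination this

end ThetaSys

end

section

open Filter Topology Finset

variable {q : ℝ}

lemma eventually_inv_one_sub_le (h0 : 0 < q) (h1 : q < 1) {y : ℝ} (hy : 0 < y) :
    ∃ C, ∀ᶠ x in 𝓝 y, ∀ n : ℤ, y * q ^ n ≠ 1 → |(1 - x * q ^ n)⁻¹| ≤ C := by
  obtain ⟨C₀, hC₀⟩ := exists_inv_one_sub_le h0 h1 hy.ne'
  set C := max C₀ 1
  have hC1 : 1 ≤ C := le_max_right _ _
  have hCp : 0 < C := by linarith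
  refine ⟨2 * C, ?_⟩
  have hδ : 0 < y * (1 / (4 * C)) := by positivity
  filter_upwards [Metric.ball_mem_nhds y hδ] with x hx n hn
  rw [Metric.mem_ball, Real.dist_eq] at hx
  set u := q ^ n
  have hu : 0 < u := by positivity
  have hne : 1 - y * u ≠ 0 := sub_ne_zero.2 (Ne.symm hn)
  have hb : 1 / C ≤ |1 - y * u| := by
    have := (hC₀ n).trans (le_max_left C₀ 1)
    rw [abs_inv] at this
    rw [one_div]
    exact inv_le_of_inv_le₀ (abs_pos.2 hne) this
  have hd : |(x - y) * u| ≤ y * u * (1 / (4 * C)) := by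
    rw [abs_mul, abs_of_pos hu]; nlinarith
  have hc : 1 / C = 4 * (1 / (4 * C)) := by field_simp
  have hc1 : 1 / C ≤ 1 := by rw [div_le_one hCp]; exact hC1
  set e := 1 / (4 * C)
  have he : 0 < e := by positivity
  have key : 1 / (2 * C) ≤ |1 - x * u| := by
    have e2 : 1 / (2 * C) = 2 * e := by simp only [e]; field_simp; norm_num
    rw [e2]
    rw [abs_le] at hd
    rcases le_or_gt (y * u) 2 with h | h
    · have h3 : |1 - y * u| ≤ |1 - x * u| + |(x - y) * u| := by
        have : 1 - y * u = (1 - x * u) + (x - y) * u := by ring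
        rw [this]; exact abs_add_le _ _
      have h4 : |(x - y) * u| ≤ y * u * e := abs_le.2 hd
      nlinarith
    · rw [le_abs]; right
      nlinarith
  rw [abs_inv]
  have := inv_anti₀ (by positivity) key
  simpa using this

lemma tendsto_appell (h0 : 0 < q) (h1 : q < 1) {w y : ℝ} (hw : w ≠ 0) (hy : 0 < y) {d : ℕ}
    (hd : 1 ≤ d) :
    Tendsto (fun x => ∑' n : ℤ, if y * q ^ n = 1 then 0 else
      w ^ n * q ^ ((d : ℤ) * tri n) / (1 - x * q ^ n)) (𝓝 y) (𝓝 (appell q d w y)) := by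
  obtain ⟨C, hC⟩ := eventually_inv_one_sub_le h0 h1 hy
  refine tendsto_tsum_of_dominated_convergence ((summable_theta h0 h1 hw hd).norm.mul_right |C|)
    (fun n => ?_) ?_
  · by_cases h : y * q ^ n = 1
    · simp [h]
    · simp only [h, if_false]
      refine Tendsto.div tendsto_const_nhds ?_ (sub_ne_zero.2 (Ne.symm h))
      exact (tendsto_id.mul_const _).const_sub 1
  · filter_upwards [hC] with x hx n
    by_cases h : y * q ^ n = 1
    · simp only [h, if_true, norm_zero]; positivity
    · simp only [h, if_false]
      rw [div_eq_mul_inv, norm_mul]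
      exact mul_le_mul_of_nonneg_left ((hx n h).trans (le_abs_self C)) (norm_nonneg _)

lemma continuousAt_appell (h0 : 0 < q) (h1 : q < 1) {w y : ℝ} (hw : w ≠ 0) (hy : 0 < y)
    (hP : jTheta q y ≠ 0) {d : ℕ} (hd : 1 ≤ d) : ContinuousAt (appell q d w) y := by
  have := tendsto_appell h0 h1 hw hy hd
  simp only [zpow_ne_of_jTheta_ne_zero h0 h1 hP, if_false] at this
  exact this

lemma tendsto_appell_one (h0 : 0 < q) (h1 : q < 1) {w : ℝ} (hw : w ≠ 0) {d : ℕ} (hd : 1 ≤ d) :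
    Tendsto (fun x => appell q d w x - 1 / (1 - x)) (𝓝 1) (𝓝 (appell q d w 1)) := by
  refine (tendsto_appell h0 h1 hw one_pos hd).congr' ?_
  filter_upwards [lt_mem_nhds one_pos] with x hx
  rw [appell, (summable_appell h0 h1 hw hx.ne' hd).tsum_eq_add_tsum_ite 0]
  simp only [zpow_zero, tri_zero, mul_zero, mul_one, one_mul, add_sub_cancel_left]
  refine tsum_congr fun n => ?_
  have : q ^ n = 1 ↔ n = 0 := zpow_eq_one_iff_right₀ h0.le h1.ne
  simp only [this]

lemma tendsto_div_jTheta (h0 : 0 < q) (h1 : q < 1) {g : ℝ → ℝ} {g' : ℝ} (hg : HasDerivAt g g' 1)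
    (hg1 : g 1 = 1) :
    Tendsto (fun x => qPoch q q ^ 2 * g x / jTheta q x - 1 / (1 - x)) (𝓝[≠] 1) (𝓝 (-g')) := by
  have h := differentiable_qPoch h0 h1
  have hJ : qPoch q q ≠ 0 := (qPoch_pos h0 h1 h1).ne'
  set B : ℝ → ℝ := fun x => qPoch q (q * x) * qPoch q (q / x) with hB
  have hdC : HasDerivAt (qPoch q) (deriv (qPoch q) q) q := (h q).hasDerivAt
  have d1 : HasDerivAt (fun x => qPoch q (q * x)) (deriv (qPoch q) q * (q * 1)) 1 :=
    HasDerivAt.comp (h₂ := qPoch q) 1 (by simpa using hdC) ((hasDerivAt_id 1).const_mul q)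
  have d2 : HasDerivAt (fun x : ℝ => qPoch q (q / x)) (deriv (qPoch q) q * (q * -(1 ^ 2)⁻¹)) 1 :=
    HasDerivAt.comp (h₂ := qPoch q) 1 (by simpa using hdC)
      ((hasDerivAt_inv one_ne_zero).const_mul q)
  have dB : HasDerivAt B 0 1 := by
    refine (d1.mul d2).congr_deriv ?_
    simp only [mul_one, div_one]; ring
  have B1 : B 1 = qPoch q q ^ 2 := by simp only [hB, mul_one, div_one]; ring
  have hP : ∀ x, jTheta q x = (1 - x) * B x := by
    intro x; simp only [jTheta, hB]; rw [qPoch_eq_mul h0 h1 x]; ring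
  have dF : HasDerivAt (fun x => qPoch q q ^ 2 * g x / B x) g' 1 := by
    refine ((hg.const_mul (qPoch q q ^ 2)).div dB (by rw [B1]; positivity)).congr_deriv ?_
    rw [B1, hg1]; field_simp; ring
  refine dF.tendsto_slope.neg.congr' ?_
  filter_upwards [self_mem_nhdsWithin, nhdsWithin_le_nhds (dB.continuousAt.eventually_ne
    (show B 1 ≠ 0 by rw [B1]; positivity))] with x hx hBx
  have hx1 : x - 1 ≠ 0 := sub_ne_zero.2 hx
  have hx2 : 1 - x ≠ 0 := sub_ne_zero.2 (Ne.symm hx)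
  rw [slope_def_field, B1, hg1, hP]
  field_simp
  ring

lemma eventually_jTheta_ne_zero (h0 : 0 < q) (h1 : q < 1) {c : ℝ} (hc : c ≠ 0)
    (hP : jTheta q c ≠ 0) : ∀ᶠ x in 𝓝[≠] 1, jTheta q (c * x) ≠ 0 := by
  have h : ContinuousAt (fun x => jTheta q (c * x)) 1 := by
    refine ContinuousAt.comp (g := jTheta q) ?_ (by fun_prop)
    rw [mul_one]
    exact (differentiableAt_jTheta h0 h1 hc).continuousAt
  exact nhdsWithin_le_nhds (h.eventually_ne (by rwa [mul_one]))

lemma eventually_jTheta_near_one (h0 : 0 < q) (h1 : q < 1) :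
    ∀ᶠ x in 𝓝[≠] (1 : ℝ), jTheta q x ≠ 0 := by
  simpa using eventually_jTheta_div_ne_zero h0 h1 one_ne_zero

lemma tendsto_appell_mul (h0 : 0 < q) (h1 : q < 1) {w c : ℝ} (hw : w ≠ 0) (hc : 0 < c)
    (hP : jTheta q c ≠ 0) {d : ℕ} (hd : 1 ≤ d) :
    Tendsto (fun x => appell q d w (c * x)) (𝓝[≠] 1) (𝓝 (appell q d w c)) := by
  have h : ContinuousAt (fun x => appell q d w (c * x)) 1 := by
    refine ContinuousAt.comp (g := appell q d w) ?_ (by fun_prop)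
    rw [mul_one]
    exact continuousAt_appell h0 h1 hw hc hP hd
  have h2 := h.tendsto
  rw [mul_one] at h2
  exact h2.mono_left nhdsWithin_le_nhds

lemma hasDerivAt_inv_jTheta_mul (h0 : 0 < q) (h1 : q < 1) {c : ℝ} (hc : c ≠ 0)
    (hP : jTheta q c ≠ 0) :
    HasDerivAt (fun x => jTheta q c / jTheta q (c * x)) (-thetaLog q c) 1 := by
  have h : HasDerivAt (fun x => jTheta q (c * x)) (thetaLog q c * jTheta q c / c * (c * 1)) 1 :=
    HasDerivAt.comp (h₂ := jTheta q) 1 (by rw [mul_one]; exact hasDerivAt_jTheta h0 h1 hc hP)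
      ((hasDerivAt_id 1).const_mul c)
  refine ((hasDerivAt_const (1 : ℝ) (jTheta q c)).div h (by rwa [mul_one])).congr_deriv ?_
  rw [mul_one]
  field_simp
  ring

lemma rank_pair_self (h0 : 0 < q) (h1 : q < 1) {z : ℝ} (hz : 0 < z)
    (hP : jTheta q z ≠ 0) (hP2 : jTheta q (z ^ 2) ≠ 0) :
    z ^ 3 * appell q 3 (-z ^ 3) (z * z) + appell q 3 (-(z ^ 3)⁻¹) 1 =
      z * (jTheta q (z ^ 2) / jTheta q z) * appell q 3 (-1) z +
        (thetaLog q z + thetaLog q (z ^ 2)) := by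
  have hz0 := hz.ne'
  have w1 : -z ^ 3 ≠ 0 := by simpa using hz0
  have w2 : -(z ^ 3)⁻¹ ≠ 0 := by simpa using hz0
  have w3 : (-1 : ℝ) ≠ 0 := by norm_num
  have d3 : 1 ≤ 3 := by norm_num
  have hzz : jTheta q (z * z) ≠ 0 := by rwa [← sq]
  have g := (hasDerivAt_inv_jTheta_mul h0 h1 hz0 hP).mul
    (hasDerivAt_inv_jTheta_mul h0 h1 (by positivity) hP2)
  have L := ((tendsto_appell_mul h0 h1 w1 (by positivity) hzz d3).const_mul (z ^ 3)).add
    ((tendsto_appell_one h0 h1 w2 d3).mono_left nhdsWithin_le_nhds)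
  have R := ((tendsto_appell_mul h0 h1 w3 hz hP d3).const_mul
    (z * (jTheta q (z ^ 2) / jTheta q z))).add
    (tendsto_div_jTheta h0 h1 g (by simp [hP, hP2]))
  have e := tendsto_nhds_unique (L.congr' ?_) R
  · rw [e]
    simp only [mul_one, div_self hP, div_self hP2]
    ring
  · filter_upwards [eventually_jTheta_near_one h0 h1, eventually_jTheta_ne_zero h0 h1 hz0 hP,
      eventually_jTheta_ne_zero h0 h1 (by positivity) hP2, nhdsWithin_le_nhds (lt_mem_nhds one_pos)]
      with x h2 h3 h4 hx
    have e1 : z * x * z = z ^ 2 * x := by ring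
    have e2 : z * x / z = x := by field_simp
    have h := rank_triple h0 h1 (z := z * x) (mul_pos hz hx).ne' hz0 h3 hP hP2
      (by rwa [e1]) (by rwa [e2])
    rw [e1, e2] at h
    rw [← sq, add_sub_assoc', h]
    simp only [Pi.mul_apply]
    field_simp
    ring

lemma crank_pair_self (h0 : 0 < q) (h1 : q < 1) {z : ℝ} (hz : 0 < z)
    (hP : jTheta q z ≠ 0) (hP2 : jTheta q (z ^ 2) ≠ 0) :
    z * appell q 1 (-z) (z * z) + appell q 1 (-z⁻¹) 1 = thetaLog q (z ^ 2) - thetaLog q z := by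
  have hz0 := hz.ne'
  have w1 : -z ≠ 0 := by simpa using hz0
  have w2 : -z⁻¹ ≠ 0 := by simpa using hz0
  have hzz : jTheta q (z * z) ≠ 0 := by rwa [← sq]
  have h3 : HasDerivAt (fun x => jTheta q (z * x) / jTheta q z) (thetaLog q z) 1 := by
    have h : HasDerivAt (fun x => jTheta q (z * x)) (thetaLog q z * jTheta q z / z * (z * 1)) 1 :=
      HasDerivAt.comp (h₂ := jTheta q) 1 (by rw [mul_one]; exact hasDerivAt_jTheta h0 h1 hz0 hP)
        ((hasDerivAt_id 1).const_mul z)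
    refine (h.div_const _).congr_deriv ?_
    field_simp
  have g := h3.mul (hasDerivAt_inv_jTheta_mul h0 h1 (by positivity) hP2)
  have L := ((tendsto_appell_mul h0 h1 w1 (by positivity) hzz le_rfl).const_mul z).add
    ((tendsto_appell_one h0 h1 w2 le_rfl).mono_left nhdsWithin_le_nhds)
  have e := tendsto_nhds_unique (L.congr' ?_) (tendsto_div_jTheta h0 h1 g (by simp [hP, hP2]))
  · rw [e]
    simp only [mul_one, div_self hP, div_self hP2]
    ring
  · filter_upwards [eventually_jTheta_near_one h0 h1, eventually_jTheta_ne_zero h0 h1 hz0 hP,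
      eventually_jTheta_ne_zero h0 h1 (by positivity) hP2, nhdsWithin_le_nhds (lt_mem_nhds one_pos)]
      with x h2 h3 h4 hx
    have e1 : z * x * z = z ^ 2 * x := by ring
    have e2 : z * x / z = x := by field_simp
    have h := crank_pair h0 h1 (z := z * x) (mul_pos hz hx).ne' hz0 hP hP2
      (by rwa [e1]) (by rwa [e2])
    rw [e1, e2] at h
    rw [← sq, add_sub_assoc', h]
    simp only [Pi.mul_apply]
    field_simp

end

section

open Filter Topology Finset

lemma tsum_int_eleven_mul {f : ℤ → ℝ} (hf : Summable f) {r : ℕ} (hr : 1 ≤ r) (hr' : r ≤ 5)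
    {g : ℤ → ℝ} (hg : ∀ c, g c = ∑' n : ℤ, f (11 * n + (r + c))) :
    ∑' k, f k = g 0 + ∑ t ∈ Icc (1 : ℤ) 5, (g (r * t) + g (-(r * t))) := by
  have hp : ∀ c, g (c + 11) = g c := by
    intro c
    rw [hg, hg, ← (Equiv.addRight (1 : ℤ)).tsum_eq fun n => f (11 * n + (r + c))]
    refine tsum_congr fun n => ?_
    rw [Equiv.coe_addRight]
    congr 1
    ring
  have hper : Function.Periodic g 11 := hp
  have hm : ∀ c, g c = g (c % 11) := by
    intro c
    have := hper.int_mul (c / 11) (c % 11)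
    rw [← this]
    congr 1
    have := Int.emod_add_mul_ediv c 11
    simp only [Int.cast_eq]
    linarith
  rw [tsum_int_eleven hf r]
  have e : ∀ i : Fin 11, ∑' n : ℤ, f (11 * n + (((i : ℕ) : ℤ) + r)) = g (i : ℕ) := by
    intro i; rw [hg]; simp only [add_comm]
  simp only [e]
  have hI : Icc (1 : ℤ) 5 = {1, 2, 3, 4, 5} := by decide
  rw [hI]
  norm_num [Fin.sum_univ_succ]
  interval_cases r <;> norm_num <;>
    [rw [hm (-1), hm (-2), hm (-3), hm (-4), hm (-5)];
     rw [hm (-2), hm (-4), hm (-6), hm (-8), hm (-10)];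
     rw [hm (-3), hm (-6), hm (-9), hm (-12), hm (-15), hm 12, hm 15];
     rw [hm (-4), hm (-8), hm (-12), hm (-16), hm (-20), hm 12, hm 16, hm 20];
     rw [hm (-5), hm (-10), hm (-15), hm (-20), hm (-25), hm 15, hm 20, hm 25]] <;>
  norm_num <;> ring

variable {V : ℝ}

/-- The Lambert series governing rank residues modulo eleven. -/
noncomputable def rankSeries (V : ℝ) (a : ℤ) : ℝ :=
  ∑' k : ℤ, (-1) ^ k * V ^ (3 * k ^ 2 - k + 2 * a * k) / (1 - V ^ (22 * k))

/-- The Lambert series governing crank residues modulo eleven. -/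
noncomputable def crankSeries (V : ℝ) (a : ℤ) : ℝ :=
  ∑' k : ℤ, (-1) ^ k * V ^ (k ^ 2 - k + 2 * a * k) / (1 - V ^ (22 * k))

lemma summable_lambert (h0 : 0 < V) (h1 : V < 1) {d : ℕ} (hd : 1 ≤ d) (b : ℤ) :
    Summable fun k : ℤ => (-1) ^ k * V ^ (d * k ^ 2 + b * k) / (1 - V ^ (22 * k)) := by
  obtain ⟨C, hC⟩ := exists_inv_one_sub_le (q := V ^ 22) (by positivity)
    (pow_lt_one₀ h0.le h1 (by norm_num)) one_ne_zero
  have hs := summable_theta (q := V ^ 2) (by positivity) (pow_lt_one₀ h0.le h1 (by norm_num))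
    (c := -V ^ (b - d)) (neg_ne_zero.2 (zpow_ne_zero _ h0.ne')) hd
  refine Summable.of_norm_bounded (hs.norm.mul_right C) fun n => ?_
  have e : (-V ^ (b - d)) ^ n * (V ^ 2) ^ ((d : ℤ) * tri n) = (-1) ^ n * V ^ (d * n ^ 2 + b * n) := by
    rw [neg_eq_neg_one_mul, mul_zpow, ← zpow_natCast V 2, ← zpow_mul, ← zpow_mul, mul_assoc,
      ← zpow_add₀ h0.ne']
    congr 2
    have := two_mul_tri n
    push_cast
    linear_combination (d : ℤ) * this
  rw [e, div_eq_mul_inv, norm_mul]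
  have e2 : V ^ (22 * n) = 1 * (V ^ 22) ^ n := by
    rw [one_mul, ← zpow_natCast V 22, ← zpow_mul]; norm_num
  rw [e2]
  exact mul_le_mul_of_nonneg_left (hC n) (norm_nonneg _)

lemma lambert_residue (h0 : 0 < V) (d : ℕ) (r c : ℤ) :
    ∑' n : ℤ, (-1) ^ (11 * n + (r + c)) * V ^ (d * (11 * n + (r + c)) ^ 2 +
        (11 * d - 2 * d * r) * (11 * n + (r + c))) / (1 - V ^ (22 * (11 * n + (r + c)))) =
      (-1) ^ r * V ^ (d * (11 * r - r ^ 2)) * ((-1) ^ c * V ^ (d * (c ^ 2 + 11 * c))) *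
        appell (V ^ 242) d (-(V ^ (22 * c)) ^ d) (V ^ (22 * (r + c))) := by
  rw [appell, ← tsum_mul_left]
  refine tsum_congr fun n => ?_
  have ht := two_mul_tri n
  rw [← mul_div_assoc]
  congr 1
  · have e1 : (-1 : ℝ) ^ (11 * n + (r + c)) = (-1) ^ r * (-1) ^ c * (-1) ^ n := by
      rw [zpow_add₀ (by norm_num), zpow_add₀ (by norm_num), zpow_mul]
      norm_num
      ring_nf
    rw [e1, neg_eq_neg_one_mul (_ ^ d), mul_zpow,
      ← zpow_natCast (V ^ (22 * c)) d, ← zpow_mul, ← zpow_mul,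
      ← zpow_natCast V 242, ← zpow_mul]
    have e2 : V ^ ((d : ℤ) * (11 * n + (r + c)) ^ 2 + (11 * d - 2 * d * r) * (11 * n + (r + c))) =
        V ^ ((d : ℤ) * (11 * r - r ^ 2)) * V ^ ((d : ℤ) * (c ^ 2 + 11 * c)) *
          (V ^ (22 * c * d * n) * V ^ (((242 : ℕ) : ℤ) * (d * tri n))) := by
      simp only [← zpow_add₀ h0.ne']
      congr 1
      push_cast
      linear_combination (-121 * (d : ℤ)) * ht
    rw [e2]
    ring_nf
  · rw [← zpow_natCast V 242, ← zpow_mul, ← zpow_add₀ h0.ne']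
    congr 3
    push_cast
    ring

/-- The part of a Lambert series supported on one residue class. -/
noncomputable def lambertPart (V : ℝ) (d : ℕ) (r c : ℤ) : ℝ :=
  (-1) ^ r * V ^ (d * (11 * r - r ^ 2)) * ((-1) ^ c * V ^ (d * (c ^ 2 + 11 * c))) *
    appell (V ^ 242) d (-(V ^ (22 * c)) ^ d) (V ^ (22 * (r + c)))

lemma lambertPart_zero (V : ℝ) (d : ℕ) (r : ℤ) : lambertPart V d r 0 =
    (-1) ^ r * V ^ (d * (11 * r - r ^ 2)) * appell (V ^ 242) d (-1) (V ^ (22 * r)) := by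
  simp [lambertPart]

lemma lambertPart_pair (h0 : 0 < V) (d : ℕ) (r c : ℤ) :
    lambertPart V d r c + lambertPart V d r (-c) =
      (-1) ^ r * V ^ (d * (11 * r - r ^ 2)) * ((-1) ^ c * V ^ (d * (c ^ 2 - 11 * c))) *
        ((V ^ (22 * c)) ^ d * appell (V ^ 242) d (-(V ^ (22 * c)) ^ d)
            (V ^ (22 * r) * V ^ (22 * c)) +
          appell (V ^ 242) d (-((V ^ (22 * c)) ^ d)⁻¹) (V ^ (22 * r) / V ^ (22 * c))) := by
  have e1 : V ^ (d * (c ^ 2 + 11 * c)) = V ^ (d * (c ^ 2 - 11 * c)) * (V ^ (22 * c)) ^ d := by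
    rw [← zpow_natCast (V ^ (22 * c)), ← zpow_mul, ← zpow_add₀ h0.ne']; congr 1; ring
  have e2 : (V ^ (22 * -c)) ^ d = ((V ^ (22 * c)) ^ d)⁻¹ := by
    rw [← inv_pow, ← zpow_neg]; congr 2; ring
  have e3 : V ^ (22 * (r + c)) = V ^ (22 * r) * V ^ (22 * c) := by
    rw [← zpow_add₀ h0.ne']; congr 1; ring
  have e4 : V ^ (22 * (r + -c)) = V ^ (22 * r) / V ^ (22 * c) := by
    rw [← zpow_sub₀ h0.ne']; congr 1; ring
  have e5 : V ^ (d * ((-c) ^ 2 + 11 * -c)) = V ^ (d * (c ^ 2 - 11 * c)) := by congr 1; ring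
  have e6 : (-1 : ℝ) ^ (-c) = (-1) ^ c := by rw [zpow_neg, ← inv_zpow]; norm_num
  rw [lambertPart, lambertPart, e1, e2, e3, e4, e5, e6]
  ring

lemma neg_one_zpow_sq (r : ℤ) : ((-1 : ℝ) ^ r) ^ 2 = 1 := by
  rw [← zpow_natCast, ← zpow_mul, mul_comm, zpow_mul]; norm_num

section pairs

variable {r c : ℤ}

lemma zpow_double (a : ℤ) : (V ^ (22 * a)) ^ 2 = V ^ (22 * (2 * a)) := by
  rw [← zpow_natCast, ← zpow_mul]; congr 1; push_cast; ring

lemma zpow_sum (h0 : 0 < V) (a b : ℤ) : V ^ (22 * a) * V ^ (22 * b) = V ^ (22 * (a + b)) := by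
  rw [← zpow_add₀ h0.ne']; congr 1; ring

lemma zpow_diff (h0 : 0 < V) (a b : ℤ) : V ^ (22 * a) / V ^ (22 * b) = V ^ (22 * (a - b)) := by
  rw [← zpow_sub₀ h0.ne']; congr 1; ring

lemma rankPart_pair (h0 : 0 < V) (h1 : V < 1)
    (hr : ¬ (11 : ℤ) ∣ r) (hc : ¬ (11 : ℤ) ∣ c) (hc2 : ¬ (11 : ℤ) ∣ 2 * c)
    (ha : ¬ (11 : ℤ) ∣ r + c) (hs : ¬ (11 : ℤ) ∣ r - c) :
    lambertPart V 3 r c + lambertPart V 3 r (-c) =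
      lambertPart V 3 r 0 * (thetaZ V (2 * c) / thetaZ V c) +
        qPoch (V ^ 242) (V ^ 242) ^ 2 * (thetaZ V c * thetaZ V (2 * c) /
          (thetaZ V (r + c) * thetaZ V r * thetaZ V (r - c))) := by
  have hq0 : 0 < V ^ 242 := by positivity
  have hq1 : V ^ 242 < 1 := pow_lt_one₀ h0.le h1 (by norm_num)
  have Pr := jTheta_zpow_ne_zero h0 h1 hr
  have Pc := jTheta_zpow_ne_zero h0 h1 hc
  have Pa := jTheta_zpow_ne_zero h0 h1 ha
  have Ps := jTheta_zpow_ne_zero h0 h1 hs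
  rw [lambertPart_pair h0, lambertPart_zero, rank_triple hq0 hq1 (by positivity) (by positivity) Pr Pc
    (by rw [zpow_double]; exact jTheta_zpow_ne_zero h0 h1 hc2)
    (by rwa [zpow_sum h0]) (by rwa [zpow_diff h0]), zpow_double, zpow_sum h0, zpow_diff h0]
  simp only [thetaZ]
  have s1 := neg_one_zpow_sq r
  have s2 := neg_one_zpow_sq c
  have n1 : (-1 : ℝ) ^ r ≠ 0 := zpow_ne_zero _ (by norm_num)
  have n2 : (-1 : ℝ) ^ c ≠ 0 := zpow_ne_zero _ (by norm_num)
  have x1 : (-1 : ℝ) ^ (2 * c) = 1 := by rw [zpow_mul]; norm_num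
  have x2 : (-1 : ℝ) ^ (r + c) = (-1) ^ r * (-1) ^ c := zpow_add₀ (by norm_num) _ _
  have x3 : (-1 : ℝ) ^ (r - c) = (-1) ^ r / (-1) ^ c := zpow_sub₀ (by norm_num) _ _
  set A := V ^ (c ^ 2 - 11 * c) with hA
  set B := V ^ (r ^ 2 - 11 * r) with hB
  set C := V ^ (22 * c) with hC
  have Ap : 0 < A := by positivity
  have Bp : 0 < B := by positivity
  have Cp : 0 < C := by positivity
  have y1 : V ^ (((3 : ℕ) : ℤ) * (11 * r - r ^ 2)) = (B ^ 3)⁻¹ := by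
    rw [hB, ← zpow_natCast, ← zpow_mul, ← zpow_neg]; congr 1; push_cast; ring
  have y2 : V ^ (((3 : ℕ) : ℤ) * (c ^ 2 - 11 * c)) = A ^ 3 := by
    rw [hA, ← zpow_natCast, ← zpow_mul]; congr 1; push_cast; ring
  have y3 : V ^ ((2 * c) ^ 2 - 11 * (2 * c)) = A ^ 4 * C := by
    rw [hA, hC, ← zpow_natCast, ← zpow_mul, ← zpow_add₀ h0.ne']; congr 1; push_cast; ring
  have y4 : V ^ ((r + c) ^ 2 - 11 * (r + c)) * V ^ ((r - c) ^ 2 - 11 * (r - c)) =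
      B ^ 2 * A ^ 2 * C := by
    rw [hA, hB, hC, ← zpow_natCast, ← zpow_natCast, ← zpow_mul, ← zpow_mul]
    simp only [← zpow_add₀ h0.ne']; congr 1; push_cast; ring
  have z4 : ∀ p₁ p₂ p₃ : ℝ, (-1) ^ (r + c) * V ^ ((r + c) ^ 2 - 11 * (r + c)) * p₁ *
      ((-1) ^ r * B * p₂) * ((-1) ^ (r - c) * V ^ ((r - c) ^ 2 - 11 * (r - c)) * p₃) =
      (-1) ^ r * B ^ 3 * A ^ 2 * C * (p₁ * p₂ * p₃) := by
    intro p₁ p₂ p₃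
    rw [x2, x3]
    field_simp
    linear_combination (((-1 : ℝ) ^ r) ^ 2 * p₁ * p₂ * p₃) * y4 +
      (B ^ 2 * A ^ 2 * C * p₁ * p₂ * p₃) * s1
  rw [z4, y1, y2, y3, x1]
  field_simp
  linear_combination (((-1 : ℝ) ^ r) ^ 2 * jTheta (V ^ 242) (V ^ (22 * (2 * c))) * C *
    appell (V ^ 242) 3 (-1) (V ^ (22 * r)) * jTheta (V ^ 242) (V ^ (22 * r)) *
    jTheta (V ^ 242) (V ^ (22 * (r + c))) * jTheta (V ^ 242) (V ^ (22 * (r - c)))) * s2 +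
    (((-1 : ℝ) ^ c) ^ 2 * jTheta (V ^ 242) (V ^ (22 * (2 * c))) * jTheta (V ^ 242) C ^ 2 *
      qPoch (V ^ 242) (V ^ 242) ^ 2) * s1

lemma rankPart_pair_self (h0 : 0 < V) (h1 : V < 1)
    (hr : ¬ (11 : ℤ) ∣ r) (hr2 : ¬ (11 : ℤ) ∣ 2 * r) :
    lambertPart V 3 r r + lambertPart V 3 r (-r) =
      lambertPart V 3 r 0 * (thetaZ V (2 * r) / thetaZ V r) +
        (thetaLog (V ^ 242) (V ^ (22 * r)) + thetaLog (V ^ 242) (V ^ (22 * (2 * r)))) := by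
  have hq0 : 0 < V ^ 242 := by positivity
  have hq1 : V ^ 242 < 1 := pow_lt_one₀ h0.le h1 (by norm_num)
  have Pr := jTheta_zpow_ne_zero h0 h1 hr
  have hne : V ^ (22 * r) ≠ 0 := by positivity
  rw [lambertPart_pair h0, lambertPart_zero, div_self hne, rank_pair_self hq0 hq1 (by positivity) Pr
    (by rw [zpow_double]; exact jTheta_zpow_ne_zero h0 h1 hr2), zpow_double]
  have s1 := neg_one_zpow_sq r
  rw [thetaZ_two_mul_div h0, zpow_double]
  have y1 : V ^ (((3 : ℕ) : ℤ) * (11 * r - r ^ 2)) * V ^ (((3 : ℕ) : ℤ) * (r ^ 2 - 11 * r)) = 1 := by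
    rw [← zpow_add₀ h0.ne', ← zpow_zero V]; congr 1; ring
  have y2 : V ^ (((3 : ℕ) : ℤ) * (11 * r - r ^ 2)) * V ^ (3 * r ^ 2 - 11 * r) = V ^ (22 * r) := by
    rw [← zpow_add₀ h0.ne']; congr 1; push_cast; ring
  linear_combination (((-1 : ℝ) ^ r) ^ 2 * (V ^ (22 * r) *
    (jTheta (V ^ 242) (V ^ (22 * (2 * r))) / jTheta (V ^ 242) (V ^ (22 * r))) *
    appell (V ^ 242) 3 (-1) (V ^ (22 * r)) + (thetaLog (V ^ 242) (V ^ (22 * r)) +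
      thetaLog (V ^ 242) (V ^ (22 * (2 * r)))))) * y1 -
    (((-1 : ℝ) ^ r) ^ 2 * appell (V ^ 242) 3 (-1) (V ^ (22 * r)) *
      (jTheta (V ^ 242) (V ^ (22 * (2 * r))) / jTheta (V ^ 242) (V ^ (22 * r)))) * y2 +
    (thetaLog (V ^ 242) (V ^ (22 * r)) + thetaLog (V ^ 242) (V ^ (22 * (2 * r)))) * s1

lemma crankPart_zero (h0 : 0 < V) (h1 : V < 1) (hr : ¬ (11 : ℤ) ∣ r) :
    lambertPart V 1 r 0 = qPoch (V ^ 242) (V ^ 242) ^ 2 * (1 / thetaZ V r) := by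
  have hq0 : 0 < V ^ 242 := by positivity
  have hq1 : V ^ 242 < 1 := pow_lt_one₀ h0.le h1 (by norm_num)
  have Pr := jTheta_zpow_ne_zero h0 h1 hr
  have s1 := neg_one_zpow_sq r
  have n1 : (-1 : ℝ) ^ r ≠ 0 := zpow_ne_zero _ (by norm_num)
  have hne : V ^ (r ^ 2 - 11 * r) ≠ 0 := by positivity
  have y1 : V ^ (((1 : ℕ) : ℤ) * (11 * r - r ^ 2)) = (V ^ (r ^ 2 - 11 * r))⁻¹ := by
    rw [← zpow_neg]; congr 1; push_cast; ring
  rw [lambertPart_zero, ← sq_div_jTheta hq0 hq1 (by positivity) Pr, thetaZ, y1]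
  field_simp
  linear_combination qPoch (V ^ 242) (V ^ 242) ^ 2 * s1

lemma crankPart_pair (h0 : 0 < V) (h1 : V < 1)
    (hr : ¬ (11 : ℤ) ∣ r) (hc : ¬ (11 : ℤ) ∣ c) (hc2 : ¬ (11 : ℤ) ∣ 2 * c)
    (ha : ¬ (11 : ℤ) ∣ r + c) (hs : ¬ (11 : ℤ) ∣ r - c) :
    lambertPart V 1 r c + lambertPart V 1 r (-c) =
      qPoch (V ^ 242) (V ^ 242) ^ 2 * (thetaZ V (2 * c) * thetaZ V r /
          (thetaZ V c * thetaZ V (r + c) * thetaZ V (r - c))) := by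
  have hq0 : 0 < V ^ 242 := by positivity
  have hq1 : V ^ 242 < 1 := pow_lt_one₀ h0.le h1 (by norm_num)
  have Pr := jTheta_zpow_ne_zero h0 h1 hr
  have Pc := jTheta_zpow_ne_zero h0 h1 hc
  have Pa := jTheta_zpow_ne_zero h0 h1 ha
  have Ps := jTheta_zpow_ne_zero h0 h1 hs
  rw [lambertPart_pair h0, pow_one, crank_pair hq0 hq1 (by positivity) (by positivity) Pc
    (by rw [zpow_double]; exact jTheta_zpow_ne_zero h0 h1 hc2)
    (by rwa [zpow_sum h0]) (by rwa [zpow_diff h0]), zpow_double, zpow_sum h0, zpow_diff h0]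
  simp only [thetaZ]
  have s1 := neg_one_zpow_sq r
  have s2 := neg_one_zpow_sq c
  have n1 : (-1 : ℝ) ^ r ≠ 0 := zpow_ne_zero _ (by norm_num)
  have n2 : (-1 : ℝ) ^ c ≠ 0 := zpow_ne_zero _ (by norm_num)
  have x1 : (-1 : ℝ) ^ (2 * c) = 1 := by rw [zpow_mul]; norm_num
  have x2 : (-1 : ℝ) ^ (r + c) = (-1) ^ r * (-1) ^ c := zpow_add₀ (by norm_num) _ _
  have x3 : (-1 : ℝ) ^ (r - c) = (-1) ^ r / (-1) ^ c := zpow_sub₀ (by norm_num) _ _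
  set A := V ^ (c ^ 2 - 11 * c) with hA
  set B := V ^ (r ^ 2 - 11 * r) with hB
  set C := V ^ (22 * c) with hC
  have Ap : 0 < A := by positivity
  have Bp : 0 < B := by positivity
  have Cp : 0 < C := by positivity
  have y1 : V ^ (((1 : ℕ) : ℤ) * (11 * r - r ^ 2)) = B⁻¹ := by
    rw [hB, ← zpow_neg]; congr 1; push_cast; ring
  have y2 : V ^ (((1 : ℕ) : ℤ) * (c ^ 2 - 11 * c)) = A := by
    rw [hA]; congr 1; push_cast; ring
  have y3 : V ^ ((2 * c) ^ 2 - 11 * (2 * c)) = A ^ 4 * C := by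
    rw [hA, hC, ← zpow_natCast, ← zpow_mul, ← zpow_add₀ h0.ne']; congr 1; push_cast; ring
  have y4 : V ^ ((r + c) ^ 2 - 11 * (r + c)) * V ^ ((r - c) ^ 2 - 11 * (r - c)) =
      B ^ 2 * A ^ 2 * C := by
    rw [hA, hB, hC, ← zpow_natCast, ← zpow_natCast, ← zpow_mul, ← zpow_mul]
    simp only [← zpow_add₀ h0.ne']; congr 1; push_cast; ring
  have z4 : ∀ p₁ p₂ p₃ : ℝ, (-1) ^ c * A * p₁ * ((-1) ^ (r + c) * V ^ ((r + c) ^ 2 - 11 * (r + c)) *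
      p₂) *
      ((-1) ^ (r - c) * V ^ ((r - c) ^ 2 - 11 * (r - c)) * p₃) =
      (-1) ^ c * B ^ 2 * A ^ 3 * C * (p₁ * p₂ * p₃) := by
    intro p₁ p₂ p₃
    rw [x2, x3]
    field_simp
    linear_combination (((-1 : ℝ) ^ r) ^ 2 * p₁ * p₂ * p₃) * y4 +
      (B ^ 2 * A ^ 2 * C * p₁ * p₂ * p₃) * s1
  rw [z4, y1, y2, y3, x1]
  field_simp
  linear_combination (qPoch (V ^ 242) (V ^ 242) ^ 2 * jTheta (V ^ 242) (V ^ (22 * (2 * c)))) * s2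

lemma crankPart_pair_self (h0 : 0 < V) (h1 : V < 1)
    (hr : ¬ (11 : ℤ) ∣ r) (hr2 : ¬ (11 : ℤ) ∣ 2 * r) :
    lambertPart V 1 r r + lambertPart V 1 r (-r) =
      thetaLog (V ^ 242) (V ^ (22 * (2 * r))) - thetaLog (V ^ 242) (V ^ (22 * r)) := by
  have hq0 : 0 < V ^ 242 := by positivity
  have hq1 : V ^ 242 < 1 := pow_lt_one₀ h0.le h1 (by norm_num)
  have Pr := jTheta_zpow_ne_zero h0 h1 hr
  have hne : V ^ (22 * r) ≠ 0 := by positivity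
  rw [lambertPart_pair h0, pow_one, div_self hne, crank_pair_self hq0 hq1 (by positivity) Pr
    (by rw [zpow_double]; exact jTheta_zpow_ne_zero h0 h1 hr2), zpow_double]
  have s1 := neg_one_zpow_sq r
  have y1 : V ^ (((1 : ℕ) : ℤ) * (11 * r - r ^ 2)) * V ^ (((1 : ℕ) : ℤ) * (r ^ 2 - 11 * r)) = 1 := by
    rw [← zpow_add₀ h0.ne', ← zpow_zero V]; congr 1; ring
  linear_combination (((-1 : ℝ) ^ r) ^ 2 * (thetaLog (V ^ 242) (V ^ (22 * (2 * r))) -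
    thetaLog (V ^ 242) (V ^ (22 * r)))) * y1 + (thetaLog (V ^ 242) (V ^ (22 * (2 * r))) -
    thetaLog (V ^ 242) (V ^ (22 * r))) * s1

lemma rankPart_pair_mul (h0 : 0 < V) (h1 : V < 1)
    (hr : ¬ (11 : ℤ) ∣ r) {t : ℤ} (ht : ¬ (11 : ℤ) ∣ t)
    (ht2 : ¬ (11 : ℤ) ∣ 2 * t) (ha : ¬ (11 : ℤ) ∣ 1 + t) (hs : ¬ (11 : ℤ) ∣ 1 - t) :
    lambertPart V 3 r (r * t) + lambertPart V 3 r (-(r * t)) =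
      lambertPart V 3 r 0 * (thetaZ V (r * (2 * t)) / thetaZ V (r * t)) +
        qPoch (V ^ 242) (V ^ 242) ^ 2 * (thetaZ V (r * t) * thetaZ V (r * (2 * t)) /
          (thetaZ V (r * (1 + t)) * thetaZ V (r * 1) * thetaZ V (r * (1 - t)))) := by
  have e1 : 2 * (r * t) = r * (2 * t) := by ring
  have e2 : r + r * t = r * (1 + t) := by ring
  have e3 : r - r * t = r * (1 - t) := by ring
  have := rankPart_pair h0 h1 hr (c := r * t) (by rwa [eleven_dvd_mul hr])
    (by rwa [e1, eleven_dvd_mul hr]) (by rwa [e2, eleven_dvd_mul hr])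
    (by rwa [e3, eleven_dvd_mul hr])
  rw [this, e1, e2, e3, mul_one]

lemma crankPart_pair_mul (h0 : 0 < V) (h1 : V < 1)
    (hr : ¬ (11 : ℤ) ∣ r) {t : ℤ} (ht : ¬ (11 : ℤ) ∣ t)
    (ht2 : ¬ (11 : ℤ) ∣ 2 * t) (ha : ¬ (11 : ℤ) ∣ 1 + t) (hs : ¬ (11 : ℤ) ∣ 1 - t) :
    lambertPart V 1 r (r * t) + lambertPart V 1 r (-(r * t)) =
      qPoch (V ^ 242) (V ^ 242) ^ 2 * (thetaZ V (r * (2 * t)) * thetaZ V (r * 1) /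
          (thetaZ V (r * t) * thetaZ V (r * (1 + t)) * thetaZ V (r * (1 - t)))) := by
  have e1 : 2 * (r * t) = r * (2 * t) := by ring
  have e2 : r + r * t = r * (1 + t) := by ring
  have e3 : r - r * t = r * (1 - t) := by ring
  have := crankPart_pair h0 h1 hr (c := r * t) (by rwa [eleven_dvd_mul hr])
    (by rwa [e1, eleven_dvd_mul hr]) (by rwa [e2, eleven_dvd_mul hr])
    (by rwa [e3, eleven_dvd_mul hr])
  rw [this, e1, e2, e3, mul_one]

lemma sq_mul_thetaL (h0 : 0 < V) (h1 : V < 1) (a : ℤ) : qPoch (V ^ 242) (V ^ 242) ^ 2 * thetaL V a =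
    thetaLog (V ^ 242) (V ^ (22 * a)) + a / 11 - 1 / 2 := by
  have hJ : qPoch (V ^ 242) (V ^ 242) ≠ 0 := by
    have hq1 : V ^ 242 < 1 := pow_lt_one₀ h0.le h1 (by norm_num)
    exact (qPoch_pos (by positivity) hq1 hq1).ne'
  rw [thetaL]
  field_simp

end pairs

lemma lambert_dissection (h0 : 0 < V) (h1 : V < 1) {d : ℕ} (hd : 1 ≤ d) {r : ℕ} (hr : 1 ≤ r)
    (hr' : r ≤ 5) :
    ∑' k : ℤ, (-1) ^ k * V ^ (d * k ^ 2 + (11 * d - 2 * d * r) * k) / (1 - V ^ (22 * k)) =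
      lambertPart V d r 0 +
        ∑ t ∈ Icc (1 : ℤ) 5, (lambertPart V d r (r * t) + lambertPart V d r (-(r * t))) :=
  tsum_int_eleven_mul (summable_lambert h0 h1 hd _) hr hr'
    fun c => (lambert_residue h0 d r c).symm

/-- The dissection of the Euler product, up to an elementary factor. -/
noncomputable def eulerSum (Z : ℤ → ℝ) : ℝ :=
  1 + (Z 2 / Z 1 + Z 4 / Z 2 + Z 6 / Z 3 + Z 8 / Z 4 + Z 10 / Z 5)

lemma Icc_one_five : Icc (1 : ℤ) 5 = {1, 2, 3, 4, 5} := by decide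

theorem rankSeries_dissection (h0 : 0 < V) (h1 : V < 1) {r : ℕ} (hr : 1 ≤ r) (hr' : r ≤ 5) :
    rankSeries V (17 - 3 * r) = lambertPart V 3 r 0 * eulerSum (fun a => thetaZ V (r * a)) +
      qPoch (V ^ 242) (V ^ 242) ^ 2 *
        rankLambert (fun a => thetaZ V (r * a)) (fun a => thetaL V (r * a)) +
      (1 - 3 * r / 11) := by
  have hr11 : ¬ (11 : ℤ) ∣ r := by omega
  have h := lambert_dissection h0 h1 (d := 3) (by norm_num) hr hr'
  have e : rankSeries V (17 - 3 * r) = ∑' k : ℤ, (-1) ^ k * V ^ (((3 : ℕ) : ℤ) * k ^ 2 +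
      (11 * (3 : ℕ) - 2 * (3 : ℕ) * r) * k) / (1 - V ^ (22 * k)) := by
    refine tsum_congr fun k => ?_
    congr 3
    push_cast
    ring
  have p := rankPart_pair_self h0 h1 hr11 (by omega)
  have l1 := sq_mul_thetaL h0 h1 (r * 1)
  have l2 := sq_mul_thetaL h0 h1 (r * 2)
  rw [e, h, Icc_one_five]
  simp only [Finset.mem_insert, Finset.mem_singleton, OfNat.one_ne_ofNat, OfNat.ofNat_eq_ofNat,
    Nat.reduceEqDiff, or_self, not_false_eq_true, Finset.sum_insert, Finset.sum_singleton]
  rw [rankPart_pair_mul h0 h1 hr11 (t := 2) (by norm_num) (by norm_num) (by norm_num) (by norm_num),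
    rankPart_pair_mul h0 h1 hr11 (t := 3) (by norm_num) (by norm_num) (by norm_num) (by norm_num),
    rankPart_pair_mul h0 h1 hr11 (t := 4) (by norm_num) (by norm_num) (by norm_num) (by norm_num),
    rankPart_pair_mul h0 h1 hr11 (t := 5) (by norm_num) (by norm_num) (by norm_num) (by norm_num),
    eulerSum, rankLambert]
  rw [mul_one] at l1 ⊢
  rw [p]
  norm_num
  push_cast at l1 l2
  rw [mul_comm (2 : ℤ) r]
  linear_combination -l1 - l2

theorem crankSeries_dissection (h0 : 0 < V) (h1 : V < 1) {r : ℕ} (hr : 1 ≤ r) (hr' : r ≤ 5) :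
    crankSeries V (6 - r) = qPoch (V ^ 242) (V ^ 242) ^ 2 *
        crankLambert (fun a => thetaZ V (r * a)) (fun a => thetaL V (r * a)) - r / 11 := by
  have hr11 : ¬ (11 : ℤ) ∣ r := by omega
  have h := lambert_dissection h0 h1 (d := 1) le_rfl hr hr'
  have e : crankSeries V (6 - r) = ∑' k : ℤ, (-1) ^ k * V ^ (((1 : ℕ) : ℤ) * k ^ 2 +
      (11 * (1 : ℕ) - 2 * (1 : ℕ) * r) * k) / (1 - V ^ (22 * k)) := by
    refine tsum_congr fun k => ?_
    congr 3
    push_cast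
    ring
  have p := crankPart_pair_self h0 h1 hr11 (by omega)
  have l1 := sq_mul_thetaL h0 h1 (r * 1)
  have l2 := sq_mul_thetaL h0 h1 (r * 2)
  rw [e, h, Icc_one_five]
  simp only [Finset.mem_insert, Finset.mem_singleton, OfNat.one_ne_ofNat, OfNat.ofNat_eq_ofNat,
    Nat.reduceEqDiff, or_self, not_false_eq_true, Finset.sum_insert, Finset.sum_singleton]
  rw [crankPart_pair_mul h0 h1 hr11 (t := 2) (by norm_num) (by norm_num) (by norm_num) (by norm_num),
    crankPart_pair_mul h0 h1 hr11 (t := 3) (by norm_num) (by norm_num) (by norm_num) (by norm_num),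
    crankPart_pair_mul h0 h1 hr11 (t := 4) (by norm_num) (by norm_num) (by norm_num) (by norm_num),
    crankPart_pair_mul h0 h1 hr11 (t := 5) (by norm_num) (by norm_num) (by norm_num) (by norm_num),
    crankPart_zero h0 h1 hr11, crankLambert]
  rw [mul_one] at l1 ⊢
  rw [p]
  norm_num
  push_cast at l1 l2
  rw [mul_comm (2 : ℤ) r]
  linear_combination l1 - l2

end

section

open Filter Topology Finset

variable {V : ℝ}

namespace ThetaSys

variable {Z p l : ℤ → ℝ} {q : ℝ}

lemma eulerSum_eq (h : ThetaSys Z p l q) : eulerSum Z = thetaSum Z eulerTerms := by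
  have n1 := h.ne_one
  have n2 := h.ne_two
  have n3 := h.ne_three
  have n4 := h.ne_four
  have n5 := h.ne_five
  norm_num [thetaSum, eulerTerms, thetaTerm, ThetaTerm.val, mon, zpow_neg, eulerSum, h.val_six,
    h.val_eight, h.val_ten]
  field_simp
  ring

end ThetaSys

lemma thetaSum_perm (Z : ℤ → ℝ) {S T : List ThetaTerm} (h : S.Perm T) :
    thetaSum Z S = thetaSum Z T := (h.map _).sum_eq

lemma eulerTerms_diamond {r : ℕ} (hr : 1 ≤ r) (hr' : r ≤ 5) :
    (eulerTerms.map (ThetaTerm.diamond r)).Perm eulerTerms := by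
  interval_cases r <;> decide +kernel

/-- The common factor of the theta quotients in the dissections. -/
noncomputable def thetaPrefactor (V : ℝ) : ℝ := qPoch (V ^ 242) (V ^ 242) / V ^ 252

lemma qPoch_eq_eulerSum (h0 : 0 < V) (h1 : V < 1) {r : ℕ} (hr : 1 ≤ r) (hr' : r ≤ 5) :
    qPoch (V ^ 2) (V ^ 2) =
    V ^ 10 * (qPoch (V ^ 242) (V ^ 242) * thetaSum (fun a => thetaZ V (r * a)) eulerTerms) := by
  have h := thetaSys h0 h1
  rw [qPoch_dissection h0 h1, h.thetaSum_diamond r hr hr',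
    thetaSum_perm _ (eulerTerms_diamond hr hr'), ← h.eulerSum_eq, eulerSum]

theorem rankSeries_div (h0 : 0 < V) (h1 : V < 1) {r : ℕ} (hr : 1 ≤ r) (hr' : r ≤ 5) :
    (rankSeries V (17 - 3 * r) - (1 - 3 * r / 11)) / qPoch (V ^ 2) (V ^ 2) =
      lambertPart V 3 r 0 / (V ^ 10 * qPoch (V ^ 242) (V ^ 242)) + thetaPrefactor V *
        thetaSum (thetaZ V) (rankTerms.map (ThetaTerm.diamond r)) / 132 := by
  have h := thetaSys h0 h1
  have h' := h.diamond (r := r) (by omega)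
  have hE : qPoch (V ^ 2) (V ^ 2) ≠ 0 := by
    have hq1 : V ^ 2 < 1 := pow_lt_one₀ h0.le h1 (by norm_num)
    exact (qPoch_pos (by positivity) hq1 hq1).ne'
  have e := qPoch_eq_eulerSum h0 h1 hr hr'
  have k := h'.rankTerms_identity
  rw [h.thetaSum_diamond r hr hr' rankTerms] at k
  rw [rankSeries_dissection h0 h1 hr hr', h'.eulerSum_eq, thetaPrefactor]
  rw [e] at hE ⊢
  set H := thetaSum (fun a => thetaZ V (r * a)) eulerTerms
  have hH : H ≠ 0 := fun h => hE (by simp [h])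
  have hJ : qPoch (V ^ 242) (V ^ 242) ≠ 0 := fun h => hE (by simp [h])
  field_simp
  linear_combination -11 * qPoch (V ^ 242) (V ^ 242) ^ 2 * k

theorem crankSeries_div (h0 : 0 < V) (h1 : V < 1) {r : ℕ} (hr : 1 ≤ r) (hr' : r ≤ 5) :
    (crankSeries V (6 - r) + r / 11) / qPoch (V ^ 2) (V ^ 2) =
      thetaPrefactor V *
        thetaSum (thetaZ V) (crankTerms.map (ThetaTerm.diamond r)) / 132 := by
  have h := thetaSys h0 h1
  have h' := h.diamond (r := r) (by omega)
  have hE : qPoch (V ^ 2) (V ^ 2) ≠ 0 := by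
    have hq1 : V ^ 2 < 1 := pow_lt_one₀ h0.le h1 (by norm_num)
    exact (qPoch_pos (by positivity) hq1 hq1).ne'
  have e := qPoch_eq_eulerSum h0 h1 hr hr'
  have k := h'.crankTerms_identity
  rw [h.thetaSum_diamond r hr hr' crankTerms] at k
  rw [crankSeries_dissection h0 h1 hr hr', thetaPrefactor]
  rw [e] at hE ⊢
  set H := thetaSum (fun a => thetaZ V (r * a)) eulerTerms
  have hH : H ≠ 0 := fun h => hE (by simp [h])
  have hJ : qPoch (V ^ 242) (V ^ 242) ≠ 0 := fun h => hE (by simp [h])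
  field_simp
  linear_combination -11 * qPoch (V ^ 242) (V ^ 242) ^ 2 * k

end

section

open Filter Topology Finset

/-- `f V` is, for `0 < V < 1`, an absolutely convergent sum of terms `c * V ^ (2 * k)` with
`s ≤ k` and `k ≡ d` modulo eleven, with nonnegative coefficients `c` if `b` holds. -/
def HasExp (b : Prop) (s d : ℤ) (f : ℝ → ℝ) : Prop :=
  ∃ (ι : Type) (c : ι → ℝ) (k : ι → ℤ), (b → ∀ i, 0 ≤ c i) ∧ (∀ i, s ≤ k i) ∧
    (∀ i, k i ≡ d [ZMOD 11]) ∧ ∀ V : ℝ, 0 < V → V < 1 →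
      HasSum (fun i => c i * V ^ (2 * k i)) (f V)

namespace HasExp

variable {b : Prop} {s d s' d' : ℤ} {f g : ℝ → ℝ}

lemma congr (h : HasExp b s d f) (hs : s' ≤ s) (hd : d ≡ d' [ZMOD 11])
    (hf : ∀ V : ℝ, 0 < V → V < 1 → g V = f V) : HasExp b s' d' g := by
  obtain ⟨ι, c, k, hb, h1, h2, h3⟩ := h
  exact ⟨ι, c, k, hb, fun i => hs.trans (h1 i), fun i => (h2 i).trans hd,
    fun V h h' => by rw [hf V h h']; exact h3 V h h'⟩

lemma of_true (h : HasExp True s d f) : HasExp b s d f := by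
  obtain ⟨ι, c, k, hb, h1, h2, h3⟩ := h
  exact ⟨ι, c, k, fun _ => hb trivial, h1, h2, h3⟩

lemma monomial (k : ℤ) : HasExp b k k (fun V => V ^ (2 * k)) := by
  refine ⟨Unit, fun _ => 1, fun _ => k, fun _ _ => by norm_num, fun _ => le_rfl, fun _ => rfl,
    fun V _ _ => ?_⟩
  simp

lemma one : HasExp b 0 0 (fun _ => 1) := by
  simpa using monomial (b := b) 0

lemma smul (h : HasExp b s d f) (x : ℝ) (hx : b → 0 ≤ x) : HasExp b s d (fun V => x * f V) := by
  obtain ⟨ι, c, k, hb, h1, h2, h3⟩ := h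
  refine ⟨ι, fun i => x * c i, k, fun h i => mul_nonneg (hx h) (hb h i), h1, h2, fun V h h' => ?_⟩
  simpa [mul_assoc] using (h3 V h h').mul_left x

lemma mul (hf : HasExp b s d f) (hg : HasExp b s' d' g) :
    HasExp b (s + s') (d + d') (fun V => f V * g V) := by
  obtain ⟨ι, c, k, hb, h1, h2, h3⟩ := hf
  obtain ⟨ι', c', k', hb', h1', h2', h3'⟩ := hg
  refine ⟨ι × ι', fun i => c i.1 * c' i.2, fun i => k i.1 + k' i.2,
    fun h i => mul_nonneg (hb h _) (hb' h _), fun i => add_le_add (h1 _) (h1' _),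
    fun i => (h2 _).add (h2' _), fun V h h' => ?_⟩
  have e := (h3 V h h').mul (h3' V h h')
    (summable_mul_of_summable_norm (h3 V h h').summable.norm (h3' V h h').summable.norm)
  refine e.congr_fun fun i => ?_
  rw [mul_add, zpow_add₀ h.ne']
  ring

lemma pow (hf : HasExp b 0 0 f) (n : ℕ) : HasExp b 0 0 (fun V => f V ^ n) := by
  induction n with
  | zero => simpa using one
  | succ n ih => simpa [pow_succ] using ih.mul hf

/-- Weighted sums of nonnegative expansions. -/
lemma tsum {ι : Type} {ε : ι → ℝ} {g : ι → ℝ → ℝ} (hε : b → ∀ i, 0 ≤ ε i)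
    (hg : ∀ i, HasExp True s d (g i))
    (hs : ∀ V : ℝ, 0 < V → V < 1 → Summable fun i => ε i * g i V) :
    HasExp b s d (fun V => ∑' i, ε i * g i V) := by
  choose κ c k hc h1 h2 h3 using hg
  refine ⟨Σ i, κ i, fun x => ε x.1 * c x.1 x.2, fun x => k x.1 x.2,
    fun h x => mul_nonneg (hε h _) (hc _ trivial _), fun x => h1 _ _, fun x => h2 _ _,
    fun V h h' => ?_⟩
  have hsum : ∀ i, HasSum (fun j => ε i * c i j * V ^ (2 * k i j)) (ε i * g i V) := fun i => by
    simpa [mul_assoc] using (h3 i V h h').mul_left (ε i)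
  have habs : Summable fun x : Σ i, κ i => ε x.1 * c x.1 x.2 * V ^ (2 * k x.1 x.2) := by
    rw [← summable_norm_iff, summable_sigma_of_nonneg fun _ => norm_nonneg _]
    refine ⟨fun i => (hsum i).summable.norm, ?_⟩
    have e : ∀ i, ∑' j, ‖ε i * c i j * V ^ (2 * k i j)‖ = ‖ε i * g i V‖ := fun i => by
      have h4 : ∀ j, 0 ≤ c i j * V ^ (2 * k i j) := fun j =>
        mul_nonneg (hc i trivial j) (zpow_nonneg h.le _)
      have e : ∀ j, ‖ε i * c i j * V ^ (2 * k i j)‖ = ‖ε i‖ * (c i j * V ^ (2 * k i j)) :=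
        fun j => by rw [mul_assoc, norm_mul, Real.norm_of_nonneg (h4 j)]
      rw [tsum_congr e, tsum_mul_left, (h3 i V h h').tsum_eq, norm_mul,
        Real.norm_of_nonneg ((h3 i V h h').nonneg h4)]
    exact (hs V h h').norm.congr fun i => (e i).symm
  have e := (habs.hasSum.sigma hsum).tsum_eq
  simpa only [e] using habs.hasSum

/-- Sums of nonnegative expansions. -/
lemma of_hasSum {ι : Type} {g : ι → ℝ → ℝ} (hg : ∀ i, HasExp True s d (g i))
    (hs : ∀ V : ℝ, 0 < V → V < 1 → HasSum (fun i => g i V) (f V)) : HasExp True s d f := by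
  refine (tsum (ε := fun _ => 1) (by simp) hg fun V h h' => by
    simpa using (hs V h h').summable).congr le_rfl rfl fun V h h' => ?_
  simpa using (hs V h h').tsum_eq.symm

lemma geometric {m : ℕ} (hm : 1 ≤ m) : HasExp b 0 0 (fun V => (1 - V ^ (22 * m))⁻¹) := by
  refine of_true (of_hasSum (g := fun n V => V ^ (2 * ((11 * m * n : ℕ) : ℤ)))
    (fun n => (monomial _).congr (by positivity) ?_ fun _ _ _ => rfl) fun V h h' => ?_)
  · rw [Int.modEq_zero_iff_dvd]
    exact ⟨m * n, by push_cast; ring⟩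
  · convert hasSum_geometric_of_lt_one (by positivity : 0 ≤ V ^ (22 * m))
      (pow_lt_one₀ h.le h' (by omega)) using 2 with n
    rw [← pow_mul, ← zpow_natCast]
    congr 1
    push_cast
    ring

lemma inv_qPochFin {m : ℕ} (hm : 1 ≤ m) (N : ℕ) :
    HasExp b 0 0 (fun V => (qPochFin (V ^ 242) (V ^ (22 * m)) N)⁻¹) := by
  induction N with
  | zero => simpa [qPochFin] using one
  | succ N ih =>
    refine (ih.mul (geometric (m := m + 11 * N) (by omega))).congr le_rfl rfl fun V h h' => ?_
    rw [qPochFin_succ, mul_inv]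
    ring

lemma inv_qPoch {m : ℕ} (hm : 1 ≤ m) :
    HasExp b 0 0 (fun V => (qPoch (V ^ 242) (V ^ (22 * m)))⁻¹) := by
  let g : ℕ → ℝ → ℝ := fun n V => n.casesOn 1
    fun n => V ^ (2 * (11 * (m + 11 * n) : ℤ)) * (qPochFin (V ^ 242) (V ^ (22 * m)) (n + 1))⁻¹
  have hg : ∀ n, HasExp True 0 0 (g n) := by
    rintro (_ | n)
    · exact one
    · refine ((monomial (11 * (m + 11 * n) : ℤ)).mul (inv_qPochFin hm (n + 1))).congr
        (by positivity) ?_ fun V h h' => rfl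
      rw [Int.modEq_zero_iff_dvd]
      exact ⟨m + 11 * n, by ring⟩
  refine of_true (of_hasSum hg fun V h h' => ?_)
  have hx1 : V ^ (22 * m) < 1 := pow_lt_one₀ h.le h' (by omega)
  have hx0 : 0 < V ^ (22 * m) := by positivity
  have hq1 : V ^ 242 < 1 := pow_lt_one₀ h.le h' (by omega)
  have hq0 : 0 < V ^ 242 := by positivity
  have hpos : ∀ n, 0 < 1 - V ^ (22 * m) * (V ^ 242) ^ n := fun n => by
    have := mul_lt_one_of_nonneg_of_lt_one_left hx0.le hx1 (pow_le_one₀ hq0.le hq1.le : (V ^ 242) ^ n ≤ 1)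
    linarith
  have hP : ∀ N, 0 < qPochFin (V ^ 242) (V ^ (22 * m)) N := fun N => by
    rw [qPochFin]
    exact Finset.prod_pos fun i _ => hpos i
  rw [hasSum_iff_tendsto_nat_of_nonneg]
  · rw [← tendsto_add_atTop_iff_nat 1]
    have key : ∀ N, ∑ i ∈ range (N + 1), g i V = (qPochFin (V ^ 242) (V ^ (22 * m)) N)⁻¹ := by
      intro N
      induction N with
      | zero => simp [g, qPochFin]
      | succ N ih =>
        rw [sum_range_succ, ih]
        have e := hP N
        have e' := hP (N + 1)
        have e2 := hpos N
        simp only [g]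
        rw [qPochFin_succ] at *
        have : V ^ (2 * (11 * (m + 11 * N) : ℤ)) = V ^ (22 * m) * (V ^ 242) ^ N := by
          rw [← pow_mul, ← pow_add, ← zpow_natCast]
          congr 1
          push_cast
          ring
        rw [this]
        have h1 := e.ne'
        have h2 := e2.ne'
        field_simp
        ring
    simp only [key]
    exact (tendsto_qPochFin hq0 hq1 _).inv₀ (qPoch_pos hq0 hq1 hx1).ne'
  · rintro (_ | n)
    · simp [g]
    · have := hP (n + 1)
      simp only [g]
      positivity

end HasExp

end

section

open Filter Topology Finset

variable {q : ℝ}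

lemma tendsto_tsum_mul_pow_zero {c : ℕ → ℝ} {t : ℝ} (ht : 0 < t)
    (hs : Summable fun n => c n * t ^ n) :
    Tendsto (fun x => ∑' n, c n * x ^ n) (𝓝[>] 0) (𝓝 (c 0)) := by
  have e : ∑' n, c n * (0 : ℝ) ^ n = c 0 := by
    rw [tsum_eq_single 0 fun n hn => by simp [hn]]
    simp
  rw [← e]
  refine tendsto_tsum_of_dominated_convergence hs.norm (fun n => ?_) ?_
  · exact (((continuous_pow n).const_mul (c n)).tendsto 0).mono_left nhdsWithin_le_nhds
  · have : ∀ᶠ x : ℝ in 𝓝[>] 0, x ∈ Set.Ioo 0 t := Ioo_mem_nhdsGT ht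
    filter_upwards [this] with x hx n
    rw [norm_mul, norm_mul, norm_pow, norm_pow, Real.norm_of_nonneg hx.1.le,
      Real.norm_of_nonneg ht.le]
    gcongr
    exacts [hx.1.le, hx.2.le]

lemma qPoch_eq_qPochFin_mul (h0 : 0 < q) (h1 : q < 1) (x : ℝ) (N : ℕ) :
    qPoch q x = qPochFin q x N * qPoch q (x * q ^ N) := by
  induction N with
  | zero => simp [qPochFin]
  | succ N ih =>
    rw [ih, qPoch_eq_mul h0 h1 (x * q ^ N), qPochFin_succ, pow_succ, mul_assoc]
    congr 3
    ring

/-- A power series whose coefficients satisfy a first order `q`-recurrence is a quotient of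
infinite products. -/
theorem tsum_mul_qPoch (h0 : 0 < q) (h1 : q < 1) {u : ℕ → ℝ} {α β t : ℝ} (hu : u 0 = 1)
    (hr : ∀ n, u (n + 1) * (1 - q * q ^ n) = (α - β * q ^ n) * u n) (ht : 0 < t)
    (hs : Summable fun n => u n * t ^ n) :
    (∑' n, u n * t ^ n) * qPoch q (α * t) = qPoch q (β * t) := by
  set F : ℝ → ℝ := fun x => ∑' n, u n * x ^ n with hF
  have hsum : ∀ x, 0 < x → x ≤ t → Summable fun n => u n * x ^ n := fun x hx hxt => by
    refine Summable.of_norm_bounded hs.norm fun n => ?_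
    rw [norm_mul, norm_mul, norm_pow, norm_pow, Real.norm_of_nonneg hx.le,
      Real.norm_of_nonneg ht.le]
    gcongr
  have step : ∀ x, 0 < x → x ≤ t → (1 - α * x) * F x = (1 - β * x) * F (q * x) := by
    intro x hx hxt
    have s1 := hsum x hx hxt
    have s2 := hsum (q * x) (by positivity) (by nlinarith)
    have e1 : F x - F (q * x) = ∑' n, u n * x ^ n * (1 - q ^ n) := by
      rw [hF, ← s1.tsum_sub s2]
      exact tsum_congr fun n => by ring
    have s3 : Summable fun n => u n * x ^ n * (1 - q ^ n) :=
      (s1.sub s2).congr fun n => by ring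
    have e2 : ∑' n, u n * x ^ n * (1 - q ^ n) = x * (α * F x - β * F (q * x)) := by
      rw [s3.tsum_eq_zero_add, hF]
      simp only [pow_zero, sub_self, mul_zero, zero_add]
      rw [← tsum_mul_left, ← tsum_mul_left, ← (s1.mul_left α).tsum_sub (s2.mul_left β),
        ← tsum_mul_left]
      refine tsum_congr fun n => ?_
      linear_combination x ^ (n + 1) * hr n
    linear_combination e1 + e2
  have iter : ∀ N : ℕ, qPochFin q (α * t) N * F t = qPochFin q (β * t) N * F (q ^ N * t) := by
    intro N
    induction N with
    | zero => simp [qPochFin]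
    | succ N ih =>
      have := step (q ^ N * t) (by positivity)
        (mul_le_of_le_one_left ht.le (pow_le_one₀ h0.le h1.le))
      rw [qPochFin_succ, qPochFin_succ, pow_succ', mul_assoc q]
      linear_combination (1 - α * t * q ^ N) * ih + qPochFin q (β * t) N * this
  have l1 := (tendsto_qPochFin h0 h1 (α * t)).mul_const (F t)
  have l2 : Tendsto (fun N : ℕ => F (q ^ N * t)) atTop (𝓝 (u 0)) := by
    refine (tendsto_tsum_mul_pow_zero ht hs).comp (tendsto_nhdsWithin_iff.2 ⟨?_, ?_⟩)
    · simpa using (tendsto_pow_atTop_nhds_zero_of_lt_one h0.le h1).mul_const t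
    · exact Eventually.of_forall fun N => by simp only [Set.mem_Ioi]; positivity
  have l3 := (tendsto_qPochFin h0 h1 (β * t)).mul l2
  have := tendsto_nhds_unique (l1.congr iter) l3
  rw [hu, mul_one] at this
  rw [← this, mul_comm]

lemma mul_pow_ne_one (h0 : 0 < q) (h1 : q < 1) {x : ℝ} (hx : x < 1) (hx0 : 0 < x) (n : ℕ) :
    x * q ^ n ≠ 1 :=
  (mul_lt_one_of_nonneg_of_lt_one_left hx0.le hx (pow_le_one₀ h0.le h1.le)).ne

/-- The `q`-binomial theorem. -/
theorem hasSum_qBinomial (h0 : 0 < q) (h1 : q < 1) (a : ℝ) {t : ℝ} (ht : 0 < t) (ht1 : t < 1) :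
    HasSum (fun n => qPochFin q a n * (qPochFin q q n)⁻¹ * t ^ n)
      (qPoch q (a * t) / qPoch q t) := by
  have hq := mul_pow_ne_one h0 h1 h1 h0
  obtain ⟨A, hA⟩ := exists_qPochFin_le h0 h1 a
  obtain ⟨B, hB⟩ := exists_inv_qPochFin_le h0 h1 hq
  have hs : Summable fun n => qPochFin q a n * (qPochFin q q n)⁻¹ * t ^ n := by
    refine Summable.of_norm_bounded ((summable_geometric_of_lt_one ht.le ht1).mul_left (A * B))
      fun n => ?_
    rw [norm_mul, norm_mul, norm_pow, Real.norm_of_nonneg ht.le]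
    have := (abs_nonneg _).trans (hA 0)
    gcongr
    exacts [hA n, hB n]
  have := tsum_mul_qPoch (u := fun n => qPochFin q a n * (qPochFin q q n)⁻¹) (α := 1) (β := a)
    h0 h1 (by simp [qPochFin]) (fun n => by
      have e2 : 1 - q * q ^ n ≠ 0 := sub_ne_zero.2 (hq n).symm
      simp only [qPochFin_succ, mul_inv]
      linear_combination qPochFin q a n * (1 - a * q ^ n) * (qPochFin q q n)⁻¹ *
        inv_mul_cancel₀ e2) ht hs
  rw [one_mul] at this
  rw [← this, mul_div_assoc, div_self (qPoch_pos h0 h1 ht1).ne', mul_one]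
  exact hs.hasSum

/-- Euler's expansion of the infinite product. -/
theorem hasSum_euler (h0 : 0 < q) (h1 : q < 1) {t : ℝ} (ht : 0 < t) (ht1 : t < 1) :
    HasSum (fun n : ℕ => (-1) ^ n * (q ^ n.choose 2 * t ^ n * (qPochFin q q n)⁻¹))
      (qPoch q t) := by
  have hq := mul_pow_ne_one h0 h1 h1 h0
  obtain ⟨B, hB⟩ := exists_inv_qPochFin_le h0 h1 hq
  have hs : Summable fun n : ℕ => (-1) ^ n * q ^ n.choose 2 * (qPochFin q q n)⁻¹ * t ^ n := by
    refine Summable.of_norm_bounded ((summable_geometric_of_lt_one ht.le ht1).mul_left B)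
      fun n => ?_
    rw [norm_mul, norm_mul, norm_mul, norm_pow, norm_pow, norm_pow, Real.norm_of_nonneg ht.le,
      norm_neg, norm_one, one_pow, one_mul, Real.norm_of_nonneg h0.le]
    have : q ^ n.choose 2 ≤ 1 := pow_le_one₀ h0.le h1.le
    have := mul_le_mul this (hB n) (abs_nonneg _) zero_le_one
    rw [one_mul] at this
    gcongr
    exact this
  have := tsum_mul_qPoch (u := fun n => (-1) ^ n * q ^ n.choose 2 * (qPochFin q q n)⁻¹)
    (α := 0) (β := 1) h0 h1 (by simp [qPochFin]) (fun n => by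
      have e2 : 1 - q * q ^ n ≠ 0 := sub_ne_zero.2 (hq n).symm
      have e3 : (n + 1).choose 2 = n + n.choose 2 := by
        rw [Nat.choose_succ_succ' n 1, Nat.choose_one_right]
      simp only [qPochFin_succ, mul_inv, e3]
      linear_combination (-1) ^ (n + 1) * q ^ (n + n.choose 2) * (qPochFin q q n)⁻¹ *
        inv_mul_cancel₀ e2) ht hs
  rw [zero_mul, qPoch_zero, mul_one, one_mul] at this
  rw [← this]
  exact hs.hasSum.congr_fun fun n => by ring

namespace HasExp

variable {b : Prop} {s d : ℤ} {f g : ℝ → ℝ}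

lemma pow_mul (m : ℕ) : HasExp b 0 0 (fun V => V ^ (22 * m)) := by
  refine (monomial (11 * m : ℤ)).congr (by positivity) ?_ fun V _ _ => ?_
  · rw [Int.modEq_zero_iff_dvd]
    exact ⟨m, rfl⟩
  · rw [← zpow_natCast]
    congr 1
    push_cast
    ring

lemma qPoch {m : ℕ} (hm : 1 ≤ m) : HasExp False 0 0 (fun V => qPoch (V ^ 242) (V ^ (22 * m))) := by
  have key : ∀ V : ℝ, 0 < V → V < 1 → _ := fun V h h' =>
    hasSum_euler (q := V ^ 242) (t := V ^ (22 * m)) (by positivity)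
      (pow_lt_one₀ h.le h' (by norm_num)) (by positivity) (pow_lt_one₀ h.le h' (by omega))
  refine (tsum (ε := fun n : ℕ => (-1) ^ n) (g := fun n V => (V ^ 242) ^ n.choose 2 *
    (V ^ (22 * m)) ^ n * (qPochFin (V ^ 242) (V ^ 242) n)⁻¹) (by simp) (fun n => ?_)
    fun V h h' => (key V h h').summable).congr le_rfl rfl fun V h h' => (key V h h').tsum_eq.symm
  refine ((pow_mul (11 * n.choose 2 + m * n)).mul (inv_qPochFin (m := 11) (by norm_num) n)).congr
    le_rfl rfl fun V _ _ => ?_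
  rw [← _root_.pow_mul, ← _root_.pow_mul, ← pow_add]
  ring_nf

lemma div_jTheta {m : ℕ} (hm : 1 ≤ m) (hm' : m ≤ 10) :
    HasExp b 0 0 (fun V => _root_.qPoch (V ^ 242) (V ^ 242) / jTheta (V ^ 242) (V ^ (22 * m))) := by
  refine of_true (of_hasSum (g := fun n V => V ^ (22 * (m * n)) *
    (qPochFin (V ^ 242) (V ^ (22 * 11)) n)⁻¹ *
    (_root_.qPoch (V ^ 242) (V ^ (22 * (11 * (n + 1) - m))))⁻¹) (fun n => ?_) fun V h h' => ?_)
  · exact (((pow_mul _).mul (inv_qPochFin (by norm_num) n)).mul (inv_qPoch (by omega))).congr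
      le_rfl rfl fun _ _ _ => rfl
  · have hq0 : 0 < V ^ 242 := by positivity
    have hq1 : V ^ 242 < 1 := pow_lt_one₀ h.le h' (by norm_num)
    have ht0 : 0 < V ^ (22 * m) := by positivity
    have hz : V ^ 242 / V ^ (22 * m) = V ^ (22 * (11 - m)) := by
      rw [div_eq_iff ht0.ne', ← pow_add]
      congr 1
      omega
    have hz1 : V ^ (22 * (11 - m)) < 1 := pow_lt_one₀ h.le h' (by omega)
    have e := (hasSum_qBinomial hq0 hq1 (V ^ (22 * (11 - m))) ht0
      (pow_lt_one₀ h.le h' (by omega))).mul_right (_root_.qPoch (V ^ 242) (V ^ (22 * (11 - m))))⁻¹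
    rw [← hz, div_mul_cancel₀ _ ht0.ne', ← div_eq_mul_inv, div_div, ← jTheta, hz] at e
    refine e.congr_fun fun n => ?_
    have hx : V ^ (22 * (11 - m)) * (V ^ 242) ^ n = V ^ (22 * (11 * (n + 1) - m)) := by
      rw [← _root_.pow_mul, ← pow_add]
      congr 1
      omega
    have hne := qPochFin_ne_zero (mul_pow_ne_one hq0 hq1 hz1 (by positivity)) n
    rw [qPoch_eq_qPochFin_mul hq0 hq1 (V ^ (22 * (11 - m))) n, hx, mul_inv]
    field_simp
    rw [← _root_.pow_mul]
    ring_nf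

end HasExp

end

section

open Filter Topology Finset

namespace HasExp

variable {b : Prop} {s d : ℤ} {f g : ℝ → ℝ}

lemma zpow_mul (m : ℤ) : HasExp b (11 * m) 0 (fun V => V ^ (22 * m)) := by
  refine (monomial (11 * m)).congr le_rfl ?_ fun V _ _ => by ring_nf
  rw [Int.modEq_zero_iff_dvd]
  exact ⟨m, rfl⟩

lemma jTheta_inv {m : ℕ} (hm : 1 ≤ m) (hm' : m ≤ 10) :
    HasExp b 0 0 (fun V => (jTheta (V ^ 242) (V ^ (22 * m)))⁻¹) :=
  ((inv_qPoch (m := 11) (by norm_num)).mul (div_jTheta hm hm')).congr le_rfl rfl fun V h h' => by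
    have hq1 : V ^ 242 < 1 := pow_lt_one₀ h.le h' (by norm_num)
    have := (qPoch_pos (by positivity) hq1 hq1).ne'
    field_simp

lemma jTheta {m : ℕ} (hm : 1 ≤ m) (hm' : m ≤ 10) :
    HasExp False 0 0 (fun V => jTheta (V ^ 242) (V ^ (22 * m))) :=
  ((qPoch hm).mul (qPoch (m := 11 - m) (by omega))).congr le_rfl rfl fun V h _ => by
    have ht0 : 0 < V ^ (22 * m) := by positivity
    have hz : V ^ 242 / V ^ (22 * m) = V ^ (22 * (11 - m)) := by
      rw [div_eq_iff ht0.ne', ← pow_add]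
      congr 1
      omega
    rw [_root_.jTheta, hz]

lemma jTheta_zpow {m : ℕ} (hm : 1 ≤ m) (hm' : m ≤ 10) {e : ℤ} (he : b → e ≤ 0) :
    HasExp b 0 0 (fun V => _root_.jTheta (V ^ 242) (V ^ (22 * m)) ^ e) := by
  obtain ⟨n, rfl | rfl⟩ := e.eq_nat_or_neg
  · rcases n.eq_zero_or_pos with rfl | hn
    · simpa using one
    · have hb : b = False := eq_false fun h => by have := he h; omega
      subst hb
      simpa using (jTheta hm hm').pow n
  · simpa using (jTheta_inv (b := b) hm hm').pow n

/-- The expansion of an Appell–Lerch sum. -/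
lemma appell {r : ℕ} (hr : 1 ≤ r) (hr' : r ≤ 10) {D : ℕ} (hD : 1 ≤ D) :
    HasExp False 0 0 (fun V => appell (V ^ 242) D (-1) (V ^ (22 * r))) := by
  let g : ℤ → ℝ → ℝ := fun n V => V ^ (22 * (11 * D * tri n)) * if 0 ≤ n then
    (1 - V ^ (22 * (r + 11 * n.toNat)))⁻¹ else
    V ^ (22 * (-r - 11 * n).toNat) * (1 - V ^ (22 * (-r - 11 * n).toNat))⁻¹
  have tri0 : ∀ n, 0 ≤ tri n := fun n => by
    have := two_mul_tri n
    rcases le_or_gt 0 n with h | h <;> nlinarith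
  have hg : ∀ n, HasExp True 0 0 (g n) := fun n => by
    rcases le_or_gt 0 n with hn | hn
    · refine ((zpow_mul (11 * D * tri n)).mul (geometric (m := r + 11 * n.toNat) (by omega))).congr
        (by have := tri0 n; positivity) rfl fun V _ _ => by simp only [g, if_pos hn]
    · refine ((zpow_mul (11 * D * tri n)).mul ((pow_mul (-r - 11 * n).toNat).mul
        (geometric (m := (-r - 11 * n).toNat) (by omega)))).congr
        (by have := tri0 n; positivity) rfl fun V _ _ => by simp only [g, if_neg hn.not_ge]
  have key : ∀ V : ℝ, 0 < V → V < 1 → ∀ n : ℤ, (-1) ^ n * (if 0 ≤ n then 1 else -1) * g n V =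
      (-1) ^ n * (V ^ 242) ^ ((D : ℤ) * tri n) / (1 - V ^ (22 * r) * (V ^ 242) ^ n) := by
    intro V h h' n
    have e1 : (V ^ 242) ^ ((D : ℤ) * tri n) = V ^ (22 * (11 * D * tri n)) := by
      rw [← zpow_natCast V 242, ← _root_.zpow_mul]
      congr 1
      push_cast
      ring
    have e2 : V ^ (22 * r) * (V ^ 242) ^ n = V ^ (22 * (r + 11 * n)) := by
      rw [← zpow_natCast V 242, ← _root_.zpow_mul, ← zpow_natCast V (22 * r), ← zpow_add₀ h.ne']
      congr 1
      push_cast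
      ring
    rw [e1, e2]
    rcases le_or_gt 0 n with hn | hn
    · have e3 : V ^ (22 * (r + 11 * n.toNat)) = V ^ (22 * (r + 11 * n)) := by
        rw [← zpow_natCast]
        congr 1
        push_cast
        rw [Int.toNat_of_nonneg hn]
      simp only [g, if_pos hn, e3]
      ring
    · have e3 : V ^ (22 * (-r - 11 * n).toNat) = (V ^ (22 * (r + 11 * n)))⁻¹ := by
        rw [← zpow_natCast, ← zpow_neg]
        congr 1
        push_cast
        rw [Int.toNat_of_nonneg (by omega)]
        ring
      have hx : 0 < V ^ (22 * (r + 11 * n)) := by positivity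
      have hx1 : V ^ (22 * (r + 11 * n)) ≠ 1 := by
        refine (one_lt_zpow_of_neg₀ h h' ?_).ne'
        omega
      have hx2 : 1 - V ^ (22 * (r + 11 * n)) ≠ 0 := sub_ne_zero.2 hx1.symm
      have hx3 : V ^ (22 * (r + 11 * n)) - 1 ≠ 0 := sub_ne_zero.2 hx1
      simp only [g, if_neg hn.not_ge, e3]
      generalize V ^ (22 * ((r : ℤ) + 11 * n)) = y at *
      have : y⁻¹ * (1 - y⁻¹)⁻¹ = -(1 - y)⁻¹ := by
        rw [← mul_inv, mul_sub, mul_inv_cancel₀ hx.ne', mul_one, ← neg_sub 1 y, inv_neg]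
      rw [this]
      ring
  refine (tsum (ε := fun n : ℤ => (-1) ^ n * (if 0 ≤ n then 1 else -1)) (by simp) hg
    fun V h h' => ?_).congr le_rfl rfl fun V h h' => ?_
  · refine Summable.congr ?_ fun n => (key V h h' n).symm
    exact summable_appell (by positivity) (pow_lt_one₀ h.le h' (by norm_num)) (by norm_num)
      (by positivity) hD
  · rw [_root_.appell]
    exact tsum_congr fun n => (key V h h' n).symm

end HasExp

lemma thetaPrefactor_mul_mon {V : ℝ} (h : 0 < V) (a b c d e : ℤ) :
    thetaPrefactor V * mon (thetaZ V) a b c d e = (-1) ^ (a + c + e) *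
      (V ^ (2 * (-126 - 5 * a - 9 * b - 12 * c - 14 * d - 15 * e)) * (qPoch (V ^ 242) (V ^ 242) *
        (jTheta (V ^ 242) (V ^ (22 * 1)) ^ a * jTheta (V ^ 242) (V ^ (22 * 2)) ^ b *
        jTheta (V ^ 242) (V ^ (22 * 3)) ^ c * jTheta (V ^ 242) (V ^ (22 * 4)) ^ d *
        jTheta (V ^ 242) (V ^ (22 * 5)) ^ e))) := by
  have e1 : V ^ (2 * (-126 - 5 * a - 9 * b - 12 * c - 14 * d - 15 * e)) =
      (V ^ 252)⁻¹ * (V ^ (-10 : ℤ)) ^ a * (V ^ (-18 : ℤ)) ^ b * (V ^ (-24 : ℤ)) ^ c *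
        (V ^ (-28 : ℤ)) ^ d * (V ^ (-30 : ℤ)) ^ e := by
    simp only [← zpow_mul, ← zpow_natCast V 252, ← zpow_neg, ← zpow_add₀ h.ne']
    congr 1
    push_cast
    ring
  have e2 : ((-1 : ℝ)) ^ (a + c + e) = (-1) ^ a * (-1) ^ c * (-1) ^ e := by
    rw [zpow_add₀ (by norm_num), zpow_add₀ (by norm_num)]
  have z1 : thetaZ V 1 = -1 * V ^ (-10 : ℤ) * jTheta (V ^ 242) (V ^ (22 * 1)) := by
    simp only [thetaZ, ← zpow_natCast V]
    norm_num
  have z2 : thetaZ V 2 = V ^ (-18 : ℤ) * jTheta (V ^ 242) (V ^ (22 * 2)) := by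
    simp only [thetaZ, ← zpow_natCast V]
    norm_num
  have z3 : thetaZ V 3 = -1 * V ^ (-24 : ℤ) * jTheta (V ^ 242) (V ^ (22 * 3)) := by
    simp only [thetaZ, ← zpow_natCast V]
    norm_num [Odd.neg_one_zpow (by decide : Odd (3 : ℤ))]
  have z4 : thetaZ V 4 = V ^ (-28 : ℤ) * jTheta (V ^ 242) (V ^ (22 * 4)) := by
    simp only [thetaZ, ← zpow_natCast V]
    norm_num [Even.neg_one_zpow (by decide : Even (4 : ℤ))]
  have z5 : thetaZ V 5 = -1 * V ^ (-30 : ℤ) * jTheta (V ^ 242) (V ^ (22 * 5)) := by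
    simp only [thetaZ, ← zpow_natCast V]
    norm_num [Odd.neg_one_zpow (by decide : Odd (5 : ℤ))]
  rw [e1, e2, thetaPrefactor, mon, z1, z2, z3, z4, z5]
  simp only [mul_zpow]
  ring

end

section

open Filter Topology Finset

namespace HasExp

/-- The product in the theta quotients of weight `-6`. -/
lemma qPoch_mul_jTheta_zpow {b : Prop} {x y z u v : ℤ}
    (hb : b → x ≤ 0 ∧ y ≤ 0 ∧ z ≤ 0 ∧ u ≤ 0 ∧ v ≤ 0 ∧ x + y + z + u + v < 0) :
    HasExp b 0 0 (fun V => _root_.qPoch (V ^ 242) (V ^ 242) *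
      (_root_.jTheta (V ^ 242) (V ^ (22 * 1)) ^ x * _root_.jTheta (V ^ 242) (V ^ (22 * 2)) ^ y *
      _root_.jTheta (V ^ 242) (V ^ (22 * 3)) ^ z * _root_.jTheta (V ^ 242) (V ^ (22 * 4)) ^ u *
      _root_.jTheta (V ^ 242) (V ^ (22 * 5)) ^ v)) := by
  have key : ∀ x y z u v : ℤ, (b → x ≤ 0 ∧ y ≤ 0 ∧ z ≤ 0 ∧ u ≤ 0 ∧ v ≤ 0) →
      HasExp b 0 0 (fun V => _root_.jTheta (V ^ 242) (V ^ (22 * 1)) ^ x *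
        _root_.jTheta (V ^ 242) (V ^ (22 * 2)) ^ y * _root_.jTheta (V ^ 242) (V ^ (22 * 3)) ^ z *
        _root_.jTheta (V ^ 242) (V ^ (22 * 4)) ^ u * _root_.jTheta (V ^ 242) (V ^ (22 * 5)) ^ v) := by
    intro x y z u v h
    exact ((((jTheta_zpow (m := 1) (by norm_num) (by norm_num) fun hb => (h hb).1).mul
      (jTheta_zpow (m := 2) (by norm_num) (by norm_num) fun hb => (h hb).2.1)).mul
      (jTheta_zpow (m := 3) (by norm_num) (by norm_num) fun hb => (h hb).2.2.1)).mul
      (jTheta_zpow (m := 4) (by norm_num) (by norm_num) fun hb => (h hb).2.2.2.1)).mul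
      (jTheta_zpow (m := 5) (by norm_num) (by norm_num) fun hb => (h hb).2.2.2.2)
  have ne : ∀ V : ℝ, 0 < V → V < 1 → ∀ m : ℕ, 1 ≤ m → m ≤ 10 →
      _root_.jTheta (V ^ 242) (V ^ (22 * m)) ≠ 0 := fun V h h' m hm hm' => by
    have := jTheta_zpow_ne_zero h h' (a := m) (by omega)
    rwa [show (22 * (m : ℤ)) = ((22 * m : ℕ) : ℤ) by push_cast; ring, zpow_natCast] at this
  by_cases hB : b
  · obtain ⟨h1, h2, h3, h4, h5, h6⟩ := hb hB
    have : x < 0 ∨ y < 0 ∨ z < 0 ∨ u < 0 ∨ v < 0 := by omega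
    rcases this with h | h | h | h | h
    · refine ((div_jTheta (m := 1) (by norm_num) (by norm_num)).mul
        (key (x + 1) y z u v fun _ => by omega)).congr le_rfl rfl fun V h h' => ?_
      rw [zpow_add_one₀ (ne V h h' 1 (by norm_num) (by norm_num))]
      have := ne V h h' 1 (by norm_num) (by norm_num)
      field_simp
    · refine ((div_jTheta (m := 2) (by norm_num) (by norm_num)).mul
        (key x (y + 1) z u v fun _ => by omega)).congr le_rfl rfl fun V h h' => ?_
      rw [zpow_add_one₀ (ne V h h' 2 (by norm_num) (by norm_num))]
      have := ne V h h' 2 (by norm_num) (by norm_num)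
      field_simp
    · refine ((div_jTheta (m := 3) (by norm_num) (by norm_num)).mul
        (key x y (z + 1) u v fun _ => by omega)).congr le_rfl rfl fun V h h' => ?_
      rw [zpow_add_one₀ (ne V h h' 3 (by norm_num) (by norm_num))]
      have := ne V h h' 3 (by norm_num) (by norm_num)
      field_simp
    · refine ((div_jTheta (m := 4) (by norm_num) (by norm_num)).mul
        (key x y z (u + 1) v fun _ => by omega)).congr le_rfl rfl fun V h h' => ?_
      rw [zpow_add_one₀ (ne V h h' 4 (by norm_num) (by norm_num))]
      have := ne V h h' 4 (by norm_num) (by norm_num)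
      field_simp
    · refine ((div_jTheta (m := 5) (by norm_num) (by norm_num)).mul
        (key x y z u (v + 1) fun _ => by omega)).congr le_rfl rfl fun V h h' => ?_
      rw [zpow_add_one₀ (ne V h h' 5 (by norm_num) (by norm_num))]
      have := ne V h h' 5 (by norm_num) (by norm_num)
      field_simp
  · have e : b = False := eq_false hB
    subst e
    exact ((qPoch (m := 11) (by norm_num)).mul (key x y z u v (by simp))).congr le_rfl rfl
      fun V _ _ => rfl

lemma thetaPrefactor_mul_mon {b : Prop} {n x y z u v : ℤ}
    (hb : b → 0 ≤ ThetaTerm.sgn (x + z + v) * n ∧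
      x ≤ 0 ∧ y ≤ 0 ∧ z ≤ 0 ∧ u ≤ 0 ∧ v ≤ 0 ∧ x + y + z + u + v < 0) :
    HasExp b (-126 - 5 * x - 9 * y - 12 * z - 14 * u - 15 * v)
      (-126 - 5 * x - 9 * y - 12 * z - 14 * u - 15 * v)
      (fun V => thetaPrefactor V * ThetaTerm.val (thetaZ V) (n, x, y, z, u, v)) := by
  refine (((monomial (-126 - 5 * x - 9 * y - 12 * z - 14 * u - 15 * v)).mul
    (qPoch_mul_jTheta_zpow fun h => (hb h).2)).smul ((ThetaTerm.sgn (x + z + v) * n : ℤ) : ℝ)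
    fun h => by exact_mod_cast (hb h).1).congr (by simp) (by simp) fun V h h' => ?_
  have := _root_.thetaPrefactor_mul_mon h x y z u v
  rw [ThetaSys.neg_one_zpow] at this
  rw [ThetaTerm.val]
  push_cast
  linear_combination (n : ℝ) * this

end HasExp

/-- `f V` is an absolutely convergent sum of terms `c * V ^ (2 * k)`, with `k` bounded below,
whose coefficients are nonnegative for `k ≡ d` modulo eleven. -/
def NonnegOn (d : ℤ) (f : ℝ → ℝ) : Prop :=
  ∃ (ι : Type) (c : ι → ℝ) (k : ι → ℤ) (s : ℤ), (∀ i, s ≤ k i) ∧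
    (∀ i, k i ≡ d [ZMOD 11] → 0 ≤ c i) ∧ ∀ V : ℝ, 0 < V → V < 1 →
      HasSum (fun i => c i * V ^ (2 * k i)) (f V)

lemma HasExp.nonnegOn {b : Prop} {s d d' : ℤ} {f : ℝ → ℝ} (h : HasExp b s d' f)
    (hd : d' ≡ d [ZMOD 11] → b) : NonnegOn d f := by
  obtain ⟨ι, c, k, hb, h1, h2, h3⟩ := h
  exact ⟨ι, c, k, s, h1, fun i hi => hb (hd ((h2 i).symm.trans hi)) i, h3⟩

namespace NonnegOn

variable {d : ℤ} {f g : ℝ → ℝ}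

lemma congr (h : NonnegOn d f) (hf : ∀ V : ℝ, 0 < V → V < 1 → g V = f V) : NonnegOn d g := by
  obtain ⟨ι, c, k, s, h1, h2, h3⟩ := h
  exact ⟨ι, c, k, s, h1, h2, fun V h h' => by rw [hf V h h']; exact h3 V h h'⟩

lemma zero : NonnegOn d (fun _ => 0) :=
  ⟨Empty, Empty.elim, Empty.elim, 0, fun i => i.elim, fun i => i.elim, fun _ _ _ => hasSum_empty⟩

lemma smul (h : NonnegOn d f) {x : ℝ} (hx : 0 ≤ x) : NonnegOn d (fun V => x * f V) := by
  obtain ⟨ι, c, k, s, h1, h2, h3⟩ := h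
  refine ⟨ι, fun i => x * c i, k, s, h1, fun i hi => mul_nonneg hx (h2 i hi), fun V h h' => ?_⟩
  simpa [mul_assoc] using (h3 V h h').mul_left x

lemma add (hf : NonnegOn d f) (hg : NonnegOn d g) : NonnegOn d (fun V => f V + g V) := by
  obtain ⟨ι, c, k, s, h1, h2, h3⟩ := hf
  obtain ⟨ι', c', k', s', h1', h2', h3'⟩ := hg
  refine ⟨ι ⊕ ι', Sum.elim c c', Sum.elim k k', min s s', ?_, ?_, fun V h h' => ?_⟩
  · rintro (i | i)
    exacts [(min_le_left _ _).trans (h1 i), (min_le_right _ _).trans (h1' i)]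
  · rintro (i | i)
    exacts [h2 i, h2' i]
  · exact HasSum.sum (f := fun i => Sum.elim c c' i * V ^ (2 * Sum.elim k k' i)) (h3 V h h')
      (h3' V h h')

end NonnegOn

/-- Two power series agreeing on `(0, 1)` have the same coefficients. -/
lemma powerSeries_coeff_unique {a b : ℕ → ℝ} {F : ℝ → ℝ}
    (ha : ∀ x : ℝ, 0 < x → x < 1 → HasSum (fun n => a n * x ^ n) (F x))
    (hb : ∀ x : ℝ, 0 < x → x < 1 → HasSum (fun n => b n * x ^ n) (F x)) (n : ℕ) : a n = b n := by
  have hd : ∀ x : ℝ, 0 < x → x < 1 → HasSum (fun n => (a n - b n) * x ^ n) 0 := fun x h h' => by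
    simpa [sub_mul] using (ha x h h').sub (hb x h h')
  rw [← sub_eq_zero]
  induction n using Nat.strong_induction_on with
  | _ n ih =>
    have e : ∀ x : ℝ, 0 < x → x < 1 → HasSum (fun m => (a (m + n) - b (m + n)) * x ^ m) 0 := by
      intro x h h'
      have h1 := (hasSum_nat_add_iff' n).2 (hd x h h')
      rw [sum_eq_zero fun i hi => by rw [ih i (mem_range.1 hi), zero_mul], sub_zero] at h1
      have h2 := h1.mul_right (x ^ n)⁻¹
      rw [zero_mul] at h2
      refine h2.congr_fun fun m => ?_
      rw [pow_add]
      field_simp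
    have l := tendsto_tsum_mul_pow_zero (c := fun m => a (m + n) - b (m + n)) (t := 1 / 2)
      (by norm_num) (e _ (by norm_num) (by norm_num)).summable
    have l2 : Tendsto (fun x : ℝ => ∑' m, (a (m + n) - b (m + n)) * x ^ m) (𝓝[>] 0) (𝓝 0) := by
      refine tendsto_const_nhds.congr' ?_
      have : ∀ᶠ x : ℝ in 𝓝[>] 0, x ∈ Set.Ioo 0 1 := Ioo_mem_nhdsGT one_pos
      filter_upwards [this] with x hx
      exact (e x hx.1 hx.2).tsum_eq.symm
    simpa using tendsto_nhds_unique l l2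

theorem NonnegOn.coeff_nonneg {d : ℤ} {f : ℝ → ℝ} (h : NonnegOn d f) {a : ℕ → ℝ}
    (ha : ∀ V : ℝ, 0 < V → V < 1 → HasSum (fun n => a n * (V ^ 2) ^ n) (f V)) {n : ℕ}
    (hn : n ≡ d [ZMOD 11]) : 0 ≤ a n := by
  obtain ⟨ι, c, k, s, h1, h2, h3⟩ := h
  obtain ⟨N, hN⟩ : ∃ N : ℕ, -s ≤ N := ⟨(-s).toNat, Int.self_le_toNat _⟩
  let m : ι → ℕ := fun i => (k i + N).toNat
  have hm : ∀ i, (m i : ℤ) = k i + N := fun i => Int.toNat_of_nonneg (by have := h1 i; omega)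
  let b : ℕ → ℝ := fun j => ∑' i : {i // m i = j}, c i
  have hb : ∀ x : ℝ, 0 < x → x < 1 → HasSum (fun j => b j * x ^ j) (x ^ N * f (√x)) := by
    intro x hx hx1
    have hV := h3 (√x) (Real.sqrt_pos.2 hx) (by rwa [Real.sqrt_lt' one_pos, one_pow])
    have e : ∀ i, x ^ N * (c i * √x ^ (2 * k i)) = c i * x ^ m i := fun i => by
      rw [zpow_mul, show √x ^ (2 : ℤ) = x from by
        rw [← Nat.cast_ofNat, zpow_natCast]; exact Real.sq_sqrt hx.le, ← zpow_natCast x (m i), hm,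
        zpow_add₀ hx.ne', zpow_natCast]
      ring
    have s1 : HasSum (fun i => c i * x ^ m i) (x ^ N * f √x) :=
      (hV.mul_left (x ^ N)).congr_fun fun i => (e i).symm
    have s2 := (Equiv.sigmaFiberEquiv m).hasSum_iff.2 s1
    refine s2.sigma fun j => ?_
    have s3 : Summable fun i : {i // m i = j} => c i * x ^ j :=
      (s1.summable.comp_injective Subtype.val_injective).congr fun i => by simp [i.2]
    have s4 : HasSum (fun i : {i // m i = j} => c i * x ^ j) (b j * x ^ j) := by
      have := s3.hasSum
      rwa [tsum_mul_right] at this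
    refine s4.congr_fun fun i => ?_
    simp [Equiv.sigmaFiberEquiv, i.2]
  have ha' : ∀ x : ℝ, 0 < x → x < 1 →
      HasSum (fun j => (if j < N then 0 else a (j - N)) * x ^ j) (x ^ N * f (√x)) := by
    intro x hx hx1
    rw [← hasSum_nat_add_iff' N, sum_eq_zero fun i hi => by simp [mem_range.1 hi], sub_zero]
    have := (ha (√x) (Real.sqrt_pos.2 hx) (by rwa [Real.sqrt_lt' one_pos, one_pow])).mul_left (x ^ N)
    refine this.congr_fun fun j => ?_
    rw [Real.sq_sqrt hx.le]
    simp [pow_add]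
    ring
  have e := powerSeries_coeff_unique ha' hb (n + N)
  simp only [add_lt_iff_neg_right, not_lt_zero, if_false, add_tsub_cancel_right] at e
  rw [e]
  refine tsum_nonneg fun i => h2 i ?_
  have := hm i
  rw [i.2] at this
  have : k i = n := by push_cast at this; omega
  rwa [this]

end

section

open Filter Topology Finset

namespace NonnegOn

variable {d : ℤ}

lemma zero_smul (f : ℝ → ℝ) : NonnegOn d (fun V => ((0 : ℤ) : ℝ) * f V) :=
  zero.congr fun V _ _ => by simp

/-- A term whose exponents avoid the residue class `d` is irrelevant. -/
lemma of_class {d' s : ℤ} {b : Prop} {f : ℝ → ℝ} (h : HasExp b s d' f) (hd : ¬ d' ≡ d [ZMOD 11])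
    (x : ℝ) : NonnegOn d (fun V => x * f V) := by
  obtain ⟨ι, c, k, -, h1, h2, h3⟩ := h
  exact ⟨ι, fun i => x * c i, k, s, h1, fun i hi => (hd ((h2 i).symm.trans hi)).elim, fun V h h' =>
    by simpa [mul_assoc] using (h3 V h h').mul_left x⟩

end NonnegOn

namespace ThetaTerm

/-- A sufficient condition for a term to be nonnegative on the class `d`. -/
def nonnegOn (d : ℤ) : ThetaTerm → Bool
  | (n, x, y, z, u, v) => cls (n, x, y, z, u, v) ≠ (d + 5) % 11 ||
    (0 ≤ sgn (x + z + v) * n && x ≤ 0 && y ≤ 0 && z ≤ 0 && u ≤ 0 && v ≤ 0 &&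
      x + y + z + u + v < 0)

lemma nonnegOn_val {d : ℤ} {t : ThetaTerm} (h : t.nonnegOn d = true) :
    NonnegOn d (fun V => thetaPrefactor V * t.val (thetaZ V)) := by
  obtain ⟨n, x, y, z, u, v⟩ := t
  simp only [nonnegOn, cls, Bool.or_eq_true, Bool.and_eq_true, decide_eq_true_eq] at h
  refine (HasExp.thetaPrefactor_mul_mon
    (b := 0 ≤ ThetaTerm.sgn (x + z + v) * n ∧
      x ≤ 0 ∧ y ≤ 0 ∧ z ≤ 0 ∧ u ≤ 0 ∧ v ≤ 0 ∧ x + y + z + u + v < 0) id).nonnegOn fun hd => ?_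
  rcases h with h | h
  · rw [Int.ModEq] at hd
    exact absurd (of_decide_eq_true h) (by omega)
  · tauto

end ThetaTerm

lemma NonnegOn.thetaSum {d : ℤ} {T : List ThetaTerm} (h : T.all (ThetaTerm.nonnegOn d) = true) :
    NonnegOn d (fun V => thetaPrefactor V * thetaSum (thetaZ V) T) := by
  induction T with
  | nil => exact NonnegOn.zero.congr fun V _ _ => by simp [_root_.thetaSum]
  | cons t T ih =>
    rw [List.all_cons, Bool.and_eq_true] at h
    exact ((ThetaTerm.nonnegOn_val h.1).add (ih h.2)).congr fun V _ _ => by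
      rw [thetaSum_cons, mul_add]

/-- A certificate `C` that the theta quotients in `L` sum to a function nonnegative on `d`. -/
def nonnegCheck (d : ℤ) (bases C L : List ThetaTerm) : Bool :=
  C.all (ThetaTerm.nonnegOn d) && curveCheck bases
    (L.filter (fun t => t.cls = (d + 5) % 11) ++ C.map (ThetaTerm.smul (-1)))

lemma thetaSum_filter (Z : ℤ → ℝ) (p : ThetaTerm → Bool) (T : List ThetaTerm) :
    thetaSum Z T = thetaSum Z (T.filter p) + thetaSum Z (T.filter fun t => !p t) := by
  induction T with
  | nil => simp [thetaSum]
  | cons t T ih =>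
    rw [thetaSum_cons, ih, List.filter_cons, List.filter_cons]
    cases p t <;> simp [thetaSum_cons] <;> ring

lemma NonnegOn.of_check {d : ℤ} {bases C L : List ThetaTerm}
    (h : nonnegCheck d bases C L = true) :
    NonnegOn d (fun V => thetaPrefactor V * _root_.thetaSum (thetaZ V) L) := by
  rw [nonnegCheck, Bool.and_eq_true] at h
  have h2 : (L.filter fun t => !decide (t.cls = (d + 5) % 11)).all (ThetaTerm.nonnegOn d) =
      true := by
    rw [List.all_eq_true]
    intro t ht
    rw [List.mem_filter] at ht
    obtain ⟨n, x, y, z, u, v⟩ := t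
    have := ht.2
    simp only [Bool.not_eq_true', decide_eq_false_iff_not] at this
    simp [ThetaTerm.nonnegOn, this]
  refine ((NonnegOn.thetaSum h.1).add (NonnegOn.thetaSum h2)).congr fun V h0 h1 => ?_
  have := (thetaSys h0 h1).thetaSum_eq_zero _ h.2
  rw [thetaSum_append, thetaSum_smul] at this
  push_cast at this
  rw [thetaSum_filter _ (fun t => decide (t.cls = (d + 5) % 11)) L]
  linear_combination thetaPrefactor V * this

/-- The mock theta function in the dissection of the rank generating function. -/
noncomputable def rankMock (V : ℝ) (r : ℕ) : ℝ :=
  lambertPart V 3 r 0 / (V ^ 10 * qPoch (V ^ 242) (V ^ 242))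

lemma hasExp_rankMock {r : ℕ} (hr : 1 ≤ r) (hr' : r ≤ 5) :
    ∃ s, HasExp False s ((33 * r - 3 * r ^ 2 - 10) / 2) (fun V => rankMock V r) := by
  have he : 2 * (((33 * r - 3 * r ^ 2 - 10) / 2 : ℤ)) = 33 * r - 3 * r ^ 2 - 10 := by
    interval_cases r <;> norm_num
  have h := (((HasExp.monomial ((33 * r - 3 * r ^ 2 - 10) / 2 : ℤ)).mul
    (HasExp.appell hr (by omega) (D := 3) (by norm_num))).mul
    (HasExp.inv_qPoch (m := 11) (b := False) (by norm_num))).smul ((-1) ^ r) False.elim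
  refine ⟨_, h.congr le_rfl (by rw [add_zero, add_zero]) fun V h0 h1 => ?_⟩
  rw [rankMock, lambertPart_zero, he, ← zpow_natCast V 10]
  have e : V ^ ((3 : ℕ) * (11 * r - (r : ℤ) ^ 2)) =
      V ^ (33 * r - 3 * (r : ℤ) ^ 2 - 10) * V ^ ((10 : ℕ) : ℤ) := by
    rw [← zpow_add₀ h0.ne']; congr 1; push_cast; ring
  have e' : V ^ (22 * (r : ℤ)) = V ^ (22 * r) := by
    rw [← zpow_natCast]; push_cast; rfl
  have : V ^ ((10 : ℕ) : ℤ) ≠ 0 := (zpow_pos h0 _).ne'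
  rw [e, e', zpow_natCast (-1 : ℝ)]
  field_simp

/-- The theta quotients in a linear combination of rank and crank generating functions. -/
def combTerms (n₀ n₁ n₂ n₃ n₄ n₅ m₀ m₁ m₂ : ℤ) : List ThetaTerm :=
  (rankTerms.map (ThetaTerm.diamond 1)).map (ThetaTerm.smul (n₂ - n₃)) ++
  (rankTerms.map (ThetaTerm.diamond 2)).map (ThetaTerm.smul (n₁ - 2 * n₀)) ++
  (rankTerms.map (ThetaTerm.diamond 3)).map (ThetaTerm.smul (n₄ - n₃)) ++
  (rankTerms.map (ThetaTerm.diamond 4)).map (ThetaTerm.smul (n₄ - n₅)) ++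
  (rankTerms.map (ThetaTerm.diamond 5)).map (ThetaTerm.smul (n₁ - n₂)) ++
  (crankTerms.map (ThetaTerm.diamond 5)).map (ThetaTerm.smul (2 * m₀ - m₁)) ++
  (crankTerms.map (ThetaTerm.diamond 4)).map (ThetaTerm.smul (m₁ - m₂)) ++
  (crankTerms.map (ThetaTerm.diamond 3)).map (ThetaTerm.smul m₂)

/-- The theta quotient and Appell part of the rank generating function, up to an eta factor. -/
noncomputable def rankQuot (V : ℝ) (r : ℕ) : ℝ :=
  (rankSeries V (17 - 3 * r) - (1 - 3 * r / 11)) / qPoch (V ^ 2) (V ^ 2)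

/-- The theta quotient part of the crank generating function, up to an eta factor. -/
noncomputable def crankQuot (V : ℝ) (r : ℕ) : ℝ :=
  (crankSeries V (6 - r) + r / 11) / qPoch (V ^ 2) (V ^ 2)

/-- The theta quotients, Appell sums and monomials in a linear combination of rank and crank
generating functions. -/
noncomputable def combSeries (n₀ n₁ n₂ n₃ n₄ n₅ m₀ m₁ m₂ : ℤ) (V : ℝ) : ℝ :=
  (n₂ - n₃) * rankQuot V 1 + (n₁ - 2 * n₀) * rankQuot V 2 +
    (n₄ - n₃) * rankQuot V 3 + (n₄ - n₅) * rankQuot V 4 + (n₁ - n₂) * rankQuot V 5 +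
    (2 * m₀ - m₁) * crankQuot V 5 + (m₁ - m₂) * crankQuot V 4 + m₂ * crankQuot V 3 +
    (n₃ - n₂) * V ^ (-2 : ℤ)

theorem nonnegOn_comb {d n₀ n₁ n₂ n₃ n₄ n₅ m₀ m₁ m₂ : ℤ} (bases C : List ThetaTerm)
    (hd : d = 0 ∧ n₁ = 2 * n₀ ∨ d = 1 ∨ d = 2 ∨ d = 3 ∨ d = 4 ∧ n₄ = n₅ ∨ d = 5)
    (h : nonnegCheck d bases C (combTerms n₀ n₁ n₂ n₃ n₄ n₅ m₀ m₁ m₂) = true) :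
    NonnegOn d (combSeries n₀ n₁ n₂ n₃ n₄ n₅ m₀ m₁ m₂) := by
  have mock : ∀ r : ℕ, 1 ≤ r → r ≤ 5 → ∀ x : ℤ,
      (x = 0 ∨ ¬ ((33 * r - 3 * r ^ 2 - 10) / 2 : ℤ) ≡ d [ZMOD 11]) →
      NonnegOn d (fun V => (x : ℝ) * rankMock V r) := by
    rintro r hr hr' x (rfl | hx)
    · exact NonnegOn.zero_smul _
    · obtain ⟨s, hs⟩ := hasExp_rankMock hr hr'
      exact NonnegOn.of_class hs hx _
  have mono : NonnegOn d (fun V => ((n₃ - n₂ : ℤ) : ℝ) * V ^ (2 * (-1) : ℤ)) :=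
    NonnegOn.of_class (b := False) (HasExp.monomial (-1)) (by rw [Int.ModEq]; omega) _
  have k1 := mock 1 le_rfl (by norm_num) (n₂ - n₃) (by right; rw [Int.ModEq]; norm_num; omega)
  have k2 := mock 2 (by norm_num) (by norm_num) (n₁ - 2 * n₀) (by rw [Int.ModEq]; norm_num; omega)
  have k3 := mock 3 (by norm_num) (by norm_num) (n₄ - n₃)
    (by right; rw [Int.ModEq]; norm_num; omega)
  have k4 := mock 4 (by norm_num) (by norm_num) (n₄ - n₅) (by rw [Int.ModEq]; norm_num; omega)
  have k5 := mock 5 (by norm_num) (by norm_num) (n₁ - n₂)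
    (by right; rw [Int.ModEq]; norm_num; omega)
  have main := (NonnegOn.of_check h).smul (x := 1 / 132) (by norm_num)
  refine ((((((main.add k1).add k2).add k3).add k4).add k5).add mono).congr fun V h0 h1 => ?_
  have a1 := rankSeries_div h0 h1 (r := 1) le_rfl (by norm_num)
  have a2 := rankSeries_div h0 h1 (r := 2) (by norm_num) (by norm_num)
  have a3 := rankSeries_div h0 h1 (r := 3) (by norm_num) (by norm_num)
  have a4 := rankSeries_div h0 h1 (r := 4) (by norm_num) (by norm_num)
  have a5 := rankSeries_div h0 h1 (r := 5) (by norm_num) (by norm_num)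
  have b3 := crankSeries_div h0 h1 (r := 3) (by norm_num) (by norm_num)
  have b4 := crankSeries_div h0 h1 (r := 4) (by norm_num) (by norm_num)
  have b5 := crankSeries_div h0 h1 (r := 5) (by norm_num) (by norm_num)
  simp only [combSeries, rankQuot, crankQuot, a1, a2, a3, a4, a5, b3, b4, b5, combTerms,
    thetaSum_append, thetaSum_smul, rankMock]
  push_cast
  norm_num
  ring

end

section

open Filter Topology Finset

lemma nonnegOn_zero_M1_sub_N4 : NonnegOn 0 (combSeries 0 0 0 0 (-1) 0 0 1 0) :=
  nonnegOn_comb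
    [thetaTerm 1 (-12) 8 (-5) (-4) 0]
    [thetaTerm (-132) (-2) (-3) (-2) (-3) (-3), thetaTerm 264 (-2) (-2) (-4) (-3) (-2)]
    (by norm_num) (by decide +kernel)

lemma nonnegOn_zero_N2N3_sub_N4M1 : NonnegOn 0 (combSeries 0 0 1 1 (-1) 0 0 (-1) 0) :=
  nonnegOn_comb
    [thetaTerm 1 (-12) 8 (-5) (-4) 0]
    [thetaTerm 132 (-3) (-1) (-3) (-2) (-4), thetaTerm 396 (-2) (-2) (-4) (-3) (-2)]
    (by norm_num) (by decide +kernel)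

lemma nonnegOn_one_N2_sub_M2 : NonnegOn 1 (combSeries 0 0 1 0 0 0 0 0 (-1)) :=
  nonnegOn_comb
    [thetaTerm 1 (-12) 8 (-5) (-3) (-1)]
    [thetaTerm 132 (-2) (-3) (-2) (-2) (-4), thetaTerm (-132) (-2) (-3) (-1) (-5) (-2)]
    (by norm_num) (by decide +kernel)

lemma nonnegOn_one_M2_sub_N4 : NonnegOn 1 (combSeries 0 0 0 0 (-1) 0 0 0 1) :=
  nonnegOn_comb
    [thetaTerm 1 (-12) 8 (-5) (-3) (-1)]
    [thetaTerm 132 (-1) (-5) (-5) (-2) 0, thetaTerm (-132) (-2) (-3) (-1) (-5) (-2)]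
    (by norm_num) (by decide +kernel)

lemma nonnegOn_one_N2N4_sub_N3N5 : NonnegOn 1 (combSeries 0 0 1 (-1) 1 (-1) 0 0 0) :=
  nonnegOn_comb
    [thetaTerm 1 (-12) 8 (-5) (-3) (-1)]
    [thetaTerm 132 (-3) (-1) (-2) (-4) (-3), thetaTerm 264 (-1) (-4) (-3) (-3) (-2),
     thetaTerm (-264) (-1) (-3) (-5) (-3) (-1)]
    (by norm_num) (by decide +kernel)

lemma nonnegOn_two_N1_sub_M2 : NonnegOn 2 (combSeries 0 1 0 0 0 0 0 0 (-1)) :=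
  nonnegOn_comb
    [thetaTerm 1 (-13) 10 (-5) (-4) (-1)]
    [thetaTerm (-132) (-3) (-1) (-2) (-3) (-4), thetaTerm 132 (-3) 0 (-4) (-3) (-3),
     thetaTerm 264 (-2) (-3) (-1) (-4) (-3)]
    (by norm_num) (by decide +kernel)

lemma nonnegOn_two_M0_sub_N5 : NonnegOn 2 (combSeries 0 0 0 0 0 (-1) 1 0 0) :=
  nonnegOn_comb
    [thetaTerm 1 (-13) 10 (-5) (-4) (-1)]
    [thetaTerm 132 (-3) (-3) (-2) (-2) (-3), thetaTerm 132 (-3) 0 (-4) (-3) (-3)]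
    (by norm_num) (by decide +kernel)

lemma nonnegOn_two_M0M0_sub_N2N5 : NonnegOn 2 (combSeries 0 0 (-1) 0 0 (-1) 2 0 0) :=
  nonnegOn_comb
    [thetaTerm 1 (-13) 10 (-5) (-4) (-1)]
    [thetaTerm 132 (-2) (-3) (-1) (-4) (-3), thetaTerm (-264) (-2) (-2) (-3) (-4) (-2)]
    (by norm_num) (by decide +kernel)

lemma nonnegOn_two_N2M0_sub_N0N5 : NonnegOn 2 (combSeries (-1) 0 1 0 0 (-1) 1 0 0) :=
  nonnegOn_comb
    [thetaTerm 1 (-13) 10 (-5) (-4) (-1)]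
    [thetaTerm 132 (-2) (-3) (-1) (-4) (-3), thetaTerm 528 (-1) (-2) (-3) (-3) (-4)]
    (by norm_num) (by decide +kernel)

lemma nonnegOn_two_N1N3_sub_M0M2 : NonnegOn 2 (combSeries 0 1 0 1 0 0 (-1) 0 (-1)) :=
  nonnegOn_comb
    [thetaTerm 1 (-13) 10 (-5) (-4) (-1)]
    [thetaTerm 132 (-3) 0 (-4) (-3) (-3), thetaTerm 132 (-2) (-3) (-1) (-4) (-3),
     thetaTerm (-264) (-1) (-4) (-3) (-2) (-3)]
    (by norm_num) (by decide +kernel)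

lemma nonnegOn_two_N1N5_sub_N4M2 : NonnegOn 2 (combSeries 0 1 0 0 (-1) 1 0 0 (-1)) :=
  nonnegOn_comb
    [thetaTerm 1 (-13) 10 (-5) (-4) (-1)]
    [thetaTerm 132 (-2) (-3) (-1) (-4) (-3), thetaTerm (-264) (-1) (-4) (-3) (-2) (-3),
     thetaTerm (-132) (-2) (-1) (-1) (-5) (-4)]
    (by norm_num) (by decide +kernel)

lemma nonnegOn_three_N0_sub_M0 : NonnegOn 3 (combSeries 1 0 0 0 0 0 (-1) 0 0) :=
  nonnegOn_comb
    [thetaTerm 1 (-14) 10 (-5) (-4) 0]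
    [thetaTerm (-264) (-2) (-3) (-1) (-3) (-4), thetaTerm 528 (-2) (-2) (-3) (-3) (-3)]
    (by norm_num) (by decide +kernel)

lemma nonnegOn_three_M1_sub_N4 : NonnegOn 3 (combSeries 0 0 0 0 (-1) 0 0 1 0) :=
  nonnegOn_comb
    [thetaTerm 1 (-14) 10 (-5) (-4) 0]
    [thetaTerm (-132) (-2) (-4) (-3) (-2) (-2), thetaTerm (-132) (-2) (-1) (-5) (-3) (-2)]
    (by norm_num) (by decide +kernel)

lemma nonnegOn_three_N0M0_sub_N2N2 : NonnegOn 3 (combSeries 1 0 (-2) 0 0 0 1 0 0) :=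
  nonnegOn_comb
    [thetaTerm 1 (-14) 10 (-5) (-4) 0]
    [thetaTerm (-264) (-1) (-2) (-3) (-2) (-5), thetaTerm 264 (-1) (-2) (-2) (-5) (-3)]
    (by norm_num) (by decide +kernel)

lemma nonnegOn_three_N2M1_sub_N4M0 : NonnegOn 3 (combSeries 0 0 1 0 (-1) 0 (-1) 1 0) :=
  nonnegOn_comb
    [thetaTerm 1 (-14) 10 (-5) (-4) 0]
    [thetaTerm 132 (-4) 0 (-4) (-3) (-2), thetaTerm 132 (-1) (-4) (-3) (-1) (-4),
     thetaTerm (-132) (-2) (-1) (-5) (-3) (-2)]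
    (by norm_num) (by decide +kernel)

lemma nonnegOn_three_N0N3_sub_N2M1 : NonnegOn 3 (combSeries 1 0 (-1) 1 0 0 0 (-1) 0) :=
  nonnegOn_comb
    [thetaTerm 1 (-14) 10 (-5) (-4) 0]
    [thetaTerm (-132) (-3) 0 (-4) (-2) (-4), thetaTerm (-132) (-2) (-1) (-5) (-3) (-2),
     thetaTerm 264 (-1) (-2) (-2) (-5) (-3)]
    (by norm_num) (by decide +kernel)

lemma nonnegOn_four_N1_sub_M0 : NonnegOn 4 (combSeries 0 1 0 0 0 0 (-1) 0 0) :=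
  nonnegOn_comb
    [thetaTerm 1 (-12) 9 (-5) (-6) 1]
    [thetaTerm (-132) (-4) 0 (-4) (-2) (-3), thetaTerm 132 (-1) (-4) (-2) (-3) (-3)]
    (by norm_num) (by decide +kernel)

lemma nonnegOn_four_N1N1_sub_N0M0 : NonnegOn 4 (combSeries (-1) 2 0 0 0 0 (-1) 0 0) :=
  nonnegOn_comb
    [thetaTerm 1 (-12) 9 (-5) (-6) 1]
    [thetaTerm 264 (-1) (-4) (-2) (-3) (-3), thetaTerm (-528) (-1) (-3) (-4) (-3) (-2)]
    (by norm_num) (by decide +kernel)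

lemma nonnegOn_four_N1M1_sub_N2M0 : NonnegOn 4 (combSeries 0 1 (-1) 0 0 0 (-1) 1 0) :=
  nonnegOn_comb
    [thetaTerm 1 (-12) 9 (-5) (-6) 1]
    [thetaTerm (-132) (-2) (-3) 0 (-5) (-3), thetaTerm (-132) (-2) (-2) (-3) (-2) (-4),
     thetaTerm 132 (-1) (-4) (-2) (-3) (-3)]
    (by norm_num) (by decide +kernel)

lemma nonnegOn_four_N1N3_sub_M0M0 : NonnegOn 4 (combSeries 0 1 0 1 0 0 (-2) 0 0) :=
  nonnegOn_comb
    [thetaTerm 1 (-12) 9 (-5) (-6) 1]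
    [thetaTerm 132 (-2) (-4) (-3) (-1) (-3), thetaTerm 264 (-1) (-4) (-2) (-3) (-3)]
    (by norm_num) (by decide +kernel)

lemma nonnegOn_five_N2_sub_M0 : NonnegOn 5 (combSeries 0 0 1 0 0 0 (-1) 0 0) :=
  nonnegOn_comb
    [thetaTerm 1 (-12) 9 (-5) (-5) 0]
    [thetaTerm 132 (-2) (-3) 0 (-4) (-4), thetaTerm (-264) (-2) (-2) (-2) (-4) (-3)]
    (by norm_num) (by decide +kernel)

lemma nonnegOn_five_M2_sub_N5 : NonnegOn 5 (combSeries 0 0 0 0 0 (-1) 0 0 1) :=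
  nonnegOn_comb
    [thetaTerm 1 (-12) 9 (-5) (-5) 0]
    [thetaTerm (-132) (-2) (-4) (-3) 0 (-4), thetaTerm (-132) (-2) (-3) (-4) (-3) (-1),
     thetaTerm 132 (-2) (-3) 0 (-4) (-4)]
    (by norm_num) (by decide +kernel)

lemma nonnegOn_five_N2N3_sub_M0M2 : NonnegOn 5 (combSeries 0 0 1 1 0 0 (-1) 0 (-1)) :=
  nonnegOn_comb
    [thetaTerm 1 (-12) 9 (-5) (-5) 0]
    [thetaTerm 132 (-2) (-2) (-3) (-1) (-5), thetaTerm (-132) (-2) (-2) (-2) (-4) (-3)]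
    (by norm_num) (by decide +kernel)

lemma nonnegOn_five_N2M2_sub_N0N5 : NonnegOn 5 (combSeries (-1) 0 1 0 0 (-1) 0 0 1) :=
  nonnegOn_comb
    [thetaTerm 1 (-12) 9 (-5) (-5) 0]
    [thetaTerm 264 (-3) 0 (-3) (-3) (-4), thetaTerm (-132) (-1) (-1) (-4) (-3) (-4)]
    (by norm_num) (by decide +kernel)

lemma nonnegOn_five_N0M0_sub_N1N4 : NonnegOn 5 (combSeries 1 (-1) 0 0 (-1) 0 1 0 0) :=
  nonnegOn_comb
    [thetaTerm 1 (-12) 9 (-5) (-5) 0]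
    [thetaTerm 132 (-3) (-1) (-5) (-2) (-2), thetaTerm (-264) (-1) (-4) (-2) (-2) (-4),
     thetaTerm 132 (-1) (-3) (-4) (-2) (-3)]
    (by norm_num) (by decide +kernel)

lemma nonnegOn_five_N2N3_sub_N1N5 : NonnegOn 5 (combSeries 0 (-1) 1 1 0 (-1) 0 0 0) :=
  nonnegOn_comb
    [thetaTerm 1 (-12) 9 (-5) (-5) 0]
    [thetaTerm 132 (-2) (-3) 0 (-4) (-4), thetaTerm 132 (-2) (-2) (-3) (-1) (-5),
     thetaTerm (-132) (-1) (-4) (-2) (-2) (-4)]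
    (by norm_num) (by decide +kernel)

lemma nonnegOn_five_N0N2_sub_N1M0 : NonnegOn 5 (combSeries 1 (-1) 1 0 0 0 (-1) 0 0) :=
  nonnegOn_comb
    [thetaTerm 1 (-12) 9 (-5) (-5) 0]
    [thetaTerm 132 (-2) (-2) (-3) (-1) (-5), thetaTerm (-528) (-1) (-4) (-2) (-2) (-4)]
    (by norm_num) (by decide +kernel)

end

section

open Filter Topology Finset

open Classical in
/-- The generating function of the multisets satisfying `P`, by sum, converges to `v` at `x`. -/
def MSum (x : ℝ) (P : Multiset ℕ → Prop) (v : ℝ) : Prop :=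
  HasSum (fun s => if P s then x ^ s.sum else 0) v

namespace MSum

variable {x v w : ℝ} {P Q R : Multiset ℕ → Prop}

lemma congr (h : MSum x P v) (hp : ∀ s, P s ↔ Q s) : MSum x Q v := by
  rwa [show P = Q from funext fun s => propext (hp s)] at h

lemma unique (h : MSum x P v) (h' : MSum x P w) : v = w := HasSum.unique h h'

lemma or (hP : MSum x P v) (hQ : MSum x Q w) (h : ∀ s, P s → ¬ Q s) :
    MSum x (fun s => P s ∨ Q s) (v + w) := by
  refine (HasSum.add hP hQ).congr_fun fun s => ?_
  have := h s
  by_cases h1 : P s <;> by_cases h2 : Q s <;> simp_all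

lemma and_not (hP : MSum x P v) (hQ : MSum x Q w) (h : ∀ s, Q s → P s) :
    MSum x (fun s => P s ∧ ¬ Q s) (v - w) := by
  refine (HasSum.sub hP hQ).congr_fun fun s => ?_
  have := h s
  by_cases h1 : P s <;> by_cases h2 : Q s <;> simp_all

lemma single (t : Multiset ℕ) : MSum x (fun s => s = t) (x ^ t.sum) := by
  refine (hasSum_ite_eq t (x ^ t.sum)).congr_fun fun s => ?_
  by_cases h : s = t <;> simp [h]

lemma empty (h : ∀ s, ¬ P s) : MSum x P 0 :=
  (hasSum_zero : HasSum (fun _ : Multiset ℕ => (0 : ℝ)) 0).congr_fun fun s => by simp [h s]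

lemma mono (h0 : 0 ≤ x) (hP : MSum x P v) (h : ∀ s, Q s → P s) :
    ∃ w, 0 ≤ w ∧ w ≤ v ∧ MSum x Q w := by
  classical
  have le : ∀ s : Multiset ℕ, (if Q s then x ^ s.sum else 0) ≤ if P s then x ^ s.sum else 0 := by
    intro s
    have := pow_nonneg h0 s.sum
    by_cases h2 : Q s
    · simp [h2, h s h2]
    · rw [if_neg h2]; positivity
  have nn : ∀ s : Multiset ℕ, 0 ≤ if Q s then x ^ s.sum else 0 := by
    intro s
    positivity
  have hs : Summable fun s : Multiset ℕ => if Q s then x ^ s.sum else 0 :=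
    Summable.of_nonneg_of_le nn le (HasSum.summable hP)
  refine ⟨_, tsum_nonneg nn, hasSum_le le hs.hasSum hP, ?_⟩
  exact hs.hasSum.congr_fun fun s => by congr

/-- Transport of a generating function along a bijection. -/
lemma of_bij {α : Type*} {F : α → ℝ} (hF : HasSum F v) {Q : Multiset ℕ → Prop} (c : ℕ)
    (hx : x ≠ 0) (f : α → Multiset ℕ) (hf : Function.Injective f) (hQ : ∀ t, Q t ↔ ∃ a, f a = t)
    (hs : ∀ a, x ^ (f a).sum = F a * x ^ c) : MSum x Q (v * x ^ c) := by
  classical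
  refine (hasSum_iff_hasSum_of_ne_zero_bij
    (g := fun a => F a * x ^ c)
    (f := fun s : Multiset ℕ => if Q s then x ^ s.sum else 0)
    (fun a => f a) (fun a b h => Subtype.ext (hf h)) ?_ ?_).2 (hF.mul_right _) |>.congr_fun
      fun s => by congr
  · intro t ht
    rw [Function.mem_support] at ht
    have hq : Q t := by by_contra h; simp [h] at ht
    obtain ⟨a, rfl⟩ := (hQ t).1 hq
    refine ⟨⟨a, ?_⟩, rfl⟩
    rw [Function.mem_support, ← hs]
    exact pow_ne_zero _ hx
  · rintro ⟨a, _⟩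
    simp only
    rw [if_pos ((hQ _).2 ⟨a, rfl⟩), hs]

lemma hasSum_subtype (h : MSum x P v) : HasSum (fun s : {s // P s} => x ^ s.1.sum) v := by
  classical
  have := (hasSum_subtype_iff_indicator (f := fun s : Multiset ℕ => x ^ s.sum)
    (s := {s | P s}) (a := v)).2 ?_
  · exact this
  · refine HasSum.congr_fun h fun s => ?_
    simp only [Set.indicator, Set.mem_ofPred_eq]

lemma bij (h : MSum x P v) (hx : x ≠ 0) (c : ℕ) (f g : Multiset ℕ → Multiset ℕ)
    (hf : ∀ s, P s → Q (f s)) (hg : ∀ t, Q t → P (g t)) (hgf : ∀ s, P s → g (f s) = s)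
    (hfg : ∀ t, Q t → f (g t) = t) (hs : ∀ s, P s → (f s).sum = s.sum + c) :
    MSum x Q (v * x ^ c) := by
  refine of_bij h.hasSum_subtype c hx (fun s => f s.1) (fun a b h => ?_) (fun t => ?_) fun a => ?_
  · exact Subtype.ext ((hgf a.1 a.2).symm.trans ((congrArg g h).trans (hgf b.1 b.2)))
  · exact ⟨fun h => ⟨⟨g t, hg t h⟩, hfg t h⟩, by rintro ⟨a, rfl⟩; exact hf _ a.2⟩
  · rw [hs _ a.2, pow_add]

lemma prod (h0 : 0 < x) (hP : MSum x P v) (hQ : MSum x Q w) (c : ℕ)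
    (f : Multiset ℕ → Multiset ℕ → Multiset ℕ) (g g' : Multiset ℕ → Multiset ℕ)
    (hf : ∀ s t, P s → Q t → R (f s t)) (hg : ∀ u, R u → P (g u) ∧ Q (g' u) ∧ f (g u) (g' u) = u)
    (hgf : ∀ s t, P s → Q t → g (f s t) = s ∧ g' (f s t) = t)
    (hs : ∀ s t, P s → Q t → (f s t).sum = s.sum + t.sum + c) :
    MSum x R (v * w * x ^ c) := by
  have h := hP.hasSum_subtype.mul hQ.hasSum_subtype
    (hP.hasSum_subtype.summable.mul_of_nonneg hQ.hasSum_subtype.summable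
      (fun _ => by positivity) fun _ => by positivity)
  refine of_bij h c h0.ne' (fun s => f s.1.1 s.2.1) (fun a b h => ?_) (fun t => ?_) fun a => ?_
  · have ha := hgf _ _ a.1.2 a.2.2
    have hb := hgf _ _ b.1.2 b.2.2
    simp only at h
    rw [h] at ha
    exact Prod.ext (Subtype.ext (ha.1.symm.trans hb.1)) (Subtype.ext (ha.2.symm.trans hb.2))
  · refine ⟨fun h => ⟨(⟨g t, (hg t h).1⟩, ⟨g' t, (hg t h).2.1⟩), (hg t h).2.2⟩, ?_⟩
    rintro ⟨a, rfl⟩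
    exact hf _ _ a.1.2 a.2.2
  · rw [hs _ _ a.1.2 a.2.2, pow_add, pow_add]

/-- Assembling a generating function from the fibres of a statistic. -/
lemma of_fiber (h0 : 0 ≤ x) {β : Type*} (κ : Multiset ℕ → β) (f : β → ℝ)
    (hf : ∀ b, MSum x (fun s => P s ∧ κ s = b) (f b)) (hv : HasSum f v) : MSum x P v := by
  classical
  let F : Multiset ℕ → ℝ := fun s => if P s then x ^ s.sum else 0
  have hb : ∀ b, HasSum (fun s : {s // κ s = b} => F s.1) (f b) := by
    intro b
    have := (hasSum_subtype_iff_indicator (f := F) (s := {s | κ s = b}) (a := f b)).2 ?_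
    · exact this
    · refine HasSum.congr_fun (hf b) fun s => ?_
      by_cases h : κ s = b <;> by_cases h' : P s <;> simp [Set.indicator, h, h', F]
  have hs : HasSum (fun p : Σ b, {s // κ s = b} => F p.2.1) v := by
    have h1 : Summable (fun p : Σ b, {s // κ s = b} => F p.2.1) := by
      refine (summable_sigma_of_nonneg fun p => ?_).2 ⟨fun b => (hb b).summable, ?_⟩
      · simp only [F]; positivity
      · exact hv.summable.congr fun b => ((hb b).tsum_eq).symm
    have h2 := HasSum.sigma h1.hasSum hb
    exact h2.unique hv ▸ h1.hasSum
  have h3 := ((Equiv.sigmaFiberEquiv κ).hasSum_iff (f := F) (a := v)).1 hs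
  exact h3.congr_fun fun s => by simp only [F]

/-- Decomposing a generating function into the fibres of a statistic. -/
lemma fiber (h : MSum x P v) {β : Type*} (κ : Multiset ℕ → β) (f : β → ℝ)
    (hf : ∀ b, MSum x (fun s => P s ∧ κ s = b) (f b)) : HasSum f v := by
  classical
  have h1 := HasSum.tsum_fiberwise h κ
  refine h1.congr_fun fun b => ?_
  have := (hasSum_subtype_iff_indicator (f := fun s : Multiset ℕ => if P s then x ^ s.sum else 0)
    (s := κ ⁻¹' {b}) (a := f b)).2 ?_
  · exact this.tsum_eq.symm
  · refine HasSum.congr_fun (hf b) fun s => ?_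
    by_cases h : κ s = b <;> by_cases h' : P s <;> simp [Set.indicator, h, h']

/-- Multisets of natural numbers with a given number of elements. -/
lemma card_eq (h0 : 0 < x) (h1 : x < 1) (k : ℕ) :
    MSum x (fun s => Multiset.card s = k) (qPochFin x x k)⁻¹ := by
  induction k with
  | zero => simpa [qPochFin] using single (x := x) 0
  | succ k ih =>
    have hg : HasSum (fun a : ℕ => (x ^ (k + 1)) ^ a) (1 - x ^ (k + 1))⁻¹ :=
      hasSum_geometric_of_lt_one (by positivity) (pow_lt_one₀ h0.le h1 (by omega))
    have h := hg.mul ih.hasSum_subtype (hg.summable.mul_of_nonneg ih.hasSum_subtype.summable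
      (fun _ => by positivity) fun _ => by positivity)
    have inj : ∀ (a b : ℕ) (s t : Multiset ℕ), a ≤ b →
        a ::ₘ s.map (· + a) = b ::ₘ t.map (· + b) → a = b ∧ s = t := by
      intro a b s t hab hst
      have : a ∈ b ::ₘ t.map (· + b) := hst ▸ Multiset.mem_cons_self _ _
      have hab' : a = b := by
        simp only [Multiset.mem_cons, Multiset.mem_map] at this
        rcases this with h | ⟨c, -, h⟩ <;> omega
      subst hab'
      exact ⟨rfl, Multiset.map_injective (add_left_injective a) ((Multiset.cons_inj_right a).1 hst)⟩
    have := of_bij (Q := fun s => Multiset.card s = k + 1) h 0 h0.ne'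
      (fun p => p.1 ::ₘ p.2.1.map (· + p.1)) ?_ ?_ ?_
    · rw [qPochFin_succ]
      convert this using 1
      rw [pow_zero, mul_one, mul_inv, mul_comm, pow_succ']
    · rintro ⟨a, s⟩ ⟨b, t⟩ hab
      rcases le_total a b with hl | hl
      · obtain ⟨rfl, h⟩ := inj a b s.1 t.1 hl hab
        rw [Subtype.ext h]
      · obtain ⟨rfl, h⟩ := inj b a t.1 s.1 hl hab.symm
        rw [Subtype.ext h]
    · intro t
      constructor
      · intro ht
        have hne : ({y | y ∈ t} : Set ℕ).Nonempty := by
          obtain ⟨a, ha⟩ := Multiset.card_pos_iff_exists_mem.1 (by omega : 0 < Multiset.card t)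
          exact ⟨a, ha⟩
        set a := sInf {y | y ∈ t}
        have ha : a ∈ t := Nat.sInf_mem hne
        have hle : ∀ y ∈ t, a ≤ y := fun y hy => Nat.sInf_le hy
        refine ⟨(a, ⟨(t.erase a).map (· - a), by simp [Multiset.card_erase_of_mem ha, ht]⟩), ?_⟩
        simp only [Multiset.map_map, Function.comp_def]
        rw [Multiset.map_congr rfl (g := id) fun y hy => by
          have := hle y (Multiset.mem_of_mem_erase hy); simp; omega, Multiset.map_id,
          Multiset.cons_erase ha]
      · rintro ⟨p, rfl⟩
        simp [p.2.2]
    · rintro ⟨a, s, hs⟩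
      simp only [Multiset.sum_cons, Multiset.sum_map_add, Multiset.map_id', Multiset.map_const',
        Multiset.sum_replicate, hs, smul_eq_mul, pow_zero, mul_one]
      rw [← pow_mul, ← pow_add]
      congr 1; ring

/-- Multisets of `k` natural numbers larger than `j`. -/
lemma card_eq_gt (h0 : 0 < x) (h1 : x < 1) (j k : ℕ) :
    MSum x (fun s => Multiset.card s = k ∧ ∀ i ∈ s, j < i)
      ((qPochFin x x k)⁻¹ * x ^ (k * (j + 1))) := by
  refine (card_eq h0 h1 k).bij h0.ne' _ (Multiset.map (· + (j + 1))) (Multiset.map (· - (j + 1)))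
    ?_ ?_ ?_ ?_ ?_
  · rintro s hs
    refine ⟨by simpa using hs, fun i hi => ?_⟩
    obtain ⟨a, -, rfl⟩ := Multiset.mem_map.1 hi
    omega
  · rintro t ⟨ht, -⟩
    simpa using ht
  · intro s _
    simp [Multiset.map_map]
  · rintro t ⟨-, ht⟩
    rw [Multiset.map_map, Multiset.map_congr rfl (g := id) fun y hy => ?_, Multiset.map_id]
    have := ht y hy
    simp only [Function.comp, id]
    omega
  · intro s hs
    simp [Multiset.sum_map_add, hs]

/-- The generating function of all partitions. -/
lemma partitions (h0 : 0 < x) (h1 : x < 1) : MSum x (fun s => 0 ∉ s) (qPoch x x)⁻¹ := by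
  refine of_fiber h0.le Multiset.card _ (fun k => (card_eq_gt h0 h1 0 k).congr fun s => ?_) ?_
  · constructor
    · rintro ⟨h, h'⟩
      exact ⟨fun h => (h' 0 h).false, h⟩
    · rintro ⟨h, h'⟩
      exact ⟨h', fun i hi => Nat.pos_of_ne_zero fun e => h (e ▸ hi)⟩
  · refine HasSum.congr_fun (a := (qPoch x x)⁻¹) ?_ fun k => by rw [zero_add, mul_one]
    have := hasSum_qBinomial h0 h1 0 h0 h1
    rw [zero_mul, qPoch_zero, one_div] at this
    exact this.congr_fun fun k => by simp [qPochFin]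

end MSum

end

section

open Filter Topology Finset

/-- The rank of a multiset of positive integers, read as a partition. -/
def multisetRank (s : Multiset ℕ) : ℤ := (s.sup : ℤ) - Multiset.card s

/-- Dyson's map: add a part `card s + c` and decrease every part by one. -/
def dysonMap (c : ℤ) (s : Multiset ℕ) : Multiset ℕ :=
  ((Multiset.card s + c).toNat ::ₘ s.map Nat.pred).filter (0 < ·)

/-- The inverse of Dyson's map. -/
def dysonInv (c : ℤ) (t : Multiset ℕ) : Multiset ℕ :=
  (t.erase t.sup).map Nat.succ +
    Multiset.replicate (t.sup - c - Multiset.card (t.erase t.sup)).toNat 1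

lemma sup_mem_of_ne_zero {t : Multiset ℕ} (ht : t ≠ 0) : t.sup ∈ t := by
  induction t using Multiset.induction with
  | empty => exact (ht rfl).elim
  | cons a s ih =>
    rcases eq_or_ne s 0 with rfl | hs
    · simp
    · rw [Multiset.sup_cons]
      rcases le_total a s.sup with h | h
      · rw [sup_eq_right.2 h]; exact Multiset.mem_cons_of_mem (ih hs)
      · rw [sup_eq_left.2 h]; exact Multiset.mem_cons_self _ _

lemma map_succ_filter_pred {s : Multiset ℕ} (hs : 0 ∉ s) :
    ((s.map Nat.pred).filter (0 < ·)).map Nat.succ + Multiset.replicate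
      (Multiset.card s - Multiset.card ((s.map Nat.pred).filter (0 < ·))) 1 = s := by
  induction s using Multiset.induction with
  | empty => simp
  | cons a s ih =>
    simp only [Multiset.mem_cons, not_or] at hs
    have hle : Multiset.card ((s.map Nat.pred).filter (0 < ·)) ≤ Multiset.card s := by
      simpa using Multiset.card_le_card (Multiset.filter_le (0 < ·) (s.map Nat.pred))
    rw [Multiset.map_cons]
    by_cases h : 0 < a.pred
    · rw [Multiset.filter_cons_of_pos _ h, Multiset.map_cons, Multiset.card_cons,
        Multiset.card_cons, Nat.add_sub_add_right, Multiset.cons_add, ih hs.2]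
      congr 1
      exact Nat.succ_pred_eq_of_pos (by simp at h; omega)
    · rw [Multiset.filter_cons_of_neg _ h, Multiset.card_cons, Nat.sub_add_comm hle,
        Multiset.replicate_succ, Multiset.add_cons, ih hs.2]
      congr 1
      simp at h; omega

lemma filter_pred_map_succ {t : Multiset ℕ} (ht : 0 ∉ t) (r : ℕ) :
    ((t.map Nat.succ + Multiset.replicate r 1).map Nat.pred).filter (0 < ·) = t := by
  rw [Multiset.map_add, Multiset.map_map, Multiset.filter_add, Multiset.map_replicate]
  simp only [Function.comp_def, Nat.pred_succ, Multiset.map_id']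
  rw [Multiset.filter_eq_self.2 fun a ha => Nat.pos_of_ne_zero fun e => ht (e ▸ ha),
    Multiset.filter_eq_nil.2 fun a ha => by rw [Multiset.eq_of_mem_replicate ha]; simp, add_zero]

lemma dysonMap_facts {c : ℤ} {s : Multiset ℕ} (hs : 0 ∉ s) (hr : multisetRank s ≤ c + 1)
    (hc : 0 ≤ s.sum + c) :
    0 ≤ Multiset.card s + c ∧ ((dysonMap c s).sup : ℤ) = Multiset.card s + c ∧
      (dysonMap c s).erase (dysonMap c s).sup = (s.map Nat.pred).filter (0 < ·) := by
  have h0 : 0 ≤ Multiset.card s + c := by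
    by_contra h
    have : s = 0 := Multiset.eq_zero_of_forall_notMem fun a ha => by
      have := Multiset.le_sup ha
      have : a ≠ 0 := fun e => hs (e ▸ ha)
      unfold multisetRank at hr
      omega
    subst this
    simp at hc h
    omega
  have hle : ∀ a ∈ (s.map Nat.pred).filter (0 < ·), (a : ℤ) ≤ Multiset.card s + c := by
    intro a ha
    obtain ⟨b, hb, rfl⟩ := Multiset.mem_map.1 (Multiset.mem_of_mem_filter ha)
    have := Multiset.le_sup hb
    have : b ≠ 0 := fun e => hs (e ▸ hb)
    unfold multisetRank at hr
    have := Nat.succ_pred this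
    omega
  refine ⟨h0, ?_⟩
  unfold dysonMap
  rcases h0.eq_or_lt with h | h
  · have e : (s.map Nat.pred).filter (0 < ·) = 0 :=
      Multiset.eq_zero_of_forall_notMem fun a ha => by
        have := hle a ha
        have := (Multiset.mem_filter.1 ha).2
        omega
    rw [← h, Multiset.filter_cons_of_neg _ (by simp), e]
    simp
  · have hp : 0 < (Multiset.card s + c).toNat := by omega
    rw [Multiset.filter_cons_of_pos _ hp]
    have e : ((Multiset.card s + c).toNat ::ₘ (s.map Nat.pred).filter (0 < ·)).sup =
        (Multiset.card s + c).toNat := by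
      rw [Multiset.sup_cons, sup_eq_left, Multiset.sup_le]
      intro a ha
      have := hle a ha
      omega
    rw [e, Multiset.erase_cons_head]
    exact ⟨by omega, rfl⟩

lemma dysonInv_dysonMap {c : ℤ} {s : Multiset ℕ} (hs : 0 ∉ s) (hr : multisetRank s ≤ c + 1)
    (hc : 0 ≤ s.sum + c) : dysonInv c (dysonMap c s) = s := by
  obtain ⟨h0, h1, h2⟩ := dysonMap_facts hs hr hc
  unfold dysonInv
  rw [h1, h2]
  nth_rewrite 4 [← map_succ_filter_pred hs]
  congr 2
  omega

lemma sum_filter_pos (s : Multiset ℕ) : (s.filter (0 < ·)).sum = s.sum := by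
  induction s using Multiset.induction with
  | empty => rfl
  | cons a s ih =>
    rcases Nat.eq_zero_or_pos a with rfl | h
    · rw [Multiset.filter_cons_of_neg _ (by simp), ih]; simp
    · rw [Multiset.filter_cons_of_pos (p := (0 < ·)) _ h, Multiset.sum_cons, Multiset.sum_cons, ih]

lemma sum_map_pred {s : Multiset ℕ} (hs : 0 ∉ s) :
    (s.map Nat.pred).sum + Multiset.card s = s.sum := by
  induction s using Multiset.induction with
  | empty => rfl
  | cons a s ih =>
    simp only [Multiset.mem_cons, not_or] at hs
    have := ih hs.2
    have := Nat.succ_pred (Ne.symm hs.1)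
    simp only [Multiset.map_cons, Multiset.sum_cons, Multiset.card_cons]
    omega

lemma dysonMap_mem {c : ℤ} {s : Multiset ℕ} (hs : 0 ∉ s) (hr : multisetRank s ≤ c + 1)
    (hc : 0 ≤ s.sum + c) : 0 ∉ dysonMap c s ∧ c - 1 ≤ multisetRank (dysonMap c s) ∧
      ((dysonMap c s).sum : ℤ) = s.sum + c := by
  obtain ⟨h0, h1, h2⟩ := dysonMap_facts hs hr hc
  refine ⟨fun h => by simp [dysonMap] at h, ?_, ?_⟩
  · unfold multisetRank
    rw [h1]
    have : Multiset.card (dysonMap c s) ≤ Multiset.card s + 1 := by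
      simpa [dysonMap] using Multiset.card_le_card (Multiset.filter_le (0 < ·)
        ((Multiset.card s + c).toNat ::ₘ s.map Nat.pred))
    omega
  · unfold dysonMap
    rw [sum_filter_pos, Multiset.sum_cons, ← sum_map_pred hs]
    push_cast
    rw [Int.toNat_of_nonneg h0]
    ring

lemma dysonInv_facts {c : ℤ} {t : Multiset ℕ} (hr : c - 1 ≤ multisetRank t)
    (hc : c ≤ t.sum) : 0 ≤ t.sup - c - Multiset.card (t.erase t.sup) ∧
      (t.erase t.sup).sum + t.sup = t.sum := by
  rcases eq_or_ne t 0 with rfl | ht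
  · simpa using hc
  · have h1 := sup_mem_of_ne_zero ht
    have h2 := Multiset.card_erase_add_one h1
    have h3 := congrArg Multiset.sum (Multiset.cons_erase h1)
    rw [Multiset.sum_cons] at h3
    unfold multisetRank at hr
    constructor <;> omega

lemma card_dysonInv {c : ℤ} {t : Multiset ℕ} (hr : c - 1 ≤ multisetRank t)
    (hc : c ≤ t.sum) : (Multiset.card (dysonInv c t) : ℤ) = t.sup - c := by
  have := (dysonInv_facts hr hc).1
  unfold dysonInv
  rw [Multiset.card_add, Multiset.card_map, Multiset.card_replicate]
  omega

lemma dysonMap_dysonInv {c : ℤ} {t : Multiset ℕ} (ht : 0 ∉ t) (hr : c - 1 ≤ multisetRank t)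
    (hc : c ≤ t.sum) : dysonMap c (dysonInv c t) = t := by
  have h1 := card_dysonInv hr hc
  have h2 : 0 ∉ t.erase t.sup := fun h => ht (Multiset.mem_of_mem_erase h)
  unfold dysonMap
  rw [h1, sub_add_cancel, Int.toNat_natCast]
  have h3 : ((dysonInv c t).map Nat.pred).filter (0 < ·) = t.erase t.sup :=
    filter_pred_map_succ h2 _
  rcases eq_or_ne t 0 with rfl | hne
  · rw [Multiset.filter_cons_of_neg _ (by simp), h3]; simp
  · have h4 := sup_mem_of_ne_zero hne
    have h5 : 0 < t.sup := Nat.pos_of_ne_zero fun e => ht (e ▸ h4)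
    rw [Multiset.filter_cons_of_pos _ h5, h3, Multiset.cons_erase h4]

lemma dysonInv_mem {c : ℤ} {t : Multiset ℕ} (hr : c - 1 ≤ multisetRank t)
    (hc : c ≤ t.sum) : 0 ∉ dysonInv c t ∧ multisetRank (dysonInv c t) ≤ c + 1 ∧
      ((dysonInv c t).sum : ℤ) = t.sum - c := by
  have h1 := card_dysonInv hr hc
  have h2 := dysonInv_facts hr hc
  refine ⟨fun h => ?_, ?_, ?_⟩
  · rcases Multiset.mem_add.1 h with h | h
    · obtain ⟨a, -, ha⟩ := Multiset.mem_map.1 h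
      exact a.succ_ne_zero ha
    · exact zero_ne_one (Multiset.eq_of_mem_replicate h)
  · have : (dysonInv c t).sup ≤ t.sup + 1 := by
      refine Multiset.sup_le.2 fun a ha => ?_
      rcases Multiset.mem_add.1 ha with h | h
      · obtain ⟨b, hb, rfl⟩ := Multiset.mem_map.1 h
        exact Nat.succ_le_succ (Multiset.le_sup (Multiset.mem_of_mem_erase hb))
      · rw [Multiset.eq_of_mem_replicate h]; omega
    unfold multisetRank
    omega
  · have e : ((t.erase t.sup).map Nat.succ).sum =
        (t.erase t.sup).sum + Multiset.card (t.erase t.sup) := by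
      simp [Multiset.sum_map_add]
    unfold dysonInv
    rw [Multiset.sum_add, e, Multiset.sum_replicate, smul_eq_mul, mul_one]
    omega

variable {x : ℝ}

lemma MSum.dyson (h0 : 0 < x) (M : ℕ) {v : ℝ}
    (h : MSum x (fun s => 0 ∉ s ∧ multisetRank s ≤ M + 2) v) :
    MSum x (fun t => 0 ∉ t ∧ M ≤ multisetRank t ∧ t ≠ 0) (v * x ^ (M + 1)) := by
  have key : ∀ t, (M : ℤ) ≤ multisetRank t → t ≠ 0 → 0 ∉ t → ((M + 1 : ℕ) : ℤ) ≤ t.sum := by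
    intro t hr ht h0t
    have h1 := sup_mem_of_ne_zero ht
    have h2 := Multiset.card_pos.2 ht
    have h3 := Multiset.single_le_sum (fun _ _ => Nat.zero_le _) _ h1
    unfold multisetRank at hr
    omega
  refine h.bij h0.ne' (M + 1) (dysonMap (M + 1 : ℕ)) (dysonInv (M + 1 : ℕ)) ?_ ?_ ?_ ?_ ?_
  · rintro s ⟨hs, hr⟩
    have := dysonMap_mem (c := (M + 1 : ℕ)) hs (by push_cast; omega) (by positivity)
    refine ⟨this.1, by have := this.2.1; push_cast at this ⊢; omega, fun e => ?_⟩
    rw [e] at this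
    have := this.2.2
    rw [Multiset.sum_zero] at this
    omega
  · rintro t ⟨ht, hr, hne⟩
    have := dysonInv_mem (c := (M + 1 : ℕ)) (by push_cast; omega) (key t hr hne ht)
    exact ⟨this.1, by have := this.2.1; push_cast at this; omega⟩
  · rintro s ⟨hs, hr⟩
    exact dysonInv_dysonMap hs (by push_cast; omega) (by positivity)
  · rintro t ⟨ht, hr, hne⟩
    exact dysonMap_dysonInv ht (by push_cast; omega) (key t hr hne ht)
  · rintro s ⟨hs, hr⟩
    have := (dysonMap_mem (c := (M + 1 : ℕ)) hs (by push_cast; omega) (by positivity)).2.2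
    exact_mod_cast this

lemma MSum.dyson_neg (h0 : 0 < x) (M : ℕ) {v : ℝ}
    (h : MSum x (fun t => 0 ∉ t ∧ -(M + 2 : ℤ) ≤ multisetRank t) v) :
    MSum x (fun s => 0 ∉ s ∧ multisetRank s ≤ -(M : ℤ) ∧ s ≠ 0) (v * x ^ (M + 1)) := by
  have key : ∀ s, multisetRank s ≤ -(M : ℤ) → s ≠ 0 → 0 ∉ s → 0 ≤ (s.sum : ℤ) + -(M + 1 : ℤ) := by
    intro t hr ht h0t
    have h1 := sup_mem_of_ne_zero ht
    have h2 := sum_map_pred h0t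
    have h3 : (t.sup : ℕ) ≠ 0 := fun e => h0t (e ▸ h1)
    unfold multisetRank at hr
    omega
  refine h.bij h0.ne' (M + 1) (dysonInv (-(M + 1 : ℤ))) (dysonMap (-(M + 1 : ℤ))) ?_ ?_ ?_ ?_ ?_
  · rintro t ⟨ht, hr⟩
    have := dysonInv_mem (c := -(M + 1 : ℤ)) (t := t) (by omega) (by omega)
    refine ⟨this.1, by omega, fun e => ?_⟩
    rw [e] at this
    have := this.2.2
    rw [Multiset.sum_zero] at this
    omega
  · rintro s ⟨hs, hr, hne⟩
    have := dysonMap_mem (c := -(M + 1 : ℤ)) hs (by omega) (key s hr hne hs)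
    exact ⟨this.1, by omega⟩
  · rintro t ⟨ht, hr⟩
    exact dysonMap_dysonInv ht (by omega) (by omega)
  · rintro s ⟨hs, hr, hne⟩
    exact dysonInv_dysonMap hs (by omega) (key s hr hne hs)
  · rintro t ⟨ht, hr⟩
    have := (dysonInv_mem (c := -(M + 1 : ℤ)) (t := t) (by omega) (by omega)).2.2
    omega

end

section

open Filter Topology Finset

/-- The terms of a partial theta series. -/
noncomputable def halfThetaTerm (x : ℝ) (c : ℕ) (m : ℤ) (k : ℕ) : ℝ :=
  (-1) ^ k * x ^ ((k + 1) * m + c * tri k : ℤ)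

/-- A partial theta series. -/
noncomputable def halfTheta (x : ℝ) (c : ℕ) (m : ℤ) : ℝ := ∑' k : ℕ, halfThetaTerm x c m k

/-- One half of a Lambert series. -/
noncomputable def halfLambert (x : ℝ) (c : ℕ) (m : ℤ) : ℝ :=
  ∑' k : ℕ, halfThetaTerm x c m k / (1 - x ^ (11 * (k + 1)))

variable {x V : ℝ} {c : ℕ}

lemma halfThetaTerm_sq (m : ℤ) (k : ℕ) : halfThetaTerm (V ^ 2) c m k =
    (-1) ^ k * V ^ (c * (k + 1) ^ 2 + (2 * m - c) * (k + 1) : ℤ) := by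
  rw [halfThetaTerm, ← zpow_natCast V 2, ← zpow_mul]
  congr 2
  have := two_mul_tri k
  push_cast
  linear_combination (c : ℤ) * this

lemma summable_halfLambert (h0 : 0 < x) (h1 : x < 1) (hc : 1 ≤ c) (m : ℤ) :
    Summable fun k : ℕ => halfThetaTerm x c m k / (1 - x ^ (11 * (k + 1))) := by
  obtain ⟨V, hV, rfl⟩ : ∃ V, 0 < V ∧ x = V ^ 2 :=
    ⟨√x, Real.sqrt_pos.2 h0, (Real.sq_sqrt h0.le).symm⟩
  have hV1 : V < 1 := lt_of_pow_lt_pow_left₀ 2 zero_le_one (by simpa using h1)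
  have inj : Function.Injective fun k : ℕ => (k : ℤ) + 1 := fun a b h => by simpa using h
  refine ((summable_lambert hV hV1 hc (2 * m - c)).comp_injective inj).neg.congr fun k => ?_
  rw [halfThetaTerm_sq, Function.comp, zpow_add₀ (by norm_num : (-1 : ℝ) ≠ 0), zpow_one,
    zpow_natCast, ← pow_mul, ← zpow_natCast V (2 * _)]
  push_cast
  rw [show (22 * ((k : ℤ) + 1)) = 2 * (11 * (k + 1)) by ring]
  ring

lemma halfThetaTerm_add (h0 : 0 < x) (m n : ℤ) (k : ℕ) :
    halfThetaTerm x c (m + n) k = halfThetaTerm x c m k * x ^ ((k + 1) * n) := by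
  rw [halfThetaTerm, halfThetaTerm, mul_assoc, ← zpow_add₀ h0.ne']
  congr 2; ring

lemma summable_halfTheta (h0 : 0 < x) (h1 : x < 1) (hc : 1 ≤ c) (m : ℤ) :
    Summable (halfThetaTerm x c m) := by
  refine ((summable_halfLambert h0 h1 hc m).sub (summable_halfLambert h0 h1 hc (m + 11))).congr
    fun k => ?_
  have : x ^ (11 * (k + 1)) < 1 := pow_lt_one₀ h0.le h1 (by omega)
  rw [halfThetaTerm_add h0, ← sub_div, show ((k : ℤ) + 1) * 11 = ((11 * (k + 1) : ℕ) : ℤ) by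
    push_cast; ring, zpow_natCast, ← mul_one_sub, mul_div_assoc, div_self (by linarith), mul_one]

lemma halfLambert_add (h0 : 0 < x) (h1 : x < 1) (hc : 1 ≤ c) (m : ℤ) :
    halfLambert x c (m + 11) = halfLambert x c m - halfTheta x c m := by
  rw [halfLambert, halfLambert, halfTheta,
    ← (summable_halfLambert h0 h1 hc m).tsum_sub (summable_halfTheta h0 h1 hc m)]
  refine tsum_congr fun k => ?_
  have : x ^ (11 * (k + 1)) < 1 := pow_lt_one₀ h0.le h1 (by omega)
  have : 1 - x ^ (11 * (k + 1)) ≠ 0 := by linarith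
  rw [halfThetaTerm_add h0, show ((k : ℤ) + 1) * 11 = ((11 * (k + 1) : ℕ) : ℤ) by
    push_cast; ring, zpow_natCast]
  field_simp
  ring

lemma halfThetaTerm_succ (h0 : 0 < x) (m : ℤ) (k : ℕ) :
    halfThetaTerm x c m (k + 1) = -(x ^ m * halfThetaTerm x c (m + c) k) := by
  rw [halfThetaTerm, halfThetaTerm, pow_succ, mul_left_comm, ← zpow_add₀ h0.ne']
  push_cast
  rw [tri_add_one, mul_neg_one, neg_mul]
  congr 3; ring

lemma halfTheta_step (h0 : 0 < x) (h1 : x < 1) (hc : 1 ≤ c) (m : ℤ) :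
    halfTheta x c m = x ^ m - x ^ m * halfTheta x c (m + c) := by
  rw [halfTheta, (summable_halfTheta h0 h1 hc m).tsum_eq_zero_add,
    tsum_congr (halfThetaTerm_succ h0 m), tsum_neg, tsum_mul_left, ← halfTheta]
  simp [halfThetaTerm, tri, sub_eq_add_neg]

lemma hasSum_halfTheta (h0 : 0 < x) (h1 : x < 1) (hc : 1 ≤ c) (m : ℤ) :
    HasSum (fun j : ℕ => halfTheta x c (m + 11 * j)) (halfLambert x c m) := by
  have e : ∀ j k : ℕ, halfThetaTerm x c (m + 11 * j) k =
      halfThetaTerm x c m k * (x ^ (11 * (k + 1))) ^ j := fun j k => by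
    rw [halfThetaTerm_add h0, ← pow_mul, ← zpow_natCast]
    push_cast
    congr 2; ring
  have lt : ∀ k : ℕ, x ^ (11 * (k + 1)) < 1 := fun k => pow_lt_one₀ h0.le h1 (by omega)
  have hg : ∀ k : ℕ, HasSum (fun j : ℕ => halfThetaTerm x c (m + 11 * j) k)
      (halfThetaTerm x c m k / (1 - x ^ (11 * (k + 1)))) := fun k => by
    simp_rw [e, div_eq_mul_inv]
    exact (hasSum_geometric_of_lt_one (by positivity) (lt k)).mul_left _
  have hs : Summable fun p : ℕ × ℕ => halfThetaTerm x c (m + 11 * p.2) p.1 := by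
    refine Summable.of_norm ((summable_prod_of_nonneg fun _ => norm_nonneg _).2
      ⟨fun k => (hg k).summable.norm, ?_⟩)
    refine (summable_halfLambert h0 h1 hc m).norm.congr fun k => ?_
    simp_rw [e, norm_mul, norm_pow, tsum_mul_left]
    have lt' := lt k
    rw [norm_div, tsum_geometric_of_lt_one (by positivity)
      (by rw [Real.norm_of_nonneg h0.le]; exact lt k), Real.norm_of_nonneg h0.le,
      Real.norm_of_nonneg (sub_nonneg.2 lt'.le), div_eq_mul_inv]
  have h2 := hs.hasSum.prod_fiberwise hg
  rw [halfLambert, h2.tsum_eq]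
  refine HasSum.prod_fiberwise ((Equiv.prodComm ℕ ℕ).hasSum_iff.2 hs.hasSum) fun j => ?_
  exact (summable_halfTheta h0 h1 hc (m + 11 * j)).hasSum

/-- Folding a bilateral Lambert series. -/
lemma tsum_lambert_eq (h0 : 0 < V) (h1 : V < 1) (hc : 1 ≤ c) (b : ℤ) :
    ∑' k : ℤ, (-1) ^ k * V ^ (c * k ^ 2 + (2 * b - c) * k) / (1 - V ^ (22 * k)) =
      halfLambert (V ^ 2) c (11 + c - b) - halfLambert (V ^ 2) c b := by
  have h0' : 0 < V ^ 2 := by positivity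
  have h1' : V ^ 2 < 1 := pow_lt_one₀ h0.le h1 (by norm_num)
  have e : ∀ k : ℕ, (V ^ 2) ^ (11 * (k + 1)) = V ^ (22 * ((k : ℤ) + 1)) := fun k => by
    rw [← pow_mul, ← zpow_natCast]
    push_cast
    congr 1; ring
  have a1 := (summable_halfLambert h0' h1' hc b).hasSum.neg
  have a2 := (summable_halfLambert h0' h1' hc (11 + c - b)).hasSum
  rw [← halfLambert] at a1 a2
  have := HasSum.of_add_one_of_neg_add_one
    (f := fun k : ℤ => (-1 : ℝ) ^ k * V ^ (c * k ^ 2 + (2 * b - c) * k) / (1 - V ^ (22 * k)))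
    (a1.congr_fun fun k => ?_) (a2.congr_fun fun k => ?_)
  · rw [this.tsum_eq]
    simp
    ring
  · rw [halfThetaTerm_sq, e, zpow_add₀ (by norm_num : (-1 : ℝ) ≠ 0), zpow_one, zpow_natCast]
    ring
  · have lt : V ^ (22 * ((k : ℤ) + 1)) < 1 := by
      rw [← e]; exact pow_lt_one₀ h0'.le h1' (by omega)
    have ne : 1 - V ^ (22 * ((k : ℤ) + 1)) ≠ 0 := by linarith
    have pos : 0 < V ^ (22 * ((k : ℤ) + 1)) := by positivity
    rw [halfThetaTerm_sq, e, zpow_neg, ← inv_zpow, inv_neg, inv_one,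
      zpow_add₀ (by norm_num : (-1 : ℝ) ≠ 0), zpow_one, zpow_natCast,
      show 22 * -((k : ℤ) + 1) = -(22 * (k + 1)) by ring, zpow_neg,
      show (c : ℤ) * (k + 1) ^ 2 + (2 * (11 + c - b) - c) * (k + 1) =
        c * (-(k + 1)) ^ 2 + (2 * b - c) * (-(k + 1)) + 22 * (k + 1) by ring, zpow_add₀ h0.ne',
      show 1 - (V ^ (22 * ((k : ℤ) + 1)))⁻¹ =
        -(1 - V ^ (22 * ((k : ℤ) + 1))) / V ^ (22 * ((k : ℤ) + 1)) by field_simp; ring]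
    field_simp
    rw [zpow_add₀ h0.ne', zpow_add₀ h0.ne']

lemma rankSeries_eq (h0 : 0 < V) (h1 : V < 1) (a : ℤ) :
    rankSeries V a = halfLambert (V ^ 2) 3 (13 - a) - halfLambert (V ^ 2) 3 (a + 1) := by
  rw [show (13 - a : ℤ) = 11 + (3 : ℕ) - (a + 1) by push_cast; ring,
    ← tsum_lambert_eq h0 h1 (by norm_num), rankSeries]
  refine tsum_congr fun k => ?_
  congr 3
  push_cast; ring

lemma crankSeries_eq (h0 : 0 < V) (h1 : V < 1) (a : ℤ) :
    crankSeries V a = halfLambert (V ^ 2) 1 (12 - a) - halfLambert (V ^ 2) 1 a := by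
  rw [show (12 - a : ℤ) = 11 + (1 : ℕ) - a by push_cast; ring,
    ← tsum_lambert_eq h0 h1 (by norm_num), crankSeries]
  refine tsum_congr fun k => ?_
  congr 3
  push_cast; ring

/-- Euler's pentagonal number theorem in terms of partial theta series. -/
lemma qPoch_self_eq_halfTheta (h0 : 0 < x) (h1 : x < 1) :
    qPoch x x = 1 - halfTheta x 3 1 - halfTheta x 3 2 := by
  have a1 := (summable_halfTheta h0 h1 (c := 3) (by norm_num) 1).hasSum.neg
  have a2 := (summable_halfTheta h0 h1 (c := 3) (by norm_num) 2).hasSum.neg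
  rw [← halfTheta] at a1 a2
  have := HasSum.of_add_one_of_neg_add_one
    (f := fun n : ℤ => (-1 : ℝ) ^ n * x ^ (3 * tri n - 2 * n))
    (a1.congr_fun fun k => ?_) (a2.congr_fun fun k => ?_)
  · rw [← pentTheta_one h0 h1, pentTheta, tsum_congr (pentTheta_term h0 1), this.tsum_eq]
    simp [tri]
    ring
  · rw [halfThetaTerm, tri_add_one, zpow_add₀ (by norm_num : (-1 : ℝ) ≠ 0), zpow_one,
      zpow_natCast, mul_neg_one, neg_mul]
    congr 3
    push_cast; ring
  · have t : tri (-((k : ℤ) + 1)) = tri k := by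
      have h2 := two_mul_tri k
      have h3 := two_mul_tri (-((k : ℤ) + 1))
      linarith [show -((k : ℤ) + 1) * (-(k + 1) + 1) = k * (k + 1) by ring]
    rw [halfThetaTerm, t, zpow_neg, ← inv_zpow, inv_neg, inv_one,
      zpow_add₀ (by norm_num : (-1 : ℝ) ≠ 0), zpow_one, zpow_natCast, mul_neg_one, neg_mul]
    congr 3
    push_cast; ring

lemma rankSeries_symm (h0 : 0 < V) (h1 : V < 1) (a : ℤ) :
    rankSeries V (12 - a) = -rankSeries V a := by
  rw [rankSeries_eq h0 h1, rankSeries_eq h0 h1]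
  ring_nf

lemma rankSeries_add (h0 : 0 < V) (h1 : V < 1) (a : ℤ) : rankSeries V (a + 11) =
    rankSeries V a + halfTheta (V ^ 2) 3 (2 - a) + halfTheta (V ^ 2) 3 (a + 1) := by
  have h0' : 0 < V ^ 2 := by positivity
  have h1' : V ^ 2 < 1 := pow_lt_one₀ h0.le h1 (by norm_num)
  have e1 := halfLambert_add h0' h1' (c := 3) (by norm_num) (2 - a)
  have e2 := halfLambert_add h0' h1' (c := 3) (by norm_num) (a + 1)
  rw [rankSeries_eq h0 h1, rankSeries_eq h0 h1, show 13 - (a + 11) = 2 - a by ring,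
    show a + 11 + 1 = a + 1 + 11 by ring, show 13 - a = 2 - a + 11 by ring, e1, e2]
  ring

lemma rankSeries_zero (h0 : 0 < V) (h1 : V < 1) :
    rankSeries V 0 = rankSeries V 11 - 1 + qPoch (V ^ 2) (V ^ 2) := by
  have h1' : V ^ 2 < 1 := pow_lt_one₀ h0.le h1 (by norm_num)
  have := rankSeries_add h0 h1 0
  norm_num at this
  rw [qPoch_self_eq_halfTheta (by positivity) h1', this]
  ring

lemma rankSeries_three (h0 : 0 < V) (h1 : V < 1) :
    rankSeries V 3 = rankSeries V 14 - 1 - V ^ (-2 : ℤ) * qPoch (V ^ 2) (V ^ 2) := by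
  have h0' : 0 < V ^ 2 := by positivity
  have h1' : V ^ 2 < 1 := pow_lt_one₀ h0.le h1 (by norm_num)
  have h2 := rankSeries_add h0 h1 3
  have h3 := halfTheta_step h0' h1' (c := 3) (by norm_num) (-1)
  have h4 := halfTheta_step h0' h1' (c := 3) (by norm_num) 1
  norm_num at h2 h3 h4
  rw [qPoch_self_eq_halfTheta h0' h1', h2, h3, h4]
  have : V ^ (-2 : ℤ) = (V ^ 2)⁻¹ := by rw [zpow_neg]; rfl
  rw [this]
  field_simp
  ring

lemma crankSeries_zero (h0 : 0 < V) (h1 : V < 1) :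
    crankSeries V 0 = -1 - crankSeries V 1 := by
  have h0' : 0 < V ^ 2 := by positivity
  have h1' : V ^ 2 < 1 := pow_lt_one₀ h0.le h1 (by norm_num)
  have e1 := halfLambert_add h0' h1' (c := 1) (by norm_num) 0
  have e2 := halfLambert_add h0' h1' (c := 1) (by norm_num) 1
  have h3 := halfTheta_step h0' h1' (c := 1) (by norm_num) 0
  rw [crankSeries_eq h0 h1, crankSeries_eq h0 h1]
  norm_num at e1 e2 h3 ⊢
  rw [e1, e2, h3]
  ring

end

section

open Filter Topology Finset

variable {x : ℝ}

lemma eq_zero_of_contraction (h0 : 0 < x) (h1 : x < 1) {d : ℕ → ℝ} {c : ℕ} {C : ℝ}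
    (hC : ∀ m, |d m| ≤ C) (hd : ∀ m, d m = -(x ^ (m + 1) * d (m + c))) (m : ℕ) : d m = 0 := by
  have key : ∀ n m, |d m| ≤ x ^ n * C := by
    intro n
    induction n with
    | zero => simpa using hC
    | succ n ih =>
      intro m
      have : x ^ (m + 1) ≤ x := pow_le_of_le_one h0.le h1.le (by omega)
      rw [hd, abs_neg, abs_mul, abs_of_pos (by positivity), pow_succ' x n, mul_assoc]
      exact mul_le_mul this (ih _) (abs_nonneg _) h0.le
  have t := (tendsto_pow_atTop_nhds_zero_of_lt_one h0.le h1).mul_const C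
  rw [zero_mul] at t
  exact abs_eq_zero.1 (le_antisymm (ge_of_tendsto' t fun n => key n m) (abs_nonneg _))

lemma exists_halfTheta_le (h0 : 0 < x) (h1 : x < 1) {c : ℕ} (hc : 1 ≤ c) :
    ∃ C, ∀ m : ℕ, |halfTheta x c m| ≤ C := by
  refine ⟨∑' k : ℕ, ‖halfThetaTerm x c 0 k‖, fun m => ?_⟩
  have s1 := (summable_halfTheta h0 h1 hc 0).norm
  have s2 := (summable_halfTheta h0 h1 hc m).norm
  refine (norm_tsum_le_tsum_norm s2).trans (s2.tsum_le_tsum (fun k => ?_) s1)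
  rw [← zero_add (m : ℤ), halfThetaTerm_add h0, norm_mul]
  refine mul_le_of_le_one_right (norm_nonneg _) ?_
  rw [show ((k : ℤ) + 1) * m = (((k + 1) * m : ℕ) : ℤ) by push_cast; ring, zpow_natCast, norm_pow,
    Real.norm_of_nonneg h0.le]
  exact pow_le_one₀ h0.le h1.le

lemma mul_eq_halfTheta_of_step (h0 : 0 < x) (h1 : x < 1) {c : ℕ} (hc : 1 ≤ c) {P C : ℝ}
    (hP : P ≠ 0) {a : ℕ → ℝ} (hC : ∀ m, |a m| ≤ C)
    (ha : ∀ m, a m = x ^ (m + 1) * (P - a (m + c))) (m : ℕ) :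
    a m = P * halfTheta x c (m + 1) := by
  obtain ⟨B, hB⟩ := exists_halfTheta_le h0 h1 hc
  refine sub_eq_zero.1 (eq_zero_of_contraction h0 h1 (c := c)
    (d := fun m => a m - P * halfTheta x c (m + 1)) (C := C + |P| * B) (fun m => ?_) (fun m => ?_) m)
  · refine (abs_sub _ _).trans (add_le_add (hC m) ?_)
    rw [abs_mul]
    have := hB (m + 1)
    push_cast at this
    gcongr
  · have := halfTheta_step h0 h1 hc (m + 1)
    rw [show (m : ℤ) + 1 = ((m + 1 : ℕ) : ℤ) by push_cast; rfl, zpow_natCast] at this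
    push_cast at this ⊢
    rw [ha m, this, show (m : ℤ) + c + 1 = m + 1 + c by ring]
    ring

lemma multisetRank_zero : multisetRank 0 = 0 := by simp [multisetRank]

lemma MSum.rank_ge (h0 : 0 < x) (h1 : x < 1) (M : ℕ) :
    MSum x (fun t => 0 ∉ t ∧ M ≤ multisetRank t ∧ t ≠ 0)
      ((qPoch x x)⁻¹ * halfTheta x 3 (M + 1)) := by
  have hp := partitions h0 h1
  choose a ha0 ha1 ha using fun M : ℕ => hp.mono h0.le
    (Q := fun t => 0 ∉ t ∧ M ≤ multisetRank t ∧ t ≠ 0) fun s h => h.1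
  have step : ∀ m, a m = x ^ (m + 1) * ((qPoch x x)⁻¹ - a (m + 3)) := fun m => by
    rw [mul_comm]
    refine (ha m).unique (dyson h0 m ((hp.and_not (ha (m + 3)) fun s h => h.1).congr fun s => ?_))
    constructor
    · rintro ⟨hs, h⟩
      refine ⟨hs, not_lt.1 fun hlt => h ⟨hs, by push_cast; omega, ?_⟩⟩
      rintro rfl
      rw [multisetRank_zero] at hlt
      omega
    · rintro ⟨hs, h⟩
      refine ⟨hs, fun h' => ?_⟩
      have := h'.2.1
      push_cast at this
      omega
  rw [← mul_eq_halfTheta_of_step h0 h1 (by norm_num) (inv_ne_zero (qPoch_pos h0 h1 h1).ne')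
    (fun m => (abs_of_nonneg (ha0 m)).le.trans (ha1 m)) step M]
  exact ha M

lemma MSum.rank_le (h0 : 0 < x) (h1 : x < 1) (M : ℕ) :
    MSum x (fun t => 0 ∉ t ∧ multisetRank t ≤ -(M : ℤ) ∧ t ≠ 0)
      ((qPoch x x)⁻¹ * halfTheta x 3 (M + 1)) := by
  have hp := partitions h0 h1
  choose a ha0 ha1 ha using fun M : ℕ => hp.mono h0.le
    (Q := fun t => 0 ∉ t ∧ multisetRank t ≤ -(M : ℤ) ∧ t ≠ 0) fun s h => h.1
  have step : ∀ m, a m = x ^ (m + 1) * ((qPoch x x)⁻¹ - a (m + 3)) := fun m => by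
    rw [mul_comm]
    refine (ha m).unique (dyson_neg h0 m
      ((hp.and_not (ha (m + 3)) fun s h => h.1).congr fun s => ?_))
    constructor
    · rintro ⟨hs, h⟩
      refine ⟨hs, not_lt.1 fun hlt => h ⟨hs, by push_cast; omega, ?_⟩⟩
      rintro rfl
      rw [multisetRank_zero] at hlt
      omega
    · rintro ⟨hs, h⟩
      refine ⟨hs, fun h' => ?_⟩
      have := h'.2.1
      push_cast at this
      omega
  rw [← mul_eq_halfTheta_of_step h0 h1 (by norm_num) (inv_ne_zero (qPoch_pos h0 h1 h1).ne')
    (fun m => (abs_of_nonneg (ha0 m)).le.trans (ha1 m)) step M]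
  exact ha M

lemma MSum.rank_eq (h0 : 0 < x) (h1 : x < 1) (m : ℤ) :
    MSum x (fun t => 0 ∉ t ∧ multisetRank t = m) ((if m = 0 then 1 else 0) +
      (qPoch x x)⁻¹ * (halfTheta x 3 (|m| + 1) - halfTheta x 3 (|m| + 2))) := by
  have hz : MSum x (fun s => s = 0 ∧ m = 0) (if m = 0 then 1 else 0) := by
    by_cases h : m = 0
    · simpa [h] using single (x := x) 0
    · rw [if_neg h]; exact empty fun s hs => h hs.2
  rw [mul_sub]
  rcases le_total 0 m with hm | hm
  · lift m to ℕ using hm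
    rw [Nat.abs_cast]
    have h := (rank_ge h0 h1 m).and_not (rank_ge h0 h1 (m + 1)) fun s hs =>
      ⟨hs.1, by have := hs.2.1; push_cast at this; omega, hs.2.2⟩
    push_cast at h
    rw [show (m : ℤ) + 1 + 1 = m + 2 by ring] at h
    refine (hz.or h fun s hs h => h.1.2.2 hs.1).congr fun s => ?_
    by_cases hs : s = 0
    · simp [hs, multisetRank_zero, eq_comm]
    · simp only [hs, false_and, ne_eq, not_false_eq_true, and_true, false_or, not_and, not_le]
      constructor
      · rintro ⟨h, h'⟩; exact ⟨h.1, by have := h' h.1; omega⟩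
      · rintro ⟨h, h'⟩; exact ⟨⟨h, h'.ge⟩, fun _ => by omega⟩
  · obtain ⟨n, rfl⟩ : ∃ n : ℕ, m = -(n : ℤ) := ⟨m.natAbs, by omega⟩
    rw [abs_neg, Nat.abs_cast]
    have h := (rank_le h0 h1 n).and_not (rank_le h0 h1 (n + 1)) fun s hs =>
      ⟨hs.1, by have := hs.2.1; push_cast at this; omega, hs.2.2⟩
    push_cast at h
    rw [show (n : ℤ) + 1 + 1 = n + 2 by ring] at h
    refine (hz.or h fun s hs h => h.1.2.2 hs.1).congr fun s => ?_
    by_cases hs : s = 0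
    · simp [hs, multisetRank_zero, eq_comm]
    · simp only [hs, false_and, ne_eq, not_false_eq_true, and_true, false_or, not_and, not_le]
      constructor
      · rintro ⟨h, h'⟩; exact ⟨h.1, by have := h' h.1; omega⟩
      · rintro ⟨h, h'⟩; exact ⟨⟨h, h'.le⟩, fun _ => by omega⟩

/-- Summing a symmetric combination of partial theta series over a residue class. -/
lemma hasSum_residue (h0 : 0 < x) (h1 : x < 1) {c : ℕ} (hc : 1 ≤ c) (r P : ℝ) (d : ℤ) {a : ℕ}
    (ha : a ≤ 10) :
    HasSum (fun j : ℤ => (if (a + 11 * j : ℤ) = 0 then r else 0) +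
      P * (halfTheta x c (|a + 11 * j| + d) - halfTheta x c (|a + 11 * j| + (d + 1))))
      ((if a = 0 then r else 0) + P * (halfLambert x c (a + d) - halfLambert x c (a + (d + 1)) +
        (halfLambert x c (11 - a + d) - halfLambert x c (11 - a + (d + 1))))) := by
  rw [mul_add, ← add_assoc]
  have t : ∀ b : ℤ, HasSum (fun j : ℕ => P * (halfTheta x c (b + d + 11 * j) -
      halfTheta x c (b + (d + 1) + 11 * j)))
      (P * (halfLambert x c (b + d) - halfLambert x c (b + (d + 1)))) := fun b =>
    ((hasSum_halfTheta h0 h1 hc _).sub (hasSum_halfTheta h0 h1 hc _)).mul_left P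
  refine HasSum.of_nat_of_neg_add_one
    (((hasSum_ite_eq 0 (if a = 0 then r else 0)).add (t a)).congr_fun fun j => ?_)
    ((t (11 - a)).congr_fun fun j => ?_)
  · rw [abs_of_nonneg (by positivity), show (a : ℤ) + 11 * j + d = a + d + 11 * j by ring,
      show (a : ℤ) + 11 * j + (d + 1) = a + (d + 1) + 11 * j by ring]
    congr 1
    by_cases h : j = 0
    · simp [h]
    · rw [if_neg h, if_neg (by omega)]
  · rw [if_neg (by omega), abs_of_neg (by omega), zero_add]
    congr 3 <;> ring

/-- The generating function of the partitions whose rank lies in a residue class. -/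
lemma MSum.rank_mod (h0 : 0 < x) (h1 : x < 1) {a : ℕ} (ha : a ≤ 10) :
    MSum x (fun t => 0 ∉ t ∧ multisetRank t % 11 = (a : ℤ) % 11)
      ((if a = 0 then 1 else 0) + (qPoch x x)⁻¹ *
        (halfLambert x 3 (a + 1) - halfLambert x 3 (a + (1 + 1)) +
          (halfLambert x 3 (11 - a + 1) - halfLambert x 3 (11 - a + (1 + 1))))) := by
  refine of_fiber h0.le (fun t => (multisetRank t - a) / 11) _
    (fun j => (rank_eq h0 h1 (a + 11 * j)).congr fun t => ?_)
    (hasSum_residue h0 h1 (c := 3) (by norm_num) 1 (qPoch x x)⁻¹ 1 ha)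
  constructor
  · rintro ⟨h, h'⟩; exact ⟨⟨h, by omega⟩, by omega⟩
  · rintro ⟨⟨h, h'⟩, h''⟩; exact ⟨h, by omega⟩

end

section

open Filter Topology Finset

/-- The summands of the Durfee rectangle expansion. -/
noncomputable def durfeeTerm (x : ℝ) (m j : ℕ) : ℝ :=
  x ^ (j * (m + j)) * ((qPochFin x x j)⁻¹ * (qPochFin x x (m + j))⁻¹)

/-- The Durfee rectangle expansion with weights. -/
noncomputable def durfeeSum (x : ℝ) (m : ℕ) : ℝ := ∑' j, x ^ (m + j) * durfeeTerm x m j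

variable {x : ℝ}

lemma exists_durfeeTerm_le (h0 : 0 < x) (h1 : x < 1) :
    ∃ C, ∀ m j, ‖durfeeTerm x m j‖ ≤ C * x ^ j := by
  obtain ⟨B, hB⟩ := exists_inv_qPochFin_le h0 h1 (mul_pow_ne_one h0 h1 h1 h0)
  have hB0 := (abs_nonneg _).trans (hB 0)
  refine ⟨B * B, fun m j => ?_⟩
  rw [durfeeTerm, norm_mul, norm_mul, norm_pow, Real.norm_of_nonneg h0.le, mul_comm]
  have h2 : x ^ (j * (m + j)) ≤ x ^ j := pow_le_pow_of_le_one h0.le h1.le (by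
    rcases j with _ | j
    · simp
    · exact Nat.le_mul_of_pos_right _ (by omega))
  gcongr
  exacts [hB j, hB _]

lemma summable_durfeeTerm (h0 : 0 < x) (h1 : x < 1) (m : ℕ) : Summable (durfeeTerm x m) := by
  obtain ⟨C, hC⟩ := exists_durfeeTerm_le h0 h1
  exact Summable.of_norm_bounded ((summable_geometric_of_lt_one h0.le h1).mul_left C) (hC m)

lemma summable_mul_durfeeTerm (h0 : 0 < x) (h1 : x < 1) (m : ℕ) {u : ℕ → ℝ} {C : ℝ}
    (hu : ∀ j, |u j| ≤ C) : Summable fun j => u j * durfeeTerm x m j := by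
  refine Summable.of_norm_bounded ((summable_durfeeTerm h0 h1 m).norm.mul_left C) fun j => ?_
  rw [norm_mul]
  have := hu j
  gcongr
  exact this

lemma abs_one_sub_pow_le (h0 : 0 < x) (h1 : x < 1) (j : ℕ) : |1 - x ^ j| ≤ 1 := by
  have := pow_pos h0 j
  have := pow_le_one₀ (n := j) h0.le h1.le
  rw [abs_of_nonneg] <;> linarith

lemma durfeeTerm_succ_left (h0 : 0 < x) (h1 : x < 1) (m j : ℕ) :
    (1 - x ^ (m + j + 1)) * durfeeTerm x (m + 1) j = x ^ j * durfeeTerm x m j := by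
  have hy : 1 - x ^ (m + j + 1) ≠ 0 := by
    linarith [pow_lt_one₀ (n := m + j + 1) h0.le h1 (by omega)]
  rw [durfeeTerm, durfeeTerm, show m + 1 + j = m + j + 1 by ring, qPochFin_succ x (m + j),
    ← pow_succ', mul_inv, show j * (m + j + 1) = j + j * (m + j) by ring, pow_add x j]
  field_simp

lemma durfeeTerm_succ_right (h0 : 0 < x) (h1 : x < 1) (m j : ℕ) :
    (1 - x ^ (m + j + 1)) * ((1 - x ^ (j + 1)) * durfeeTerm x m (j + 1)) =
      x ^ (m + 2 * j + 1) * durfeeTerm x m j := by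
  have hy : 1 - x ^ (m + j + 1) ≠ 0 := by
    linarith [pow_lt_one₀ (n := m + j + 1) h0.le h1 (by omega)]
  have hz : 1 - x ^ (j + 1) ≠ 0 := by
    linarith [pow_lt_one₀ (n := j + 1) h0.le h1 (by omega)]
  rw [durfeeTerm, durfeeTerm, ← add_assoc m j 1, qPochFin_succ x (m + j), qPochFin_succ x j,
    ← pow_succ', ← pow_succ', mul_inv, mul_inv,
    show (j + 1) * (m + j + 1) = m + 2 * j + 1 + j * (m + j) by ring, pow_add x (m + 2 * j + 1)]
  field_simp

lemma tsum_durfeeTerm (h0 : 0 < x) (h1 : x < 1) (m : ℕ) :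
    ∑' j, durfeeTerm x m j = (qPoch x x)⁻¹ := by
  have step : ∀ m, ∑' j, durfeeTerm x (m + 1) j = ∑' j, durfeeTerm x m j := by
    intro m
    have s := summable_durfeeTerm h0 h1
    have sG := summable_mul_durfeeTerm h0 h1 m (u := fun j => 1 - x ^ j) (abs_one_sub_pow_le h0 h1)
    have e1 := sG.tsum_eq_zero_add
    have e2 := (s m).tsum_sub (s (m + 1))
    have e3 := sG.tsum_sub ((summable_nat_add_iff 1).2 sG)
    rw [show ∑' j, ((1 - x ^ j) * durfeeTerm x m j - (1 - x ^ (j + 1)) * durfeeTerm x m (j + 1)) =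
      ∑' j, (durfeeTerm x m j - durfeeTerm x (m + 1) j) from tsum_congr fun j => ?_] at e3
    · simp only [pow_zero, sub_self, zero_mul, zero_add] at e1
      linarith
    · have hy : 1 - x ^ (m + j + 1) ≠ 0 := by
        linarith [pow_lt_one₀ (n := m + j + 1) h0.le h1 (by omega)]
      refine mul_left_cancel₀ hy ?_
      linear_combination durfeeTerm_succ_left h0 h1 m j - durfeeTerm_succ_right h0 h1 m j
  have const : ∀ n, ∑' j, durfeeTerm x n j = ∑' j, durfeeTerm x 0 j := fun n => by
    induction n with
    | zero => rfl
    | succ n ih => rw [step, ih]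
  obtain ⟨C, hC⟩ := exists_durfeeTerm_le h0 h1
  have hinv := (tendsto_qPochFin h0 h1 x).inv₀ (qPoch_pos h0 h1 h1).ne'
  have lim : Tendsto (fun n => ∑' j, durfeeTerm x n j) atTop
      (𝓝 (∑' j, if j = 0 then (qPoch x x)⁻¹ else 0)) := by
    refine tendsto_tsum_of_dominated_convergence
      ((summable_geometric_of_lt_one h0.le h1).mul_left C) (fun j => ?_)
      (Eventually.of_forall fun n j => hC n j)
    rcases j with _ | j
    · simpa [durfeeTerm, qPochFin] using hinv
    · rw [if_neg (by omega)]
      have t1 := hinv.comp (tendsto_add_atTop_nat (j + 1))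
      have t2 := (tendsto_pow_atTop_nhds_zero_of_lt_one h0.le h1).comp
        (tendsto_id.nsmul_atTop (Nat.succ_pos j) |>.comp (tendsto_add_atTop_nat (j + 1)))
      have := t2.mul (t1.const_mul (qPochFin x x (j + 1))⁻¹)
      rw [zero_mul] at this
      exact this
  rw [tsum_ite_eq] at lim
  simp_rw [const] at lim
  rw [const, tendsto_nhds_unique lim tendsto_const_nhds]

lemma abs_pow_add_le (h0 : 0 < x) (h1 : x < 1) (m j : ℕ) : |x ^ (m + j)| ≤ 1 := by
  rw [abs_of_pos (by positivity)]
  exact pow_le_one₀ h0.le h1.le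

lemma durfeeSum_step (h0 : 0 < x) (h1 : x < 1) (m : ℕ) :
    durfeeSum x m = x ^ m * ((qPoch x x)⁻¹ - durfeeSum x (m + 1)) := by
  have s := summable_durfeeTerm h0 h1 m
  have sK := summable_mul_durfeeTerm h0 h1 m (abs_pow_add_le h0 h1 m)
  have sG := summable_mul_durfeeTerm h0 h1 m (u := fun j => 1 - x ^ j) (abs_one_sub_pow_le h0 h1)
  have e1 := sG.tsum_eq_zero_add
  simp only [pow_zero, sub_self, zero_mul, zero_add] at e1
  have e2 := (s.mul_left (x ^ m)).tsum_sub sK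
  have e3 : ∑' j, (1 - x ^ (j + 1)) * durfeeTerm x m (j + 1) = durfeeSum x (m + 1) := by
    refine tsum_congr fun j => ?_
    have hy : 1 - x ^ (m + j + 1) ≠ 0 := by
      linarith [pow_lt_one₀ (n := m + j + 1) h0.le h1 (by omega)]
    refine mul_left_cancel₀ hy ?_
    have := durfeeTerm_succ_left h0 h1 m j
    rw [durfeeTerm_succ_right h0 h1, mul_left_comm, this, ← mul_assoc, ← pow_add]
    congr 2; ring
  rw [tsum_mul_left, tsum_durfeeTerm h0 h1, ← durfeeSum,
    tsum_congr (fun j => show x ^ m * durfeeTerm x m j - x ^ (m + j) * durfeeTerm x m j =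
      x ^ m * ((1 - x ^ j) * durfeeTerm x m j) by rw [pow_add]; ring), tsum_mul_left, e1, e3] at e2
  linarith

lemma durfeeSum_eq (h0 : 0 < x) (h1 : x < 1) (m : ℕ) :
    durfeeSum x m = (qPoch x x)⁻¹ * halfTheta x 1 m := by
  have hpos : ∀ j, 0 < qPochFin x x j := fun j => by
    refine Finset.prod_pos fun i _ => sub_pos.2 ?_
    rw [← pow_succ']
    exact pow_lt_one₀ h0.le h1 (by omega)
  have nn : ∀ m j, 0 ≤ durfeeTerm x m j := fun m j => by
    have := hpos j
    have := hpos (m + j)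
    rw [durfeeTerm]
    positivity
  have key : ∀ m : ℕ, durfeeSum x (m + 1) = (qPoch x x)⁻¹ * halfTheta x 1 (m + 1) := fun m => by
    refine mul_eq_halfTheta_of_step (a := fun m => durfeeSum x (m + 1)) (C := (qPoch x x)⁻¹)
      h0 h1 le_rfl (inv_ne_zero (qPoch_pos h0 h1 h1).ne') (fun m => ?_)
      (fun m => durfeeSum_step h0 h1 (m + 1)) m
    have s := summable_durfeeTerm h0 h1 (m + 1)
    have sK := summable_mul_durfeeTerm h0 h1 (m + 1) (abs_pow_add_le h0 h1 (m + 1))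
    rw [durfeeSum, abs_of_nonneg (tsum_nonneg fun j => mul_nonneg (by positivity) (nn _ _)),
      ← tsum_durfeeTerm h0 h1 (m + 1)]
    exact sK.tsum_le_tsum (fun j => mul_le_of_le_one_left (nn _ _) (pow_le_one₀ h0.le h1.le)) s
  rw [durfeeSum_step h0 h1, key, halfTheta_step h0 h1 le_rfl m, zpow_natCast]
  push_cast
  ring

/-- The generating function of the partitions with crank data `(j, k)`, up to small corrections. -/
noncomputable def crankTerm (x : ℝ) (j k : ℕ) : ℝ :=
  (1 - x) * x ^ (j * k + j + k) * ((qPochFin x x j)⁻¹ * (qPochFin x x k)⁻¹)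

lemma crankTerm_comm (j k : ℕ) : crankTerm x j k = crankTerm x k j := by
  rw [crankTerm, crankTerm, mul_comm (qPochFin x x j)⁻¹]
  congr 3; ring

lemma hasSum_crankTerm (h0 : 0 < x) (h1 : x < 1) (m : ℕ) :
    HasSum (fun j => crankTerm x j (m + j))
      ((qPoch x x)⁻¹ * (halfTheta x 1 m - halfTheta x 1 (m + 1))) := by
  have sK := fun m => summable_mul_durfeeTerm h0 h1 m (abs_pow_add_le h0 h1 m)
  have sG := summable_mul_durfeeTerm h0 h1 m (u := fun j => x ^ (m + j) * (1 - x ^ j)) (C := 1)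
    fun j => by
      rw [abs_mul]
      exact mul_le_one₀ (abs_pow_add_le h0 h1 m j) (abs_nonneg _) (abs_one_sub_pow_le h0 h1 j)
  have sG' := (summable_nat_add_iff 1).2 sG
  have e1 := sG.tsum_eq_zero_add
  simp only [pow_zero, sub_self, mul_zero, zero_mul, zero_add] at e1
  have hs := (((sK m).hasSum.sub (sK (m + 1)).hasSum).add sG'.hasSum).sub sG.hasSum
  rw [← durfeeSum, ← durfeeSum, e1, add_sub_cancel_right, durfeeSum_eq h0 h1, durfeeSum_eq h0 h1,
    ← mul_sub] at hs
  push_cast at hs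
  refine hs.congr_fun fun j => ?_
  have hy : 1 - x ^ (m + j + 1) ≠ 0 := by
    linarith [pow_lt_one₀ (n := m + j + 1) h0.le h1 (by omega)]
  have e : crankTerm x j (m + j) = (1 - x) * x ^ (m + 2 * j) * durfeeTerm x m j := by
    rw [crankTerm, durfeeTerm, show j * (m + j) + j + (m + j) = m + 2 * j + j * (m + j) by ring,
      pow_add x (m + 2 * j)]
    ring
  refine mul_left_cancel₀ hy ?_
  rw [e]
  have a1 := durfeeTerm_succ_left h0 h1 m j
  have a2 := durfeeTerm_succ_right h0 h1 m j
  linear_combination x ^ (m + 1 + j) * a1 - x ^ (m + (j + 1)) * a2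
end

section

open Filter Topology Finset

/-- The crank of a multiset of positive integers, read as a partition. -/
def multisetCrank (s : Multiset ℕ) : ℤ :=
  if s.count 1 = 0 then (s.sup : ℤ)
  else (Multiset.card (s.filter fun i => s.count 1 < i) : ℤ) - s.count 1

variable {x : ℝ}

namespace MSum

/-- Multisets with all elements between `2` and `j + 1`. -/
lemma mem_between (h0 : 0 < x) (h1 : x < 1) (j : ℕ) :
    MSum x (fun s => ∀ i ∈ s, 2 ≤ i ∧ i ≤ j + 1) ((1 - x) * (qPochFin x x (j + 1))⁻¹) := by
  induction j with
  | zero =>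
    have hx : 1 - x ≠ 0 := by linarith
    rw [show (1 - x) * (qPochFin x x (0 + 1))⁻¹ = x ^ (0 : Multiset ℕ).sum by simp [qPochFin, hx]]
    refine (single 0).congr fun s => ?_
    exact ⟨by rintro rfl; simp, fun h => Multiset.eq_zero_of_forall_notMem fun a ha => by
      have := h a ha; omega⟩
  | succ j ih =>
    have hg : HasSum (fun a : ℕ => (x ^ (j + 2)) ^ a) (1 - x ^ (j + 2))⁻¹ :=
      hasSum_geometric_of_lt_one (by positivity) (pow_lt_one₀ h0.le h1 (by omega))
    have h := hg.mul ih.hasSum_subtype (hg.summable.mul_of_nonneg ih.hasSum_subtype.summable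
      (fun _ => by positivity) fun _ => by positivity)
    have := of_bij (Q := fun s => ∀ i ∈ s, 2 ≤ i ∧ i ≤ j + 1 + 1) h 0 h0.ne'
      (fun p => p.2.1 + Multiset.replicate p.1 (j + 2)) ?_ ?_ ?_
    · convert this using 1
      rw [qPochFin_succ x (j + 1), ← pow_succ', mul_inv]
      ring
    · rintro ⟨a, s, hs⟩ ⟨b, t, ht⟩ hab
      simp only at hab
      have hs' : j + 2 ∉ s := fun h => by have := hs _ h; omega
      have ht' : j + 2 ∉ t := fun h => by have := ht _ h; omega
      have e := congrArg (Multiset.count (j + 2)) hab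
      simp only [Multiset.count_add, Multiset.count_eq_zero_of_notMem hs',
        Multiset.count_eq_zero_of_notMem ht', Multiset.count_replicate_self, zero_add] at e
      subst e
      rw [Prod.mk.injEq, Subtype.mk.injEq]
      exact ⟨rfl, add_right_cancel hab⟩
    · intro t
      constructor
      · intro ht
        refine ⟨(t.count (j + 2), ⟨t.filter (· ≠ j + 2), fun i hi => ?_⟩), ?_⟩
        · have h := Multiset.mem_filter.1 hi
          have := ht i h.1
          have := h.2
          omega
        · ext i
          simp only [Multiset.count_add, Multiset.count_filter, Multiset.count_replicate]
          by_cases h : i = j + 2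
          · simp [h]
          · simp [h, Ne.symm h]
      · rintro ⟨⟨a, s, hs⟩, rfl⟩ i hi
        rcases Multiset.mem_add.1 hi with h | h
        · have := hs i h; omega
        · rw [Multiset.eq_of_mem_replicate h]; omega
    · rintro ⟨a, s, hs⟩
      simp only [Multiset.sum_add, Multiset.sum_replicate, smul_eq_mul, pow_zero, mul_one]
      rw [← pow_mul, ← pow_add]
      congr 1; ring

/-- Partitions with `j + 1` ones and `k` parts larger than `j + 1`. -/
lemma count_one (h0 : 0 < x) (h1 : x < 1) (j k : ℕ) :
    MSum x (fun s => 0 ∉ s ∧ s.count 1 = j + 1 ∧ Multiset.card (s.filter (j + 1 < ·)) = k)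
      (crankTerm x (j + 1) k) := by
  have := (mem_between h0 h1 j).prod h0 (card_eq_gt h0 h1 (j + 1) k) (j + 1)
    (fun s t => s + t + Multiset.replicate (j + 1) 1)
    (fun u => u.filter fun i => 2 ≤ i ∧ i ≤ j + 1) (fun u => u.filter (j + 1 < ·))
    (R := fun s => 0 ∉ s ∧ s.count 1 = j + 1 ∧ Multiset.card (s.filter (j + 1 < ·)) = k) ?_ ?_ ?_ ?_
  · convert this using 1
    rw [crankTerm, show (j + 1) * k + (j + 1) + k = (j + 1) + k * (j + 1 + 1) by ring,
      pow_add x (j + 1)]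
    ring
  · rintro s t hs ⟨hk, ht⟩
    have s0 : 0 ∉ s := fun h => by have := hs _ h; omega
    have t0 : 0 ∉ t := fun h => by have := ht _ h; omega
    have s1 : 1 ∉ s := fun h => by have := hs _ h; omega
    have t1 : 1 ∉ t := fun h => by have := ht _ h; omega
    refine ⟨?_, ?_, ?_⟩
    · simp [s0, t0, Multiset.mem_replicate]
    · simp [s1, t1]
    · rw [Multiset.filter_add, Multiset.filter_add, Multiset.filter_eq_nil.2 fun a ha => by
        have := hs a ha; omega, Multiset.filter_eq_self.2 ht, Multiset.filter_eq_nil.2 fun a ha => by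
        rw [Multiset.eq_of_mem_replicate ha]; omega]
      simpa using hk
  · rintro u ⟨u0, u1, uk⟩
    refine ⟨fun i hi => (Multiset.mem_filter.1 hi).2,
      ⟨uk, fun i hi => (Multiset.mem_filter.1 hi).2⟩, ?_⟩
    ext i
    simp only [Multiset.count_add, Multiset.count_filter, Multiset.count_replicate]
    rcases Nat.lt_or_ge i 2 with h | h
    · interval_cases i
      · simp [u0]
      · simp [u1]
    · rw [if_neg (by omega : ¬ 1 = i), add_zero]
      by_cases h' : i ≤ j + 1
      · rw [if_pos ⟨h, h'⟩, if_neg (by omega), add_zero]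
      · rw [if_neg (by omega), if_pos (by omega), zero_add]
  · rintro s t hs ⟨-, ht⟩
    constructor
    · rw [Multiset.filter_add, Multiset.filter_add, Multiset.filter_eq_self.2 hs,
        Multiset.filter_eq_nil.2 fun a ha => by
          have := ht a ha; omega, Multiset.filter_eq_nil.2 fun a ha => by
        rw [Multiset.eq_of_mem_replicate ha]; omega]
      simp
    · rw [Multiset.filter_add, Multiset.filter_add, Multiset.filter_eq_nil.2 fun a ha => by
        have := hs a ha; omega, Multiset.filter_eq_self.2 ht, Multiset.filter_eq_nil.2 fun a ha => by
        rw [Multiset.eq_of_mem_replicate ha]; omega]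
      simp
  · intro s t _ _
    simp only [Multiset.sum_add, Multiset.sum_replicate, smul_eq_mul, mul_one]

/-- Partitions without ones with largest part `k`. -/
lemma sup_eq (h0 : 0 < x) (h1 : x < 1) (k : ℕ) :
    MSum x (fun s => 0 ∉ s ∧ s.count 1 = 0 ∧ s.sup = k)
      (crankTerm x 0 k + ((if k = 0 then x else 0) - if k = 1 then x else 0)) := by
  have hx : 1 - x ≠ 0 := by linarith
  rcases k with _ | _ | k
  · rw [show crankTerm x 0 0 + ((if 0 = 0 then x else 0) - if 0 = 1 then x else 0) =
      x ^ (0 : Multiset ℕ).sum by simp [crankTerm, qPochFin]]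
    refine (single 0).congr fun s => ?_
    constructor
    · rintro rfl; simp
    · rintro ⟨hs, -, h⟩
      refine Multiset.eq_zero_of_forall_notMem fun a ha => ?_
      have := Multiset.le_sup ha
      have : a ≠ 0 := fun e => hs (e ▸ ha)
      omega
  · convert empty ?_ using 1
    · simp [crankTerm, qPochFin]
      field_simp
      ring
    · rintro s ⟨hs, h, h'⟩
      have : s ≠ 0 := by rintro rfl; simp at h'
      have := sup_mem_of_ne_zero this
      rw [h'] at this
      exact Multiset.count_eq_zero.1 h this
  · have := (mem_between h0 h1 (k + 1)).bij h0.ne' (k + 2) (fun s => (k + 2) ::ₘ s)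
      (fun s => s.erase (k + 2)) (Q := fun s => 0 ∉ s ∧ s.count 1 = 0 ∧ s.sup = k + 2)
      ?_ ?_ ?_ ?_ ?_
    · convert this using 1
      simp [crankTerm, qPochFin]
      ring
    · intro s hs
      refine ⟨fun h => ?_, ?_, ?_⟩
      · rcases Multiset.mem_cons.1 h with h | h
        · omega
        · have := hs _ h; omega
      · refine Multiset.count_eq_zero.2 fun h => ?_
        rcases Multiset.mem_cons.1 h with h | h
        · omega
        · have := hs _ h; omega
      · rw [Multiset.sup_cons, sup_eq_left, Multiset.sup_le]
        exact fun b hb => (hs b hb).2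
    · rintro t ⟨t0, t1, tk⟩ i hi
      have hi := Multiset.mem_of_mem_erase hi
      have h0 : i ≠ 0 := fun e => t0 (e ▸ hi)
      have h1 : i ≠ 1 := fun e => Multiset.count_eq_zero.1 t1 (e ▸ hi)
      have := Multiset.le_sup hi
      omega
    · intro s _
      exact Multiset.erase_cons_head _ _
    · rintro t ⟨t0, t1, tk⟩
      refine Multiset.cons_erase ?_
      rw [← tk]
      refine sup_mem_of_ne_zero ?_
      rintro rfl
      simp at tk
    · intro s _
      rw [Multiset.sum_cons, add_comm]

lemma crank_eq (h0 : 0 < x) (h1 : x < 1) (m : ℤ) :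
    MSum x (fun t => 0 ∉ t ∧ multisetCrank t = m) (((if m = 0 then x else 0) +
      (qPoch x x)⁻¹ * (halfTheta x 1 (|m| + 0) - halfTheta x 1 (|m| + (0 + 1)))) -
        if m = 1 then x else 0) := by
  rw [add_zero, zero_add]
  rcases le_or_gt 0 m with hm | hm
  · lift m to ℕ using hm
    rw [Nat.abs_cast]
    have hs := (hasSum_crankTerm h0 h1 m).add
      (hasSum_ite_eq 0 ((if (m : ℤ) = 0 then x else 0) - if (m : ℤ) = 1 then x else 0))
    have hs' := of_fiber (P := fun t => 0 ∉ t ∧ multisetCrank t = m) h0.le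
      (fun s => s.count 1) _ (fun j => ?_) hs
    · convert hs' using 1
      ring
    rcases j with _ | j
    · have h := sup_eq h0 h1 m
      rw [if_pos rfl, add_zero]
      simp only [Nat.cast_eq_zero, Nat.cast_eq_one]
      refine h.congr fun s => ?_
      rw [multisetCrank]
      constructor
      · rintro ⟨hs, h, h'⟩; simp [hs, h, h']
      · rintro ⟨⟨hs, h⟩, h'⟩; rw [if_pos h'] at h; exact ⟨hs, h', by exact_mod_cast h⟩
    · rw [if_neg (Nat.succ_ne_zero j), add_zero]
      refine (count_one h0 h1 j (m + (j + 1))).congr fun s => ?_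
      rw [multisetCrank]
      constructor
      · rintro ⟨hs, h, h'⟩
        rw [h, if_neg (by omega), h']
        exact ⟨⟨hs, by push_cast; ring⟩, rfl⟩
      · rintro ⟨⟨hs, h⟩, h'⟩
        rw [h', if_neg (by omega)] at h
        exact ⟨hs, h', by omega⟩
  · obtain ⟨n, rfl⟩ : ∃ n : ℕ, m = -((n + 1 : ℕ) : ℤ) := ⟨(-m - 1).toNat, by omega⟩
    rw [abs_neg, Nat.abs_cast, if_neg (by omega), if_neg (by omega), zero_add, sub_zero]
    refine of_fiber h0.le (fun s => Multiset.card (s.filter fun i => s.count 1 < i)) _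
      (fun k => ?_) (hasSum_crankTerm h0 h1 (n + 1))
    rw [crankTerm_comm]
    have h := count_one h0 h1 (n + k) k
    rw [show n + k + 1 = n + 1 + k by ring] at h
    refine h.congr fun s => ?_
    rw [multisetCrank]
    constructor
    · rintro ⟨hs, h, h'⟩
      rw [h, if_neg (by omega), h']
      exact ⟨⟨hs, by push_cast; ring⟩, rfl⟩
    · rintro ⟨⟨hs, h⟩, h'⟩
      have hc : s.count 1 ≠ 0 := by
        intro h0
        rw [if_pos h0] at h
        omega
      rw [if_neg hc] at h
      have hc' : s.count 1 = n + 1 + k := by omega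
      rw [hc'] at h'
      exact ⟨hs, hc', h'⟩

/-- The generating function of the partitions whose crank lies in a residue class. -/
lemma crank_mod (h0 : 0 < x) (h1 : x < 1) {a : ℕ} (ha : a ≤ 10) :
    MSum x (fun t => 0 ∉ t ∧ multisetCrank t % 11 = (a : ℤ) % 11)
      (((if a = 0 then x else 0) + (qPoch x x)⁻¹ *
        (halfLambert x 1 (a + 0) - halfLambert x 1 (a + (0 + 1)) +
          (halfLambert x 1 (11 - a + 0) - halfLambert x 1 (11 - a + (0 + 1))))) -
        if a = 1 then x else 0) := by
  have hs := (hasSum_residue h0 h1 (c := 1) le_rfl x (qPoch x x)⁻¹ 0 ha).sub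
    (hasSum_ite_eq (0 : ℤ) (if a = 1 then x else 0))
  refine of_fiber h0.le (fun t => (multisetCrank t - a) / 11) _
    (fun j => ?_) hs
  have e : (if j = 0 then if a = 1 then x else 0 else 0) = if (a + 11 * j : ℤ) = 1 then x else 0 := by
    by_cases h : j = 0
    · simp [h]
    · rw [if_neg h, if_neg (by omega)]
  rw [e]
  refine (crank_eq h0 h1 (a + 11 * j)).congr fun t => ?_
  constructor
  · rintro ⟨h, h'⟩; exact ⟨⟨h, by omega⟩, by omega⟩
  · rintro ⟨⟨h, h'⟩, h''⟩; exact ⟨h, by omega⟩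

end MSum

end

section

open Filter Topology Finset

variable {x V : ℝ}

lemma HasSum.congr_val {f : ℕ → ℝ} {v w : ℝ} (h : HasSum f v) (e : v = w) : HasSum f w := e ▸ h

lemma MSum.hasSum_card {P : Multiset ℕ → Prop} {v : ℝ} (h0 : 0 < x)
    (h : MSum x (fun s => 0 ∉ s ∧ P s) v) (p : ∀ n, Nat.Partition n → Prop)
    [∀ n, DecidablePred (p n)] (hp : ∀ n π, p n π ↔ P π.parts) :
    HasSum (fun n => ((univ.filter (p n)).card : ℝ) * x ^ n) v := by
  refine h.fiber Multiset.sum _ fun n => ?_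
  have hF : HasSum (fun _ : ↥(univ.filter (p n)) => (1 : ℝ)) (univ.filter (p n)).card := by
    have := hasSum_fintype fun _ : ↥(univ.filter (p n)) => (1 : ℝ)
    rwa [sum_const, card_univ, Fintype.card_coe, nsmul_eq_mul, mul_one] at this
  refine of_bij hF n h0.ne' (fun π => π.1.parts) (fun π σ e => ?_) (fun t => ?_) fun π => ?_
  · exact Subtype.ext (Nat.Partition.ext e)
  · constructor
    · rintro ⟨⟨h0, ht⟩, hn⟩
      refine ⟨⟨⟨t, fun {i} hi => Nat.pos_of_ne_zero fun e => h0 (e ▸ hi), hn⟩, ?_⟩, rfl⟩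
      rw [mem_filter]
      exact ⟨mem_univ _, (hp _ _).2 ht⟩
    · rintro ⟨π, rfl⟩
      exact ⟨⟨fun h => (π.1.parts_pos h).false, (hp _ _).1 (mem_filter.1 π.2).2⟩, π.1.parts_sum⟩
  · rw [π.1.parts_sum, one_mul]

lemma hasSum_rankCount (h0 : 0 < V) (h1 : V < 1) {a : ℕ} (ha : a ≤ 10) :
    HasSum (fun n => (rankCount a 11 n : ℝ) * (V ^ 2) ^ n)
      ((if a = 0 then 1 else 0) +
        (qPoch (V ^ 2) (V ^ 2))⁻¹ * (rankSeries V (a + 1) - rankSeries V a)) := by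
  have h0' : 0 < V ^ 2 := by positivity
  have h1' : V ^ 2 < 1 := pow_lt_one₀ h0.le h1 (by norm_num)
  have h := (MSum.rank_mod h0' h1' ha).hasSum_card h0'
    (fun n π => partitionRank π % 11 = (a : ℤ) % 11) fun n π => Iff.rfl
  rw [rankSeries_eq h0 h1, rankSeries_eq h0 h1]
  refine (h.congr_fun fun n => rfl).congr_val ?_
  ring_nf

lemma hasSum_crankCount (h0 : 0 < V) (h1 : V < 1) {a : ℕ} (ha : a ≤ 9) :
    HasSum (fun n => (crankCount a n : ℝ) * (V ^ 2) ^ n)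
      ((qPoch (V ^ 2) (V ^ 2))⁻¹ * (crankSeries V (a + 1) - crankSeries V a)) := by
  have h0' : 0 < V ^ 2 := by positivity
  have h1' : V ^ 2 < 1 := pow_lt_one₀ h0.le h1 (by norm_num)
  have h := ((MSum.crank_mod h0' h1' (ha.trans (by norm_num))).hasSum_card h0'
    (fun n π => partitionCrank π % 11 = (a : ℤ) % 11) fun n π => Iff.rfl).add
      (hasSum_ite_eq (1 : ℕ) ((if a = 1 then V ^ 2 else 0) - if a = 0 then V ^ 2 else 0))
  have e : (univ.filter fun π : Nat.Partition 1 => partitionCrank π % 11 = (a : ℤ) % 11) = ∅ := by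
    refine filter_eq_empty_iff.2 fun π _ => ?_
    rw [Subsingleton.elim π (Nat.Partition.indiscrete 1)]
    have : partitionCrank (Nat.Partition.indiscrete 1) = -1 := by decide
    rw [this]
    omega
  rw [crankSeries_eq h0 h1, crankSeries_eq h0 h1]
  refine HasSum.congr_val (HasSum.congr_fun h fun n => ?_) ?_
  · by_cases hn : n = 1
    · subst hn
      rw [e, crankCount, if_pos rfl, if_pos rfl, card_empty, pow_one]
      rcases a with _ | _ | a
      · norm_num
      · norm_num
      · rw [if_neg (by omega), if_neg (by omega), if_neg (by omega), if_neg (by omega)]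
        norm_num
    · rw [crankCount, if_neg hn, if_neg hn, add_zero]
      norm_cast
  · ring_nf

/-- The linear combinations of rank and crank counts in which the main terms cancel. -/
lemma hasSum_combSeries (h0 : 0 < V) (h1 : V < 1) {n₀ n₁ n₂ n₃ n₄ n₅ m₀ m₁ m₂ : ℤ}
    (h : n₀ + n₁ + n₂ + n₃ + n₄ + n₅ + m₀ + m₁ + m₂ = 0) :
    HasSum (fun n => ((n₀ * rankCount 0 11 n + n₁ * rankCount 1 11 n + n₂ * rankCount 2 11 n +
      n₃ * rankCount 3 11 n + n₄ * rankCount 4 11 n + n₅ * rankCount 5 11 n +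
      m₀ * crankCount 0 n + m₁ * crankCount 1 n + m₂ * crankCount 2 n : ℤ) : ℝ) * (V ^ 2) ^ n)
      (combSeries n₀ n₁ n₂ n₃ n₄ n₅ m₀ m₁ m₂ V) := by
  have hE : qPoch (V ^ 2) (V ^ 2) ≠ 0 := by
    have h1' : V ^ 2 < 1 := pow_lt_one₀ h0.le h1 (by norm_num)
    exact (qPoch_pos (by positivity) h1' h1').ne'
  have s0 := (hasSum_rankCount h0 h1 (a := 0) (by norm_num)).mul_left (n₀ : ℝ)
  have s1 := (hasSum_rankCount h0 h1 (a := 1) (by norm_num)).mul_left (n₁ : ℝ)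
  have s2 := (hasSum_rankCount h0 h1 (a := 2) (by norm_num)).mul_left (n₂ : ℝ)
  have s3 := (hasSum_rankCount h0 h1 (a := 3) (by norm_num)).mul_left (n₃ : ℝ)
  have s4 := (hasSum_rankCount h0 h1 (a := 4) (by norm_num)).mul_left (n₄ : ℝ)
  have s5 := (hasSum_rankCount h0 h1 (a := 5) (by norm_num)).mul_left (n₅ : ℝ)
  have t0 := (hasSum_crankCount h0 h1 (a := 0) (by norm_num)).mul_left (m₀ : ℝ)
  have t1 := (hasSum_crankCount h0 h1 (a := 1) (by norm_num)).mul_left (m₁ : ℝ)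
  have t2 := (hasSum_crankCount h0 h1 (a := 2) (by norm_num)).mul_left (m₂ : ℝ)
  have r1 := rankSeries_symm h0 h1 11
  have r4 := rankSeries_symm h0 h1 8
  have r6 := rankSeries_symm h0 h1 6
  have r0 := rankSeries_zero h0 h1
  have r3 := rankSeries_three h0 h1
  have c0 := crankSeries_zero h0 h1
  norm_num at s0 s1 s2 s3 s4 s5 t0 t1 t2 r1 r4 r6
  refine HasSum.congr_val (HasSum.congr_fun
    ((((((((s0.add s1).add s2).add s3).add s4).add s5).add t0).add t1).add t2) fun n => ?_) ?_
  · push_cast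
    ring
  · have hm : (m₂ : ℝ) = -(n₀ + n₁ + n₂ + n₃ + n₄ + n₅ + m₀ + m₁) := by
      have : m₂ = -(n₀ + n₁ + n₂ + n₃ + n₄ + n₅ + m₀ + m₁) := by linarith
      rw [this]; push_cast; ring
    have r6' : rankSeries V 6 = 0 := by linarith
    simp only [combSeries, rankQuot, crankQuot]
    norm_num
    rw [r1, r4, r6', r0, r3, c0, hm]
    have hV : V ^ (-2 : ℤ) = (V ^ 2)⁻¹ := by rw [zpow_neg]; rfl
    simp only [hV]
    field_simp
    ring

lemma NonnegOn.comb_nonneg {d n₀ n₁ n₂ n₃ n₄ n₅ m₀ m₁ m₂ : ℤ}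
    (hc : NonnegOn d (combSeries n₀ n₁ n₂ n₃ n₄ n₅ m₀ m₁ m₂))
    (h : n₀ + n₁ + n₂ + n₃ + n₄ + n₅ + m₀ + m₁ + m₂ = 0) {n : ℕ} (hn : n ≡ d [ZMOD 11]) :
    0 ≤ n₀ * rankCount 0 11 n + n₁ * rankCount 1 11 n + n₂ * rankCount 2 11 n +
      n₃ * rankCount 3 11 n + n₄ * rankCount 4 11 n + n₅ * rankCount 5 11 n +
      m₀ * crankCount 0 n + m₁ * crankCount 1 n + m₂ * crankCount 2 n := by
  exact_mod_cast hc.coeff_nonneg (fun V h0 h1 => hasSum_combSeries h0 h1 h) hn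

lemma natCast_modEq_eleven (n d : ℕ) : ((11 * n + d : ℕ) : ℤ) ≡ d [ZMOD 11] := by
  rw [Int.ModEq]
  push_cast
  omega

end

/-- Two-term and four-term rank-crank inequalities, residues zero to five. -/
theorem rank_crank_two_and_four_term_residues_zero_to_five (n : ℕ) :
    (crankCount 1 (11  *  n) ≥ (rankCount 4 11 (11  *  n) : ℤ))
    ∧ ((rankCount 2 11 (11  *  n) : ℤ)  +  (rankCount 3 11 (11  *  n) : ℤ) ≥ (rankCount 4 11 (11  *  n) : ℤ)  +  crankCount 1 (11  *  n))
    ∧ ((rankCount 2 11 (11  *  n  +  1) : ℤ) ≥ crankCount 2 (11  *  n  +  1))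
    ∧ (crankCount 2 (11  *  n  +  1) ≥ (rankCount 4 11 (11  *  n  +  1) : ℤ))
    ∧ ((rankCount 2 11 (11  *  n  +  1) : ℤ)  +  (rankCount 4 11 (11  *  n  +  1) : ℤ) ≥ (rankCount 3 11 (11  *  n  +  1) : ℤ)  +  (rankCount 5 11 (11  *  n  +  1) : ℤ))
    ∧ ((rankCount 1 11 (11  *  n  +  2) : ℤ) ≥ crankCount 2 (11  *  n  +  2))
    ∧ (crankCount 0 (11  *  n  +  2) ≥ (rankCount 5 11 (11  *  n  +  2) : ℤ))
    ∧ (2 * crankCount 0 (11  *  n  +  2) ≥ (rankCount 2 11 (11  *  n  +  2) : ℤ)  +  (rankCount 5 11 (11  *  n  +  2) : ℤ))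
    ∧ ((rankCount 2 11 (11  *  n  +  2) : ℤ)  +  crankCount 0 (11  *  n  +  2) ≥ (rankCount 0 11 (11  *  n  +  2) : ℤ)  +  (rankCount 5 11 (11  *  n  +  2) : ℤ))
    ∧ ((rankCount 1 11 (11  *  n  +  2) : ℤ)  +  (rankCount 3 11 (11  *  n  +  2) : ℤ) ≥ crankCount 0 (11  *  n  +  2)  +  crankCount 2 (11  *  n  +  2))
    ∧ ((rankCount 1 11 (11  *  n  +  2) : ℤ)  +  (rankCount 5 11 (11  *  n  +  2) : ℤ) ≥ (rankCount 4 11 (11  *  n  +  2) : ℤ)  +  crankCount 2 (11  *  n  +  2))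
    ∧ ((rankCount 0 11 (11  *  n  +  3) : ℤ) ≥ crankCount 0 (11  *  n  +  3))
    ∧ (crankCount 1 (11  *  n  +  3) ≥ (rankCount 4 11 (11  *  n  +  3) : ℤ))
    ∧ ((rankCount 0 11 (11  *  n  +  3) : ℤ)  +  crankCount 0 (11  *  n  +  3) ≥ 2 * (rankCount 2 11 (11  *  n  +  3) : ℤ))
    ∧ ((rankCount 2 11 (11  *  n  +  3) : ℤ)  +  crankCount 1 (11  *  n  +  3) ≥ (rankCount 4 11 (11  *  n  +  3) : ℤ)  +  crankCount 0 (11  *  n  +  3))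
    ∧ ((rankCount 0 11 (11  *  n  +  3) : ℤ)  +  (rankCount 3 11 (11  *  n  +  3) : ℤ) ≥ (rankCount 2 11 (11  *  n  +  3) : ℤ)  +  crankCount 1 (11  *  n  +  3))
    ∧ ((rankCount 1 11 (11  *  n  +  4) : ℤ) ≥ crankCount 0 (11  *  n  +  4))
    ∧ (2 * (rankCount 1 11 (11  *  n  +  4) : ℤ) ≥ (rankCount 0 11 (11  *  n  +  4) : ℤ)  +  crankCount 0 (11  *  n  +  4))
    ∧ ((rankCount 1 11 (11  *  n  +  4) : ℤ)  +  crankCount 1 (11  *  n  +  4) ≥ (rankCount 2 11 (11  *  n  +  4) : ℤ)  +  crankCount 0 (11  *  n  +  4))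
    ∧ ((rankCount 1 11 (11  *  n  +  4) : ℤ)  +  (rankCount 3 11 (11  *  n  +  4) : ℤ) ≥ 2 * crankCount 0 (11  *  n  +  4))
    ∧ ((rankCount 2 11 (11  *  n  +  5) : ℤ) ≥ crankCount 0 (11  *  n  +  5))
    ∧ (crankCount 2 (11  *  n  +  5) ≥ (rankCount 5 11 (11  *  n  +  5) : ℤ))
    ∧ ((rankCount 2 11 (11  *  n  +  5) : ℤ)  +  (rankCount 3 11 (11  *  n  +  5) : ℤ) ≥ crankCount 0 (11  *  n  +  5)  +  crankCount 2 (11  *  n  +  5))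
    ∧ ((rankCount 2 11 (11  *  n  +  5) : ℤ)  +  crankCount 2 (11  *  n  +  5) ≥ (rankCount 0 11 (11  *  n  +  5) : ℤ)  +  (rankCount 5 11 (11  *  n  +  5) : ℤ))
    ∧ ((rankCount 0 11 (11  *  n  +  5) : ℤ)  +  crankCount 0 (11  *  n  +  5) ≥ (rankCount 1 11 (11  *  n  +  5) : ℤ)  +  (rankCount 4 11 (11  *  n  +  5) : ℤ))
    ∧ ((rankCount 2 11 (11  *  n  +  5) : ℤ)  +  (rankCount 3 11 (11  *  n  +  5) : ℤ) ≥ (rankCount 1 11 (11  *  n  +  5) : ℤ)  +  (rankCount 5 11 (11  *  n  +  5) : ℤ))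
    ∧ ((rankCount 0 11 (11  *  n  +  5) : ℤ)  +  (rankCount 2 11 (11  *  n  +  5) : ℤ) ≥ (rankCount 1 11 (11  *  n  +  5) : ℤ)  +  crankCount 0 (11  *  n  +  5)) := by
  have h0 : ((11 * n : ℕ) : ℤ) ≡ 0 [ZMOD 11] := natCast_modEq_eleven n 0
  refine ⟨?_, ?_, ?_, ?_, ?_, ?_, ?_, ?_, ?_, ?_, ?_, ?_, ?_, ?_, ?_, ?_, ?_, ?_, ?_, ?_, ?_, ?_, ?_,
    ?_, ?_, ?_, ?_⟩
  · linarith [nonnegOn_zero_M1_sub_N4.comb_nonneg (by norm_num) h0]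
  · linarith [nonnegOn_zero_N2N3_sub_N4M1.comb_nonneg (by norm_num) h0]
  · linarith [nonnegOn_one_N2_sub_M2.comb_nonneg (by norm_num) (natCast_modEq_eleven n 1)]
  · linarith [nonnegOn_one_M2_sub_N4.comb_nonneg (by norm_num) (natCast_modEq_eleven n 1)]
  · linarith [nonnegOn_one_N2N4_sub_N3N5.comb_nonneg (by norm_num) (natCast_modEq_eleven n 1)]
  · linarith [nonnegOn_two_N1_sub_M2.comb_nonneg (by norm_num) (natCast_modEq_eleven n 2)]
  · linarith [nonnegOn_two_M0_sub_N5.comb_nonneg (by norm_num) (natCast_modEq_eleven n 2)]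
  · linarith [nonnegOn_two_M0M0_sub_N2N5.comb_nonneg (by norm_num) (natCast_modEq_eleven n 2)]
  · linarith [nonnegOn_two_N2M0_sub_N0N5.comb_nonneg (by norm_num) (natCast_modEq_eleven n 2)]
  · linarith [nonnegOn_two_N1N3_sub_M0M2.comb_nonneg (by norm_num) (natCast_modEq_eleven n 2)]
  · linarith [nonnegOn_two_N1N5_sub_N4M2.comb_nonneg (by norm_num) (natCast_modEq_eleven n 2)]
  · linarith [nonnegOn_three_N0_sub_M0.comb_nonneg (by norm_num) (natCast_modEq_eleven n 3)]
  · linarith [nonnegOn_three_M1_sub_N4.comb_nonneg (by norm_num) (natCast_modEq_eleven n 3)]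
  · linarith [nonnegOn_three_N0M0_sub_N2N2.comb_nonneg (by norm_num) (natCast_modEq_eleven n 3)]
  · linarith [nonnegOn_three_N2M1_sub_N4M0.comb_nonneg (by norm_num) (natCast_modEq_eleven n 3)]
  · linarith [nonnegOn_three_N0N3_sub_N2M1.comb_nonneg (by norm_num) (natCast_modEq_eleven n 3)]
  · linarith [nonnegOn_four_N1_sub_M0.comb_nonneg (by norm_num) (natCast_modEq_eleven n 4)]
  · linarith [nonnegOn_four_N1N1_sub_N0M0.comb_nonneg (by norm_num) (natCast_modEq_eleven n 4)]
  · linarith [nonnegOn_four_N1M1_sub_N2M0.comb_nonneg (by norm_num) (natCast_modEq_eleven n 4)]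
  · linarith [nonnegOn_four_N1N3_sub_M0M0.comb_nonneg (by norm_num) (natCast_modEq_eleven n 4)]
  · linarith [nonnegOn_five_N2_sub_M0.comb_nonneg (by norm_num) (natCast_modEq_eleven n 5)]
  · linarith [nonnegOn_five_M2_sub_N5.comb_nonneg (by norm_num) (natCast_modEq_eleven n 5)]
  · linarith [nonnegOn_five_N2N3_sub_M0M2.comb_nonneg (by norm_num) (natCast_modEq_eleven n 5)]
  · linarith [nonnegOn_five_N2M2_sub_N0N5.comb_nonneg (by norm_num) (natCast_modEq_eleven n 5)]
  · linarith [nonnegOn_five_N0M0_sub_N1N4.comb_nonneg (by norm_num) (natCast_modEq_eleven n 5)]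
  · linarith [nonnegOn_five_N2N3_sub_N1N5.comb_nonneg (by norm_num) (natCast_modEq_eleven n 5)]
  · linarith [nonnegOn_five_N0N2_sub_N1M0.comb_nonneg (by norm_num) (natCast_modEq_eleven n 5)]
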